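/- Suppose that for every n∈ℤ an at most countable set 𝔖(n)={s_n(i): i∈ℕ}⊂[1,2^b] is given, and for R∈ℕ let B_p(R) be the best constant in ‖𝔐_R[f,w]‖_{L^p(ℝ²)} ≤ C (sup_{n∈ℤ}‖w_n‖_{ℓ^p(ℕ)}) ‖f‖_{L^p(ℝ²)}. Then for all 1<p≤2, p≤q≤∞, all integers ℓ≥1, all R∈ℕ, all sequences of Schwartz functions (g_{j,n})_{j,n∈ℤ} and all w_n:ℕ→ℂ, ‖ ( Σ_{-R≤j,n≤R} Σ_{i∈ℕ} |w_n(i) A_{j,ℓ}^{2^{bn}s_n(i)} g_{j,n}|^q )^{1/q} ‖_{L^p(ℝ²)} ≤ C (p-1)^{-2(1-p/q)} B_p(R)^{1-p/q} 2^{-ℓ(1-1/p)(p/q)} (sup_{n∈ℤ}‖w_n‖_{ℓ^p(ℕ)}) ‖ ( Σ_{j,n∈ℤ} |g_{j,n}|^q )^{1/q} ‖_{L^p(ℝ²)}, with C depending only on b, c_+, c_- and the fixed cutoff functions. -/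

import Mathlib

open MeasureTheory Filter Set Topology
open scoped ENNReal NNReal Topology Classical

noncomputable section

/-- The homogeneous curve of degree `b`: `γ_b(t) = c₊ t^b` for `t > 0`,
`γ_b(t) = c₋ (-t)^b` for `t < 0`, `γ_b(0) = 0`. -/
def curve (b cp cm t : ℝ) : ℝ :=
  if 0 < t then cp * t ^ b else if t < 0 then cm * (-t) ^ b else 0

/-- The maximal function along the curve `(t, u γ_b(t))`. -/
def Mu (b cp cm u : ℝ) (f : ℝ × ℝ → ℝ) (x : ℝ × ℝ) : ℝ :=
  ⨆ R : {R : ℝ // 0 < R},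
    ((R : ℝ))⁻¹ * ∫ t in (0:ℝ)..(R : ℝ), |f (x - (t, u * curve b cp cm t))|

/-- The maximal function `𝓜^U f = sup_{u ∈ U} M^{(u)} f`. -/
def calM (b cp cm : ℝ) (U : Set ℝ) (f : ℝ × ℝ → ℝ) (x : ℝ × ℝ) : ℝ :=
  ⨆ u : U, Mu b cp cm (u : ℝ) f x

/-- The Hilbert transform along the curve `(t, u γ_b(t))` (principal value). -/
def Hu (b cp cm u : ℝ) (f : ℝ × ℝ → ℝ) (x : ℝ × ℝ) : ℝ :=
  limUnder (𝓝[>] (0:ℝ)) fun ε : ℝ =>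
    ∫ t in {t : ℝ | ε < |t| ∧ |t| < ε⁻¹}, f (x - (t, u * curve b cp cm t)) / t

/-- The maximal function `𝓗^U f = sup_{u ∈ U} |H^{(u)} f|`, valued in `ℝ≥0∞`. -/
def calH (b cp cm : ℝ) (U : Set ℝ) (f : ℝ × ℝ → ℝ) (x : ℝ × ℝ) : ℝ≥0∞ :=
  ⨆ u : U, ENNReal.ofReal |Hu b cp cm (u : ℝ) f x|

/-- The `L^p` norm of an `ℝ≥0∞`-valued function on `ℝ²`. -/
def lpN (g : ℝ × ℝ → ℝ≥0∞) (p : ℝ) : ℝ≥0∞ :=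
  (∫⁻ x : ℝ × ℝ, g x ^ p) ^ (1 / p)

def eN (p : ℝ) : ℝ≥0∞ := ENNReal.ofReal p

/-- `U^r = r⁻¹ U ∩ [1,2] = {ρ ∈ [1,2] : rρ ∈ U}`. -/
def UrSet (U : Set ℝ) (r : ℝ) : Set ℝ := {ρ : ℝ | ρ ∈ Icc (1:ℝ) 2 ∧ r * ρ ∈ U}

/-- `N(A,δ)`: minimal number of intervals of length `δ` needed to cover `A`. -/
def covN (A : Set ℝ) (δ : ℝ) : ℕ :=
  sInf {n : ℕ | ∃ F : Finset ℝ, F.card = n ∧ A ⊆ ⋃ a ∈ F, Icc a (a + δ)}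

/-- `𝒦_p(U,δ) = δ^{1-1/p} sup_{r>0} N(U^r,δ)^{1/p}`. -/
def Kp (U : Set ℝ) (δ p : ℝ) : ℝ :=
  δ ^ (1 - 1 / p) * ⨆ r : {r : ℝ // 0 < r}, ((covN (UrSet U (r : ℝ)) δ : ℝ)) ^ (1 / p)

/-- `p_cr(U) = 1 + limsup_{δ→0+} sup_{r>0} log N(U^r,δ) / log(1/δ)`. -/
def pcr (U : Set ℝ) : ℝ :=
  1 + limsup (fun δ : ℝ =>
      (⨆ r : {r : ℝ // 0 < r}, Real.log (covN (UrSet U (r : ℝ)) δ)) / Real.log δ⁻¹)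
    (𝓝[>] (0:ℝ))

/-- `𝔑(U) = 1 + #{n ∈ ℤ : [2ⁿ, 2ⁿ⁺¹] ∩ U ≠ ∅}`. -/
def frakN (U : Set ℝ) : ℕ∞ :=
  1 + Set.encard {n : ℤ | (Icc ((2:ℝ) ^ n) ((2:ℝ) ^ (n + 1)) ∩ U).Nonempty}

/-- `√(log 𝔑(U))`, valued in `ℝ≥0∞` (equal to `∞` if `𝔑(U) = ∞`). -/
def sqrtLogN (U : Set ℝ) : ℝ≥0∞ :=
  if frakN U = ⊤ then ⊤
  else ENNReal.ofReal (Real.sqrt (Real.log ((frakN U).toNat : ℝ)))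

/-- The `L^p → L^p` operator norm of `𝓜^U` (smallest admissible constant, possibly `∞`). -/
def opNormM (b cp cm : ℝ) (U : Set ℝ) (p : ℝ) : ℝ≥0∞ :=
  sInf {C : ℝ≥0∞ | ∀ f : SchwartzMap (ℝ × ℝ) ℝ,
    eLpNorm (calM b cp cm U ⇑f) (eN p) volume ≤ C * eLpNorm ⇑f (eN p) volume}

/-- The `L^p → L^p` operator norm of `𝓗^U` (smallest admissible constant, possibly `∞`). -/
def opNormH (b cp cm : ℝ) (U : Set ℝ) (p : ℝ) : ℝ≥0∞ :=
  sInf {C : ℝ≥0∞ | ∀ f : SchwartzMap (ℝ × ℝ) ℝ,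
    lpN (calH b cp cm U ⇑f) p ≤ C * eLpNorm ⇑f (eN p) volume}

/-- `θ_{p,ℓ}`. -/
def theta (p : ℝ) (l : ℕ) : ℝ :=
  if (l : ℝ) ≤ (p - 1)⁻¹ then (p - 1) ^ (3 - 10 / p) else (l : ℝ) ^ (7 * (2 / p - 1))

/-- `Σ_{ℓ≥1} θ_{p,ℓ} 𝒦_p(U, 2^{-ℓ})`, valued in `ℝ≥0∞`. -/
def KpSum (U : Set ℝ) (p : ℝ) : ℝ≥0∞ :=
  ∑' l : ℕ, ENNReal.ofReal (theta p (l + 1) * Kp U ((2:ℝ) ^ (-((l : ℝ) + 1))) p)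



/-- The Fourier transform on `ℝ²`. -/
def FT (f : ℝ × ℝ → ℂ) (ξ : ℝ × ℝ) : ℂ :=
  ∫ x : ℝ × ℝ,
    Complex.exp ((((-(2 * Real.pi * (x.1 * ξ.1 + x.2 * ξ.2))) : ℝ) : ℂ) * Complex.I) * f x

/-- The inverse Fourier transform on `ℝ²`. -/
def FTinv (g : ℝ × ℝ → ℂ) (x : ℝ × ℝ) : ℂ :=
  ∫ ξ : ℝ × ℝ,
    Complex.exp (((2 * Real.pi * (x.1 * ξ.1 + x.2 * ξ.2) : ℝ) : ℂ) * Complex.I) * g ξ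

/-- `τ̂₀(ξ) = ∫ e^{-2πi(ξ₁t + ξ₂γ_b(t))} χ₊(t) dt`. -/
def tauHat (b cp cm : ℝ) (χp : ℝ → ℝ) (ξ : ℝ × ℝ) : ℂ :=
  ∫ t : ℝ,
    Complex.exp ((((-(2 * Real.pi * (ξ.1 * t + ξ.2 * curve b cp cm t))) : ℝ) : ℂ) * Complex.I)
      * ((χp t : ℝ) : ℂ)

/-- `σ̂(ξ) = ∫ e^{-2πi(ξ₁t + ξ₂γ_b(t))} χ(t) dt/t` for a cutoff `χ`. -/
def sigmaHat (b cp cm : ℝ) (χ : ℝ → ℝ) (ξ : ℝ × ℝ) : ℂ :=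
  ∫ t : ℝ,
    Complex.exp ((((-(2 * Real.pi * (ξ.1 * t + ξ.2 * curve b cp cm t))) : ℝ) : ℂ) * Complex.I)
      * ((χ t / t : ℝ) : ℂ)

/-- `ρ̂₀(ξ) = (1-η₀(ξ)) ς₋(ξ₁/(c₊ξ₂)) τ̂₀(ξ)`. -/
def rhoHat (b cp cm : ℝ) (χp : ℝ → ℝ) (η : ℝ × ℝ → ℝ) (ςm : ℝ → ℝ) (ξ : ℝ × ℝ) : ℂ :=
  (((1 - η ξ) * ςm (ξ.1 / (cp * ξ.2)) : ℝ) : ℂ) * tauHat b cp cm χp ξ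

/-- `μ̂_{0,±}`; `sgn = true` is the `+` sign. -/
def muHat (b cp cm : ℝ) (χp : ℝ → ℝ) (η : ℝ × ℝ → ℝ) (ςp ςm : ℝ → ℝ) (sgn : Bool)
    (ξ : ℝ × ℝ) : ℂ :=
  if sgn then
    (((1 - η ξ) * ςm (ξ.1 / (cp * ξ.2)) : ℝ) : ℂ) * sigmaHat b cp cm χp ξ
  else
    (((1 - η ξ) * ςp (ξ.1 / (cm * ξ.2)) : ℝ) : ℂ) * sigmaHat b cp cm (fun t => χp (-t)) ξ

/-- `ζ_ℓ(ξ) = ζ₀(2^{-ℓ}ξ) - ζ₀(2^{1-ℓ}ξ)`. -/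
def zl (ζ : ℝ × ℝ → ℝ) (l : ℕ) (ξ : ℝ × ℝ) : ℝ :=
  ζ ((2:ℝ) ^ (-(l : ℝ)) • ξ) - ζ ((2:ℝ) ^ (1 - (l : ℝ)) • ξ)

/-- The anisotropic dilation `ξ ↦ (2^{-j}ξ₁, 2^{-jb} u ξ₂)`. -/
def dil (b : ℝ) (j : ℤ) (u : ℝ) (ξ : ℝ × ℝ) : ℝ × ℝ :=
  ((2:ℝ) ^ (-(j : ℝ)) * ξ.1, (2:ℝ) ^ (-((j : ℝ) * b)) * (u * ξ.2))

/-- `A_{j,ℓ}^u`, defined via `(A_{j,ℓ}^u f)^(ξ) = ζ_ℓ(...) ρ̂₀(...) f̂(ξ)`. -/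
def Ajl (b cp cm : ℝ) (χp : ℝ → ℝ) (η : ℝ × ℝ → ℝ) (ςm : ℝ → ℝ) (ζ : ℝ × ℝ → ℝ)
    (j : ℤ) (l : ℕ) (u : ℝ) (f : ℝ × ℝ → ℝ) : ℝ × ℝ → ℂ :=
  FTinv fun ξ =>
    ((zl ζ l (dil b j u ξ) : ℝ) : ℂ) * rhoHat b cp cm χp η ςm (dil b j u ξ)
      * FT (fun x => ((f x : ℝ) : ℂ)) ξ

/-- `T_{j,ℓ,±}^u`, defined via `(T_{j,ℓ,±}^u f)^(ξ) = ζ_ℓ(...) μ̂_{0,±}(...) f̂(ξ)`. -/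
def Tjl (b cp cm : ℝ) (χp : ℝ → ℝ) (η : ℝ × ℝ → ℝ) (ςp ςm : ℝ → ℝ) (ζ : ℝ × ℝ → ℝ)
    (sgn : Bool) (j : ℤ) (l : ℕ) (u : ℝ) (f : ℝ × ℝ → ℝ) : ℝ × ℝ → ℂ :=
  FTinv fun ξ =>
    ((zl ζ l (dil b j u ξ) : ℝ) : ℂ) * muHat b cp cm χp η ςp ςm sgn (dil b j u ξ)
      * FT (fun x => ((f x : ℝ) : ℂ)) ξ

/-- `φ̂₀(ξ) = η₀(ξ)τ̂₀(ξ) + (1-η₀(ξ))(1-ς₋(ξ₁/(c₊ξ₂)))τ̂₀(ξ)` (maximal-function version). -/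
def phiHatTau (b cp cm : ℝ) (χp : ℝ → ℝ) (η : ℝ × ℝ → ℝ) (ςm : ℝ → ℝ) (ξ : ℝ × ℝ) : ℂ :=
  ((η ξ + (1 - η ξ) * (1 - ςm (ξ.1 / (cp * ξ.2))) : ℝ) : ℂ) * tauHat b cp cm χp ξ

/-- `A_{j,0}^u`, defined via `(A_{j,0}^u f)^(ξ) = φ̂₀(2^{-j}ξ₁, 2^{-jb}uξ₂) f̂(ξ)`. -/
def Aj0 (b cp cm : ℝ) (χp : ℝ → ℝ) (η : ℝ × ℝ → ℝ) (ςm : ℝ → ℝ)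
    (j : ℤ) (u : ℝ) (f : ℝ × ℝ → ℝ) : ℝ × ℝ → ℂ :=
  FTinv fun ξ => phiHatTau b cp cm χp η ςm (dil b j u ξ) * FT (fun x => ((f x : ℝ) : ℂ)) ξ

/-- `φ̂₀(ξ)` (Hilbert-transform version, built from `σ̂_±`). -/
def phiHatSigma (b cp cm : ℝ) (χp : ℝ → ℝ) (η : ℝ × ℝ → ℝ) (ςp ςm : ℝ → ℝ)
    (ξ : ℝ × ℝ) : ℂ :=
  ((η ξ : ℝ) : ℂ) * (sigmaHat b cp cm χp ξ + sigmaHat b cp cm (fun t => χp (-t)) ξ)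
    + (((1 - η ξ) * (1 - ςm (ξ.1 / (cp * ξ.2))) : ℝ) : ℂ) * sigmaHat b cp cm χp ξ
    + (((1 - η ξ) * (1 - ςp (ξ.1 / (cm * ξ.2))) : ℝ) : ℂ)
        * sigmaHat b cp cm (fun t => χp (-t)) ξ

/-- `S^{(u)}`, defined via `(S^{(u)} f)^(ξ) = Σ_j φ̂₀(2^{-j}ξ₁, 2^{-jb}uξ₂) f̂(ξ)`. -/
def Sop (b cp cm : ℝ) (χp : ℝ → ℝ) (η : ℝ × ℝ → ℝ) (ςp ςm : ℝ → ℝ)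
    (u : ℝ) (f : ℝ × ℝ → ℝ) : ℝ × ℝ → ℂ :=
  FTinv fun ξ =>
    (∑' j : ℤ, phiHatSigma b cp cm χp η ςp ςm (dil b j u ξ)) * FT (fun x => ((f x : ℝ) : ℂ)) ξ

/-- The convolution `τ_j^u * f`. -/
def tauConv (b cp cm : ℝ) (χp : ℝ → ℝ) (j : ℤ) (u : ℝ) (f : ℝ × ℝ → ℝ) (x : ℝ × ℝ) : ℝ :=
  ∫ t : ℝ, f (x - (t, u * curve b cp cm t)) * ((2:ℝ) ^ j * χp ((2:ℝ) ^ j * t))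

/-- The `ℓ^p(ℕ)` norm of a sequence. -/
def wNorm (w : ℕ → ℂ) (p : ℝ) : ℝ≥0∞ :=
  (∑' i : ℕ, ENNReal.ofReal (‖w i‖ ^ p)) ^ (1 / p)

/-- The auxiliary maximal operator `𝔐_R[f,w]`. -/
def MfrakR (b cp cm : ℝ) (χp : ℝ → ℝ) (s : ℤ → ℕ → ℝ) (R : ℕ)
    (f : ℝ × ℝ → ℝ) (w : ℤ → ℕ → ℂ) (x : ℝ × ℝ) : ℝ≥0∞ :=
  ⨆ (j : ℤ) (_ : -(R:ℤ) ≤ j ∧ j ≤ R) (n : ℤ) (_ : -(R:ℤ) ≤ n ∧ n ≤ R) (i : ℕ),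
    ENNReal.ofReal
      (‖w n i‖ * |tauConv b cp cm χp j ((2:ℝ) ^ (b * (n : ℝ)) * s n i) f x|)

/-- `B_p(R)`: the best constant in `‖𝔐_R[f,w]‖_p ≤ C (sup_n ‖w_n‖_{ℓ^p}) ‖f‖_p`. -/
def BpR (b cp cm : ℝ) (χp : ℝ → ℝ) (s : ℤ → ℕ → ℝ) (p : ℝ) (R : ℕ) : ℝ≥0∞ :=
  ⨆ (f : SchwartzMap (ℝ × ℝ) ℝ) (w : ℤ → ℕ → ℂ)
    (_ : eLpNorm ⇑f (eN p) volume ≤ 1) (_ : ∀ n : ℤ, wNorm (w n) p ≤ 1),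
    lpN (MfrakR b cp cm χp s R ⇑f w) p

/-- `ℓ^q` norm (over an index type) of an `ℝ≥0∞`-valued family, `q ∈ (0,∞]`. -/
def lqS {ι : Type*} (q : ℝ≥0∞) (g : ι → ℝ≥0∞) : ℝ≥0∞ :=
  if q = ⊤ then ⨆ i, g i else (∑' i, g i ^ q.toReal) ^ (1 / q.toReal)

/-- The quotient `p/q`, with the convention `p/∞ = 0`. -/
def pqr (p : ℝ) (q : ℝ≥0∞) : ℝ := if q = ⊤ then 0 else p / q.toReal

section

open Complex (I_sq conj_mul' conj_ofReal continuous_conj exp_zero measurable_ofReal norm_I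
  norm_exp_ofReal_mul_I norm_real ofRealCLM ofReal_sub ofReal_sum ofReal_zero real_smul)
open ENNReal (coe_rpow_of_nonneg le_tsum mul_iSup mul_ne_top mul_rpow_of_nonneg mul_top
  natCast_ne_top ofReal ofReal_add ofReal_eq_zero ofReal_le_ofReal ofReal_le_ofReal_iff
  ofReal_le_one ofReal_lt_top ofReal_mul ofReal_natCast ofReal_ne_top ofReal_ofNat ofReal_one
  ofReal_rpow_of_nonneg ofReal_rpow_of_pos ofReal_sum_of_nonneg ofReal_toReal one_rpow
  rpow_inv_le_iff rpow_le_rpow rpow_le_rpow_iff rpow_ne_top_of_nonneg toReal_nonneg toReal_pos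
  zero_rpow_of_pos)
open Finset (induction_on measurable_sum mem_filter mem_product mul_sum single_le_sum
  sum_add_distrib sum_comm sum_congr sum_const sum_eq_zero sum_filter sum_image sum_insert
  sum_le_sum sum_le_sum_of_subset sum_mul sum_nonneg sum_product sum_range_succ sum_singleton)
open Function (Injective uncurry)
open Metric (closedBall isClosed_closedBall)
open Nat (cast_le cast_nonneg le_ceil)
open Prod (fst smul_fst smul_snd)
open Real (dist_eq div_rpow exp exp_add exp_le_exp exp_log exp_mul exp_one_lt_d9 exp_pos exp_sub
  hasDerivAt_rpow_const inv_rpow log_mul mul_rpow norm_eq_abs norm_of_nonneg one_le_sqrt rpow_add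
  rpow_add' rpow_le_rpow_of_exponent_le rpow_mul rpow_natCast rpow_neg rpow_nonneg rpow_one
  rpow_one_add' rpow_sub rpow_sub_one rpow_two rpow_zero sq_sqrt sqrt_eq_rpow sqrt_mul
  sqrt_nonneg volume_Icc zero_rpow)

local notation "ℝ²" => ℝ × ℝ

lemma lpN_rpow (g : ℝ² → ℝ≥0∞) {p : ℝ} (hp : 0 < p) : lpN g p ^ p = ∫⁻ x, g x ^ p := by
  rw [lpN, ← ENNReal.rpow_mul, one_div, inv_mul_cancel₀ hp.ne', ENNReal.rpow_one]

lemma lpN_mono {f g : ℝ² → ℝ≥0∞} {p : ℝ} (hp : 0 < p) (h : ∀ x, f x ≤ g x) :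
    lpN f p ≤ lpN g p := by
  unfold lpN
  gcongr with x
  exact h x

lemma lpN_add_le {f g : ℝ² → ℝ≥0∞} {p : ℝ} (hp : 1 ≤ p) (hf : Measurable f)
    (hg : Measurable g) : lpN (fun x => f x + g x) p ≤ lpN f p + lpN g p :=
  ENNReal.lintegral_Lp_add_le hf.aemeasurable hg.aemeasurable hp

lemma lpN_zero {p : ℝ} (hp : 0 < p) : lpN (fun _ => 0) p = 0 := by
  simp [lpN, hp]

lemma lpN_sum_le {ι : Type*} (s : Finset ι) {f : ι → ℝ² → ℝ≥0∞} {p : ℝ} (hp : 1 ≤ p)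
    (hf : ∀ i ∈ s, Measurable (f i)) :
    lpN (fun x => ∑ i ∈ s, f i x) p ≤ ∑ i ∈ s, lpN (f i) p := by
  induction s using induction_on with
  | empty => simp [lpN_zero (by linarith : 0 < p)]
  | insert a s ha ih =>
    simp only [sum_insert ha]
    refine (lpN_add_le hp (hf a (by simp))
      (measurable_sum _ fun i hi => hf i (by simp [hi]))).trans ?_
    gcongr
    exact ih fun i hi => hf i (by simp [hi])

lemma lpN_const_mul (c : ℝ≥0∞) {f : ℝ² → ℝ≥0∞} {p : ℝ} (hp : 0 < p) (hf : Measurable f) :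
    lpN (fun x => c * f x) p = c * lpN f p := by
  unfold lpN
  simp_rw [mul_rpow_of_nonneg _ _ hp.le]
  rw [lintegral_const_mul _ (hf.pow_const p), mul_rpow_of_nonneg _ _ (by positivity),
    ← ENNReal.rpow_mul, mul_one_div_cancel hp.ne', ENNReal.rpow_one]

lemma lintegral_mul_le_lpN {f g : ℝ² → ℝ≥0∞} {p q : ℝ} (hpq : p.HolderConjugate q)
    (hf : Measurable f) (hg : Measurable g) :
    ∫⁻ x, f x * g x ≤ lpN f p * lpN g q :=
  ENNReal.lintegral_mul_le_Lp_mul_Lq volume hpq hf.aemeasurable hg.aemeasurable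

lemma lintegral_rpow_le_of_finite {α : Type*} [MeasurableSpace α] (ν : Measure α)
    {F : α → ℝ≥0∞} (hF : Measurable F) {q : ℝ} (hq : 1 ≤ q) :
    (∫⁻ a, F a ∂ν) ^ q ≤ (ν univ) ^ (q - 1) * ∫⁻ a, F a ^ q ∂ν := by
  rcases hq.eq_or_lt with rfl | hq'
  · simp
  have hpq : q.HolderConjugate q.conjExponent := Real.HolderConjugate.conjExponent hq'
  have h := ENNReal.lintegral_mul_le_Lp_mul_Lq ν hpq hF.aemeasurable
    (aemeasurable_const (b := (1 : ℝ≥0∞)))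
  simp only [Pi.mul_apply, mul_one, one_rpow, lintegral_const, one_mul] at h
  have hq0 : 0 < q := by linarith
  calc (∫⁻ a, F a ∂ν) ^ q ≤ ((∫⁻ a, F a ^ q ∂ν) ^ (1 / q) *
      (ν univ) ^ (1 / q.conjExponent)) ^ q := by gcongr
    _ = _ := by
      rw [mul_rpow_of_nonneg _ _ hq0.le, ← ENNReal.rpow_mul, ← ENNReal.rpow_mul,
        one_div_mul_cancel hq0.ne', ENNReal.rpow_one, mul_comm]
      congr 2
      unfold Real.conjExponent
      field_simp

/-- The average of `f (x + y)` over `y` distributed according to `μ`. -/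
def addAvg (μ : Measure (ℝ²)) (f : ℝ² → ℝ≥0∞) (x : ℝ²) : ℝ≥0∞ :=
  ∫⁻ y, f (x + y) ∂μ

/-- The average of `f (x - y)` over `y` distributed according to `μ`. -/
def subAvg (μ : Measure (ℝ²)) (f : ℝ² → ℝ≥0∞) (x : ℝ²) : ℝ≥0∞ :=
  ∫⁻ y, f (x - y) ∂μ

lemma measurable_addAvg (μ : Measure (ℝ²)) [SFinite μ] {f : ℝ² → ℝ≥0∞}
    (hf : Measurable f) : Measurable (addAvg μ f) :=
  Measurable.lintegral_prod_right' (f := fun z : ℝ² × ℝ² => f (z.1 + z.2))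
    (hf.comp (measurable_fst.add measurable_snd))

lemma measurable_subAvg (μ : Measure (ℝ²)) [SFinite μ] {f : ℝ² → ℝ≥0∞}
    (hf : Measurable f) : Measurable (subAvg μ f) :=
  Measurable.lintegral_prod_right' (f := fun z : ℝ² × ℝ² => f (z.1 - z.2))
    (hf.comp (measurable_fst.sub measurable_snd))

lemma lintegral_mul_subAvg (μ : Measure (ℝ²)) [SFinite μ] {f h : ℝ² → ℝ≥0∞}
    (hf : Measurable f) (hh : Measurable h) :
    ∫⁻ x, h x * subAvg μ f x = ∫⁻ x, addAvg μ h x * f x := by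
  have e1 : ∫⁻ x, h x * subAvg μ f x = ∫⁻ x, ∫⁻ y, h x * f (x - y) ∂μ := by
    refine lintegral_congr fun x => ?_
    rw [subAvg, lintegral_const_mul]
    exact hf.comp (measurable_const.sub measurable_id)
  have e2 : ∫⁻ x, addAvg μ h x * f x = ∫⁻ x, ∫⁻ y, h (x + y) * f x ∂μ := by
    refine lintegral_congr fun x => ?_
    rw [addAvg, lintegral_mul_const]
    exact hh.comp (measurable_const.add measurable_id)
  rw [e1, e2, lintegral_lintegral_swap (f := fun x y => h x * f (x - y)) (μ := volume) (ν := μ)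
      ((hh.comp measurable_fst).mul
        (hf.comp (measurable_fst.sub measurable_snd))).aemeasurable,
    lintegral_lintegral_swap (f := fun x y => h (x + y) * f x) (μ := volume) (ν := μ)
      ((hh.comp (measurable_fst.add measurable_snd)).mul
        (hf.comp measurable_fst)).aemeasurable]
  refine lintegral_congr fun y => ?_
  rw [← lintegral_sub_right_eq_self (fun x => h (x + y) * f x) y]
  simp

lemma lpN_addAvg_le (μ : Measure (ℝ²)) [IsFiniteMeasure μ] {f : ℝ² → ℝ≥0∞}
    (hf : Measurable f) {q : ℝ} (hq : 1 ≤ q) :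
    lpN (addAvg μ f) q ≤ μ univ * lpN f q := by
  have hq0 : 0 < q := by linarith
  rw [← rpow_le_rpow_iff hq0, mul_rpow_of_nonneg _ _ hq0.le, lpN_rpow _ hq0,
    lpN_rpow _ hq0]
  calc ∫⁻ x, addAvg μ f x ^ q ≤ ∫⁻ x, μ univ ^ (q - 1) * ∫⁻ y, f (x + y) ^ q ∂μ := by
        refine lintegral_mono fun x => ?_
        exact lintegral_rpow_le_of_finite μ (hf.comp (measurable_const.add measurable_id)) hq
    _ = μ univ ^ (q - 1) * ∫⁻ x, addAvg μ (fun z => f z ^ q) x := by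
        rw [← lintegral_const_mul _ (measurable_addAvg μ (hf.pow_const q))]; rfl
    _ = μ univ ^ (q - 1) * (μ univ * ∫⁻ x, f x ^ q) := by
        congr 1
        have := lintegral_mul_subAvg μ (f := fun _ => 1) (h := fun z => f z ^ q)
          measurable_const (hf.pow_const q)
        simp only [mul_one] at this
        rw [← this]
        simp only [subAvg, lintegral_const, one_mul]
        rw [lintegral_mul_const _ (hf.pow_const q), mul_comm]
    _ = _ := by
        rw [← mul_assoc]
        congr 1
        rcases eq_or_ne (μ univ) 0 with h0 | h0
        · simp [h0, hq0]
        · conv_lhs => rw [← ENNReal.rpow_one (μ univ), ← ENNReal.rpow_mul, one_mul]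
          rw [← ENNReal.rpow_add _ _ h0 (measure_ne_top _ _)]
          simp

lemma lpN_sum_rpow_le {ι : Type*} (s : Finset ι) {f : ι → ℝ² → ℝ≥0∞} {q : ℝ} (hq : 1 ≤ q)
    (hf : ∀ i ∈ s, Measurable (f i)) :
    ∑ i ∈ s, lpN (f i) q ^ q ≤ lpN (fun x => ∑ i ∈ s, f i x) q ^ q := by
  have hq0 : 0 < q := by linarith
  simp_rw [lpN_rpow _ hq0]
  rw [← lintegral_finsetSum _ fun i hi => (hf i hi).pow_const q]
  refine lintegral_mono fun x => ?_
  simp only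
  clear hf
  induction s using induction_on with
  | empty => simp
  | insert a s ha ih =>
    rw [sum_insert ha, sum_insert ha]
    refine le_trans ?_ (ENNReal.add_rpow_le_rpow_add _ _ hq)
    gcongr

lemma rpow_add_le_add_mul_real {y b q : ℝ} (hy : 0 ≤ y) (hb : 0 ≤ b) (hq : 1 ≤ q) :
    (y + b) ^ q ≤ y ^ q + q * (exp 1 * (b * y ^ (q - 1)) + (1 + q) ^ (q - 1) * b ^ q) := by
  have hq0 : 0 < q := by linarith
  rcases hb.eq_or_lt with rfl | hb'
  · simp [zero_rpow hq0.ne']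
  have hyb : 0 < y + b := by linarith
  have h1 : (y + b) ^ q ≤ y ^ q + q * b * (y + b) ^ (q - 1) := by
    have := one_add_mul_self_le_rpow_one_add (s := -(b / (y + b)))
      (by rw [neg_le_neg_iff, div_le_one hyb]; linarith) hq
    have e : 1 + -(b / (y + b)) = y / (y + b) := by field_simp; ring
    rw [e, div_rpow hy hyb.le, le_div_iff₀ (by positivity)] at this
    have e2 : (y + b) ^ q = (y + b) * (y + b) ^ (q - 1) := by
      rw [rpow_sub_one hyb.ne']; field_simp
    have e3 : b / (y + b) * (y + b) ^ q = b * (y + b) ^ (q - 1) := by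
      rw [e2]; field_simp
    nlinarith
  have h2 : (y + b) ^ (q - 1) ≤
      exp 1 * y ^ (q - 1) + (1 + q) ^ (q - 1) * b ^ (q - 1) := by
    rcases le_total (q * b) y with h | h
    · have : (y + b) ^ (q - 1) ≤ exp 1 * y ^ (q - 1) := by
        calc (y + b) ^ (q - 1) ≤ (exp (1 / q) * y) ^ (q - 1) := by
              refine Real.rpow_le_rpow hyb.le ?_ (by linarith)
              have h3 : 1 / q + 1 ≤ exp (1 / q) := Real.add_one_le_exp _
              have h4 : b ≤ 1 / q * y := by
                rw [one_div, inv_mul_eq_div, le_div_iff₀ hq0]; linarith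
              nlinarith
          _ = exp (1 / q * (q - 1)) * y ^ (q - 1) := by
              rw [mul_rpow (by positivity) hy, ← exp_mul]
          _ ≤ _ := by
              gcongr
              rw [one_div, inv_mul_eq_div, div_le_one hq0]; linarith
      have : 0 ≤ (1 + q) ^ (q - 1) * b ^ (q - 1) := by positivity
      linarith
    · have : (y + b) ^ (q - 1) ≤ (1 + q) ^ (q - 1) * b ^ (q - 1) := by
        rw [← mul_rpow (by positivity) hb]
        exact Real.rpow_le_rpow hyb.le (by nlinarith) (by linarith)
      have : 0 ≤ exp 1 * y ^ (q - 1) := by positivity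
      linarith
  have e4 : b ^ q = b * b ^ (q - 1) := by
    rw [rpow_sub_one hb'.ne']; field_simp
  rw [e4]
  have : q * b * (y + b) ^ (q - 1) ≤
      q * b * (exp 1 * y ^ (q - 1) + (1 + q) ^ (q - 1) * b ^ (q - 1)) := by gcongr
  linarith

lemma rpow_add_le_add_mul (y b : ℝ≥0∞) {q : ℝ} (hq : 1 < q) :
    (y + b) ^ q ≤ y ^ q + (ofReal (q * exp 1) * (b * y ^ (q - 1)) +
      ofReal ((1 + q) ^ q) * b ^ q) := by
  have hq0 : 0 < q := by linarith
  rcases eq_or_ne y ⊤ with rfl | hy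
  · simp [hq0]
  rcases eq_or_ne b ⊤ with rfl | hb
  · have : ofReal ((1 + q) ^ q) ≠ 0 := by
      simp only [ne_eq, ofReal_eq_zero, not_le]; positivity
    simp [hq0, this]
  lift y to ℝ≥0 using hy
  lift b to ℝ≥0 using hb
  have hA : ofReal (q * exp 1) = ((q * exp 1).toNNReal : ℝ≥0∞) := rfl
  have hB : ofReal ((1 + q) ^ q) = (((1 + q) ^ q).toNNReal : ℝ≥0∞) := rfl
  rw [hA, hB, ← coe_rpow_of_nonneg _ hq0.le, ← coe_rpow_of_nonneg _ hq0.le,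
    ← ENNReal.coe_add, ← coe_rpow_of_nonneg _ hq0.le,
    ← coe_rpow_of_nonneg _ (by linarith : 0 ≤ q - 1)]
  norm_cast
  rw [← NNReal.coe_le_coe]
  push_cast
  rw [Real.coe_toNNReal _ (by positivity), Real.coe_toNNReal _ (by positivity)]
  refine (rpow_add_le_add_mul_real y.2 b.2 hq.le).trans ?_
  have e : (1 + q) ^ q = (1 + q) * (1 + q) ^ (q - 1) := by
    rw [rpow_sub_one (by positivity)]; field_simp
  rw [e]
  have : 0 ≤ (1 + q) ^ (q - 1) * (b : ℝ) ^ q := by positivity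
  simp only [NNReal.val_eq_coe]
  nlinarith

lemma rpow_sum_range_le (b : ℕ → ℝ≥0∞) {q : ℝ} (hq : 1 < q) (N : ℕ) :
    (∑ m ∈ Finset.range N, b m) ^ q ≤ ∑ m ∈ Finset.range N,
      (ofReal (q * exp 1) * (b m * (∑ k ∈ Finset.range m, b k) ^ (q - 1)) +
      ofReal ((1 + q) ^ q) * b m ^ q) := by
  induction N with
  | zero => simp [show 0 < q by linarith]
  | succ N ih =>
    rw [sum_range_succ, sum_range_succ]
    refine (rpow_add_le_add_mul _ _ hq).trans ?_
    gcongr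

lemma ENNReal.le_of_rpow_le_add {z a d : ℝ≥0∞} {q : ℝ} (hq : 1 ≤ q) (hz : z ≠ ⊤)
    (h : z ^ q ≤ a * z ^ (q - 1) + d ^ q) : z ≤ 2 * a + 2 * d := by
  have hq0 : 0 < q := by linarith
  by_cases hd : z ≤ 2 * d
  · exact hd.trans le_add_self
  rw [not_le] at hd
  have hz0 : z ≠ 0 := (lt_of_le_of_lt zero_le hd).ne'
  have h1 : d ^ q ≤ z ^ q / 2 := by
    have : d ≤ z / 2 := by
      rw [ENNReal.le_div_iff_mul_le (by simp) (by simp), mul_comm]; exact hd.le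
    calc d ^ q ≤ (z / 2) ^ q := by gcongr
      _ = z ^ q / 2 ^ q := ENNReal.div_rpow_of_nonneg _ _ hq0.le
      _ ≤ _ := by
        gcongr
        conv_lhs => rw [← ENNReal.rpow_one 2]
        exact ENNReal.rpow_le_rpow_of_exponent_le (by norm_num) hq
  have hzq : z ^ q ≠ ⊤ := rpow_ne_top_of_nonneg hq0.le hz
  have h2 : z ^ q / 2 ≤ a * z ^ (q - 1) := by
    have h3 : z ^ q / 2 + z ^ q / 2 ≤ a * z ^ (q - 1) + z ^ q / 2 := by
      rw [ENNReal.add_halves]; exact h.trans (by gcongr)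
    exact (ENNReal.add_le_add_iff_right (ENNReal.div_ne_top hzq (by norm_num))).1 h3
  have e : z ^ q = z * z ^ (q - 1) := by
    conv_rhs => rw [← ENNReal.rpow_one z, ← ENNReal.rpow_mul, one_mul]
    rw [← ENNReal.rpow_add _ _ hz0 hz]; simp
  have hw0 : z ^ (q - 1) ≠ 0 := by simp [hz0, hz]
  have hwt : z ^ (q - 1) ≠ ⊤ := rpow_ne_top_of_nonneg (by linarith) hz
  have h4 : z / 2 ≤ a := by
    rw [e, div_eq_mul_inv, mul_right_comm, ← div_eq_mul_inv] at h2
    exact (ENNReal.mul_le_mul_iff_left hw0 hwt).1 h2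
  have : z ≤ 2 * a := by
    rw [ENNReal.div_le_iff_le_mul (by simp) (by simp)] at h4
    rwa [mul_comm]
  exact this.trans le_self_add

/-- A dual form of Doob's maximal inequality, for blocks ordered from coarse to fine. -/
lemma lpN_sum_le_of_blocks {q : ℝ} (hq : 2 ≤ q) (N : ℕ) {b h : ℕ → ℝ² → ℝ≥0∞}
    (hb : ∀ m, Measurable (b m)) (hh : ∀ m, Measurable (h m)) {A d : ℝ≥0∞} (hd : d ≠ ⊤)
    (hfin : lpN (fun x => ∑ m ∈ Finset.range N, h m x) q ≠ ⊤)
    (hdiag : ∀ m < N, lpN (b m) q ≤ d * lpN (h m) q)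
    (hpair : ∑ m ∈ Finset.range N, ∫⁻ x, b m x * (∑ k ∈ Finset.range m, b k x) ^ (q - 1) ≤
      A * lpN (fun x => ∑ m ∈ Finset.range N, h m x) q *
        lpN (fun x => ∑ m ∈ Finset.range N, b m x) q ^ (q - 1)) :
    lpN (fun x => ∑ m ∈ Finset.range N, b m x) q ≤
      (ofReal (2 * q * exp 1) * A + ofReal (2 * (1 + q)) * d) *
        lpN (fun x => ∑ m ∈ Finset.range N, h m x) q := by
  have hq0 : 0 < q := by linarith
  have hq1 : 1 ≤ q := by linarith
  set H := lpN (fun x => ∑ m ∈ Finset.range N, h m x) q with hH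
  set z := lpN (fun x => ∑ m ∈ Finset.range N, b m x) q with hz
  have hhm : ∀ m < N, lpN (h m) q ≤ H := fun m hm =>
    lpN_mono hq0 fun x =>
      single_le_sum (f := fun m => h m x) (fun _ _ => zero_le) (Finset.mem_range.2 hm)
  have hzt : z ≠ ⊤ := by
    refine ne_top_of_le_ne_top ?_ (lpN_sum_le _ hq1 fun i _ => hb i)
    refine ENNReal.sum_ne_top.2 fun m hm => ?_
    have hm' := Finset.mem_range.1 hm
    exact ne_top_of_le_ne_top (mul_ne_top hd hfin)
      ((hdiag m hm').trans (by gcongr; exact hhm m hm'))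
  have main : z ^ q ≤ (ofReal (q * exp 1) * (A * H)) * z ^ (q - 1) +
      (ofReal (1 + q) * (d * H)) ^ q := by
    calc z ^ q = ∫⁻ x, (∑ m ∈ Finset.range N, b m x) ^ q := lpN_rpow _ hq0
      _ ≤ ∫⁻ x, ∑ m ∈ Finset.range N,
          (ofReal (q * exp 1) * (b m x * (∑ k ∈ Finset.range m, b k x) ^ (q - 1)) +
          ofReal ((1 + q) ^ q) * b m x ^ q) :=
          lintegral_mono fun x => rpow_sum_range_le _ (by linarith) N
      _ = ofReal (q * exp 1) * ∑ m ∈ Finset.range N,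
            (∫⁻ x, b m x * (∑ k ∈ Finset.range m, b k x) ^ (q - 1)) +
          ofReal ((1 + q) ^ q) * ∑ m ∈ Finset.range N, lpN (b m) q ^ q := by
          have hmeas : ∀ m, Measurable fun x => b m x * (∑ k ∈ Finset.range m, b k x) ^ (q - 1) :=
            fun m => (hb m).mul ((measurable_sum _ fun i _ => hb i).pow_const _)
          rw [lintegral_finsetSum _ fun m _ => by
            exact ((hmeas m).const_mul _).add (((hb m).pow_const q).const_mul _)]
          rw [mul_sum, mul_sum, ← sum_add_distrib]
          refine sum_congr rfl fun m _ => ?_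
          rw [lintegral_add_left ((hmeas m).const_mul _), lintegral_const_mul _ (hmeas m),
            lintegral_const_mul _ ((hb m).pow_const q), lpN_rpow _ hq0]
      _ ≤ ofReal (q * exp 1) * (A * H * z ^ (q - 1)) +
          ofReal ((1 + q) ^ q) * (d ^ q * H ^ q) := by
          gcongr
          calc ∑ m ∈ Finset.range N, lpN (b m) q ^ q
              ≤ ∑ m ∈ Finset.range N, d ^ q * lpN (h m) q ^ q := by
                refine sum_le_sum fun m hm => ?_
                rw [← mul_rpow_of_nonneg _ _ hq0.le]
                gcongr
                exact hdiag m (Finset.mem_range.1 hm)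
            _ = d ^ q * ∑ m ∈ Finset.range N, lpN (h m) q ^ q := by rw [mul_sum]
            _ ≤ _ := by
                gcongr
                exact lpN_sum_rpow_le _ hq1 fun m _ => hh m
      _ = _ := by
          rw [mul_rpow_of_nonneg _ _ hq0.le, mul_rpow_of_nonneg _ _ hq0.le,
            ofReal_rpow_of_pos (by positivity)]
          ring
  refine (ENNReal.le_of_rpow_le_add hq1 hzt main).trans (le_of_eq ?_)
  have e1 : ofReal (2 * q * exp 1) = 2 * ofReal (q * exp 1) := by
    rw [mul_assoc, ofReal_mul (by norm_num)]; simp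
  have e2 : ofReal (2 * (1 + q)) = 2 * ofReal (1 + q) := by
    rw [ofReal_mul (by norm_num)]; simp
  rw [e1, e2]; ring

lemma sum_range_le_residues (F : ℕ → ℝ≥0∞) (D N : ℕ) (hD : 0 < D) :
    ∑ m ∈ Finset.range N, F m ≤ ∑ c ∈ Finset.range D, ∑ l ∈ Finset.range N,
      (if c + D * l < N then F (c + D * l) else 0) := by
  rw [← Finset.sum_product']
  have : ∑ m ∈ Finset.range N, F m = ∑ z ∈ (Finset.range N).image (fun m => (m % D, m / D)),
      (if z.1 + D * z.2 < N then F (z.1 + D * z.2) else 0) := by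
    rw [sum_image]
    · refine sum_congr rfl fun m hm => ?_
      simp only [Nat.mod_add_div, Finset.mem_range.1 hm, if_true]
    · intro m _ m' _ h
      simp only [Prod.mk.injEq] at h
      rw [← Nat.mod_add_div m D, ← Nat.mod_add_div m' D, h.1, h.2]
  rw [this]
  refine sum_le_sum_of_subset fun z hz => ?_
  obtain ⟨m, hm, rfl⟩ := Finset.mem_image.1 hz
  simp only [mem_product, Finset.mem_range] at hm ⊢
  exact ⟨Nat.mod_lt _ hD, lt_of_le_of_lt (Nat.div_le_self _ _) hm⟩

lemma sum_residue_le (F : ℕ → ℝ≥0∞) (D N c : ℕ) (hD : 0 < D) :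
    ∑ l ∈ Finset.range N, (if c + D * l < N then F (c + D * l) else 0) ≤
      ∑ m ∈ Finset.range N, F m := by
  rw [← sum_filter]
  have : ∑ l ∈ (Finset.range N).filter (fun l => c + D * l < N), F (c + D * l) =
      ∑ m ∈ ((Finset.range N).filter (fun l => c + D * l < N)).image (fun l => c + D * l), F m := by
    rw [sum_image]
    intro l _ l' _ h
    exact Nat.eq_of_mul_eq_mul_left hD (Nat.add_left_cancel h)
  rw [this]
  refine sum_le_sum_of_subset fun z hz => ?_
  obtain ⟨m, hm, rfl⟩ := Finset.mem_image.1 hz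
  exact Finset.mem_range.2 (mem_filter.1 hm).2

/-- Splitting the blocks into residue classes. -/
lemma lpN_sum_le_of_residues {q : ℝ} (hq : 1 ≤ q) (N D : ℕ) (hD : 0 < D)
    {b h : ℕ → ℝ² → ℝ≥0∞} (hb : ∀ m, Measurable (b m)) {K : ℝ≥0∞}
    (hK : ∀ c < D, lpN (fun x => ∑ l ∈ Finset.range N,
        (if c + D * l < N then b (c + D * l) x else 0)) q ≤
      K * lpN (fun x => ∑ l ∈ Finset.range N,
        (if c + D * l < N then h (c + D * l) x else 0)) q) :
    lpN (fun x => ∑ m ∈ Finset.range N, b m x) q ≤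
      D * K * lpN (fun x => ∑ m ∈ Finset.range N, h m x) q := by
  have hq0 : 0 < q := by linarith
  calc lpN (fun x => ∑ m ∈ Finset.range N, b m x) q
      ≤ lpN (fun x => ∑ c ∈ Finset.range D, ∑ l ∈ Finset.range N,
        (if c + D * l < N then b (c + D * l) x else 0)) q :=
        lpN_mono hq0 fun x => sum_range_le_residues (fun m => b m x) D N hD
    _ ≤ ∑ c ∈ Finset.range D, lpN (fun x => ∑ l ∈ Finset.range N,
        (if c + D * l < N then b (c + D * l) x else 0)) q := by
        refine lpN_sum_le _ hq fun c _ => measurable_sum _ fun l _ => ?_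
        split_ifs
        · exact hb _
        · exact measurable_const
    _ ≤ ∑ c ∈ Finset.range D, K * lpN (fun x => ∑ m ∈ Finset.range N, h m x) q := by
        refine sum_le_sum fun c hc => (hK c (Finset.mem_range.1 hc)).trans ?_
        gcongr
        exact lpN_mono hq0 fun x => sum_residue_le (fun m => h m x) D N c hD
    _ = _ := by simp [mul_assoc]

/-- The two-sided exponential distribution at scale `a`. -/
def lap (a : ℝ) : Measure ℝ :=
  volume.withDensity fun y => ofReal (exp (-|y| / a) / (2 * a))

lemma measurable_lapDensity (a : ℝ) :
    Measurable fun y : ℝ => ofReal (exp (-|y| / a) / (2 * a)) := by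
  fun_prop

lemma lintegral_lap (a : ℝ) {f : ℝ → ℝ≥0∞} (hf : Measurable f) :
    ∫⁻ y, f y ∂lap a = ∫⁻ y, ofReal (exp (-|y| / a) / (2 * a)) * f y := by
  rw [lap, lintegral_withDensity_eq_lintegral_mul _ (measurable_lapDensity a) hf]
  rfl

lemma integrable_integral_exp_abs {a : ℝ} (ha : 0 < a) (s : ℝ) :
    Integrable (fun y : ℝ => ((exp (-|y| / a) / (2 * a) : ℝ) : ℂ) *
      Complex.exp (((s * y : ℝ) : ℂ) * Complex.I)) ∧
    ∫ y : ℝ, ((exp (-|y| / a) / (2 * a) : ℝ) : ℂ) *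
      Complex.exp (((s * y : ℝ) : ℂ) * Complex.I) = ((1 / (1 + (a * s) ^ 2) : ℝ) : ℂ) := by
  set F : ℝ → ℂ := fun y => ((exp (-|y| / a) / (2 * a) : ℝ) : ℂ) *
      Complex.exp (((s * y : ℝ) : ℂ) * Complex.I) with hF
  set c1 : ℂ := ((1 / a : ℝ) : ℂ) + s * Complex.I with hc1
  set c2 : ℂ := ((-(1 / a) : ℝ) : ℂ) + s * Complex.I with hc2
  have hre1 : 0 < c1.re := by simp [hc1]; positivity
  have hre2 : c2.re < 0 := by simp [hc2]; positivity
  have hL : ∀ y ∈ Iic (0:ℝ), F y = (1 / (2 * a) : ℂ) * Complex.exp (c1 * y) := by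
    intro y hy
    simp only [hF, abs_of_nonpos (mem_Iic.1 hy), hc1]
    push_cast
    rw [add_mul, Complex.exp_add]
    have : ((1:ℂ) / a * y) = - -(y:ℂ) / a := by ring
    rw [this]; ring_nf
  have hR : ∀ y ∈ Ioi (0:ℝ), F y = (1 / (2 * a) : ℂ) * Complex.exp (c2 * y) := by
    intro y hy
    simp only [hF, abs_of_pos (mem_Ioi.1 hy), hc2]
    push_cast
    rw [add_mul, Complex.exp_add]
    have : (-((1:ℂ) / a) * y) = -(y:ℂ) / a := by ring
    rw [this]; ring_nf
  have iL : IntegrableOn F (Iic 0) :=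
    (integrableOn_congr_fun hL measurableSet_Iic).2
      ((integrableOn_exp_mul_complex_Iic hre1 0).const_mul _)
  have iR : IntegrableOn F (Ioi 0) :=
    (integrableOn_congr_fun hR measurableSet_Ioi).2
      ((integrableOn_exp_mul_complex_Ioi hre2 0).const_mul _)
  have hI : Integrable F := by
    rw [← integrableOn_univ, ← Iic_union_Ioi (a := (0:ℝ))]
    exact iL.union iR
  refine ⟨hI, ?_⟩
  rw [← intervalIntegral.integral_Iic_add_Ioi iL iR, setIntegral_congr_fun measurableSet_Iic hL,
    setIntegral_congr_fun measurableSet_Ioi hR, integral_const_mul, integral_const_mul,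
    integral_exp_mul_complex_Iic hre1, integral_exp_mul_complex_Ioi hre2]
  have h1 : c1 ≠ 0 := fun h => by rw [h] at hre1; simp at hre1
  have h2 : c2 ≠ 0 := fun h => by rw [h] at hre2; simp at hre2
  have hac : (a : ℂ) ≠ 0 := by exact_mod_cast ha.ne'
  have h3 : (1 + ((a : ℂ) * s) ^ 2) ≠ 0 := by
    have : (0:ℝ) < 1 + (a * s) ^ 2 := by positivity
    exact_mod_cast this.ne'
  simp only [ofReal_zero, mul_zero, exp_zero]
  push_cast
  have h4 : c1 * c2 = -(1 + ((a : ℂ) * s) ^ 2) / a ^ 2 := by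
    simp only [hc1, hc2]; push_cast; field_simp; ring_nf; simp [I_sq]; ring
  have h5 : c2 - c1 = -2 / a := by simp only [hc1, hc2]; push_cast; field_simp; ring
  have : 1 / (2 * (a:ℂ)) * (1 / c1) + 1 / (2 * (a:ℂ)) * (-1 / c2) =
      1 / (2 * a) * ((c2 - c1) / (c1 * c2)) := by field_simp; ring
  rw [this, h4, h5]
  field_simp

lemma lap_univ {a : ℝ} (ha : 0 < a) : lap a univ = 1 := by
  obtain ⟨h1, h2⟩ := integrable_integral_exp_abs ha 0
  simp only [zero_mul, ofReal_zero, exp_zero, mul_one] at h1 h2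
  have h1' : Integrable fun y : ℝ => exp (-|y| / a) / (2 * a) := by
    refine (integrable_norm_iff h1.aestronglyMeasurable).2 h1 |>.congr ?_
    refine ae_of_all _ fun y => ?_
    simp only
    rw [norm_real, norm_of_nonneg (by positivity)]
  rw [integral_complex_ofReal] at h2
  have h3 : ∫ y : ℝ, exp (-|y| / a) / (2 * a) = 1 := by
    have := Complex.ofReal_injective h2; simpa using this
  rw [lap, withDensity_apply _ MeasurableSet.univ, Measure.restrict_univ,
    ← ofReal_integral_eq_lintegral_ofReal h1' (ae_of_all _ fun y => by positivity), h3]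
  simp

lemma isProbabilityMeasure_lap {a : ℝ} (ha : 0 < a) : IsProbabilityMeasure (lap a) :=
  ⟨lap_univ ha⟩

instance sFinite_lap (a : ℝ) : SFinite (lap a) := by unfold lap; infer_instance

lemma lintegral_exp_lap_le {a κ : ℝ} (ha : 0 < a) (hκ : κ * a ≤ 1 / 2) :
    ∫⁻ y, ofReal (exp (κ * |y|)) ∂lap a ≤ 2 := by
  have h2a : 0 < 2 * a := by linarith
  rw [lintegral_lap a (by fun_prop)]
  calc _ ≤ ∫⁻ y : ℝ, 2 * ofReal (exp (-|y| / (2 * a)) / (2 * (2 * a))) := by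
        refine lintegral_mono fun y => ?_
        rw [← ofReal_mul (by positivity), show (2:ℝ≥0∞) = ofReal 2 by simp,
          ← ofReal_mul (by norm_num)]
        refine ofReal_le_ofReal ?_
        have : exp (-|y| / a) * exp (κ * |y|) ≤ exp (-|y| / (2 * a)) := by
          rw [← exp_add]
          refine exp_le_exp.2 ?_
          have h : κ ≤ 1 / (2 * a) := by
            rw [le_div_iff₀ h2a]; linarith
          have h' : κ * |y| ≤ 1 / (2 * a) * |y| := by gcongr
          have : -|y| / a + 1 / (2 * a) * |y| = -|y| / (2 * a) := by field_simp; ring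
          linarith
        calc _ = exp (-|y| / a) * exp (κ * |y|) / (2 * a) := by ring
          _ ≤ exp (-|y| / (2 * a)) / (2 * a) := by gcongr
          _ = _ := by field_simp
    _ = 2 * lap (2 * a) univ := by
        rw [lintegral_const_mul _ (by fun_prop), lap, withDensity_apply _ MeasurableSet.univ,
          Measure.restrict_univ]
    _ ≤ 2 := by rw [lap_univ h2a, mul_one]

lemma lintegral_lap_comp_add_le {a : ℝ} (ha : 0 < a) {f : ℝ → ℝ≥0∞} (hf : Measurable f) (s : ℝ) :
    ∫⁻ y, f (s + y) ∂lap a ≤ ofReal (exp (1 / a * |s|)) * ∫⁻ y, f y ∂lap a := by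
  rw [lintegral_lap a (f := fun y => f (s + y)) (by fun_prop), lintegral_lap a hf,
    ← lintegral_const_mul _ (by fun_prop),
    ← lintegral_sub_right_eq_self (fun y => ofReal (exp (-|y| / a) / (2 * a)) *
      f (s + y)) s]
  refine lintegral_mono fun y => ?_
  simp only [add_sub_cancel]
  rw [← mul_assoc, ← ofReal_mul (by positivity)]
  gcongr
  rw [mul_div_assoc', ← exp_add]
  gcongr
  have := abs_sub_abs_le_abs_sub y s
  have h2 : |y| ≤ |y - s| + |s| := by linarith
  rw [one_div, inv_mul_eq_div, ← add_div]
  gcongr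
  linarith

/-- `f` varies at most exponentially, with rate `κ`, along the direction `e`. -/
def HarnackAlong (e : ℝ²) (κ : ℝ) (f : ℝ² → ℝ≥0∞) : Prop :=
  ∀ x s, f (x + s • e) ≤ ofReal (exp (κ * |s|)) * f x

namespace HarnackAlong

variable {e : ℝ²} {κ : ℝ} {f : ℝ² → ℝ≥0∞}

lemma mono (hf : HarnackAlong e κ f) {κ' : ℝ} (h : κ ≤ κ') : HarnackAlong e κ' f := fun x s =>
  (hf x s).trans (mul_le_mul' (ofReal_le_ofReal (exp_le_exp.2
    (mul_le_mul_of_nonneg_right h (abs_nonneg _)))) le_rfl)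

lemma sum {ι : Type*} (t : Finset ι) {f : ι → ℝ² → ℝ≥0∞}
    (hf : ∀ i ∈ t, HarnackAlong e κ (f i)) : HarnackAlong e κ (fun x => ∑ i ∈ t, f i x) :=
  fun x s => by
    rw [mul_sum]
    exact sum_le_sum fun i hi => hf i hi x s

lemma const_mul (hf : HarnackAlong e κ f) (c : ℝ≥0∞) : HarnackAlong e κ (fun x => c * f x) :=
  fun x s => by
    rw [mul_left_comm]
    exact mul_le_mul' le_rfl (hf x s)

lemma lintegral {α : Type*} [MeasurableSpace α] (ν : Measure α) {f : α → ℝ² → ℝ≥0∞}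
    (hm : ∀ x, Measurable fun a => f a x)
    (hf : ∀ a, HarnackAlong e κ (f a)) : HarnackAlong e κ (fun x => ∫⁻ a, f a x ∂ν) :=
  fun x s => by
    rw [← lintegral_const_mul _ (hm x)]
    exact lintegral_mono fun a => hf a x s

lemma rpow (hf : HarnackAlong e κ f) {t : ℝ} (ht : 0 ≤ t) :
    HarnackAlong e (t * κ) (fun x => f x ^ t) := fun x s => by
  calc f (x + s • e) ^ t ≤ (ofReal (exp (κ * |s|)) * f x) ^ t := by
        gcongr; exact hf x s
    _ = _ := by
        rw [mul_rpow_of_nonneg _ _ ht, ofReal_rpow_of_pos (exp_pos _),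
          ← exp_mul]
        ring_nf

end HarnackAlong

/-- The law of `(s + y) • e`, where `y` has a two-sided exponential distribution. -/
def lapAlong (e : ℝ²) (s a : ℝ) : Measure (ℝ²) := (lap a).map fun y => (s + y) • e

instance (e : ℝ²) (s a : ℝ) : SFinite (lapAlong e s a) := by unfold lapAlong; infer_instance

lemma isProbabilityMeasure_lapAlong (e : ℝ²) (s : ℝ) {a : ℝ} (ha : 0 < a) :
    IsProbabilityMeasure (lapAlong e s a) := by
  have := isProbabilityMeasure_lap ha
  exact Measure.isProbabilityMeasure_map (by fun_prop)

lemma addAvg_lapAlong (e : ℝ²) (s a : ℝ) {f : ℝ² → ℝ≥0∞} (hf : Measurable f) (x : ℝ²) :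
    addAvg (lapAlong e s a) f x = ∫⁻ y, f (x + (s + y) • e) ∂lap a := by
  rw [addAvg, lapAlong, lintegral_map (by fun_prop) (by fun_prop)]

lemma subAvg_lapAlong (e : ℝ²) (s a : ℝ) {f : ℝ² → ℝ≥0∞} (hf : Measurable f) (x : ℝ²) :
    subAvg (lapAlong e s a) f x = ∫⁻ y, f (x - (s + y) • e) ∂lap a := by
  rw [subAvg, lapAlong, lintegral_map (by fun_prop) (by fun_prop)]

lemma harnackAlong_addAvg_lapAlong (e : ℝ²) (s : ℝ) {a : ℝ} (ha : 0 < a)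
    {f : ℝ² → ℝ≥0∞} (hf : Measurable f) :
    HarnackAlong e (1 / a) (addAvg (lapAlong e s a) f) := fun x t => by
  rw [addAvg_lapAlong e s a hf, addAvg_lapAlong e s a hf]
  have := lintegral_lap_comp_add_le ha (f := fun y => f (x + (s + y) • e)) (by fun_prop) t
  refine le_trans (le_of_eq ?_) this
  refine lintegral_congr fun y => ?_
  congr 1
  rw [add_assoc, ← add_smul]
  ring_nf

lemma subAvg_lapAlong_le {e : ℝ²} {κ s a : ℝ} (ha : 0 < a) {f : ℝ² → ℝ≥0∞}
    (hm : Measurable f) (hf : HarnackAlong e κ f) (hκ : 0 ≤ κ) (hs : κ * |s| ≤ 1 / 2)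
    (hκa : κ * a ≤ 1 / 2) (x : ℝ²) : subAvg (lapAlong e s a) f x ≤ 4 * f x := by
  rw [subAvg_lapAlong e s a hm]
  calc ∫⁻ y, f (x - (s + y) • e) ∂lap a
      ≤ ∫⁻ y, ofReal (exp (1 / 2)) * f x *
          ofReal (exp (κ * |y|)) ∂lap a := by
        refine lintegral_mono fun y => ?_
        rw [sub_eq_add_neg, ← neg_smul]
        refine (hf x _).trans ?_
        rw [mul_right_comm, ← ofReal_mul (by positivity), ← exp_add, abs_neg]
        gcongr
        have := abs_add_le s y
        nlinarith
    _ = ofReal (exp (1 / 2)) * f x *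
          ∫⁻ y, ofReal (exp (κ * |y|)) ∂lap a := lintegral_const_mul _ (by fun_prop)
    _ ≤ ofReal 2 * f x * 2 := by
        gcongr
        · have h1 := exp_one_lt_d9
          have h2 : exp (1 / 2) * exp (1 / 2) = exp 1 := by
            rw [← exp_add]; norm_num
          nlinarith [exp_pos (1 / 2)]
        · exact lintegral_exp_lap_le ha hκa
    _ = 4 * f x := by
        rw [ofReal_ofNat, mul_right_comm]; norm_num

lemma lpN_rpow_sub_one {f : ℝ² → ℝ≥0∞} {q r : ℝ} (hqr : q.HolderConjugate r) :
    lpN (fun x => f x ^ (q - 1)) r = lpN f q ^ (q - 1) := by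
  have h : (q - 1) * r = q := by
    have := hqr.sub_one_mul_conj; linarith
  simp only [lpN, ← ENNReal.rpow_mul, h]
  congr 1
  have hq := hqr.ne_zero
  have hr := hqr.symm.ne_zero
  have h1 : (q - 1) = q / r := by field_simp; linarith
  rw [h1]; field_simp

lemma sum_range_ite_residue (F : ℕ → ℝ≥0∞) {D : ℕ} (hD : 0 < D) (N M c : ℕ) :
    ∑ l ∈ Finset.range M, (if c + D * l < N then F (c + D * l) else 0) =
      ∑ m ∈ ((Finset.range M).filter fun l => c + D * l < N).image (fun l => c + D * l), F m := by
  rw [sum_image, sum_filter]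
  intro l _ l' _ h
  exact Nat.eq_of_mul_eq_mul_left hD (Nat.add_left_cancel h)

/-- Summing over scales, where the interaction of well separated scales is controlled by
majorants `b'`. -/
lemma lpN_sum_le_of_majorant {q r : ℝ} (hq : 2 ≤ q) (hqr : q.HolderConjugate r) (N D : ℕ)
    (hD : 0 < D) {b b' h : ℕ → ℝ² → ℝ≥0∞} (hb : ∀ m, Measurable (b m))
    (hb' : ∀ m, Measurable (b' m)) (hh : ∀ m, Measurable (h m)) {A d : ℝ≥0∞} (hd : d ≠ ⊤)
    (hfin : lpN (fun x => ∑ m ∈ Finset.range N, h m x) q ≠ ⊤)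
    (hdiag : ∀ m < N, lpN (b m) q ≤ d * lpN (h m) q)
    (hcross : ∀ m < N, ∀ S : Finset ℕ, (∀ k ∈ S, k + D ≤ m) →
      ∫⁻ x, b m x * (∑ k ∈ S, b k x) ^ (q - 1) ≤ ∫⁻ x, b' m x * (∑ k ∈ S, b k x) ^ (q - 1))
    (hmaj : ∀ S ⊆ Finset.range N,
      lpN (fun x => ∑ m ∈ S, b' m x) q ≤ A * lpN (fun x => ∑ m ∈ S, h m x) q) :
    lpN (fun x => ∑ m ∈ Finset.range N, b m x) q ≤
      D * (ofReal (2 * q * exp 1) * A + ofReal (2 * (1 + q)) * d) *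
        lpN (fun x => ∑ m ∈ Finset.range N, h m x) q := by
  have hq0 : 0 < q := by linarith
  have hq1 : 0 ≤ q - 1 := by linarith
  refine lpN_sum_le_of_residues (by linarith) N D hD hb fun c _ => ?_
  have hmeas : ∀ {f : ℕ → ℝ² → ℝ≥0∞}, (∀ m, Measurable (f m)) →
      ∀ l, Measurable fun x => if c + D * l < N then f (c + D * l) x else 0 := by
    intro f hf l
    split_ifs
    · exact hf _
    · exact measurable_const
  refine lpN_sum_le_of_blocks hq N (b := fun l x => if c + D * l < N then b (c + D * l) x else 0)
    (h := fun l x => if c + D * l < N then h (c + D * l) x else 0) (hmeas hb) (hmeas hh) hd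
    (ne_top_of_le_ne_top hfin (lpN_mono hq0 fun x => sum_residue_le (fun m => h m x) D N c hD))
    (fun l _ => ?_) ?_
  · by_cases hl : c + D * l < N
    · simpa only [hl, if_true] using hdiag _ hl
    · simp only [hl, if_false, lpN_zero hq0, zero_le]
  · set z : ℝ² → ℝ≥0∞ := fun x =>
      ∑ l ∈ Finset.range N, (if c + D * l < N then b (c + D * l) x else 0) with hz
    have hzm : Measurable z := Finset.measurable_fun_sum _ fun l _ => hmeas hb l
    have step : ∀ l ∈ Finset.range N,
        ∫⁻ x, (if c + D * l < N then b (c + D * l) x else 0) *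
          (∑ k ∈ Finset.range l, (if c + D * k < N then b (c + D * k) x else 0)) ^ (q - 1) ≤
        ∫⁻ x, (if c + D * l < N then b' (c + D * l) x else 0) * z x ^ (q - 1) := by
      intro l hl
      by_cases hlN : c + D * l < N
      swap
      · simp only [hlN, if_false, zero_mul, le_refl]
      simp only [hlN, if_true]
      calc _ ≤ ∫⁻ x, b' (c + D * l) x *
            (∑ k ∈ Finset.range l, (if c + D * k < N then b (c + D * k) x else 0)) ^ (q - 1) := by
            have := hcross _ hlN
              (((Finset.range l).filter fun k => c + D * k < N).image (fun k => c + D * k)) ?_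
            · simpa only [← sum_range_ite_residue _ hD] using this
            · intro k hk
              obtain ⟨k', hk', rfl⟩ := Finset.mem_image.1 hk
              have : k' + 1 ≤ l := Finset.mem_range.1 (mem_filter.1 hk').1
              nlinarith
        _ ≤ _ := by
            refine lintegral_mono fun x => mul_le_mul' le_rfl (rpow_le_rpow ?_ hq1)
            refine sum_le_sum_of_subset ?_
            exact Finset.range_subset_range.2 (Finset.mem_range.1 hl).le
    calc _ ≤ ∑ l ∈ Finset.range N,
          ∫⁻ x, (if c + D * l < N then b' (c + D * l) x else 0) * z x ^ (q - 1) :=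
          sum_le_sum step
      _ = ∫⁻ x, (∑ l ∈ Finset.range N, (if c + D * l < N then b' (c + D * l) x else 0)) *
            z x ^ (q - 1) := by
          rw [← lintegral_finsetSum]
          · simp only [sum_mul]
          · exact fun l _ => (hmeas hb' l).mul (hzm.pow_const _)
      _ ≤ lpN (fun x => ∑ l ∈ Finset.range N, (if c + D * l < N then b' (c + D * l) x else 0)) q *
            lpN (fun x => z x ^ (q - 1)) r :=
          lintegral_mul_le_lpN hqr (Finset.measurable_fun_sum _ fun l _ => hmeas hb' l)
            (hzm.pow_const _)
      _ ≤ _ := by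
          rw [lpN_rpow_sub_one hqr]
          refine mul_le_mul' ?_ le_rfl
          have hrew := fun x => sum_range_ite_residue (fun m => b' m x) hD N N c
          have hrew' := fun x => sum_range_ite_residue (fun m => h m x) hD N N c
          simp only [hrew, hrew']
          refine hmaj _ fun m hm => ?_
          obtain ⟨k', hk', rfl⟩ := Finset.mem_image.1 hm
          exact Finset.mem_range.2 (mem_filter.1 hk').2

lemma le_of_sum_rpow_le {ι : Type*} {I : Finset ι} {v : ι → ℝ≥0∞} {W : ℝ≥0∞} {r : ℝ} (hr : 0 < r)
    (hv : ∑ i ∈ I, v i ^ r ≤ W ^ r) {i : ι} (hi : i ∈ I) : v i ≤ W :=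
  (rpow_le_rpow_iff hr).1
    ((single_le_sum (f := fun i => v i ^ r) (fun _ _ => zero_le) hi).trans hv)

lemma lpN_sum_weighted_le {q r : ℝ} (hqr : q.HolderConjugate r) {ι : Type*} (I : Finset ι)
    {v : ι → ℝ≥0∞} {W : ℝ≥0∞} (hv : ∑ i ∈ I, v i ^ r ≤ W ^ r) {f h : ι → ℝ² → ℝ≥0∞}
    (hf : ∀ i ∈ I, Measurable (f i)) (hh : ∀ i ∈ I, Measurable (h i))
    (hfh : ∀ i ∈ I, lpN (f i) q ≤ lpN (h i) q) :
    lpN (fun x => ∑ i ∈ I, v i * f i x) q ≤ W * lpN (fun x => ∑ i ∈ I, h i x) q := by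
  have hq0 := hqr.pos
  have hr0 := hqr.symm.pos
  rw [← rpow_le_rpow_iff hq0, mul_rpow_of_nonneg _ _ hq0.le]
  calc lpN (fun x => ∑ i ∈ I, v i * f i x) q ^ q
      = ∫⁻ x, (∑ i ∈ I, v i * f i x) ^ q := lpN_rpow _ hq0
    _ ≤ ∫⁻ x, W ^ q * ∑ i ∈ I, f i x ^ q := by
        refine lintegral_mono fun x => ?_
        have h1 := ENNReal.inner_le_Lp_mul_Lq I v (fun i => f i x) hqr.symm
        calc (∑ i ∈ I, v i * f i x) ^ q
            ≤ ((∑ i ∈ I, v i ^ r) ^ (1 / r) * (∑ i ∈ I, f i x ^ q) ^ (1 / q)) ^ q :=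
              rpow_le_rpow h1 hq0.le
          _ ≤ (W * (∑ i ∈ I, f i x ^ q) ^ (1 / q)) ^ q := by
              gcongr
              calc _ ≤ (W ^ r) ^ (1 / r) := by gcongr
                _ = W := by rw [one_div, ENNReal.rpow_rpow_inv hr0.ne']
          _ = _ := by
              rw [mul_rpow_of_nonneg _ _ hq0.le, one_div, ENNReal.rpow_inv_rpow hq0.ne']
    _ = W ^ q * ∑ i ∈ I, lpN (f i) q ^ q := by
        rw [lintegral_const_mul _ (Finset.measurable_fun_sum _ fun i hi => (hf i hi).pow_const _),
          lintegral_finsetSum _ (fun i hi => (hf i hi).pow_const _)]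
        simp only [lpN_rpow _ hq0]
    _ ≤ W ^ q * ∑ i ∈ I, lpN (h i) q ^ q := by
        gcongr with i hi
        exact hfh i hi
    _ ≤ _ := by
        gcongr
        exact lpN_sum_rpow_le I hqr.lt.le hh

lemma lpN_addAvg_le_of_isProbabilityMeasure (μ : Measure (ℝ²)) [IsProbabilityMeasure μ]
    {f : ℝ² → ℝ≥0∞} (hf : Measurable f) {q : ℝ} (hq : 1 ≤ q) :
    lpN (addAvg μ f) q ≤ lpN f q := by
  simpa using lpN_addAvg_le μ hf hq

/-- Dual one-parameter maximal inequality with weights, along a direction. -/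
lemma lpN_sum_lapAlong_le {e : ℝ²} {ϑ B η Ω ω q r : ℝ} (hq : 2 ≤ q)
    (hqr : q.HolderConjugate r) (hϑ : 1 ≤ ϑ) (hB : 0 < B) (hη : 0 < η) (hη1 : η ≤ 1)
    (hω : |ω| ≤ Ω) {ι : Type*} (I : Finset ι) (N D : ℕ) (hD : 0 < D)
    (hDq : 2 * q * (Ω + 1) * ϑ ≤ η * ϑ ^ D) {β : ℕ → ι → ℝ}
    (hβ : ∀ m, ∀ i ∈ I, B / ϑ ^ m ≤ β m i ∧ β m i ≤ ϑ * (B / ϑ ^ m)) {v : ℕ → ι → ℝ≥0∞}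
    {W : ℝ≥0∞} (hW : W ≠ ⊤) (hv : ∀ m, ∑ i ∈ I, v m i ^ r ≤ W ^ r)
    {h : ℕ → ι → ℝ² → ℝ≥0∞} (hh : ∀ m i, Measurable (h m i))
    (hfin : lpN (fun x => ∑ m ∈ Finset.range N, ∑ i ∈ I, h m i x) q ≠ ⊤) :
    lpN (fun x => ∑ m ∈ Finset.range N, ∑ i ∈ I,
        v m i * addAvg (lapAlong e (β m i * ω) (β m i * η)) (h m i) x) q ≤
      ofReal (25 * D * q) * W *
        lpN (fun x => ∑ m ∈ Finset.range N, ∑ i ∈ I, h m i x) q := by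
  have hq0 : 0 < q := by linarith
  have hϑ0 : 0 < ϑ := by linarith
  have hΩ : 0 ≤ Ω := (abs_nonneg _).trans hω
  have hβ0 : ∀ m, ∀ i ∈ I, 0 < β m i := fun m i hi => lt_of_lt_of_le (by positivity) (hβ m i hi).1
  have hb : ∀ m, Measurable fun x => ∑ i ∈ I,
      v m i * addAvg (lapAlong e (β m i * ω) (β m i * η)) (h m i) x := fun m =>
    Finset.measurable_fun_sum _ fun i _ => (measurable_addAvg _ (hh m i)).const_mul _
  have hb' : ∀ m, Measurable fun x => ∑ i ∈ I, 4 * (v m i * h m i x) := fun m =>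
    Finset.measurable_fun_sum _ fun i _ => ((hh m i).const_mul _).const_mul _
  have key := lpN_sum_le_of_majorant hq hqr N D hD (A := 4 * W) (d := W) hb hb'
    (h := fun m x => ∑ i ∈ I, h m i x) (fun m => Finset.measurable_fun_sum _ fun i _ => hh m i)
    hW hfin ?_ ?_ ?_
  · refine key.trans (mul_le_mul' ?_ le_rfl)
    calc (D : ℝ≥0∞) * (ofReal (2 * q * exp 1) * (4 * W) +
          ofReal (2 * (1 + q)) * W)
        = ofReal (D * (2 * q * exp 1 * 4 + 2 * (1 + q))) * W := by
          rw [ofReal_mul (p := (D : ℝ)) (by positivity), ofReal_add (by positivity)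
            (by positivity), ofReal_mul (p := 2 * q * exp 1) (by positivity), ofReal_natCast,
            ofReal_ofNat]
          ring
      _ ≤ _ := by
          refine mul_le_mul' (ofReal_le_ofReal ?_) le_rfl
          have h1 := exp_one_lt_d9
          have : 2 * q * exp 1 * 4 + 2 * (1 + q) ≤ 25 * q := by nlinarith
          calc (D:ℝ) * (2 * q * exp 1 * 4 + 2 * (1 + q)) ≤ D * (25 * q) := by gcongr
            _ = _ := by ring
  · intro m _
    refine lpN_sum_weighted_le hqr I (hv m) (fun i _ => measurable_addAvg _ (hh m i))
      (fun i _ => hh m i) fun i hi => ?_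
    have := isProbabilityMeasure_lapAlong e (β m i * ω) (mul_pos (hβ0 m i hi) hη)
    exact lpN_addAvg_le_of_isProbabilityMeasure _ (hh m i) (by linarith)
  · intro m _ S hS
    have hY : HarnackAlong e (ϑ ^ m / ϑ ^ D / (B * η)) fun x => ∑ k ∈ S, ∑ i ∈ I,
        v k i * addAvg (lapAlong e (β k i * ω) (β k i * η)) (h k i) x := by
      refine .sum _ fun k hk => .sum _ fun i hi => .const_mul ?_ _
      refine (harnackAlong_addAvg_lapAlong e _ (mul_pos (hβ0 k i hi) hη) (hh k i)).mono ?_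
      have h1 : ϑ ^ k ≤ ϑ ^ m / ϑ ^ D := by
        rw [le_div_iff₀ (by positivity), ← pow_add]
        exact pow_le_pow_right₀ hϑ (hS k hk)
      calc 1 / (β k i * η) ≤ 1 / (B / ϑ ^ k * η) := by
            gcongr
            exact (hβ k i hi).1
        _ = ϑ ^ k / (B * η) := by field_simp
        _ ≤ _ := by gcongr
    set Y := fun x => ∑ k ∈ S, ∑ i ∈ I,
        v k i * addAvg (lapAlong e (β k i * ω) (β k i * η)) (h k i) x with hYdef
    have hYm : Measurable Y := Finset.measurable_fun_sum _ fun k _ => hb k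
    have hYp := hY.rpow (t := q - 1) (by linarith)
    set κ := (q - 1) * (ϑ ^ m / ϑ ^ D / (B * η)) with hκ
    have hκ0 : 0 ≤ κ := mul_nonneg (by linarith) (by positivity)
    have hκβ : ∀ i ∈ I, κ * β m i * (Ω + 1) ≤ 1 / 2 := fun i hi => by
      calc κ * β m i * (Ω + 1) ≤ κ * (ϑ * (B / ϑ ^ m)) * (Ω + 1) := by
            gcongr
            exact (hβ m i hi).2
        _ = (q - 1) * (Ω + 1) * ϑ / (η * ϑ ^ D) := by
            rw [hκ]; field_simp
        _ ≤ 1 / 2 := by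
            rw [div_le_div_iff₀ (by positivity) (by norm_num)]
            nlinarith [mul_nonneg (by linarith : 0 ≤ Ω + 1) hϑ0.le]
    have hstep : ∀ i ∈ I, ∫⁻ x, addAvg (lapAlong e (β m i * ω) (β m i * η)) (h m i) x *
        Y x ^ (q - 1) ≤ ∫⁻ x, 4 * (h m i x * Y x ^ (q - 1)) := fun i hi => by
      have hβi := hβ0 m i hi
      rw [← lintegral_mul_subAvg _ (hYm.pow_const _) (hh m i)]
      refine lintegral_mono fun x => ?_
      rw [mul_left_comm]
      refine mul_le_mul' le_rfl (subAvg_lapAlong_le (mul_pos hβi hη) (hYm.pow_const _) hYp hκ0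
        ?_ ?_ x)
      · refine le_trans ?_ (hκβ i hi)
        rw [abs_mul, abs_of_pos hβi, ← mul_assoc]
        have : |ω| ≤ Ω + 1 := by linarith
        gcongr
      · refine le_trans ?_ (hκβ i hi)
        rw [← mul_assoc]
        have : η ≤ Ω + 1 := by linarith
        gcongr
    calc ∫⁻ x, (∑ i ∈ I, v m i * addAvg (lapAlong e (β m i * ω) (β m i * η)) (h m i) x) *
          Y x ^ (q - 1)
        = ∑ i ∈ I, v m i * ∫⁻ x, addAvg (lapAlong e (β m i * ω) (β m i * η)) (h m i) x *
            Y x ^ (q - 1) := by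
          simp only [sum_mul]
          rw [lintegral_finsetSum]
          · refine sum_congr rfl fun i _ => ?_
            have hm : Measurable fun x => addAvg (lapAlong e (β m i * ω) (β m i * η)) (h m i) x *
                Y x ^ (q - 1) := (measurable_addAvg _ (hh m i)).mul (hYm.pow_const _)
            rw [← lintegral_const_mul _ hm]
            simp only [mul_assoc]
          · exact fun i _ => ((measurable_addAvg _ (hh m i)).const_mul _).mul (hYm.pow_const _)
      _ ≤ ∑ i ∈ I, v m i * ∫⁻ x, 4 * (h m i x * Y x ^ (q - 1)) := by
          exact sum_le_sum fun i hi => mul_le_mul' le_rfl (hstep i hi)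
      _ = _ := by
          simp only [sum_mul]
          rw [lintegral_finsetSum]
          · refine sum_congr rfl fun i _ => ?_
            have hm : Measurable fun x => 4 * (h m i x * Y x ^ (q - 1)) :=
              ((hh m i).mul (hYm.pow_const _)).const_mul _
            rw [← lintegral_const_mul _ hm]
            refine lintegral_congr fun x => ?_
            ring
          · exact fun i _ => (((hh m i).const_mul _).const_mul _).mul (hYm.pow_const _)
  · intro S _
    rw [← lpN_const_mul _ hq0 (Finset.measurable_fun_sum _ fun m _ =>
      Finset.measurable_fun_sum _ fun i _ => hh m i)]
    refine lpN_mono hq0 fun x => ?_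
    simp only [mul_sum]
    refine sum_le_sum fun m _ => sum_le_sum fun i hi => ?_
    rw [mul_assoc]
    gcongr
    exact le_of_sum_rpow_le hqr.symm.pos (hv m) hi

lemma lintegral_lap_le_mul {a a' : ℝ} (ha : 0 < a) (haa' : a ≤ a') {f : ℝ → ℝ≥0∞}
    (hf : Measurable f) :
    ∫⁻ y, f y ∂lap a ≤ ofReal (a' / a) * ∫⁻ y, f y ∂lap a' := by
  have ha' : 0 < a' := by linarith
  rw [lintegral_lap a hf, lintegral_lap a' hf, ← lintegral_const_mul _ (by fun_prop)]
  refine lintegral_mono fun y => ?_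
  rw [← mul_assoc, ← ofReal_mul (by positivity)]
  refine mul_le_mul' (ofReal_le_ofReal ?_) le_rfl
  have h1 : exp (-|y| / a) ≤ exp (-|y| / a') := by
    rw [neg_div, neg_div]
    gcongr
  calc _ ≤ exp (-|y| / a') / (2 * a) := by gcongr
    _ = _ := by field_simp

lemma lintegral_lap_scale {a : ℝ} (ha : 0 < a) {f : ℝ → ℝ≥0∞} (hf : Measurable f) :
    ∫⁻ y, f (a * y) ∂lap 1 = ∫⁻ y, f y ∂lap a := by
  have h := lintegral_image_eq_lintegral_abs_deriv_mul (s := univ) (f := fun y => a * y)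
    (f' := fun _ => a) MeasurableSet.univ
    (fun x _ => by simpa using (hasDerivAt_id x).const_mul a)
    (fun x _ y _ hxy => mul_left_cancel₀ ha.ne' hxy)
    (fun y => ofReal (exp (-|y| / a) / (2 * a)) * f y)
  have himg : (fun y => a * y) '' univ = univ := by
    rw [image_univ]
    exact (mul_left_surjective₀ ha.ne').range_eq
  rw [himg, Measure.restrict_univ] at h
  rw [lintegral_lap 1 (f := fun y => f (a * y)) (by fun_prop), lintegral_lap a hf, h]
  refine lintegral_congr fun y => ?_
  rw [← mul_assoc, ← ofReal_mul (abs_nonneg _), abs_mul, abs_of_pos ha]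
  congr 2
  have : -(a * |y|) / a = -|y| / 1 := by field_simp
  rw [this]; field_simp

/-- Averages along a monomial curve are dominated by averages of exponential type. -/
lemma exists_lintegral_monomial_le {b c : ℝ} (hb : 1 < b) (hc : c ≠ 0) :
    ∃ C : ℝ, 0 < C ∧ ∀ g : ℝ → ℝ≥0∞, Measurable g →
      ∫⁻ t in Icc (1 / 2 : ℝ) 2, g (c * t ^ b) ≤ ofReal C * ∫⁻ s, g s ∂lap 1 := by
  set K : ℝ := |c| * 2 ^ b with hK
  set δ : ℝ := |c| * (b * (1 / 2) ^ (b - 1)) with hδ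
  have hc0 : 0 < |c| := abs_pos.2 hc
  have hb0 : 0 < b := by linarith
  have hδ0 : 0 < δ := by positivity
  refine ⟨δ⁻¹ * (2 * exp K), by positivity, fun g hg => ?_⟩
  have himg := lintegral_image_eq_lintegral_abs_deriv_mul (s := Icc (1 / 2 : ℝ) 2)
    (f := fun t => c * t ^ b) (f' := fun t => c * (b * t ^ (b - 1))) measurableSet_Icc
    (fun x hx => ((hasDerivAt_rpow_const (Or.inl (by linarith [hx.1]))).const_mul c
      ).hasDerivWithinAt)
    (fun x hx y hy hxy => by
      have h1 := mul_left_cancel₀ hc hxy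
      exact (Real.rpow_left_inj (by linarith [hx.1]) (by linarith [hy.1]) hb0.ne').1 h1) g
  have h1 : ofReal δ * ∫⁻ t in Icc (1 / 2 : ℝ) 2, g (c * t ^ b) ≤
      ∫⁻ s in (fun t => c * t ^ b) '' Icc (1 / 2 : ℝ) 2, g s := by
    rw [himg, ← lintegral_const_mul _ (by fun_prop)]
    refine setLIntegral_mono' measurableSet_Icc fun t ht => ?_
    refine mul_le_mul' (ofReal_le_ofReal ?_) le_rfl
    have ht0 : 0 < t := by linarith [ht.1]
    rw [abs_mul, abs_of_pos (a := b * t ^ (b - 1)) (by positivity)]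
    have : (1 / 2 : ℝ) ^ (b - 1) ≤ t ^ (b - 1) :=
      Real.rpow_le_rpow (by norm_num) ht.1 (by linarith)
    rw [hδ]
    gcongr
  have h2 : ∫⁻ s in (fun t => c * t ^ b) '' Icc (1 / 2 : ℝ) 2, g s ≤
      ofReal (2 * exp K) * ∫⁻ s, g s ∂lap 1 := by
    rw [lintegral_lap 1 hg, ← lintegral_const_mul _ (by fun_prop)]
    calc _ ≤ ∫⁻ s in Icc (-K) K, g s := by
          refine lintegral_mono_set ?_
          rintro _ ⟨t, ht, rfl⟩
          rw [mem_Icc, ← abs_le, abs_mul, abs_of_nonneg (rpow_nonneg (by linarith [ht.1]) _)]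
          have : t ^ b ≤ 2 ^ b := Real.rpow_le_rpow (by linarith [ht.1]) ht.2 hb0.le
          exact mul_le_mul_of_nonneg_left this hc0.le
      _ ≤ ∫⁻ s in Icc (-K) K, ofReal (2 * exp K) *
            (ofReal (exp (-|s| / 1) / (2 * 1)) * g s) := by
          refine setLIntegral_mono' measurableSet_Icc fun s hs => ?_
          rw [← mul_assoc, ← ofReal_mul (by positivity)]
          have hs' := abs_le.2 hs
          have h3 : 1 ≤ 2 * exp K * (exp (-|s| / 1) / (2 * 1)) := by
            have h4 : exp K * exp (-|s|) = exp (K - |s|) := by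
              rw [← exp_add]; rfl
            have h5 : 1 ≤ exp (K - |s|) := Real.one_le_exp (by linarith)
            rw [div_one]
            calc (1:ℝ) ≤ exp K * exp (-|s|) := by rw [h4]; exact h5
              _ = _ := by ring
          calc g s = 1 * g s := (one_mul _).symm
            _ ≤ _ := by
                refine mul_le_mul' ?_ le_rfl
                rw [← ofReal_one]
                exact ofReal_le_ofReal h3
      _ ≤ _ := setLIntegral_le_lintegral _ _
  have h3 := h1.trans h2
  have hδE : ofReal δ ≠ 0 := by simpa using hδ0
  calc _ = (ofReal δ)⁻¹ * (ofReal δ * ∫⁻ t in Icc (1 / 2 : ℝ) 2, g (c * t ^ b)) := by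
        rw [← mul_assoc, ENNReal.inv_mul_cancel hδE ofReal_ne_top, one_mul]
    _ ≤ (ofReal δ)⁻¹ * (ofReal (2 * exp K) * ∫⁻ s, g s ∂lap 1) := by gcongr
    _ = _ := by
        rw [ofReal_mul (p := δ⁻¹) (by positivity), ENNReal.ofReal_inv_of_pos hδ0, mul_assoc]

lemma lpN_lintegral_le {α : Type*} [MeasurableSpace α] (ν : Measure α) [IsFiniteMeasure ν]
    {F : α → ℝ² → ℝ≥0∞} (hF : Measurable (uncurry F)) {q : ℝ} (hq : 1 ≤ q)
    {K : ℝ≥0∞} (hK : ∀ᵐ a ∂ν, lpN (F a) q ≤ K) :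
    lpN (fun x => ∫⁻ a, F a x ∂ν) q ≤ ν univ * K := by
  have hq0 : 0 < q := by linarith
  rw [← rpow_le_rpow_iff hq0, lpN_rpow _ hq0]
  calc ∫⁻ x, (∫⁻ a, F a x ∂ν) ^ q
      ≤ ∫⁻ x, ν univ ^ (q - 1) * ∫⁻ a, F a x ^ q ∂ν := by
        refine lintegral_mono fun x => lintegral_rpow_le_of_finite ν ?_ hq
        exact hF.of_uncurry_right
    _ = ν univ ^ (q - 1) * ∫⁻ a, (∫⁻ x, F a x ^ q) ∂ν := by
        have hm : Measurable (uncurry fun (x : ℝ²) (a : α) => F a x ^ q) :=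
          (hF.comp measurable_swap).pow_const q
        rw [lintegral_const_mul _ hm.lintegral_prod_right, lintegral_lintegral_swap hm.aemeasurable]
    _ ≤ ν univ ^ (q - 1) * ∫⁻ _, K ^ q ∂ν := by
        refine mul_le_mul' le_rfl (lintegral_mono_ae ?_)
        filter_upwards [hK] with a ha
        rw [← lpN_rpow _ hq0]
        gcongr
    _ = (ν univ * K) ^ q := by
        rw [lintegral_const, mul_rpow_of_nonneg _ _ hq0.le, mul_left_comm, mul_comm]
        congr 1
        by_cases h0 : ν univ = 0
        · rcases eq_or_lt_of_le hq with h1 | h1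
          · simp [h0, ← h1]
          · simp [h0, hq0]
        · nth_rewrite 2 [← ENNReal.rpow_one (ν univ)]
          rw [← ENNReal.rpow_add _ _ h0 (measure_ne_top _ _)]
          congr 1; ring

/-- The law of a smoothed curve: `(α (t + η₁ y₁), β (c t ^ b + η₂ y₂))` with `t` uniform on `[1/2, 2]`
and `y₁`, `y₂` two-sided exponentials. -/
def curveLap (b c α β η₁ η₂ : ℝ) : Measure (ℝ²) :=
  ((volume.restrict (Icc (1 / 2 : ℝ) 2)).prod ((lap (α * η₁)).prod (lap (β * η₂)))).map
    fun z => (α * z.1 + z.2.1, β * (c * z.1 ^ b) + z.2.2)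

instance (b c α β η₁ η₂ : ℝ) : SFinite (curveLap b c α β η₁ η₂) := by unfold curveLap; infer_instance

lemma lintegral_curveLap (b c α β η₁ η₂ : ℝ) {f : ℝ² → ℝ≥0∞} (hf : Measurable f) :
    ∫⁻ y, f y ∂curveLap b c α β η₁ η₂ = ∫⁻ t in Icc (1 / 2 : ℝ) 2,
      ∫⁻ y₁, ∫⁻ y₂, f (α * t + y₁, β * (c * t ^ b) + y₂) ∂lap (β * η₂) ∂lap (α * η₁) := by
  rw [curveLap, lintegral_map hf (by fun_prop), lintegral_prod _ (by fun_prop)]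
  refine lintegral_congr fun t => ?_
  rw [lintegral_prod _ (by fun_prop)]

lemma addAvg_curveLap (b c α β η₁ η₂ : ℝ) {f : ℝ² → ℝ≥0∞} (hf : Measurable f) (x : ℝ²) :
    addAvg (curveLap b c α β η₁ η₂) f x = ∫⁻ t in Icc (1 / 2 : ℝ) 2,
      addAvg (lapAlong (1, 0) (α * t) (α * η₁))
        (addAvg (lapAlong (0, 1) (β * (c * t ^ b)) (β * η₂)) f) x := by
  rw [addAvg, lintegral_curveLap _ _ _ _ _ _ (by fun_prop)]
  refine lintegral_congr fun t => ?_
  rw [addAvg_lapAlong _ _ _ (measurable_addAvg _ hf)]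
  refine lintegral_congr fun y₁ => ?_
  rw [addAvg_lapAlong _ _ _ hf]
  refine lintegral_congr fun y₂ => ?_
  congr 1
  ext <;> simp [add_assoc]

lemma subAvg_curveLap (b c α β η₁ η₂ : ℝ) {f : ℝ² → ℝ≥0∞} (hf : Measurable f) (x : ℝ²) :
    subAvg (curveLap b c α β η₁ η₂) f x = ∫⁻ t in Icc (1 / 2 : ℝ) 2,
      subAvg (lapAlong (0, 1) (β * (c * t ^ b)) (β * η₂))
        (subAvg (lapAlong (1, 0) (α * t) (α * η₁)) f) x := by
  rw [subAvg, lintegral_curveLap _ _ _ _ _ _ (by fun_prop)]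
  refine lintegral_congr fun t => ?_
  rw [subAvg_lapAlong _ _ _ (measurable_subAvg _ hf), lintegral_lintegral_swap (by fun_prop)]
  refine lintegral_congr fun y₂ => ?_
  rw [subAvg_lapAlong _ _ _ hf]
  refine lintegral_congr fun y₁ => ?_
  congr 1
  ext <;> simp

/-- A vertical average along the curve is dominated by an average of exponential type. -/
lemma lintegral_subAvg_curve_le {b c : ℝ} {C : ℝ}
    (hC : ∀ g : ℝ → ℝ≥0∞, Measurable g →
      ∫⁻ t in Icc (1 / 2 : ℝ) 2, g (c * t ^ b) ≤ ofReal C * ∫⁻ s, g s ∂lap 1)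
    {β η B : ℝ} (hβ : 0 < β) (hη : 0 < η) (hη1 : η ≤ 1) (hB : 2 * β ≤ B) (e : ℝ²)
    {f : ℝ² → ℝ≥0∞} (hf : Measurable f) (x : ℝ²) :
    ∫⁻ t in Icc (1 / 2 : ℝ) 2, subAvg (lapAlong e (β * (c * t ^ b)) (β * η)) f x ≤
      ofReal C * (4 * ofReal (B / (2 * β))) * subAvg (lapAlong e 0 B) f x := by
  set G : ℝ≥0∞ := ∫⁻ s, f (x - s • e) ∂lap (2 * β) with hG
  have hβη : 0 < β * η := mul_pos hβ hη
  calc ∫⁻ t in Icc (1 / 2 : ℝ) 2, subAvg (lapAlong e (β * (c * t ^ b)) (β * η)) f x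
      = ∫⁻ t in Icc (1 / 2 : ℝ) 2,
          (fun s => ∫⁻ y, f (x - (β * s + y) • e) ∂lap (β * η)) (c * t ^ b) := by
        refine lintegral_congr fun t => ?_
        rw [subAvg_lapAlong _ _ _ hf]
    _ ≤ ofReal C * ∫⁻ s, ∫⁻ y, f (x - (β * s + y) • e) ∂lap (β * η) ∂lap 1 :=
        hC _ (by fun_prop)
    _ = ofReal C * ∫⁻ s, ∫⁻ y, f (x - (s + y) • e) ∂lap (β * η) ∂lap β := by
        rw [lintegral_lap_scale hβ (f := fun s => ∫⁻ y, f (x - (s + y) • e) ∂lap (β * η))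
          (by fun_prop)]
    _ ≤ ofReal C * (2 * ∫⁻ s, ∫⁻ y, f (x - (s + y) • e) ∂lap (β * η) ∂lap (2 * β)) := by
        gcongr
        have := lintegral_lap_le_mul hβ (by linarith : β ≤ 2 * β)
          (f := fun s => ∫⁻ y, f (x - (s + y) • e) ∂lap (β * η)) (by fun_prop)
        rwa [show 2 * β / β = 2 by field_simp, ofReal_ofNat] at this
    _ ≤ ofReal C * (2 * (2 * G)) := by
        gcongr
        rw [lintegral_lintegral_swap (by fun_prop)]
        calc ∫⁻ y, ∫⁻ s, f (x - (s + y) • e) ∂lap (2 * β) ∂lap (β * η)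
            ≤ ∫⁻ y, ofReal (exp (1 / (2 * β) * |y|)) * G ∂lap (β * η) := by
              refine lintegral_mono fun y => ?_
              simp only [add_comm _ y]
              exact lintegral_lap_comp_add_le (by positivity) (f := fun s => f (x - s • e))
                (by fun_prop) y
          _ = (∫⁻ y, ofReal (exp (1 / (2 * β) * |y|)) ∂lap (β * η)) * G :=
              lintegral_mul_const _ (by fun_prop)
          _ ≤ 2 * G := by
              gcongr
              refine lintegral_exp_lap_le hβη ?_
              have : 1 / (2 * β) * (β * η) = η / 2 := by field_simp
              linarith
    _ ≤ ofReal C * (2 * (2 * (ofReal (B / (2 * β)) *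
          ∫⁻ s, f (x - s • e) ∂lap B))) := by
        gcongr
        exact lintegral_lap_le_mul (by positivity) hB (by fun_prop)
    _ = _ := by
        rw [subAvg_lapAlong _ _ _ hf]
        simp only [zero_add]
        rw [← mul_assoc 2 2, show (2:ℝ≥0∞) * 2 = 4 by norm_num]
        ring

lemma addAvg_finsetSum (μ : Measure (ℝ²)) {ι : Type*} (s : Finset ι) {f : ι → ℝ² → ℝ≥0∞}
    (hf : ∀ i ∈ s, Measurable (f i)) (x : ℝ²) :
    addAvg μ (fun y => ∑ i ∈ s, f i y) x = ∑ i ∈ s, addAvg μ (f i) x := by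
  simp only [addAvg]
  rw [lintegral_finsetSum]
  exact fun i hi => (hf i hi).comp (measurable_const.add measurable_id)

lemma two_mul_le_two_pow (n : ℕ) (hn : 1 ≤ n) : 2 * n ≤ 2 ^ n := by
  induction n, hn using Nat.le_induction with
  | base => norm_num
  | succ n hn ih => rw [pow_succ]; nlinarith [Nat.one_le_two_pow (n := n)]

lemma lpN_sum_lapAlong_geometric_le {e : ℝ²} {ϑ B q r : ℝ} (hq : 2 ≤ q)
    (hqr : q.HolderConjugate r) (hϑ : 2 ≤ ϑ) (hB : 0 < B) (N : ℕ)
    {h : ℕ → ℝ² → ℝ≥0∞} (hh : ∀ m, Measurable (h m)) :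
    lpN (fun x => ∑ m ∈ Finset.range N, addAvg (lapAlong e 0 (B / ϑ ^ m)) (h m) x) q ≤
      ofReal (50 * q ^ 2) * lpN (fun x => ∑ m ∈ Finset.range N, h m x) q := by
  have hq0 : 0 < q := by linarith
  have hϑ0 : 0 < ϑ := by linarith
  by_cases hfin : lpN (fun x => ∑ m ∈ Finset.range N, h m x) q = ⊤
  · rw [hfin, mul_top]
    · exact le_top
    · simp only [ne_eq, ofReal_eq_zero, not_le]; positivity
  have hn : q ≤ ⌈q⌉₊ := le_ceil q
  have hn1 : 1 ≤ ⌈q⌉₊ := Nat.ceil_pos.2 hq0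
  have hpow : 2 * q ≤ ϑ ^ ⌈q⌉₊ := by
    calc 2 * q ≤ 2 * ⌈q⌉₊ := by linarith
      _ ≤ 2 ^ ⌈q⌉₊ := by exact_mod_cast two_mul_le_two_pow _ hn1
      _ ≤ ϑ ^ ⌈q⌉₊ := pow_le_pow_left₀ (by norm_num) hϑ _
  have key := lpN_sum_lapAlong_le (e := e) (ϑ := ϑ) (B := B) (η := 1) (Ω := 0) (ω := 0) hq hqr
    (by linarith) hB one_pos le_rfl (by simp) ({()} : Finset Unit) N (⌈q⌉₊ + 1) (by positivity)
    (by
      rw [pow_succ]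
      nlinarith) (β := fun m _ => B / ϑ ^ m)
    (fun m _ _ => ⟨le_rfl, le_mul_of_one_le_left (by positivity) (by linarith)⟩)
    (v := fun _ _ => 1) (W := 1) ENNReal.one_ne_top (by simp) (h := fun m _ => h m)
    (fun m _ => hh m) (by simpa using hfin)
  simp only [sum_singleton, one_mul, mul_zero, mul_one] at key
  refine key.trans (mul_le_mul' (ofReal_le_ofReal ?_) le_rfl)
  have : (⌈q⌉₊ : ℝ) < q + 1 := Nat.ceil_lt_add_one hq0.le
  push_cast
  nlinarith

/-- Dual strong maximal inequality with weights. -/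
lemma lpN_sum_lapAlong_lapAlong_le {ϑ₁ ϑ₂ B₁ B₂ q r : ℝ} (hq : 2 ≤ q)
    (hqr : q.HolderConjugate r) (hϑ₁ : 2 ≤ ϑ₁) (hϑ₂ : 2 ≤ ϑ₂) (hB₁ : 0 < B₁) (hB₂ : 0 < B₂)
    (N₁ N₂ : ℕ) {h : ℕ → ℕ → ℝ² → ℝ≥0∞} (hh : ∀ j m, Measurable (h j m)) :
    lpN (fun x => ∑ j ∈ Finset.range N₁, ∑ m ∈ Finset.range N₂,
        addAvg (lapAlong (1, 0) 0 (B₁ / ϑ₁ ^ j)) (addAvg (lapAlong (0, 1) 0 (B₂ / ϑ₂ ^ m)) (h j m))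
          x) q ≤
      ofReal (2500 * q ^ 4) *
        lpN (fun x => ∑ j ∈ Finset.range N₁, ∑ m ∈ Finset.range N₂, h j m x) q := by
  have hm : ∀ j m, Measurable (addAvg (lapAlong (0, 1) 0 (B₂ / ϑ₂ ^ m)) (h j m)) := fun j m =>
    measurable_addAvg _ (hh j m)
  have h1 := lpN_sum_lapAlong_geometric_le (e := (1, 0)) hq hqr hϑ₁ hB₁ N₁ (h := fun j x =>
    ∑ m ∈ Finset.range N₂, addAvg (lapAlong (0, 1) 0 (B₂ / ϑ₂ ^ m)) (h j m) x)
    (fun j => Finset.measurable_fun_sum _ fun m _ => hm j m)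
  have h2 := lpN_sum_lapAlong_geometric_le (e := (0, 1)) hq hqr hϑ₂ hB₂ N₂ (h := fun m x =>
    ∑ j ∈ Finset.range N₁, h j m x) (fun m => Finset.measurable_fun_sum _ fun j _ => hh j m)
  have e1 : ∀ j x, addAvg (lapAlong (1, 0) 0 (B₁ / ϑ₁ ^ j)) (fun x =>
      ∑ m ∈ Finset.range N₂, addAvg (lapAlong (0, 1) 0 (B₂ / ϑ₂ ^ m)) (h j m) x) x =
      ∑ m ∈ Finset.range N₂, addAvg (lapAlong (1, 0) 0 (B₁ / ϑ₁ ^ j))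
        (addAvg (lapAlong (0, 1) 0 (B₂ / ϑ₂ ^ m)) (h j m)) x := fun j x =>
    addAvg_finsetSum _ _ (fun m _ => hm j m) x
  have e2 : ∀ m x, addAvg (lapAlong (0, 1) 0 (B₂ / ϑ₂ ^ m)) (fun x =>
      ∑ j ∈ Finset.range N₁, h j m x) x = ∑ j ∈ Finset.range N₁,
        addAvg (lapAlong (0, 1) 0 (B₂ / ϑ₂ ^ m)) (h j m) x := fun m x =>
    addAvg_finsetSum _ _ (fun j _ => hh j m) x
  simp only [e1] at h1
  simp only [e2] at h2
  rw [show (fun x => ∑ m ∈ Finset.range N₂, ∑ j ∈ Finset.range N₁,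
      addAvg (lapAlong (0, 1) 0 (B₂ / ϑ₂ ^ m)) (h j m) x) = fun x => ∑ j ∈ Finset.range N₁,
      ∑ m ∈ Finset.range N₂, addAvg (lapAlong (0, 1) 0 (B₂ / ϑ₂ ^ m)) (h j m) x from
      funext fun x => sum_comm, show (fun x => ∑ m ∈ Finset.range N₂,
      ∑ j ∈ Finset.range N₁, h j m x) = fun x => ∑ j ∈ Finset.range N₁, ∑ m ∈ Finset.range N₂,
      h j m x from funext fun x => sum_comm] at h2
  refine h1.trans ((mul_le_mul' le_rfl h2).trans (le_of_eq ?_))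
  rw [← mul_assoc, ← ofReal_mul (by positivity)]
  ring_nf

/-- Dual maximal inequality for smoothed curves, with weights. -/
lemma lpN_sum_curveLap_le {b c C : ℝ} (hb : 1 < b) (hC0 : 0 < C)
    (hC : ∀ g : ℝ → ℝ≥0∞, Measurable g →
      ∫⁻ t in Icc (1 / 2 : ℝ) 2, g (c * t ^ b) ≤ ofReal C * ∫⁻ s, g s ∂lap 1)
    {ϑ A₁ A₂ η₁ η₂ q r : ℝ} (hq : 2 ≤ q) (hqr : q.HolderConjugate r) (hϑ : 2 ≤ ϑ) (hA₁ : 0 < A₁)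
    (hA₂ : 0 < A₂) (hη₁ : 0 < η₁) (hη₁1 : η₁ ≤ 1)
    (hη₂ : 0 < η₂) (hη₂1 : η₂ ≤ 1) {ι : Type*} (I : Finset ι) (N₁ N₂ D : ℕ)
    (hqD : q ≤ D) (hD₁ : 12 * q ≤ η₁ * 2 ^ D) (hD₂ : 4 * q * (|c| * 2 ^ b + 1) ≤ η₂ * 2 ^ D)
    {β : ℕ → ℕ → ι → ℝ} (hβ : ∀ j m, ∀ i ∈ I, A₂ / ϑ ^ m ≤ β j m i ∧ β j m i ≤ ϑ * (A₂ / ϑ ^ m))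
    {v : ℕ → ℕ → ι → ℝ≥0∞} {W : ℝ≥0∞} (hW : W ≠ ⊤)
    (hv : ∀ j m, ∑ i ∈ I, v j m i ^ r ≤ W ^ r)
    {h : ℕ → ℕ → ι → ℝ² → ℝ≥0∞} (hh : ∀ j m i, Measurable (h j m i))
    (hfin : lpN (fun x => ∑ j ∈ Finset.range N₁, ∑ m ∈ Finset.range N₂, ∑ i ∈ I, h j m i x) q ≠ ⊤) :
    lpN (fun x => ∑ j ∈ Finset.range N₁, ∑ m ∈ Finset.range N₂, ∑ i ∈ I,
        v j m i * addAvg (curveLap b c (A₁ / 2 ^ j) (β j m i) η₁ η₂) (h j m i) x) q ≤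
      ofReal ((5000 * C * ϑ + 200) * D ^ 2 * q ^ 2) * W *
        lpN (fun x => ∑ j ∈ Finset.range N₁, ∑ m ∈ Finset.range N₂, ∑ i ∈ I, h j m i x) q := by
  have hq0 : 0 < q := by linarith
  have hϑ0 : 0 < ϑ := by linarith
  have hD : 0 < D := by
    have : (0:ℝ) < D := by linarith
    exact_mod_cast this
  have hβ0 : ∀ j m, ∀ i ∈ I, 0 < β j m i := fun j m i hi =>
    lt_of_lt_of_le (by positivity) (hβ j m i hi).1
  set Ω : ℝ := |c| * 2 ^ b with hΩ
  have hΩ0 : 0 ≤ Ω := by positivity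
  have hDϑ : 2 * q * (Ω + 1) * ϑ ≤ η₂ * ϑ ^ D := by
    obtain ⟨D', rfl⟩ := Nat.exists_eq_add_of_le hD
    rw [pow_add, pow_one] at hD₂ ⊢
    have h1 : 2 * q * (Ω + 1) ≤ η₂ * 2 ^ D' := by linarith
    have h2 : (2:ℝ) ^ D' ≤ ϑ ^ D' := pow_le_pow_left₀ (by norm_num) hϑ _
    calc 2 * q * (Ω + 1) * ϑ ≤ η₂ * 2 ^ D' * ϑ := by gcongr
      _ ≤ η₂ * ϑ ^ D' * ϑ := by gcongr
      _ = _ := by ring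
  set B : ℕ → ℝ := fun m => 2 * ϑ * A₂ / ϑ ^ m with hB
  have hB0 : ∀ m, 0 < B m := fun m => by positivity
  set C₂ : ℝ≥0∞ := ofReal (16 * C * ϑ) with hC₂
  have hsumI : ∀ j m, Measurable fun x => ∑ i ∈ I, v j m i * h j m i x := fun j m =>
    Finset.measurable_fun_sum _ fun i _ => (hh j m i).const_mul _
  have hcm : ∀ j m i, Measurable
      (addAvg (curveLap b c (A₁ / 2 ^ j) (β j m i) η₁ η₂) (h j m i)) := fun j m i =>
    measurable_addAvg _ (hh j m i)
  have hb : ∀ j, Measurable fun x => ∑ m ∈ Finset.range N₂, ∑ i ∈ I,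
      v j m i * addAvg (curveLap b c (A₁ / 2 ^ j) (β j m i) η₁ η₂) (h j m i) x := fun j =>
    Finset.measurable_fun_sum _ fun m _ => Finset.measurable_fun_sum _ fun i _ =>
      (hcm j m i).const_mul _
  have hb' : ∀ j, Measurable fun x => ∑ m ∈ Finset.range N₂,
      C₂ * addAvg (lapAlong (0, 1) 0 (B m)) (fun x => ∑ i ∈ I, v j m i * h j m i x) x := fun j =>
    Finset.measurable_fun_sum _ fun m _ => (measurable_addAvg _ (hsumI j m)).const_mul _
  have hhm : ∀ j, Measurable fun x => ∑ m ∈ Finset.range N₂, ∑ i ∈ I, h j m i x := fun j =>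
    Finset.measurable_fun_sum _ fun m _ => Finset.measurable_fun_sum _ fun i _ => hh j m i
  have key := lpN_sum_le_of_majorant hq hqr N₁ D hD
    (A := C₂ * ofReal (50 * q ^ 2) * W)
    (d := ofReal (3 / 2 * (25 * D * q)) * W) hb hb' hhm
    (mul_ne_top ofReal_ne_top hW) hfin ?_ ?_ ?_
  · refine key.trans (mul_le_mul' ?_ le_rfl)
    calc (D : ℝ≥0∞) * (ofReal (2 * q * exp 1) *
            (C₂ * ofReal (50 * q ^ 2) * W) +
          ofReal (2 * (1 + q)) * (ofReal (3 / 2 * (25 * D * q)) * W))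
        = ofReal (D * (2 * q * exp 1 * (16 * C * ϑ * (50 * q ^ 2)) +
            2 * (1 + q) * (3 / 2 * (25 * D * q)))) * W := by
          rw [ofReal_mul (p := (D : ℝ)) (by positivity), ofReal_add (by positivity)
            (by positivity), ofReal_mul (p := 2 * q * exp 1) (by positivity),
            ofReal_mul (p := 16 * C * ϑ) (by positivity),
            ofReal_mul (p := 2 * (1 + q)) (by positivity), ofReal_natCast]
          ring
      _ ≤ _ := by
          refine mul_le_mul' (ofReal_le_ofReal ?_) le_rfl
          have h1 := exp_one_lt_d9
          have h2 : 2 * q * exp 1 * (16 * C * ϑ * (50 * q ^ 2)) ≤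
              5000 * C * ϑ * (D * q ^ 2) := by
            calc 2 * q * exp 1 * (16 * C * ϑ * (50 * q ^ 2))
                = (1600 * exp 1) * (C * ϑ * q ^ 2) * q := by ring
              _ ≤ 5000 * (C * ϑ * q ^ 2) * D := by gcongr; linarith
              _ = _ := by ring
          have h3 : 2 * (1 + q) * (3 / 2 * (25 * D * q)) ≤ 200 * (D * q ^ 2) := by
            calc 2 * (1 + q) * (3 / 2 * (25 * D * q)) = 75 * (1 + q) * (D * q) := by ring
              _ ≤ 75 * (2 * q) * (D * q) := by gcongr; linarith
              _ ≤ _ := by nlinarith [mul_nonneg (cast_nonneg (α := ℝ) D) (sq_nonneg q)]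
          calc (D:ℝ) * (2 * q * exp 1 * (16 * C * ϑ * (50 * q ^ 2)) +
                2 * (1 + q) * (3 / 2 * (25 * D * q)))
              ≤ D * (5000 * C * ϑ * (D * q ^ 2) + 200 * (D * q ^ 2)) := by gcongr
            _ = _ := by ring
  · intro j hj
    have hGm : ∀ t, Measurable fun x => ∑ m ∈ Finset.range N₂, ∑ i ∈ I, v j m i *
        addAvg (lapAlong (0, 1) (β j m i * (c * t ^ b)) (β j m i * η₂)) (h j m i) x := fun t =>
      Finset.measurable_fun_sum _ fun m _ => Finset.measurable_fun_sum _ fun i _ =>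
        (measurable_addAvg _ (hh j m i)).const_mul _
    have hα : 0 < A₁ / 2 ^ j * η₁ := by positivity
    have heq : (fun x => ∑ m ∈ Finset.range N₂, ∑ i ∈ I,
        v j m i * addAvg (curveLap b c (A₁ / 2 ^ j) (β j m i) η₁ η₂) (h j m i) x) = fun x =>
        ∫⁻ t in Icc (1 / 2 : ℝ) 2, addAvg (lapAlong (1, 0) (A₁ / 2 ^ j * t) (A₁ / 2 ^ j * η₁))
          (fun x => ∑ m ∈ Finset.range N₂, ∑ i ∈ I, v j m i *
            addAvg (lapAlong (0, 1) (β j m i * (c * t ^ b)) (β j m i * η₂)) (h j m i) x) x := by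
      funext x
      have h1 : ∀ m i, Measurable fun t : ℝ =>
          addAvg (lapAlong (1, 0) (A₁ / 2 ^ j * t) (A₁ / 2 ^ j * η₁))
            (addAvg (lapAlong (0, 1) (β j m i * (c * t ^ b)) (β j m i * η₂)) (h j m i)) x := by
        intro m i
        have := hh j m i
        simp only [addAvg_lapAlong _ _ _ (measurable_addAvg _ this), addAvg_lapAlong _ _ _ this]
        fun_prop
      have h2 : ∀ t : ℝ, addAvg (lapAlong (1, 0) (A₁ / 2 ^ j * t) (A₁ / 2 ^ j * η₁))
          (fun x => ∑ m ∈ Finset.range N₂, ∑ i ∈ I, v j m i *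
            addAvg (lapAlong (0, 1) (β j m i * (c * t ^ b)) (β j m i * η₂)) (h j m i) x) x =
          ∑ m ∈ Finset.range N₂, ∑ i ∈ I, v j m i *
          addAvg (lapAlong (1, 0) (A₁ / 2 ^ j * t) (A₁ / 2 ^ j * η₁))
            (addAvg (lapAlong (0, 1) (β j m i * (c * t ^ b)) (β j m i * η₂)) (h j m i)) x := by
        intro t
        have hm : ∀ m i, Measurable
            (addAvg (lapAlong (0, 1) (β j m i * (c * t ^ b)) (β j m i * η₂)) (h j m i)) :=
          fun m i => measurable_addAvg _ (hh j m i)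
        rw [addAvg_finsetSum _ _ fun m _ => Finset.measurable_fun_sum _ fun i _ =>
          (hm m i).const_mul _]
        refine sum_congr rfl fun m _ => ?_
        rw [addAvg_finsetSum _ _ fun i _ => (hm m i).const_mul _]
        refine sum_congr rfl fun i _ => ?_
        have hm' : Measurable fun y : ℝ² =>
            addAvg (lapAlong (0, 1) (β j m i * (c * t ^ b)) (β j m i * η₂)) (h j m i) (x + y) :=
          (hm m i).comp (by fun_prop)
        exact lintegral_const_mul _ hm'
      simp only [h2]
      rw [lintegral_finsetSum _ fun m _ => Finset.measurable_fun_sum _ fun i _ =>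
        (h1 m i).const_mul _]
      refine sum_congr rfl fun m _ => ?_
      rw [lintegral_finsetSum _ fun i _ => (h1 m i).const_mul _]
      refine sum_congr rfl fun i _ => ?_
      rw [lintegral_const_mul _ (h1 m i), addAvg_curveLap _ _ _ _ _ _ (hh j m i)]
    have hfin' : lpN (fun x => ∑ m ∈ Finset.range N₂, ∑ i ∈ I, h j m i x) q ≠ ⊤ :=
      ne_top_of_le_ne_top hfin (lpN_mono hq0 fun x =>
        single_le_sum (f := fun j => ∑ m ∈ Finset.range N₂, ∑ i ∈ I, h j m i x)
          (fun _ _ => zero_le) (Finset.mem_range.2 hj))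
    rw [heq]
    refine (lpN_lintegral_le _ ?_ (by linarith) (K := ofReal (25 * D * q) * W *
      lpN (fun x => ∑ m ∈ Finset.range N₂, ∑ i ∈ I, h j m i x) q) ?_).trans (le_of_eq ?_)
    · have : ∀ m i, Measurable (h j m i) := hh j
      simp only [Function.uncurry_def, addAvg_lapAlong _ _ _ (hGm _)]
      simp only [addAvg_lapAlong _ _ _ (this _ _)]
      fun_prop
    · refine (ae_restrict_iff' measurableSet_Icc).2 (ae_of_all _ fun t ht => ?_)
      have := isProbabilityMeasure_lapAlong (1, 0) (A₁ / 2 ^ j * t) hα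
      refine (lpN_addAvg_le_of_isProbabilityMeasure _ (hGm t) (by linarith)).trans ?_
      refine lpN_sum_lapAlong_le hq hqr (by linarith) hA₂ hη₂ hη₂1 (Ω := Ω) ?_ I N₂ D hD hDϑ
        (hβ j) hW (hv j) (hh j) hfin'
      have ht0 : 0 ≤ t := by linarith [ht.1]
      rw [abs_mul, abs_of_nonneg (rpow_nonneg ht0 _), hΩ]
      exact mul_le_mul_of_nonneg_left (Real.rpow_le_rpow ht0 ht.2 (by linarith)) (abs_nonneg _)
    · rw [Measure.restrict_apply_univ, volume_Icc, ofReal_mul (by norm_num)]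
      norm_num
      ring
  · intro j _ S hS
    set Y := fun x => ∑ k ∈ S, ∑ m ∈ Finset.range N₂, ∑ i ∈ I,
        v k m i * addAvg (curveLap b c (A₁ / 2 ^ k) (β k m i) η₁ η₂) (h k m i) x with hYdef
    have hYm : Measurable Y := Finset.measurable_fun_sum _ fun k _ => hb k
    have hY : HarnackAlong (1, 0) (2 ^ j / 2 ^ D / (A₁ * η₁)) Y := by
      refine .sum _ fun k hk => .sum _ fun m _ => .sum _ fun i hi => .const_mul ?_ _
      have hm := hh k m i
      have : addAvg (curveLap b c (A₁ / 2 ^ k) (β k m i) η₁ η₂) (h k m i) = fun x =>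
          ∫⁻ t in Icc (1 / 2 : ℝ) 2, addAvg (lapAlong (1, 0) (A₁ / 2 ^ k * t) (A₁ / 2 ^ k * η₁))
            (addAvg (lapAlong (0, 1) (β k m i * (c * t ^ b)) (β k m i * η₂)) (h k m i)) x :=
        funext fun x => addAvg_curveLap _ _ _ _ _ _ hm x
      rw [this]
      refine .lintegral _ (fun x => ?_) fun t => ?_
      · simp only [addAvg_lapAlong _ _ _ (measurable_addAvg _ hm), addAvg_lapAlong _ _ _ hm]
        fun_prop
      · refine (harnackAlong_addAvg_lapAlong _ _ (by positivity) (measurable_addAvg _ hm)).mono ?_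
        have h1 : (2:ℝ) ^ k ≤ 2 ^ j / 2 ^ D := by
          rw [le_div_iff₀ (by positivity), ← pow_add]
          exact pow_le_pow_right₀ one_le_two (hS k hk)
        calc 1 / (A₁ / 2 ^ k * η₁) = 2 ^ k / (A₁ * η₁) := by field_simp
          _ ≤ _ := by gcongr
    have hYp := hY.rpow (t := q - 1) (by linarith)
    set F := fun x => Y x ^ (q - 1) with hF
    have hFm : Measurable F := hYm.pow_const _
    set κ := (q - 1) * (2 ^ j / 2 ^ D / (A₁ * η₁)) with hκ
    have hκ0 : 0 ≤ κ := mul_nonneg (by linarith) (by positivity)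
    have hκα : κ * (A₁ / 2 ^ j) * 2 ≤ 1 / 2 := by
      calc κ * (A₁ / 2 ^ j) * 2 = (q - 1) * 2 / (η₁ * 2 ^ D) := by
            rw [hκ]; field_simp
        _ ≤ 1 / 2 := by
            rw [div_le_div_iff₀ (by positivity) (by norm_num)]
            nlinarith
    have hα : 0 < A₁ / 2 ^ j := by positivity
    have hpt : ∀ m, ∀ i ∈ I, ∀ x, subAvg (curveLap b c (A₁ / 2 ^ j) (β j m i) η₁ η₂) F x ≤
        C₂ * subAvg (lapAlong (0, 1) 0 (B m)) F x := by
      intro m i hi x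
      rw [subAvg_curveLap _ _ _ _ _ _ hFm]
      calc ∫⁻ t in Icc (1 / 2 : ℝ) 2, subAvg (lapAlong (0, 1) (β j m i * (c * t ^ b)) (β j m i * η₂))
              (subAvg (lapAlong (1, 0) (A₁ / 2 ^ j * t) (A₁ / 2 ^ j * η₁)) F) x
          ≤ ∫⁻ t in Icc (1 / 2 : ℝ) 2, 4 *
              subAvg (lapAlong (0, 1) (β j m i * (c * t ^ b)) (β j m i * η₂)) F x := by
            refine setLIntegral_mono' measurableSet_Icc fun t ht => ?_
            have ht0 : 0 ≤ t := by linarith [ht.1]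
            rw [subAvg, subAvg, ← lintegral_const_mul _ (by fun_prop)]
            refine lintegral_mono fun y => subAvg_lapAlong_le (by positivity) hFm hYp hκ0 ?_ ?_ _
            · rw [abs_of_nonneg (by positivity), ← mul_assoc]
              refine le_trans ?_ hκα
              gcongr
              exact ht.2
            · rw [← mul_assoc]
              refine le_trans ?_ hκα
              gcongr
              linarith
        _ = 4 * ∫⁻ t in Icc (1 / 2 : ℝ) 2,
              subAvg (lapAlong (0, 1) (β j m i * (c * t ^ b)) (β j m i * η₂)) F x := by
            rw [lintegral_const_mul]
            simp only [subAvg_lapAlong _ _ _ hFm]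
            fun_prop
        _ ≤ 4 * (ofReal C * (4 * ofReal (B m / (2 * β j m i))) *
              subAvg (lapAlong (0, 1) 0 (B m)) F x) := by
            gcongr
            refine lintegral_subAvg_curve_le hC (hβ0 j m i hi) hη₂ hη₂1 ?_ _ hFm x
            have := (hβ j m i hi).2
            calc 2 * β j m i ≤ 2 * (ϑ * (A₂ / ϑ ^ m)) := by linarith
              _ = B m := by rw [hB]; ring
        _ ≤ 4 * (ofReal C * (4 * ofReal ϑ) *
              subAvg (lapAlong (0, 1) 0 (B m)) F x) := by
            have h1 : B m / (2 * β j m i) ≤ ϑ := by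
              rw [div_le_iff₀ (mul_pos two_pos (hβ0 j m i hi))]
              have := (hβ j m i hi).1
              calc B m = ϑ * (2 * (A₂ / ϑ ^ m)) := by rw [hB]; ring
                _ ≤ _ := by gcongr
            gcongr
        _ = _ := by
            rw [hC₂, ofReal_mul (by positivity), ofReal_mul (by positivity),
              show (16:ℝ) = 4 * 4 by norm_num, ofReal_mul (by norm_num),
              ofReal_ofNat]
            ring
    calc ∫⁻ x, (∑ m ∈ Finset.range N₂, ∑ i ∈ I,
            v j m i * addAvg (curveLap b c (A₁ / 2 ^ j) (β j m i) η₁ η₂) (h j m i) x) * F x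
        = ∑ m ∈ Finset.range N₂, ∑ i ∈ I, v j m i *
            ∫⁻ x, h j m i x * subAvg (curveLap b c (A₁ / 2 ^ j) (β j m i) η₁ η₂) F x := by
          have h1 : ∀ m i, Measurable fun x =>
              addAvg (curveLap b c (A₁ / 2 ^ j) (β j m i) η₁ η₂) (h j m i) x * F x := fun m i =>
            (hcm j m i).mul hFm
          simp only [sum_mul, mul_assoc]
          rw [lintegral_finsetSum _ fun m _ => Finset.measurable_fun_sum _ fun i _ =>
            (h1 m i).const_mul _]
          refine sum_congr rfl fun m _ => ?_
          rw [lintegral_finsetSum _ fun i _ => (h1 m i).const_mul _]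
          refine sum_congr rfl fun i _ => ?_
          rw [lintegral_const_mul _ (h1 m i), lintegral_mul_subAvg _ hFm (hh j m i)]
      _ ≤ ∑ m ∈ Finset.range N₂, ∑ i ∈ I, v j m i *
            ∫⁻ x, h j m i x * (C₂ * subAvg (lapAlong (0, 1) 0 (B m)) F x) :=
          sum_le_sum fun m _ => sum_le_sum fun i hi => mul_le_mul' le_rfl
            (lintegral_mono fun x => mul_le_mul' le_rfl (hpt m i hi x))
      _ = ∑ m ∈ Finset.range N₂, C₂ *
            ∫⁻ x, (∑ i ∈ I, v j m i * h j m i x) * subAvg (lapAlong (0, 1) 0 (B m)) F x := by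
          refine sum_congr rfl fun m _ => ?_
          have h1 : ∀ i, Measurable fun x =>
              h j m i x * subAvg (lapAlong (0, 1) 0 (B m)) F x := fun i =>
            (hh j m i).mul (measurable_subAvg _ hFm)
          simp only [sum_mul, mul_assoc, mul_left_comm (h j m _ _) C₂]
          rw [lintegral_finsetSum _ fun i _ => (h1 i).const_mul _, mul_sum]
          refine sum_congr rfl fun i _ => ?_
          rw [lintegral_const_mul _ (h1 i), lintegral_const_mul _ (h1 i)]
          ring
      _ = _ := by
          have h1 : ∀ m, Measurable fun x => addAvg (lapAlong (0, 1) 0 (B m))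
              (fun x => ∑ i ∈ I, v j m i * h j m i x) x * F x := fun m =>
            (measurable_addAvg _ (hsumI j m)).mul hFm
          simp only [sum_mul, mul_assoc]
          rw [lintegral_finsetSum _ fun m _ => (h1 m).const_mul _]
          refine sum_congr rfl fun m _ => ?_
          rw [lintegral_const_mul _ (h1 m), ← lintegral_mul_subAvg _ hFm (hsumI j m)]
          simp only [sum_mul, mul_assoc]
  · intro S _
    have h1 : ∀ m, Measurable fun x => ∑ j ∈ S, ∑ i ∈ I, v j m i * h j m i x := fun m =>
      Finset.measurable_fun_sum _ fun j _ => hsumI j m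
    have h2 := lpN_sum_lapAlong_geometric_le (e := (0, 1)) (B := 2 * ϑ * A₂) hq hqr hϑ
      (by positivity) N₂ h1
    have h3 : (fun x => ∑ j ∈ S, ∑ m ∈ Finset.range N₂,
        C₂ * addAvg (lapAlong (0, 1) 0 (B m)) (fun x => ∑ i ∈ I, v j m i * h j m i x) x) =
        fun x => C₂ * ∑ m ∈ Finset.range N₂, addAvg (lapAlong (0, 1) 0 (2 * ϑ * A₂ / ϑ ^ m))
          (fun x => ∑ j ∈ S, ∑ i ∈ I, v j m i * h j m i x) x := by
      funext x
      rw [sum_comm, mul_sum]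
      refine sum_congr rfl fun m _ => ?_
      rw [addAvg_finsetSum _ _ fun j _ => hsumI j m, mul_sum]
    rw [h3, lpN_const_mul _ hq0 (Finset.measurable_fun_sum _ fun m _ => measurable_addAvg _ (h1 m)),
      mul_assoc C₂, mul_assoc C₂, mul_assoc (ofReal _)]
    refine mul_le_mul' le_rfl (h2.trans (mul_le_mul' le_rfl ?_))
    rw [← lpN_const_mul _ hq0 (Finset.measurable_fun_sum _ fun j _ => hhm j)]
    refine lpN_mono hq0 fun x => ?_
    rw [sum_comm]
    simp only [mul_sum]
    refine sum_le_sum fun j _ => sum_le_sum fun m _ =>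
      sum_le_sum fun i hi => ?_
    gcongr
    exact le_of_sum_rpow_le hqr.symm.pos (hv j m) hi

/-- The analytic family `a ^ (1 - z) * b ^ z`, vanishing when `a` or `b` does. -/
def cpw (a b : ℝ) (z : ℂ) : ℂ :=
  if 0 < a ∧ 0 < b then Complex.exp ((1 - z) * Real.log a + z * Real.log b) else 0

lemma norm_cpw_of_pos {a b : ℝ} (ha : 0 < a) (hb : 0 < b) (z : ℂ) :
    ‖cpw a b z‖ = a * exp (z.re * (Real.log b - Real.log a)) := by
  rw [cpw, if_pos ⟨ha, hb⟩, Complex.norm_exp]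
  nth_rewrite 2 [← exp_log ha]
  rw [← exp_add]
  congr 1
  simp
  ring

lemma norm_cpw_le {a b : ℝ} (ha : 0 ≤ a) (hb : 0 ≤ b) {z : ℂ} (h0 : 0 ≤ z.re) (h1 : z.re ≤ 1) :
    ‖cpw a b z‖ ≤ a + b := by
  by_cases h : 0 < a ∧ 0 < b
  · rw [norm_cpw_of_pos h.1 h.2]
    have hb' : b = a * exp (Real.log b - Real.log a) := by
      rw [exp_sub, exp_log h.1, exp_log h.2, mul_div_cancel₀ _ h.1.ne']
    rcases le_total 0 (Real.log b - Real.log a) with hx | hx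
    · have : a * exp (z.re * (Real.log b - Real.log a)) ≤
          a * exp (Real.log b - Real.log a) := by
        gcongr; nlinarith
      linarith
    · have : exp (z.re * (Real.log b - Real.log a)) ≤ 1 :=
        Real.exp_le_one_iff.2 (mul_nonpos_of_nonneg_of_nonpos h0 hx)
      nlinarith
  · rw [cpw, if_neg h, norm_zero]; positivity

lemma norm_cpw_le_left {a b : ℝ} (ha : 0 ≤ a) {z : ℂ} (h : z.re = 0) : ‖cpw a b z‖ ≤ a := by
  by_cases h' : 0 < a ∧ 0 < b
  · rw [norm_cpw_of_pos h'.1 h'.2, h]; simp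
  · rwa [cpw, if_neg h', norm_zero]

lemma norm_cpw_le_right {a b : ℝ} (hb : 0 ≤ b) {z : ℂ} (h : z.re = 1) : ‖cpw a b z‖ ≤ b := by
  by_cases h' : 0 < a ∧ 0 < b
  · rw [norm_cpw_of_pos h'.1 h'.2, h, one_mul, exp_sub, exp_log h'.1, exp_log h'.2,
      mul_div_cancel₀ _ h'.1.ne']
  · rwa [cpw, if_neg h', norm_zero]

lemma cpw_mul {a b c d : ℝ} (ha : 0 ≤ a) (hb : 0 ≤ b) (hc : 0 ≤ c) (hd : 0 ≤ d) (z : ℂ) :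
    cpw (a * c) (b * d) z = cpw a b z * cpw c d z := by
  by_cases h : (0 < a ∧ 0 < b) ∧ 0 < c ∧ 0 < d
  · rw [cpw, cpw, cpw, if_pos h.1, if_pos h.2,
      if_pos ⟨mul_pos h.1.1 h.2.1, mul_pos h.1.2 h.2.2⟩, ← Complex.exp_add,
      log_mul h.1.1.ne' h.2.1.ne', log_mul h.1.2.ne' h.2.2.ne']
    congr 1
    push_cast
    ring
  · have h' : ¬(0 < a * c ∧ 0 < b * d) := fun hh => h
      ⟨⟨pos_of_mul_pos_left hh.1 hc, pos_of_mul_pos_left hh.2 hd⟩,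
        pos_of_mul_pos_right hh.1 ha, pos_of_mul_pos_right hh.2 hb⟩
    rw [cpw, if_neg h']
    rcases not_and_or.1 h with h | h
    · rw [cpw, if_neg h, zero_mul]
    · rw [cpw, cpw, if_neg h, mul_zero]

lemma cpw_ofReal {a b : ℝ} (ha : 0 ≤ a) (hb : 0 ≤ b) {t : ℝ} (h0 : 0 < t) (h1 : t < 1) :
    cpw a b t = ((a ^ (1 - t) * b ^ t : ℝ) : ℂ) := by
  by_cases h : 0 < a ∧ 0 < b
  · rw [cpw, if_pos h, Real.rpow_def_of_pos h.1, Real.rpow_def_of_pos h.2, ← exp_add]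
    push_cast
    congr 1
    ring
  · rw [cpw, if_neg h]
    rcases not_and_or.1 h with h | h
    · rw [le_antisymm (not_lt.1 h) ha, zero_rpow (by linarith)]; simp
    · rw [le_antisymm (not_lt.1 h) hb, zero_rpow h0.ne']; simp

lemma differentiable_cpw (a b : ℝ) : Differentiable ℂ (cpw a b) := by
  by_cases h : 0 < a ∧ 0 < b
  · have : cpw a b = fun z => Complex.exp ((1 - z) * Real.log a + z * Real.log b) := by
      funext z; rw [cpw, if_pos h]
    rw [this]; fun_prop
  · have : cpw a b = fun _ => 0 := by
      funext z; rw [cpw, if_neg h]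
    rw [this]; fun_prop

lemma hasDerivAt_cpw (a b : ℝ) (z : ℂ) :
    HasDerivAt (cpw a b) (((Real.log b - Real.log a : ℝ) : ℂ) * cpw a b z) z := by
  by_cases h : 0 < a ∧ 0 < b
  · have h1 : cpw a b = fun z => Complex.exp ((1 - z) * Real.log a + z * Real.log b) := by
      funext z; rw [cpw, if_pos h]
    rw [h1]
    have h2 : HasDerivAt (fun z : ℂ => (1 - z) * Real.log a + z * Real.log b)
        (-1 * Real.log a + 1 * Real.log b) z :=
      (((hasDerivAt_id z).const_sub 1).mul_const _).add ((hasDerivAt_id z).mul_const _)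
    exact h2.cexp.congr_deriv (by push_cast; ring)
  · have h1 : cpw a b = fun _ => 0 := by
      funext z; rw [cpw, if_neg h]
    rw [h1, mul_zero]
    exact hasDerivAt_const _ _

lemma norm_deriv_cpw_le {a b δ : ℝ} (ha : 0 ≤ a) (hb : 0 ≤ b) (hδ : 0 < δ) {z : ℂ}
    (h0 : δ ≤ z.re) (h1 : z.re ≤ 1 - δ) :
    ‖((Real.log b - Real.log a : ℝ) : ℂ) * cpw a b z‖ ≤ (a + b) / δ := by
  by_cases h : 0 < a ∧ 0 < b
  · have hb' : b = a * exp (Real.log b - Real.log a) := by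
      rw [exp_sub, exp_log h.1, exp_log h.2, mul_div_cancel₀ _ h.1.ne']
    rw [norm_mul, norm_cpw_of_pos h.1 h.2, norm_real, norm_eq_abs, le_div_iff₀ hδ]
    set x := Real.log b - Real.log a
    have hx1 : |x| * δ ≤ exp (δ * |x|) := by
      have := Real.add_one_le_exp (δ * |x|); linarith
    calc |x| * (a * exp (z.re * x)) * δ = a * (|x| * δ * exp (z.re * x)) := by ring
      _ ≤ a * (exp (δ * |x|) * exp (z.re * x)) := by gcongr
      _ = a * exp (δ * |x| + z.re * x) := by rw [exp_add]
      _ ≤ a + b := by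
        rcases le_total 0 x with hx | hx
        · have : exp (δ * |x| + z.re * x) ≤ exp x := by
            rw [abs_of_nonneg hx]; gcongr; nlinarith
          nlinarith [mul_le_mul_of_nonneg_left this ha]
        · have : exp (δ * |x| + z.re * x) ≤ 1 := by
            rw [abs_of_nonpos hx]
            exact Real.exp_le_one_iff.2 (by nlinarith)
          nlinarith
  · rw [cpw, if_neg h, mul_zero, norm_zero]; positivity

lemma measurable_cpw {α : Type*} [MeasurableSpace α] {A B : α → ℝ} (hA : Measurable A)
    (hB : Measurable B) (z : ℂ) : Measurable fun x => cpw (A x) (B x) z := by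
  unfold cpw
  refine Measurable.ite ((measurableSet_lt measurable_const hA).inter
    (measurableSet_lt measurable_const hB)) ?_ measurable_const
  fun_prop

/-- The three lines lemma for integrals of analytic families of products of powers. -/
lemma norm_sum_integral_le_of_three_lines {κ α : Type*} [MeasurableSpace α] (K : Finset κ)
    (ν : κ → Measure α) {m : κ → α → ℂ} {A B : κ → α → ℝ} (hm : ∀ k, Measurable (m k))
    (hA : ∀ k, Measurable (A k)) (hB : ∀ k, Measurable (B k)) (hA0 : ∀ k x, 0 ≤ A k x)
    (hB0 : ∀ k x, 0 ≤ B k x) (hmA : ∀ k, Integrable (fun x => ‖m k x‖ * A k x) (ν k))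
    (hmB : ∀ k, Integrable (fun x => ‖m k x‖ * B k x) (ν k)) {N₀ N₁ t : ℝ}
    (h₀ : ∀ z : ℂ, z.re = 0 → ‖∑ k ∈ K, ∫ x, m k x * cpw (A k x) (B k x) z ∂ν k‖ ≤ N₀)
    (h₁ : ∀ z : ℂ, z.re = 1 → ‖∑ k ∈ K, ∫ x, m k x * cpw (A k x) (B k x) z ∂ν k‖ ≤ N₁)
    (ht0 : 0 ≤ t) (ht1 : t ≤ 1) :
    ‖∑ k ∈ K, ∫ x, m k x * cpw (A k x) (B k x) t ∂ν k‖ ≤ N₀ ^ (1 - t) * N₁ ^ t := by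
  have hmeas : ∀ k (z : ℂ), AEStronglyMeasurable (fun x => m k x * cpw (A k x) (B k x) z) (ν k) :=
    fun k z => ((hm k).mul (measurable_cpw (hA k) (hB k) z)).aestronglyMeasurable
  have hbd : ∀ k (z : ℂ), 0 ≤ z.re → z.re ≤ 1 → ∀ x, ‖m k x * cpw (A k x) (B k x) z‖ ≤
      ‖m k x‖ * A k x + ‖m k x‖ * B k x := fun k z h0 h1 x => by
    rw [norm_mul, ← mul_add]
    exact mul_le_mul_of_nonneg_left (norm_cpw_le (hA0 k x) (hB0 k x) h0 h1) (norm_nonneg _)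
  have hint : ∀ k, Integrable (fun x => ‖m k x‖ * A k x + ‖m k x‖ * B k x) (ν k) := fun k =>
    (hmA k).add (hmB k)
  have key := Complex.HadamardThreeLines.norm_le_interp_of_mem_verticalClosedStrip₀₁'
    (fun z => ∑ k ∈ K, ∫ x, m k x * cpw (A k x) (B k x) z ∂ν k) (z := (t : ℂ)) (a := N₀) (b := N₁)
    (by simp [Complex.HadamardThreeLines.verticalClosedStrip, ht0, ht1]) ?_ ?_
    (fun z hz => h₀ z hz) (fun z hz => h₁ z hz)
  · simpa using key
  · refine ⟨?_, ?_⟩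
    · intro z hz
      obtain ⟨hz0, hz1⟩ : 0 < z.re ∧ z.re < 1 := hz
      refine DifferentiableAt.differentiableWithinAt ?_
      refine DifferentiableAt.fun_sum fun k _ => ?_
      set δ := min z.re (1 - z.re) / 2 with hδ
      have hδ0 : 0 < δ := by
        have : 0 < min z.re (1 - z.re) := lt_min hz0 (by linarith)
        positivity
      have hδ1 : 2 * δ ≤ z.re := by
        have := min_le_left z.re (1 - z.re); linarith
      have hδ2 : 2 * δ ≤ 1 - z.re := by
        have := min_le_right z.re (1 - z.re); linarith
      refine (hasDerivAt_integral_of_dominated_loc_of_deriv_le (Metric.ball_mem_nhds z hδ0)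
        (Eventually.of_forall fun w => hmeas k w) ((hint k).mono' (hmeas k z)
          (ae_of_all _ fun x => hbd k z hz0.le hz1.le x))
        (F' := fun w x => m k x * (((Real.log (B k x) - Real.log (A k x) : ℝ) : ℂ) *
          cpw (A k x) (B k x) w))
        (bound := fun x => (‖m k x‖ * A k x + ‖m k x‖ * B k x) / δ) ?_ ?_ ?_ ?_).2.differentiableAt
      · have h1 := hA k
        have h2 := hB k
        have h3 := hm k
        have h4 := measurable_cpw (hA k) (hB k) z
        exact Measurable.aestronglyMeasurable (by fun_prop)
      · refine ae_of_all _ fun x w hw => ?_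
        have hw' : |w.re - z.re| < δ := by
          rw [← Complex.sub_re]
          exact (Complex.abs_re_le_norm _).trans_lt (by simpa [dist_eq_norm] using hw)
        rw [abs_lt] at hw'
        rw [norm_mul, ← mul_add, mul_div_assoc]
        exact mul_le_mul_of_nonneg_left (norm_deriv_cpw_le (hA0 k x) (hB0 k x) hδ0
          (by linarith) (by linarith)) (norm_nonneg _)
      · exact (hint k).div_const _
      · exact ae_of_all _ fun x w _ => (hasDerivAt_cpw _ _ w).const_mul _
    · rw [Complex.HadamardThreeLines.verticalStrip, Complex.closure_preimage_re,
        closure_Ioo zero_ne_one]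
      refine continuousOn_finset_sum _ fun k _ => ?_
      intro z hz
      refine continuousWithinAt_of_dominated (bound := fun x => ‖m k x‖ * A k x + ‖m k x‖ * B k x)
        (Eventually.of_forall fun w => hmeas k w) ?_ (hint k) ?_
      · filter_upwards [self_mem_nhdsWithin] with w hw
        exact ae_of_all _ fun x => hbd k w hw.1 hw.2 x
      · exact ae_of_all _ fun x =>
          ((differentiable_cpw _ _).continuous.const_mul _).continuousWithinAt
  · refine ⟨∑ k ∈ K, ∫ x, (‖m k x‖ * A k x + ‖m k x‖ * B k x) ∂ν k, ?_⟩
    rintro _ ⟨z, hz, rfl⟩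
    refine (norm_sum_le _ _).trans (sum_le_sum fun k _ => ?_)
    exact norm_integral_le_of_norm_le (hint k) (ae_of_all _ fun x => hbd k z hz.1 hz.2 x)

/-- The generalized convolution `x ↦ ∫ m(ω) g(x - Y(ω)) dμ(ω)`. -/
def kop {Ω : Type*} [MeasurableSpace Ω] (μ : Measure Ω) (m : Ω → ℂ) (Y : Ω → ℝ²)
    (g : ℝ² → ℂ) (x : ℝ²) : ℂ :=
  ∫ ω, m ω * g (x - Y ω) ∂μ

/-- Complex interpolation for bilinear forms given by generalized convolutions. -/
lemma norm_sum_integral_kop_le {κ ι Ω : Type*} [MeasurableSpace Ω] (μ : Measure Ω) [SFinite μ]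
    (K : Finset κ) (π : κ → ι) {m : κ → Ω → ℂ} {Y : κ → Ω → ℝ²} (hm : ∀ k, Measurable (m k))
    (hmi : ∀ k, Integrable (m k) μ) (hY : ∀ k, Measurable (Y k))
    {a₀ a₁ : ι → ℝ² → ℝ} {c₀ c₁ : κ → ℝ² → ℝ}
    (ha₀ : ∀ i, Measurable (a₀ i)) (ha₁ : ∀ i, Measurable (a₁ i))
    (hc₀ : ∀ k, Measurable (c₀ k)) (hc₁ : ∀ k, Measurable (c₁ k))
    (ha₀0 : ∀ i x, 0 ≤ a₀ i x) (ha₁0 : ∀ i x, 0 ≤ a₁ i x)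
    (hc₀0 : ∀ k x, 0 ≤ c₀ k x) (hc₁0 : ∀ k x, 0 ≤ c₁ k x) {M : ℝ} (ha₀M : ∀ i x, a₀ i x ≤ M)
    (ha₁M : ∀ i x, a₁ i x ≤ M) (hc₀i : ∀ k, Integrable (c₀ k)) (hc₁i : ∀ k, Integrable (c₁ k))
    {N₀ N₁ t : ℝ} (ht0 : 0 < t) (ht1 : t ≤ 1)
    (H₀ : ∀ (g : ι → ℝ² → ℂ) (h : κ → ℝ² → ℂ), (∀ i, Measurable (g i)) →
      (∀ k, Measurable (h k)) → (∀ i x, ‖g i x‖ ≤ a₀ i x) → (∀ k x, ‖h k x‖ ≤ c₀ k x) →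
      ‖∑ k ∈ K, ∫ x, h k x * kop μ (m k) (Y k) (g (π k)) x‖ ≤ N₀)
    (H₁ : ∀ (g : ι → ℝ² → ℂ) (h : κ → ℝ² → ℂ), (∀ i, Measurable (g i)) →
      (∀ k, Measurable (h k)) → (∀ i x, ‖g i x‖ ≤ a₁ i x) → (∀ k x, ‖h k x‖ ≤ c₁ k x) →
      ‖∑ k ∈ K, ∫ x, h k x * kop μ (m k) (Y k) (g (π k)) x‖ ≤ N₁)
    {g : ι → ℝ² → ℂ} {h : κ → ℝ² → ℂ} (hg : ∀ i, Measurable (g i))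
    (hh : ∀ k, Measurable (h k))
    (hga : ∀ i x, ‖g i x‖ ≤ a₀ i x ^ (1 - t) * a₁ i x ^ t)
    (hhc : ∀ k x, ‖h k x‖ ≤ c₀ k x ^ (1 - t) * c₁ k x ^ t) :
    ‖∑ k ∈ K, ∫ x, h k x * kop μ (m k) (Y k) (g (π k)) x‖ ≤ N₀ ^ (1 - t) * N₁ ^ t := by
  rcases ht1.eq_or_lt with rfl | ht1
  · simp only [sub_self, rpow_zero, one_mul, rpow_one] at *
    exact H₁ g h hg hh hga hhc
  set φ : ι → ℝ² → ℂ := fun k x => g k x / ((a₀ k x ^ (1 - t) * a₁ k x ^ t : ℝ) : ℂ) with hφ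
  set ψ : κ → ℝ² → ℂ := fun k x => h k x / ((c₀ k x ^ (1 - t) * c₁ k x ^ t : ℝ) : ℂ) with hψ
  have hdiv : ∀ {w : ℂ} {r : ℝ}, ‖w‖ ≤ r → ‖w / (r : ℂ)‖ ≤ 1 := by
    intro w r hw
    rw [norm_div, norm_real, norm_eq_abs]
    exact div_le_one_of_le₀ (hw.trans (le_abs_self _)) (abs_nonneg _)
  have hcanc : ∀ {w : ℂ} {r : ℝ}, ‖w‖ ≤ r → w / (r : ℂ) * (r : ℂ) = w := by
    intro w r hw
    rcases eq_or_ne r 0 with rfl | hr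
    · have : w = 0 := norm_le_zero_iff.1 hw
      simp [this]
    · exact div_mul_cancel₀ _ (by exact_mod_cast hr)
  have hφ1 : ∀ k x, ‖φ k x‖ ≤ 1 := fun k x => hdiv (hga k x)
  have hψ1 : ∀ k x, ‖ψ k x‖ ≤ 1 := fun k x => hdiv (hhc k x)
  have hφm : ∀ k, Measurable (φ k) := fun k => by
    have h1 := hg k; have h2 := ha₀ k; have h3 := ha₁ k
    simp only [hφ]; fun_prop
  have hψm : ∀ k, Measurable (ψ k) := fun k => by
    have h1 := hh k; have h2 := hc₀ k; have h3 := hc₁ k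
    simp only [hψ]; fun_prop
  set mm : κ → ℝ² × Ω → ℂ := fun k p => m k p.2 * φ (π k) (p.1 - Y k p.2) * ψ k p.1 with hmm
  set A : κ → ℝ² × Ω → ℝ := fun k p => a₀ (π k) (p.1 - Y k p.2) * c₀ k p.1 with hA
  set B : κ → ℝ² × Ω → ℝ := fun k p => a₁ (π k) (p.1 - Y k p.2) * c₁ k p.1 with hB
  have hmmm : ∀ k, Measurable (mm k) := fun k => by
    have h1 := hm k; have h2 := hφm (π k); have h3 := hψm k; have h4 := hY k
    simp only [hmm]; fun_prop
  have hAm : ∀ k, Measurable (A k) := fun k => by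
    have h1 := ha₀ (π k); have h2 := hc₀ k; have h4 := hY k
    simp only [hA]; fun_prop
  have hBm : ∀ k, Measurable (B k) := fun k => by
    have h1 := ha₁ (π k); have h2 := hc₁ k; have h4 := hY k
    simp only [hB]; fun_prop
  have hA0 : ∀ k p, 0 ≤ A k p := fun k p => mul_nonneg (ha₀0 _ _) (hc₀0 _ _)
  have hB0 : ∀ k p, 0 ≤ B k p := fun k p => mul_nonneg (ha₁0 _ _) (hc₁0 _ _)
  have hmm1 : ∀ k p, ‖mm k p‖ ≤ ‖m k p.2‖ := fun k p => by
    simp only [hmm, norm_mul]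
    have := mul_le_one₀ (hφ1 (π k) (p.1 - Y k p.2)) (norm_nonneg _) (hψ1 k p.1)
    rw [mul_assoc]
    exact mul_le_of_le_one_right (norm_nonneg _) this
  have hinteg : ∀ k, ∀ {a c : ℝ² → ℝ}, Measurable a → Measurable c → (∀ x, 0 ≤ a x) →
      (∀ x, 0 ≤ c x) → (∀ x, a x ≤ M) → Integrable c →
      Integrable (fun p : ℝ² × Ω => ‖mm k p‖ * (a (p.1 - Y k p.2) * c p.1))
        (volume.prod μ) := by
    intro k a c ha hc ha0 hc0 haM hci
    have h4 := hY k
    have h5 := hmmm k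
    refine ((hci.const_mul M).mul_prod (hmi k).norm).mono'
      (Measurable.aestronglyMeasurable (by fun_prop)) (ae_of_all _ fun p => ?_)
    rw [norm_of_nonneg (mul_nonneg (norm_nonneg _) (mul_nonneg (ha0 _) (hc0 _))), mul_comm]
    exact mul_le_mul (mul_le_mul_of_nonneg_right (haM _) (hc0 _)) (hmm1 k p) (norm_nonneg _)
      (mul_nonneg ((ha0 p.1).trans (haM _)) (hc0 _))
  have hmA := fun k => hinteg k (ha₀ (π k)) (hc₀ k) (ha₀0 (π k)) (hc₀0 k) (ha₀M (π k)) (hc₀i k)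
  have hmB := fun k => hinteg k (ha₁ (π k)) (hc₁ k) (ha₁0 (π k)) (hc₁0 k) (ha₁M (π k)) (hc₁i k)
  have hform : ∀ z : ℂ, 0 ≤ z.re → z.re ≤ 1 →
      ∑ k ∈ K, ∫ p, mm k p * cpw (A k p) (B k p) z ∂(volume.prod μ) =
      ∑ k ∈ K, ∫ x, (ψ k x * cpw (c₀ k x) (c₁ k x) z) *
        kop μ (m k) (Y k) (fun y => φ (π k) y * cpw (a₀ (π k) y) (a₁ (π k) y) z) x := by
    intro z hz0 hz1
    refine sum_congr rfl fun k _ => ?_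
    rw [integral_prod]
    · refine integral_congr_ae (ae_of_all _ fun x => ?_)
      simp only [kop]
      rw [← integral_const_mul]
      refine integral_congr_ae (ae_of_all _ fun ω => ?_)
      simp only [hA, hB, hmm, cpw_mul (ha₀0 _ _) (ha₁0 _ _) (hc₀0 _ _) (hc₁0 _ _)]
      ring
    · refine ((hmA k).add (hmB k)).mono' ((hmmm k).mul
        (measurable_cpw (hAm k) (hBm k) z)).aestronglyMeasurable (ae_of_all _ fun p => ?_)
      rw [norm_mul, Pi.add_apply, ← mul_add]
      exact mul_le_mul_of_nonneg_left (norm_cpw_le (hA0 k p) (hB0 k p) hz0 hz1) (norm_nonneg _)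
  have hle : ∀ {u v : ℂ} {r : ℝ}, ‖u‖ ≤ 1 → ‖v‖ ≤ r → ‖u * v‖ ≤ r := fun hu hv => by
    rw [norm_mul]
    exact (mul_le_of_le_one_left (norm_nonneg _) hu).trans hv
  have key := norm_sum_integral_le_of_three_lines K (fun _ => (volume : Measure (ℝ²)).prod μ)
    hmmm hAm hBm hA0 hB0 hmA hmB (N₀ := N₀) (N₁ := N₁) (t := t) ?_ ?_ ht0.le ht1.le
  · rw [hform t (by simpa using ht0.le) (by simpa using ht1.le)] at key
    have e1 : ∀ k, (fun y => φ k y * cpw (a₀ k y) (a₁ k y) t) = g k := fun k => funext fun y => by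
      rw [cpw_ofReal (ha₀0 _ _) (ha₁0 _ _) ht0 ht1]
      exact hcanc (hga k y)
    have e2 : ∀ k x, ψ k x * cpw (c₀ k x) (c₁ k x) t = h k x := fun k x => by
      rw [cpw_ofReal (hc₀0 _ _) (hc₁0 _ _) ht0 ht1]
      exact hcanc (hhc k x)
    simp only [e1, e2] at key
    exact key
  · intro z hz
    rw [hform z hz.ge (hz.le.trans zero_le_one)]
    exact H₀ (fun i y => φ i y * cpw (a₀ i y) (a₁ i y) z)
      (fun k x => ψ k x * cpw (c₀ k x) (c₁ k x) z) (fun k => (hφm k).mul (measurable_cpw (ha₀ k) (ha₁ k) z))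
      (fun k => (hψm k).mul (measurable_cpw (hc₀ k) (hc₁ k) z))
      (fun k x => hle (hφ1 k x) (norm_cpw_le_left (ha₀0 k x) hz))
      (fun k x => hle (hψ1 k x) (norm_cpw_le_left (hc₀0 k x) hz))
  · intro z hz
    rw [hform z (hz.ge.trans' zero_le_one) hz.le]
    exact H₁ (fun i y => φ i y * cpw (a₀ i y) (a₁ i y) z)
      (fun k x => ψ k x * cpw (c₀ k x) (c₁ k x) z) (fun k => (hφm k).mul (measurable_cpw (ha₀ k) (ha₁ k) z))
      (fun k => (hψm k).mul (measurable_cpw (hc₀ k) (hc₁ k) z))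
      (fun k x => hle (hφ1 k x) (norm_cpw_le_right (ha₁0 k x) hz))
      (fun k x => hle (hψ1 k x) (norm_cpw_le_right (hc₁0 k x) hz))

open scoped FourierTransform SchwartzMap in
/-- Plancherel's theorem for integrable square-integrable functions. -/
lemma lintegral_enorm_fourier_sq {V : Type*} [NormedAddCommGroup V] [InnerProductSpace ℝ V]
    [FiniteDimensional ℝ V] [MeasurableSpace V] [BorelSpace V] {f : V → ℂ} (h1 : Integrable f)
    (h2 : MemLp f 2) : ∫⁻ x, ‖𝓕 f x‖ₑ ^ (2 : ℝ) = ∫⁻ x, ‖f x‖ₑ ^ (2 : ℝ) := by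
  have hcont : Continuous (𝓕 f) :=
    VectorFourier.fourierIntegral_continuous Real.continuous_fourierChar continuous_inner h1
  set F := h2.toLp f with hF
  have hae : (𝓕 F : Lp ℂ 2 (volume : Measure V)) =ᵐ[volume] 𝓕 f := by
    refine ae_eq_of_integral_contDiff_smul_eq
      ((Lp.memLp _).locallyIntegrable (by norm_num)) hcont.locallyIntegrable fun g hg hgc => ?_
    have hgS : ContDiff ℝ (⊤ : ℕ∞) (fun x => (g x : ℂ)) := ofRealCLM.contDiff.comp hg
    have hgSc : HasCompactSupport (fun x => (g x : ℂ)) := hgc.comp_left (g := Complex.ofReal) ofReal_zero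
    set S : 𝓢(V, ℂ) := hgSc.toSchwartzMap hgS with hS
    have e1 := congrArg (fun T => T S) (Lp.fourier_toTemperedDistribution_eq F)
    simp only [TemperedDistribution.fourier_apply, Lp.toTemperedDistribution_apply] at e1
    have e2 : ∫ x, S x * 𝓕 f x = ∫ x, 𝓕 S x * f x := by
      have := VectorFourier.integral_fourierIntegral_smul_eq_flip (L := innerₗ V) (μ := volume)
        (ν := volume) Real.continuous_fourierChar continuous_inner S.integrable h1
      simp only [smul_eq_mul, flip_innerₗ] at this
      exact this.symm
    have e3 : ∫ x, 𝓕 S x • F x = ∫ x, 𝓕 S x * f x := by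
      refine integral_congr_ae ?_
      filter_upwards [h2.coeFn_toLp] with x hx
      rw [hF, hx, smul_eq_mul]
    rw [e3, ← e2] at e1
    simpa [hS, real_smul] using e1.symm
  have e : eLpNorm (𝓕 f) 2 volume = eLpNorm f 2 volume := by
    rw [← eLpNorm_congr_ae hae, ← Lp.enorm_def, ← eLpNorm_congr_ae h2.coeFn_toLp,
      ← Lp.enorm_def]
    rw [← ofReal_norm, ← ofReal_norm, Lp.norm_fourier_eq]
  have h := congrArg (· ^ (2 : ℝ)) e
  simp only [eLpNorm_eq_lintegral_rpow_enorm_toReal (two_ne_zero) (by norm_num : (2:ℝ≥0∞) ≠ ⊤),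
    ENNReal.toReal_ofNat, ← ENNReal.rpow_mul] at h
  simpa using h

/-- The Euclidean structure on `ℝ²`. -/
abbrev EuclPlane : Type := WithLp 2 (ℝ²)

lemma measurableEmbedding_ofLp : MeasurableEmbedding (WithLp.ofLp : EuclPlane → ℝ²) :=
  (MeasurableEquiv.toLp 2 (ℝ²)).symm.measurableEmbedding

lemma volume_preserving_ofLp_plane : MeasurePreserving (WithLp.ofLp : EuclPlane → ℝ²) :=
  WithLp.volume_preserving_ofLp ℝ ℝ

open scoped FourierTransform in
lemma FT_eq_fourier (f : ℝ² → ℂ) (ξ : ℝ²) :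
    FT f ξ = 𝓕 (fun v : EuclPlane => f (WithLp.ofLp v)) (WithLp.toLp 2 ξ) := by
  rw [Real.fourier_eq', FT, ← volume_preserving_ofLp_plane.integral_comp measurableEmbedding_ofLp]
  refine integral_congr_ae (ae_of_all _ fun v => ?_)
  simp only [WithLp.prod_inner_apply, smul_eq_mul]
  congr 2
  simp
  ring_nf

open scoped FourierTransform in
lemma FTinv_eq_fourierInv (f : ℝ² → ℂ) (ξ : ℝ²) :
    FTinv f ξ = 𝓕⁻ (fun v : EuclPlane => f (WithLp.ofLp v)) (WithLp.toLp 2 ξ) := by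
  rw [Real.fourierInv_eq', FTinv,
    ← volume_preserving_ofLp_plane.integral_comp measurableEmbedding_ofLp]
  refine integral_congr_ae (ae_of_all _ fun v => ?_)
  simp only [WithLp.prod_inner_apply, smul_eq_mul]
  congr 2

lemma lintegral_enorm_FT_sq {f : ℝ² → ℂ} (h1 : Integrable f) (h2 : MemLp f 2) :
    ∫⁻ ξ, ‖FT f ξ‖ₑ ^ (2 : ℝ) = ∫⁻ x, ‖f x‖ₑ ^ (2 : ℝ) := by
  have hp := volume_preserving_ofLp_plane
  have he := measurableEmbedding_ofLp
  have key := lintegral_enorm_fourier_sq ((hp.integrable_comp_emb he).2 h1)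
    (h2.comp_measurePreserving hp)
  rw [← hp.lintegral_comp_emb he, ← hp.lintegral_comp_emb he]
  simp only [FT_eq_fourier, WithLp.toLp_ofLp]
  exact key

open scoped FourierTransform in
lemma FTinv_FT {f : ℝ² → ℂ} (hc : Continuous f) (hf : Integrable f) (hF : Integrable (FT f))
    (x : ℝ²) : FTinv (FT f) x = f x := by
  have hp := volume_preserving_ofLp_plane
  have he := measurableEmbedding_ofLp
  have e : (fun v : EuclPlane => FT f (WithLp.ofLp v)) =
      𝓕 (fun v : EuclPlane => f (WithLp.ofLp v)) := by
    funext v; rw [FT_eq_fourier, WithLp.toLp_ofLp]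
  rw [FTinv_eq_fourierInv, e]
  refine Integrable.fourierInv_fourier_eq ((hp.integrable_comp_emb he).2 hf) ?_
    (hc.comp (WithLp.prod_continuous_ofLp 2 ℝ ℝ)).continuousAt
  change Integrable (𝓕 (fun v : EuclPlane => f (WithLp.ofLp v)))
  rw [← e]
  exact (hp.integrable_comp_emb he).2 hF

lemma FTinv_eq_FT_neg (f : ℝ² → ℂ) (x : ℝ²) : FTinv f x = FT f (-x) := by
  simp only [FT, FTinv]
  congr 1; funext v; congr 4; simp; ring

lemma FT_FTinv {f : ℝ² → ℂ} (hc : Continuous f) (hf : Integrable f) (hF : Integrable (FT f))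
    (x : ℝ²) : FT (FTinv f) x = f x := by
  have e : FTinv f = fun y => FT f (-y) := funext (FTinv_eq_FT_neg f)
  rw [← FTinv_FT hc hf hF x, FTinv_eq_FT_neg (FT f), e, FT, FT, ← integral_neg_eq_self]
  refine integral_congr_ae (ae_of_all _ fun v => ?_)
  simp

open scoped FourierTransform in
/-- The Fourier transform of a Schwartz function is a Schwartz function. -/
lemma exists_schwartz_FT (g : SchwartzMap (ℝ²) ℂ) :
    ∃ h : SchwartzMap (ℝ²) ℂ, ∀ ξ, FT g ξ = h ξ := by
  let L := WithLp.prodContinuousLinearEquiv 2 ℝ ℝ ℝ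
  refine ⟨SchwartzMap.compCLMOfContinuousLinearEquiv ℂ L.symm
    (𝓕 (SchwartzMap.compCLMOfContinuousLinearEquiv ℂ L g)), fun ξ => ?_⟩
  rw [FT_eq_fourier]
  rfl

/-- The Fourier multiplier `∫ e^{-2πi ξ·Y(ω)} m(ω) dμ(ω)` of `kop μ m Y`. -/
def kopSymbol {Ω : Type*} [MeasurableSpace Ω] (μ : Measure Ω) (m : Ω → ℂ) (Y : Ω → ℝ²)
    (ξ : ℝ²) : ℂ :=
  ∫ ω, Complex.exp ((((-(2 * Real.pi * ((Y ω).1 * ξ.1 + (Y ω).2 * ξ.2))) : ℝ) : ℂ) * Complex.I)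
    * m ω ∂μ

section kop

variable {Ω : Type*} [MeasurableSpace Ω] {μ : Measure Ω} [SFinite μ] {m : Ω → ℂ}
  {Y : Ω → ℝ²} {g : ℝ² → ℂ}

lemma measurable_kop (hm : Measurable m) (hY : Measurable Y) (hg : Measurable g) :
    Measurable (kop μ m Y g) := by
  have : StronglyMeasurable fun p : ℝ² × Ω => m p.2 * g (p.1 - Y p.2) :=
    Measurable.stronglyMeasurable (by fun_prop)
  exact this.integral_prod_right.measurable

lemma norm_kop_le {M : ℝ} (hmi : Integrable m μ) (hM : ∀ x, ‖g x‖ ≤ M) (x : ℝ²) :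
    ‖kop μ m Y g x‖ ≤ (∫ ω, ‖m ω‖ ∂μ) * M := by
  rw [kop, ← integral_mul_const]
  refine norm_integral_le_of_norm_le (hmi.norm.mul_const M) (ae_of_all _ fun ω => ?_)
  rw [norm_mul]
  exact mul_le_mul_of_nonneg_left (hM _) (norm_nonneg _)

lemma enorm_kop_le (x : ℝ²) : ‖kop μ m Y g x‖ₑ ≤ ∫⁻ ω, ‖m ω‖ₑ * ‖g (x - Y ω)‖ₑ ∂μ := by
  refine (enorm_integral_le_lintegral_enorm _).trans_eq ?_
  simp only [enorm_mul]

lemma integrable_kop_kernel (hm : Measurable m) (hmi : Integrable m μ) (hY : Measurable Y)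
    (hg : Measurable g) (hgi : Integrable g) :
    Integrable (fun p : ℝ² × Ω => m p.2 * g (p.1 - Y p.2)) (volume.prod μ) := by
  refine (integrable_prod_iff' (Measurable.aestronglyMeasurable (by fun_prop))).2
    ⟨ae_of_all _ fun ω => ?_, ?_⟩
  · exact (hgi.comp_sub_right (Y ω)).const_mul (m ω)
  · simp only [norm_mul, integral_const_mul, integral_sub_right_eq_self (fun y => ‖g y‖)]
    exact hmi.norm.mul_const _

lemma integrable_kop (hm : Measurable m) (hmi : Integrable m μ) (hY : Measurable Y)
    (hg : Measurable g) (hgi : Integrable g) : Integrable (kop μ m Y g) :=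
  (integrable_kop_kernel hm hmi hY hg hgi).integral_prod_left

lemma memLp_two_of_bounded {f : ℝ² → ℂ} (hf : Integrable f) {M : ℝ} (hM : ∀ x, ‖f x‖ ≤ M) :
    MemLp f 2 := by
  refine (memLp_two_iff_integrable_sq_norm hf.aestronglyMeasurable).2 ?_
  refine (hf.norm.const_mul M).mono' (hf.aestronglyMeasurable.norm.pow 2) (ae_of_all _ fun x => ?_)
  rw [norm_of_nonneg (by positivity), sq]
  exact mul_le_mul_of_nonneg_right (hM x) (norm_nonneg _)

lemma FT_kop (hm : Measurable m) (hmi : Integrable m μ) (hY : Measurable Y)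
    (hg : Measurable g) (hgi : Integrable g) (ξ : ℝ²) :
    FT (kop μ m Y g) ξ = kopSymbol μ m Y ξ * FT g ξ := by
  set e : ℝ² → ℂ := fun x =>
    Complex.exp ((((-(2 * Real.pi * (x.1 * ξ.1 + x.2 * ξ.2))) : ℝ) : ℂ) * Complex.I) with he
  have hem : Measurable e := by simp only [he]; fun_prop
  have he1 : ∀ x, ‖e x‖ = 1 := fun x => norm_exp_ofReal_mul_I _
  have headd : ∀ x y, e (x + y) = e x * e y := fun x y => by
    simp only [he, ← Complex.exp_add]
    congr 1
    simp
    ring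
  have hint : Integrable (fun p : ℝ² × Ω => e p.1 * (m p.2 * g (p.1 - Y p.2)))
      (volume.prod μ) :=
    (integrable_kop_kernel hm hmi hY hg hgi).bdd_mul (c := 1)
      (hem.comp measurable_fst).aestronglyMeasurable (ae_of_all _ fun p => (he1 _).le)
  calc FT (kop μ m Y g) ξ = ∫ x, ∫ ω, e x * (m ω * g (x - Y ω)) ∂μ := by
        simp only [FT, kop, integral_const_mul, he]
    _ = ∫ ω, (∫ x, e x * (m ω * g (x - Y ω))) ∂μ := integral_integral_swap hint
    _ = ∫ ω, e (Y ω) * m ω * FT g ξ ∂μ := by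
        refine integral_congr_ae (ae_of_all _ fun ω => ?_)
        simp only [FT]
        rw [← integral_const_mul, ← integral_add_right_eq_self _ (Y ω)]
        refine integral_congr_ae (ae_of_all _ fun x => ?_)
        simp only [add_sub_cancel_right, headd]
        ring
    _ = kopSymbol μ m Y ξ * FT g ξ := integral_mul_const _ _

lemma norm_kopSymbol_le (ξ : ℝ²) : ‖kopSymbol μ m Y ξ‖ ≤ ∫ ω, ‖m ω‖ ∂μ := by
  refine (norm_integral_le_integral_norm _).trans_eq ?_
  simp only [norm_mul, norm_exp_ofReal_mul_I, one_mul]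

lemma measurable_kopSymbol (hm : Measurable m) (hY : Measurable Y) :
    Measurable (kopSymbol μ m Y) := by
  have : StronglyMeasurable fun p : ℝ² × Ω =>
      Complex.exp ((((-(2 * Real.pi * ((Y p.2).1 * p.1.1 + (Y p.2).2 * p.1.2))) : ℝ) : ℂ)
        * Complex.I) * m p.2 := Measurable.stronglyMeasurable (by fun_prop)
  exact this.integral_prod_right.measurable

lemma lintegral_enorm_kop_sq (hm : Measurable m) (hmi : Integrable m μ) (hY : Measurable Y)
    (hg : Measurable g) (hgi : Integrable g) {M : ℝ} (hM : ∀ x, ‖g x‖ ≤ M) :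
    ∫⁻ x, ‖kop μ m Y g x‖ₑ ^ (2 : ℝ) = ∫⁻ ξ, ‖kopSymbol μ m Y ξ‖ₑ ^ (2 : ℝ) * ‖FT g ξ‖ₑ ^ (2 : ℝ) := by
  have h1 := integrable_kop hm hmi hY hg hgi
  rw [← lintegral_enorm_FT_sq h1 (memLp_two_of_bounded h1 (norm_kop_le hmi hM))]
  simp only [FT_kop hm hmi hY hg hgi, enorm_mul, mul_rpow_of_nonneg _ _ zero_le_two]

end kop

/-- Square function estimate for generalized convolutions in dual form. -/
lemma sum_lintegral_mul_kop_le {κ Ω : Type*} [MeasurableSpace Ω] {μ : Measure Ω} [SFinite μ]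
    (K : Finset κ) {m : κ → Ω → ℂ} {Y : κ → Ω → ℝ²} (hm : ∀ k, Measurable (m k))
    (hmi : ∀ k, Integrable (m k) μ) (hY : ∀ k, Measurable (Y k)) {g : ℝ² → ℂ}
    (hg : Measurable g) (hgi : Integrable g) {M : ℝ} (hM : ∀ x, ‖g x‖ ≤ M) {N : ℝ≥0∞}
    (w : κ → ℝ≥0∞) (hN : ∀ ξ, ∑ k ∈ K, w k ^ (2 : ℝ) * ‖kopSymbol μ (m k) (Y k) ξ‖ₑ ^ (2 : ℝ)
      ≤ N ^ (2 : ℝ)) {d : κ → ℝ² → ℝ≥0∞} (hd : ∀ k, Measurable (d k)) :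
    ∑ k ∈ K, ∫⁻ x, (w k * d k x) * ‖kop μ (m k) (Y k) g x‖ₑ
      ≤ lpN (fun x => ∑ k ∈ K, d k x) 2 * (N * lpN (fun x => ‖g x‖ₑ) 2) := by
  have hk := fun k => measurable_kop (μ := μ) (hm k) (hY k) hg
  set S : ℝ² → ℝ≥0∞ :=
    fun x => (∑ k ∈ K, (w k * ‖kop μ (m k) (Y k) g x‖ₑ) ^ (2 : ℝ)) ^ (1 / 2 : ℝ) with hS
  have hSm : Measurable S := by simp only [hS]; fun_prop
  have h1 : ∑ k ∈ K, ∫⁻ x, (w k * d k x) * ‖kop μ (m k) (Y k) g x‖ₑ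
      ≤ ∫⁻ x, (∑ k ∈ K, d k x) * S x := by
    rw [← lintegral_finsetSum _ fun k _ => by have := hk k; have := hd k; fun_prop]
    refine lintegral_mono fun x => ?_
    simp only
    rw [sum_mul]
    refine sum_le_sum fun k hkK => ?_
    rw [mul_comm (w k), mul_assoc]
    refine mul_le_mul' le_rfl ?_
    have : w k * ‖kop μ (m k) (Y k) g x‖ₑ =
        ((w k * ‖kop μ (m k) (Y k) g x‖ₑ) ^ (2 : ℝ)) ^ (1 / 2 : ℝ) := by
      rw [← ENNReal.rpow_mul]; norm_num
    rw [this]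
    exact rpow_le_rpow (single_le_sum
      (f := fun k => (w k * ‖kop μ (m k) (Y k) g x‖ₑ) ^ (2 : ℝ)) (fun _ _ => zero_le) hkK)
      (by norm_num)
  refine h1.trans ((lintegral_mul_le_lpN Real.HolderConjugate.two_two
    (by fun_prop) hSm).trans (mul_le_mul' le_rfl ?_))
  have h2 : lpN S 2 ^ (2 : ℝ) ≤ (N * lpN (fun x => ‖g x‖ₑ) 2) ^ (2 : ℝ) := by
    rw [lpN_rpow _ two_pos, mul_rpow_of_nonneg _ _ zero_le_two, lpN_rpow _ two_pos]
    calc ∫⁻ x, S x ^ (2 : ℝ)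
        = ∑ k ∈ K, w k ^ (2 : ℝ) * ∫⁻ x, ‖kop μ (m k) (Y k) g x‖ₑ ^ (2 : ℝ) := by
          simp only [hS, ← ENNReal.rpow_mul]
          norm_num
          rw [lintegral_finsetSum _ fun k _ => by have := hk k; fun_prop]
          refine sum_congr rfl fun k _ => ?_
          rw [← lintegral_const_mul _ (by have := hk k; fun_prop)]
          simp only [mul_pow]
      _ = ∫⁻ ξ, (∑ k ∈ K, w k ^ (2 : ℝ) * ‖kopSymbol μ (m k) (Y k) ξ‖ₑ ^ (2 : ℝ))
            * ‖FT g ξ‖ₑ ^ (2 : ℝ) := by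
          have hF : Measurable (FT g) := by
            have : StronglyMeasurable fun p : ℝ² × ℝ² => Complex.exp
              ((((-(2 * Real.pi * (p.2.1 * p.1.1 + p.2.2 * p.1.2))) : ℝ) : ℂ)
              * Complex.I) * g p.2 := Measurable.stronglyMeasurable (by fun_prop)
            exact this.integral_prod_right.measurable
          have hs := fun k => measurable_kopSymbol (μ := μ) (hm k) (hY k)
          simp only [sum_mul]
          rw [lintegral_finsetSum _ fun k _ => by have := hs k; fun_prop]
          refine sum_congr rfl fun k _ => ?_
          rw [lintegral_enorm_kop_sq (hm k) (hmi k) (hY k) hg hgi hM,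
            ← lintegral_const_mul _ (by have := hs k; fun_prop)]
          simp only [mul_assoc]
      _ ≤ ∫⁻ ξ, N ^ (2 : ℝ) * ‖FT g ξ‖ₑ ^ (2 : ℝ) :=
          lintegral_mono fun ξ => mul_le_mul' (hN ξ) le_rfl
      _ ≤ N ^ (2 : ℝ) * ∫⁻ x, ‖g x‖ₑ ^ (2 : ℝ) := by
          rw [← lintegral_enorm_FT_sq hgi (memLp_two_of_bounded hgi hM)]
          have hF : Measurable (FT g) := by
            have : StronglyMeasurable fun p : ℝ² × ℝ² => Complex.exp
              ((((-(2 * Real.pi * (p.2.1 * p.1.1 + p.2.2 * p.1.2))) : ℝ) : ℂ)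
              * Complex.I) * g p.2 := Measurable.stronglyMeasurable (by fun_prop)
            exact this.integral_prod_right.measurable
          rw [lintegral_const_mul _ (by fun_prop)]
  exact (rpow_le_rpow_iff two_pos).1 h2

/-- Generalized convolutions as Fourier multipliers on Schwartz functions. -/
lemma FTinv_kopSymbol_mul_FT {Ω : Type*} [MeasurableSpace Ω] {μ : Measure Ω} [SFinite μ]
    {m : Ω → ℂ} {Y : Ω → ℝ²} (hm : Measurable m) (hmi : Integrable m μ) (hY : Measurable Y)
    (g : SchwartzMap (ℝ²) ℂ) (x : ℝ²) :
    FTinv (fun ξ => kopSymbol μ m Y ξ * FT g ξ) x = kop μ m Y g x := by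
  have hg := g.continuous
  obtain ⟨M, hM⟩ := g.toBoundedContinuousFunction.bddAbove_range_norm_comp
  have hM' : ∀ x, ‖g x‖ ≤ M := fun x => hM ⟨x, rfl⟩
  have e : (fun ξ => kopSymbol μ m Y ξ * FT g ξ) = FT (kop μ m Y g) :=
    funext fun ξ => (FT_kop hm hmi hY hg.measurable g.integrable ξ).symm
  rw [e]
  refine FTinv_FT ?_ (integrable_kop hm hmi hY hg.measurable g.integrable) ?_ x
  · refine continuous_of_dominated (fun x => Measurable.aestronglyMeasurable (by
      have := hg.measurable; fun_prop)) (bound := fun ω => ‖m ω‖ * M)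
      (fun x => ae_of_all _ fun ω => ?_) (hmi.norm.mul_const M) (ae_of_all _ fun ω => by fun_prop)
    rw [norm_mul]
    exact mul_le_mul_of_nonneg_left (hM' _) (norm_nonneg _)
  · rw [← e]
    obtain ⟨h, hh⟩ := exists_schwartz_FT g
    simp only [hh]
    exact h.integrable.bdd_mul (c := ∫ ω, ‖m ω‖ ∂μ)
      (measurable_kopSymbol hm hY).aestronglyMeasurable (ae_of_all _ norm_kopSymbol_le)

/-- Oscillatory integral estimate for phases with large monotone derivative. -/
lemma norm_oscillatory_le_of_deriv {φ φ₁ φ₂ ψ ψ₁ : ℝ → ℝ} {u v μ A A' : ℝ} (huv : u ≤ v)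
    (hφ : ∀ t ∈ Icc u v, HasDerivAt φ (φ₁ t) t) (hφ₁ : ∀ t ∈ Icc u v, HasDerivAt φ₁ (φ₂ t) t)
    (hφ₂ : ContinuousOn φ₂ (Icc u v)) (hφ₂0 : ∀ t ∈ Icc u v, 0 ≤ φ₂ t) (hμ : 0 < μ)
    (hμφ : (∀ t ∈ Icc u v, μ ≤ φ₁ t) ∨ ∀ t ∈ Icc u v, φ₁ t ≤ -μ)
    (hψ : ∀ t ∈ Icc u v, HasDerivAt ψ (ψ₁ t) t) (hψ₁ : ContinuousOn ψ₁ (Icc u v))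
    (hA : ∀ t ∈ Icc u v, |ψ t| ≤ A) (hA' : ∀ t ∈ Icc u v, |ψ₁ t| ≤ A') :
    ‖∫ t in u..v, Complex.exp ((φ t : ℂ) * Complex.I) * (ψ t : ℂ)‖
      ≤ (3 * A + A' * (v - u)) / μ := by
  have hI : uIcc u v = Icc u v := uIcc_of_le huv
  have habs : ∀ t ∈ Icc u v, μ ≤ |φ₁ t| := fun t ht => by
    rcases hμφ with h | h
    · exact (h t ht).trans (le_abs_self _)
    · exact (by linarith [h t ht] : μ ≤ -φ₁ t).trans (neg_le_abs _)
  have hne : ∀ t ∈ Icc u v, φ₁ t ≠ 0 := fun t ht h => by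
    have := habs t ht; rw [h, abs_zero] at this; linarith
  have hA0 : 0 ≤ A := (abs_nonneg _).trans (hA u ⟨le_rfl, huv⟩)
  have cφ : ContinuousOn φ (Icc u v) := fun t ht => (hφ t ht).continuousAt.continuousWithinAt
  have cφ₁ : ContinuousOn φ₁ (Icc u v) := fun t ht => (hφ₁ t ht).continuousAt.continuousWithinAt
  have cψ : ContinuousOn ψ (Icc u v) := fun t ht => (hψ t ht).continuousAt.continuousWithinAt
  have cg : ContinuousOn (fun t => ψ₁ t / φ₁ t - ψ t * φ₂ t / φ₁ t ^ 2) (Icc u v) :=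
    (hψ₁.div cφ₁ hne).sub ((cψ.mul hφ₂).div (cφ₁.pow 2) fun t ht => pow_ne_zero _ (hne t ht))
  have ce : ContinuousOn (fun t => Complex.exp ((φ t : ℂ) * Complex.I)) (Icc u v) := by fun_prop
  have hF : ∀ t ∈ Icc u v, HasDerivAt
      (fun t => Complex.exp ((φ t : ℂ) * Complex.I) * ((ψ t / φ₁ t : ℝ) : ℂ) * (-Complex.I))
      (Complex.exp ((φ t : ℂ) * Complex.I) * (ψ t : ℂ) + Complex.exp ((φ t : ℂ) * Complex.I)
        * ((ψ₁ t / φ₁ t - ψ t * φ₂ t / φ₁ t ^ 2 : ℝ) : ℂ) * (-Complex.I)) t := fun t ht => by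
    have h1 := ((hφ t ht).ofReal_comp.mul_const Complex.I).cexp
    have h2 := ((hψ t ht).div (hφ₁ t ht) (hne t ht)).ofReal_comp
    have h3 : (φ₁ t : ℂ) ≠ 0 := by exact_mod_cast hne t ht
    refine ((h1.mul h2).mul_const (-Complex.I)).congr_deriv ?_
    simp only [Pi.div_apply]
    push_cast
    field_simp
    linear_combination (-((ψ t : ℂ) * φ₁ t ^ 2)) * I_sq
  have i1 : IntervalIntegrable (fun t => Complex.exp ((φ t : ℂ) * Complex.I) * (ψ t : ℂ))
      volume u v := ContinuousOn.intervalIntegrable (by rw [hI]; fun_prop)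
  have i2 : IntervalIntegrable (fun t => Complex.exp ((φ t : ℂ) * Complex.I)
      * ((ψ₁ t / φ₁ t - ψ t * φ₂ t / φ₁ t ^ 2 : ℝ) : ℂ) * (-Complex.I)) volume u v :=
    ContinuousOn.intervalIntegrable (by
      rw [hI]
      exact (ce.mul (Complex.continuous_ofReal.comp_continuousOn cg)).mul continuousOn_const)
  have e1 := intervalIntegral.integral_eq_sub_of_hasDerivAt (fun t ht => hF t (hI ▸ ht))
    (i1.add i2)
  rw [intervalIntegral.integral_add i1 i2] at e1
  have b1 : ∀ t ∈ Icc u v, ‖Complex.exp ((φ t : ℂ) * Complex.I) * ((ψ t / φ₁ t : ℝ) : ℂ)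
      * (-Complex.I)‖ ≤ A / μ := fun t ht => by
    rw [norm_mul, norm_mul, norm_exp_ofReal_mul_I, norm_neg, norm_I,
      norm_real, one_mul, mul_one, norm_eq_abs, abs_div]
    exact div_le_div₀ hA0 (hA t ht) hμ (habs t ht)
  have i3 : IntervalIntegrable (fun t => φ₂ t / φ₁ t ^ 2) volume u v :=
    ContinuousOn.intervalIntegrable (by
      rw [hI]; exact hφ₂.div (cφ₁.pow 2) fun t ht => pow_ne_zero _ (hne t ht))
  have b2 : ‖∫ t in u..v, Complex.exp ((φ t : ℂ) * Complex.I)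
      * ((ψ₁ t / φ₁ t - ψ t * φ₂ t / φ₁ t ^ 2 : ℝ) : ℂ) * (-Complex.I)‖
      ≤ ∫ t in u..v, (A' / μ + A * (φ₂ t / φ₁ t ^ 2)) := by
    refine intervalIntegral.norm_integral_le_of_norm_le huv ?_
      (intervalIntegrable_const.add (i3.const_mul A))
    refine ae_of_all _ fun t ht => ?_
    have ht : t ∈ Icc u v := ⟨ht.1.le, ht.2⟩
    rw [norm_mul, norm_mul, norm_exp_ofReal_mul_I, norm_neg, norm_I,
      norm_real, one_mul, mul_one, norm_eq_abs]
    refine (abs_sub _ _).trans (add_le_add ?_ ?_)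
    · rw [abs_div]
      exact div_le_div₀ ((abs_nonneg _).trans (hA' t ht)) (hA' t ht) hμ (habs t ht)
    · rw [abs_div, abs_mul, abs_of_nonneg (hφ₂0 t ht), abs_of_nonneg (sq_nonneg (φ₁ t)),
        mul_div_assoc]
      exact mul_le_mul_of_nonneg_right (hA t ht) (div_nonneg (hφ₂0 t ht) (sq_nonneg _))
  have b3 : ∫ t in u..v, φ₂ t / φ₁ t ^ 2 = (φ₁ u)⁻¹ - (φ₁ v)⁻¹ := by
    have := intervalIntegral.integral_eq_sub_of_hasDerivAt (f := fun t => -(φ₁ t)⁻¹)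
      (fun t ht => by
        have h := ((hφ₁ t (hI ▸ ht)).inv (hne t (hI ▸ ht))).neg
        rwa [← neg_div, neg_neg] at h) i3
    rw [this]; ring
  have b4 : (φ₁ u)⁻¹ - (φ₁ v)⁻¹ ≤ 1 / μ := by
    have hu : u ∈ Icc u v := ⟨le_rfl, huv⟩
    have hv : v ∈ Icc u v := ⟨huv, le_rfl⟩
    rcases hμφ with h | h
    · have h1 : (φ₁ u)⁻¹ ≤ 1 / μ := by rw [one_div]; exact inv_anti₀ hμ (h u hu)
      have h2 : 0 ≤ (φ₁ v)⁻¹ := inv_nonneg.2 (hμ.le.trans (h v hv))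
      linarith
    · have h1 : (-φ₁ v)⁻¹ ≤ 1 / μ := by
        rw [one_div]; exact inv_anti₀ hμ (by linarith [h v hv])
      have h2 : (φ₁ u)⁻¹ ≤ 0 := inv_nonpos.2 (by linarith [h u hu])
      rw [inv_neg] at h1
      linarith
  rw [intervalIntegral.integral_add intervalIntegrable_const (i3.const_mul A),
    intervalIntegral.integral_const_mul, b3, intervalIntegral.integral_const, smul_eq_mul] at b2
  have e2 := eq_sub_of_add_eq e1
  rw [e2]
  refine (norm_sub_le _ _).trans ((add_le_add (norm_sub_le _ _) b2).trans ?_)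
  have h1 := b1 u ⟨le_rfl, huv⟩
  have h2 := b1 v ⟨huv, le_rfl⟩
  have h3 := mul_le_mul_of_nonneg_left b4 hA0
  have : (3 * A + A' * (v - u)) / μ = A / μ + A / μ + ((v - u) * (A' / μ) + A * (1 / μ)) := by
    ring
  rw [this]
  linarith

/-- The second derivative test for oscillatory integrals. -/
lemma norm_oscillatory_le_of_deriv2 {φ φ₁ φ₂ ψ ψ₁ : ℝ → ℝ} {u v lam A A' : ℝ} (huv : u ≤ v)
    (hφ : ∀ t ∈ Icc u v, HasDerivAt φ (φ₁ t) t) (hφ₁ : ∀ t ∈ Icc u v, HasDerivAt φ₁ (φ₂ t) t)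
    (hφ₂ : ContinuousOn φ₂ (Icc u v)) (hlam : 0 < lam) (hφ₂l : ∀ t ∈ Icc u v, lam ≤ φ₂ t)
    (hψ : ∀ t ∈ Icc u v, HasDerivAt ψ (ψ₁ t) t) (hψ₁ : ContinuousOn ψ₁ (Icc u v))
    (hA : ∀ t ∈ Icc u v, |ψ t| ≤ A) (hA' : ∀ t ∈ Icc u v, |ψ₁ t| ≤ A') :
    ‖∫ t in u..v, Complex.exp ((φ t : ℂ) * Complex.I) * (ψ t : ℂ)‖
      ≤ (8 * A + 2 * A' * (v - u)) * lam ^ (-(1 / 2) : ℝ) := by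
  have hI : uIcc u v = Icc u v := uIcc_of_le huv
  have hu : u ∈ Icc u v := ⟨le_rfl, huv⟩
  have hv : v ∈ Icc u v := ⟨huv, le_rfl⟩
  have hA0 : 0 ≤ A := (abs_nonneg _).trans (hA u hu)
  have hA'0 : 0 ≤ A' := (abs_nonneg _).trans (hA' u hu)
  set δ : ℝ := lam ^ (-(1 / 2) : ℝ) with hδ
  have hδ0 : 0 < δ := Real.rpow_pos_of_pos hlam _
  have hδl : lam * δ = δ⁻¹ := by
    rw [hδ, ← rpow_neg hlam.le]
    nth_rewrite 1 [← rpow_one lam]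
    rw [← rpow_add hlam]
    norm_num
  have cφ₁ : ContinuousOn φ₁ (Icc u v) := fun t ht => (hφ₁ t ht).continuousAt.continuousWithinAt
  have cφ : ContinuousOn φ (Icc u v) := fun t ht => (hφ t ht).continuousAt.continuousWithinAt
  have cψ : ContinuousOn ψ (Icc u v) := fun t ht => (hψ t ht).continuousAt.continuousWithinAt
  have hslope : ∀ s ∈ Icc u v, ∀ t ∈ Icc u v, s ≤ t → lam * (t - s) ≤ φ₁ t - φ₁ s := by
    intro s hs t ht hst
    refine (convex_Icc u v).mul_sub_le_image_sub_of_le_deriv cφ₁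
      (fun x hx => (hφ₁ x (interior_subset hx)).differentiableAt.differentiableWithinAt)
      (fun x hx => ?_) s hs t ht hst
    rw [(hφ₁ x (interior_subset hx)).deriv]
    exact hφ₂l x (interior_subset hx)
  obtain ⟨t₀, ht₀, hneg, hpos⟩ : ∃ t₀ ∈ Icc u v,
      (u < t₀ → φ₁ t₀ ≤ 0) ∧ (t₀ < v → 0 ≤ φ₁ t₀) := by
    rcases le_or_gt 0 (φ₁ u) with h | h
    · exact ⟨u, hu, fun h' => absurd h' (lt_irrefl _), fun _ => h⟩
    rcases le_or_gt (φ₁ v) 0 with h' | h'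
    · exact ⟨v, hv, fun _ => h', fun h'' => absurd h'' (lt_irrefl _)⟩
    obtain ⟨t₀, ht₀, h0⟩ := intermediate_value_Icc huv cφ₁ ⟨h.le, h'.le⟩
    exact ⟨t₀, ht₀, fun _ => h0.le, fun _ => h0.ge⟩
  set t₁ := max u (t₀ - δ) with ht₁
  set t₂ := min v (t₀ + δ) with ht₂
  have h01 : u ≤ t₁ := le_max_left _ _
  have h10 : t₁ ≤ t₀ := max_le ht₀.1 (by linarith)
  have h02 : t₀ ≤ t₂ := le_min ht₀.2 (by linarith)
  have h2v : t₂ ≤ v := min_le_left _ _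
  have hint : ∀ x ∈ Icc u v, ∀ y ∈ Icc u v, IntervalIntegrable
      (fun t => Complex.exp ((φ t : ℂ) * Complex.I) * (ψ t : ℂ)) volume x y := fun x hx y hy =>
    ContinuousOn.intervalIntegrable (ContinuousOn.mono (by fun_prop)
      (uIcc_subset_Icc hx hy))
  have m1 : t₁ ∈ Icc u v := ⟨h01, h10.trans ht₀.2⟩
  have m2 : t₂ ∈ Icc u v := ⟨ht₀.1.trans h02, h2v⟩
  have hμ : 0 < δ⁻¹ := inv_pos.2 hδ0
  have B1 : ‖∫ t in u..t₁, Complex.exp ((φ t : ℂ) * Complex.I) * (ψ t : ℂ)‖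
      ≤ (3 * A + A' * (v - u)) * δ := by
    rcases h01.eq_or_lt with h | h
    · rw [← h, intervalIntegral.integral_same, norm_zero]
      have : 0 ≤ v - u := by linarith
      positivity
    have e1 : t₁ = t₀ - δ := by
      rcases max_choice u (t₀ - δ) with h' | h'
      · rw [ht₁, h'] at h; exact absurd h (lt_irrefl _)
      · exact h'
    have hs : Icc u t₁ ⊆ Icc u v := Icc_subset_Icc le_rfl m1.2
    refine (norm_oscillatory_le_of_deriv h01 (fun t ht => hφ t (hs ht)) (fun t ht => hφ₁ t (hs ht))
      (hφ₂.mono hs) (fun t ht => hlam.le.trans (hφ₂l t (hs ht))) hμ (Or.inr fun t ht => ?_)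
      (fun t ht => hψ t (hs ht)) (hψ₁.mono hs) (fun t ht => hA t (hs ht))
      fun t ht => hA' t (hs ht)).trans ?_
    · have := hslope t (hs ht) t₀ ht₀ (ht.2.trans h10)
      have h3 := hneg (by linarith)
      have h4 : lam * δ ≤ lam * (t₀ - t) :=
        mul_le_mul_of_nonneg_left (by linarith [ht.2]) hlam.le
      linarith
    · rw [div_inv_eq_mul]
      have : A' * (t₁ - u) ≤ A' * (v - u) := mul_le_mul_of_nonneg_left (by linarith [m1.2]) hA'0
      exact mul_le_mul_of_nonneg_right (by linarith) hδ0.le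
  have B3 : ‖∫ t in t₂..v, Complex.exp ((φ t : ℂ) * Complex.I) * (ψ t : ℂ)‖
      ≤ (3 * A + A' * (v - u)) * δ := by
    rcases h2v.eq_or_lt with h | h
    · rw [h, intervalIntegral.integral_same, norm_zero]
      have : 0 ≤ v - u := by linarith
      positivity
    have e1 : t₂ = t₀ + δ := by
      rcases min_choice v (t₀ + δ) with h' | h'
      · rw [ht₂, h'] at h; exact absurd h (lt_irrefl _)
      · exact h'
    have hs : Icc t₂ v ⊆ Icc u v := Icc_subset_Icc m2.1 le_rfl
    refine (norm_oscillatory_le_of_deriv h2v (fun t ht => hφ t (hs ht)) (fun t ht => hφ₁ t (hs ht))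
      (hφ₂.mono hs) (fun t ht => hlam.le.trans (hφ₂l t (hs ht))) hμ (Or.inl fun t ht => ?_)
      (fun t ht => hψ t (hs ht)) (hψ₁.mono hs) (fun t ht => hA t (hs ht))
      fun t ht => hA' t (hs ht)).trans ?_
    · have := hslope t₀ ht₀ t (hs ht) (h02.trans ht.1)
      have h3 := hpos (by linarith)
      have h4 : lam * δ ≤ lam * (t - t₀) :=
        mul_le_mul_of_nonneg_left (by linarith [ht.1]) hlam.le
      linarith
    · rw [div_inv_eq_mul]
      have : A' * (v - t₂) ≤ A' * (v - u) := mul_le_mul_of_nonneg_left (by linarith [m2.1]) hA'0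
      exact mul_le_mul_of_nonneg_right (by linarith) hδ0.le
  have B2 : ‖∫ t in t₁..t₂, Complex.exp ((φ t : ℂ) * Complex.I) * (ψ t : ℂ)‖ ≤ A * (2 * δ) := by
    refine (intervalIntegral.norm_integral_le_of_norm_le_const (C := A) fun t ht => ?_).trans ?_
    · rw [uIoc_of_le (h10.trans h02)] at ht
      rw [norm_mul, norm_exp_ofReal_mul_I, one_mul, norm_real]
      exact hA t ⟨h01.trans ht.1.le, ht.2.trans h2v⟩
    · rw [abs_of_nonneg (by linarith)]
      refine mul_le_mul_of_nonneg_left ?_ hA0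
      have h1 : t₀ - δ ≤ t₁ := le_max_right _ _
      have h2 : t₂ ≤ t₀ + δ := min_le_right _ _
      linarith
  rw [← intervalIntegral.integral_add_adjacent_intervals (hint u hu t₂ m2) (hint t₂ m2 v hv),
    ← intervalIntegral.integral_add_adjacent_intervals (hint u hu t₁ m1) (hint t₁ m1 t₂ m2)]
  refine (norm_add_le _ _).trans ((add_le_add (norm_add_le _ _) le_rfl).trans ?_)
  linarith

lemma norm_oscillatory_neg (φ ψ : ℝ → ℝ) (u v : ℝ) :
    ‖∫ t in u..v, Complex.exp (((-φ t : ℝ) : ℂ) * Complex.I) * (ψ t : ℂ)‖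
      = ‖∫ t in u..v, Complex.exp ((φ t : ℂ) * Complex.I) * (ψ t : ℂ)‖ := by
  rw [← Complex.norm_conj (∫ t in u..v, Complex.exp ((φ t : ℂ) * Complex.I) * (ψ t : ℂ)),
    intervalIntegral.intervalIntegral_eq_integral_uIoc,
    intervalIntegral.intervalIntegral_eq_integral_uIoc, real_smul, real_smul,
    map_mul, conj_ofReal, ← integral_conj]
  congr 3
  ext t
  rw [map_mul, conj_ofReal, ← Complex.exp_conj, map_mul, conj_ofReal,
    Complex.conj_I]
  push_cast
  ring_nf

/-- Decay of oscillatory integrals along `(t, t ^ b)`. -/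
lemma exists_norm_curve_oscillatory_le {b : ℝ} (hb : 1 < b) :
    ∃ C : ℝ, 0 < C ∧ ∀ (ψ ψ₁ : ℝ → ℝ) (A A' : ℝ),
      (∀ t ∈ Icc (1 / 2 : ℝ) 2, HasDerivAt ψ (ψ₁ t) t) → ContinuousOn ψ₁ (Icc (1 / 2 : ℝ) 2) →
      (∀ t ∈ Icc (1 / 2 : ℝ) 2, |ψ t| ≤ A) → (∀ t ∈ Icc (1 / 2 : ℝ) 2, |ψ₁ t| ≤ A') →
      ∀ a₁ a₂ : ℝ, 0 < |a₁| + |a₂| →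
        ‖∫ t in (1 / 2 : ℝ)..2, Complex.exp (((a₁ * t + a₂ * t ^ b : ℝ) : ℂ) * Complex.I)
            * (ψ t : ℂ)‖ ≤ C * (A + A') * (|a₁| + |a₂|) ^ (-(1 / 2) : ℝ) := by
  set K : ℝ := b * 2 ^ b with hK
  set κ : ℝ := b * (b - 1) * ((2 : ℝ) ^ (-b) / 4) / (2 * K + 1) with hκ
  have hb0 : 0 < b := by linarith
  have hb1 : 0 < b - 1 := by linarith
  have hK0 : 0 < K := by positivity
  have hκ0 : 0 < κ := by positivity
  have hK1 : 1 ≤ K := by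
    have : (1 : ℝ) ≤ 2 ^ b := Real.one_le_rpow (by norm_num) hb0.le
    nlinarith
  refine ⟨14 + 8 * κ ^ (-(1 / 2) : ℝ), by positivity, ?_⟩
  intro ψ ψ₁ A A' hψ hψ₁ hA hA' a₁ a₂
  have h12 : (1 / 2 : ℝ) ∈ Icc (1 / 2 : ℝ) 2 := by norm_num
  have hA0 : 0 ≤ A := (abs_nonneg _).trans (hA _ h12)
  have hA'0 : 0 ≤ A' := (abs_nonneg _).trans (hA' _ h12)
  wlog ha₂ : 0 ≤ a₂ generalizing a₁ a₂ with H
  · intro hs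
    have := H (-a₁) (-a₂) (by linarith) (by rwa [abs_neg, abs_neg])
    rw [abs_neg, abs_neg] at this
    rw [← norm_oscillatory_neg]
    refine le_trans (le_of_eq ?_) this
    congr 3
    ext t
    congr 3
    push_cast
    ring
  intro hs
  set s := |a₁| + |a₂| with hs'
  have hpos : ∀ t ∈ Icc (1 / 2 : ℝ) 2, 0 < t := fun t ht => by linarith [ht.1]
  have hφ : ∀ t ∈ Icc (1 / 2 : ℝ) 2, HasDerivAt (fun t => a₁ * t + a₂ * t ^ b)
      (a₁ + a₂ * (b * t ^ (b - 1))) t := fun t ht => by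
    have h1 := (hasDerivAt_id t).const_mul a₁
    have h2 := (hasDerivAt_rpow_const (p := b) (Or.inl (hpos t ht).ne')).const_mul a₂
    exact (h1.add h2).congr_deriv (by ring)
  have hφ₁ : ∀ t ∈ Icc (1 / 2 : ℝ) 2, HasDerivAt (fun t => a₁ + a₂ * (b * t ^ (b - 1)))
      (a₂ * (b * ((b - 1) * t ^ (b - 1 - 1)))) t := fun t ht => by
    have h2 := (((hasDerivAt_rpow_const (p := b - 1)
      (Or.inl (hpos t ht).ne')).const_mul b).const_mul a₂).const_add a₁
    simpa using h2
  have hφ₂ : ContinuousOn (fun t : ℝ => a₂ * (b * ((b - 1) * t ^ (b - 1 - 1))))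
      (Icc (1 / 2 : ℝ) 2) := by
    refine continuousOn_const.mul (continuousOn_const.mul (continuousOn_const.mul ?_))
    exact ContinuousOn.rpow_const continuousOn_id fun t ht => Or.inl (hpos t ht).ne'
  have hs12 : 0 < s ^ (-(1 / 2) : ℝ) := Real.rpow_pos_of_pos hs _
  have hκ12 : 0 < κ ^ (-(1 / 2) : ℝ) := Real.rpow_pos_of_pos hκ0 _
  rcases le_or_gt (2 * K * |a₂|) |a₁| with hc | hc
  · have hfirst : ‖∫ t in (1 / 2 : ℝ)..2,
        Complex.exp (((a₁ * t + a₂ * t ^ b : ℝ) : ℂ) * Complex.I) * (ψ t : ℂ)‖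
        ≤ (3 * A + A' * (2 - 1 / 2)) / (s / 4) := by
      refine norm_oscillatory_le_of_deriv (by norm_num) hφ hφ₁ hφ₂ (fun t ht => ?_)
        (by positivity) ?_ hψ hψ₁ hA hA'
      · have := hpos t ht
        positivity
      · have hbd : ∀ t ∈ Icc (1 / 2 : ℝ) 2, 0 ≤ a₂ * (b * t ^ (b - 1)) ∧
            a₂ * (b * t ^ (b - 1)) ≤ |a₁| / 2 := fun t ht => by
          have h0 := hpos t ht
          refine ⟨by positivity, ?_⟩
          have h1 : t ^ (b - 1) ≤ 2 ^ b :=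
            (Real.rpow_le_rpow h0.le ht.2 hb1.le).trans
              (rpow_le_rpow_of_exponent_le (by norm_num) (by linarith))
          have h2 : a₂ * (b * t ^ (b - 1)) ≤ a₂ * K :=
            mul_le_mul_of_nonneg_left (mul_le_mul_of_nonneg_left h1 hb0.le) ha₂
          rw [abs_of_nonneg ha₂] at hc
          linarith
        have hsa : s / 4 ≤ |a₁| / 2 := by
          have : |a₂| ≤ K * |a₂| := le_mul_of_one_le_left (abs_nonneg _) hK1
          nlinarith [abs_nonneg a₂]
        rcases le_total 0 a₁ with h | h
        · left
          intro t ht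
          rw [abs_of_nonneg h] at hsa hbd
          linarith [(hbd t ht).1]
        · right
          intro t ht
          rw [abs_of_nonpos h] at hsa hbd
          linarith [(hbd t ht).2]
    rcases le_or_gt 1 s with h1 | h1
    · refine hfirst.trans ?_
      have : s⁻¹ ≤ s ^ (-(1 / 2) : ℝ) := by
        rw [← Real.rpow_neg_one]
        exact rpow_le_rpow_of_exponent_le h1 (by norm_num)
      calc (3 * A + A' * (2 - 1 / 2)) / (s / 4) = (12 * A + 6 * A') * s⁻¹ := by
            field_simp; ring
        _ ≤ (12 * A + 6 * A') * s ^ (-(1 / 2) : ℝ) :=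
            mul_le_mul_of_nonneg_left this (by positivity)
        _ ≤ _ := mul_le_mul_of_nonneg_right (by nlinarith) hs12.le
    · have h3 : 1 ≤ s ^ (-(1 / 2) : ℝ) :=
        Real.one_le_rpow_of_pos_of_le_one_of_nonpos hs h1.le (by norm_num)
      refine (intervalIntegral.norm_integral_le_of_norm_le_const (C := A) fun t ht => ?_).trans ?_
      · rw [uIoc_of_le (by norm_num)] at ht
        rw [norm_mul, norm_exp_ofReal_mul_I, one_mul, norm_real]
        exact hA t ⟨ht.1.le, ht.2⟩
      · have : A * |(2 : ℝ) - 1 / 2| ≤ (14 + 8 * κ ^ (-(1 / 2) : ℝ)) * (A + A') := by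
          rw [abs_of_nonneg (by norm_num)]
          nlinarith [mul_nonneg hκ12.le (add_nonneg hA0 hA'0)]
        exact this.trans (le_mul_of_one_le_right (by positivity) h3)
  · have hlam : ∀ t ∈ Icc (1 / 2 : ℝ) 2, κ * s ≤ a₂ * (b * ((b - 1) * t ^ (b - 1 - 1))) := by
      intro t ht
      have h0 := hpos t ht
      have h1 : (2 : ℝ) ^ (-b) / 4 ≤ t ^ (b - 1 - 1) := by
        rw [show b - 1 - 1 = b - (2 : ℕ) by push_cast; ring, Real.rpow_sub_natCast h0.ne']
        refine div_le_div₀ (by positivity) ?_ (by positivity) (by nlinarith [ht.2])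
        rw [rpow_neg (by norm_num), ← inv_rpow (by norm_num)]
        exact Real.rpow_le_rpow (by norm_num) (by linarith [ht.1]) hb0.le
      have h2 : s ≤ (2 * K + 1) * a₂ := by
        rw [abs_of_nonneg ha₂] at hc hs'
        linarith
      calc κ * s ≤ κ * ((2 * K + 1) * a₂) := mul_le_mul_of_nonneg_left h2 hκ0.le
        _ = a₂ * (b * ((b - 1) * ((2 : ℝ) ^ (-b) / 4))) := by
            rw [hκ]; field_simp
        _ ≤ _ := by gcongr
    refine (norm_oscillatory_le_of_deriv2 (by norm_num) hφ hφ₁ hφ₂ (mul_pos hκ0 hs) hlam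
      hψ hψ₁ hA hA').trans ?_
    rw [mul_rpow hκ0.le hs.le, ← mul_assoc]
    refine mul_le_mul_of_nonneg_right ?_ hs12.le
    nlinarith [mul_nonneg hκ12.le hA'0, mul_nonneg hκ12.le hA0]

lemma integrable_rpow_of_bounded {F : ℝ² → ℝ} (hF : Measurable F) (hF0 : ∀ x, 0 ≤ F x) {M : ℝ}
    (hM : ∀ x, F x ≤ M) {B : Set (ℝ²)} (hB : MeasurableSet B) (hBf : volume B ≠ ⊤)
    (hFB : ∀ x, x ∉ B → F x = 0) {s : ℝ} (hs : 0 < s) : Integrable fun x => F x ^ s := by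
  have hi : Integrable (B.indicator fun _ => M ^ s) :=
    (integrable_indicator_iff hB).2 (integrableOn_const hBf)
  refine hi.mono' (hF.pow_const s).aestronglyMeasurable (ae_of_all _ fun x => ?_)
  rw [norm_of_nonneg (rpow_nonneg (hF0 x) _)]
  by_cases hx : x ∈ B
  · rw [indicator_of_mem hx]
    exact Real.rpow_le_rpow (hF0 x) (hM x) hs.le
  · rw [indicator_of_notMem hx, hFB x hx, zero_rpow hs.ne']

lemma lpN_ofReal_rpow {F : ℝ² → ℝ} (hF0 : ∀ x, 0 ≤ F x) {p s : ℝ}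
    (hs : 0 < s) (hi : Integrable fun x => F x ^ p) :
    lpN (fun x => ofReal (F x ^ (p / s))) s = ofReal ((∫ x, F x ^ p) ^ (1 / s)) := by
  have h1 : ∀ x, ofReal (F x ^ (p / s)) ^ s = ofReal (F x ^ p) := fun x => by
    rw [ofReal_rpow_of_nonneg (rpow_nonneg (hF0 x) _) hs.le,
      ← rpow_mul (hF0 x), div_mul_cancel₀ _ hs.ne']
  rw [lpN]
  simp only [h1]
  rw [← ofReal_integral_eq_lintegral_ofReal hi (ae_of_all _ fun x => rpow_nonneg (hF0 x) _),
    ofReal_rpow_of_nonneg (integral_nonneg fun x => rpow_nonneg (hF0 x) _)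
      (by positivity)]

lemma mul_rpow_sub_one_of_nonneg {x s : ℝ} (hx : 0 ≤ x) (hs : 0 < s) :
    x * x ^ (s - 1) = x ^ s := by
  rcases hx.eq_or_lt with rfl | hx
  · rw [zero_mul, zero_rpow hs.ne']
  · rw [rpow_sub_one hx.ne', mul_div_cancel₀ _ hx.ne']

/-- Interpolation of bilinear bounds for weighted families of generalized convolutions. -/
lemma sum_lintegral_mul_kop_interp_le {κ Ω : Type*} [MeasurableSpace Ω] (μ : Measure Ω) [SFinite μ]
    (K : Finset κ) {m : κ → Ω → ℂ} {Y : κ → Ω → ℝ²} (hm : ∀ k, Measurable (m k))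
    (hmi : ∀ k, Integrable (m k) μ) (hY : ∀ k, Measurable (Y k)) {p p₀ p₁ q q₀ q₁ θ : ℝ}
    (hpq : p.HolderConjugate q) (hpq₀ : p₀.HolderConjugate q₀) (hpq₁ : p₁.HolderConjugate q₁)
    (hθ0 : 0 < θ) (hθ1 : θ ≤ 1) (hθ : 1 / p = (1 - θ) / p₀ + θ / p₁) {v : κ → ℝ}
    (hv : ∀ k, 0 ≤ v k) {N₀ N₁ : ℝ} (hN₀ : 0 ≤ N₀) (hN₁ : 0 ≤ N₁)
    (H₀ : ∀ (g : ℝ² → ℂ) (d : κ → ℝ² → ℝ≥0∞), Measurable g → Integrable g →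
      (∃ M, ∀ x, ‖g x‖ ≤ M) → (∀ k, Measurable (d k)) → lpN (fun x => ∑ k ∈ K, d k x) q₀ ≠ ⊤ →
      ∑ k ∈ K, ∫⁻ x, (ofReal (v k ^ (p / p₀)) * d k x) * ‖kop μ (m k) (Y k) g x‖ₑ
        ≤ ofReal N₀ * lpN (fun x => ‖g x‖ₑ) p₀ * lpN (fun x => ∑ k ∈ K, d k x) q₀)
    (H₁ : ∀ (g : ℝ² → ℂ) (d : κ → ℝ² → ℝ≥0∞), Measurable g → Integrable g →
      (∃ M, ∀ x, ‖g x‖ ≤ M) → (∀ k, Measurable (d k)) → lpN (fun x => ∑ k ∈ K, d k x) q₁ ≠ ⊤ →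
      ∑ k ∈ K, ∫⁻ x, (ofReal (v k ^ (p / p₁)) * d k x) * ‖kop μ (m k) (Y k) g x‖ₑ
        ≤ ofReal N₁ * lpN (fun x => ‖g x‖ₑ) p₁ * lpN (fun x => ∑ k ∈ K, d k x) q₁)
    {g : ℝ² → ℂ} {h : κ → ℝ² → ℝ} (hg : Measurable g) (hh : ∀ k, Measurable (h k))
    {B : Set (ℝ²)} (hB : MeasurableSet B) (hBf : volume B ≠ ⊤) {M : ℝ} (hgM : ∀ x, ‖g x‖ ≤ M)
    (hh0 : ∀ k x, 0 ≤ h k x) (hhM : ∀ k x, h k x ≤ M) (hgB : ∀ x, x ∉ B → g x = 0)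
    (hhB : ∀ k x, x ∉ B → h k x = 0) :
    ∑ k ∈ K, ∫⁻ x, ofReal (v k * h k x) * ‖kop μ (m k) (Y k) g x‖ₑ
      ≤ ofReal (N₀ ^ (1 - θ) * N₁ ^ θ) * lpN (fun x => ‖g x‖ₑ) p *
        lpN (fun x => ∑ k ∈ K, ofReal (h k x)) q := by
  set H : ℝ² → ℝ := fun x => ∑ k ∈ K, h k x with hH
  have hHm : Measurable H := Finset.measurable_fun_sum _ fun k _ => hh k
  have hH0 : ∀ x, 0 ≤ H x := fun x => sum_nonneg fun k _ => hh0 k x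
  have hHB : ∀ x, x ∉ B → H x = 0 := fun x hx => sum_eq_zero fun k _ => hhB k x hx
  have hHM : ∀ x, H x ≤ K.card * M := fun x => by
    rw [← nsmul_eq_mul]; exact Finset.sum_le_card_nsmul _ _ _ fun k _ => hhM k x
  set h' : κ → ℝ² → ℝ := fun k x => min (h k x) (H x) with hh'
  have hh'm : ∀ k, Measurable (h' k) := fun k => (hh k).min hHm
  have hh'0 : ∀ k x, 0 ≤ h' k x := fun k x => le_min (hh0 k x) (hH0 x)
  have hh'H : ∀ k x, h' k x ≤ H x := fun k x => min_le_right _ _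
  have hh'e : ∀ k ∈ K, ∀ x, h' k x = h k x := fun k hk x =>
    min_eq_left (single_le_sum (f := fun k => h k x) (fun k _ => hh0 k x) hk)
  have hHint : ∀ s : ℝ, 0 < s → Integrable fun x => H x ^ s := fun s hs =>
    integrable_rpow_of_bounded (F := H) (s := s) hHm hH0 hHM hB hBf hHB hs
  have hgint : ∀ s : ℝ, 0 < s → Integrable fun x => ‖g x‖ ^ s := fun s hs =>
    integrable_rpow_of_bounded hg.norm (fun x => norm_nonneg _) hgM hB hBf
      (fun x hx => by rw [hgB x hx, norm_zero]) hs
  have hp0 : 0 < p := hpq.pos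
  have hq0 : 0 < q := hpq.symm.pos
  set Gn := ∫ x, ‖g x‖ ^ p with hGn
  set Hn := ∫ x, H x ^ q with hHn
  have hGn0 : 0 ≤ Gn := integral_nonneg fun x => rpow_nonneg (norm_nonneg _) _
  have hHn0 : 0 ≤ Hn := integral_nonneg fun x => rpow_nonneg (hH0 x) _
  set c : ℝ → ℝ → κ → ℝ² → ℝ := fun s s' k x =>
    v k ^ (p / s) * (h' k x * H x ^ (q / s' - 1)) with hc
  have hcm : ∀ s s' k, Measurable (c s s' k) := fun s s' k => by
    have := hh'm k; simp only [hc]; fun_prop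
  have hc0 : ∀ s s' k x, 0 ≤ c s s' k x := fun s s' k x =>
    mul_nonneg (rpow_nonneg (hv k) _) (mul_nonneg (hh'0 k x) (rpow_nonneg (hH0 x) _))
  have hcle : ∀ s' : ℝ, 0 < s' → ∀ k x, h' k x * H x ^ (q / s' - 1) ≤ H x ^ (q / s') :=
    fun s' hs' k x => by
      rw [← mul_rpow_sub_one_of_nonneg (hH0 x) (div_pos hq0 hs')]
      exact mul_le_mul_of_nonneg_right (hh'H k x) (rpow_nonneg (hH0 x) _)
  have hci : ∀ s s' : ℝ, 0 < s' → ∀ k, Integrable (c s s' k) := fun s s' hs' k => by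
    refine ((hHint (q / s') (div_pos hq0 hs')).const_mul (v k ^ (p / s))).mono'
      (hcm s s' k).aestronglyMeasurable (ae_of_all _ fun x => ?_)
    rw [norm_of_nonneg (hc0 s s' k x)]
    exact mul_le_mul_of_nonneg_left (hcle s' hs' k x) (rpow_nonneg (hv k) _)
  have key : ∀ s s' N : ℝ, s.HolderConjugate s' → 0 ≤ N →
      (∀ (g : ℝ² → ℂ) (d : κ → ℝ² → ℝ≥0∞), Measurable g → Integrable g →
      (∃ M, ∀ x, ‖g x‖ ≤ M) → (∀ k, Measurable (d k)) → lpN (fun x => ∑ k ∈ K, d k x) s' ≠ ⊤ →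
      ∑ k ∈ K, ∫⁻ x, (ofReal (v k ^ (p / s)) * d k x) * ‖kop μ (m k) (Y k) g x‖ₑ
        ≤ ofReal N * lpN (fun x => ‖g x‖ₑ) s * lpN (fun x => ∑ k ∈ K, d k x) s') →
      ∀ (g' : Unit → ℝ² → ℂ) (k' : κ → ℝ² → ℂ), (∀ i, Measurable (g' i)) →
      (∀ k, Measurable (k' k)) → (∀ i x, ‖g' i x‖ ≤ ‖g x‖ ^ (p / s)) →
      (∀ k x, ‖k' k x‖ ≤ c s s' k x) →
      ‖∑ k ∈ K, ∫ x, k' k x * kop μ (m k) (Y k) (g' ((fun _ => ()) k)) x‖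
        ≤ N * Gn ^ (1 / s) * Hn ^ (1 / s') := by
    intro s s' N hss hN HH g' k' hg' hk' hga hkc
    have hs : 0 < s := hss.pos
    have hs' : 0 < s' := hss.symm.pos
    set d : κ → ℝ² → ℝ≥0∞ := fun k x => ofReal (h' k x * H x ^ (q / s' - 1)) with hd
    have hdm : ∀ k, Measurable (d k) := fun k => by
      have := hh'm k; simp only [hd]; fun_prop
    have hdH : ∀ x, ∑ k ∈ K, d k x = ofReal (H x ^ (q / s')) := fun x => by
      simp only [hd]
      rw [← ofReal_sum_of_nonneg fun k _ =>
        mul_nonneg (hh'0 k x) (rpow_nonneg (hH0 x) _), ← sum_mul,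
        sum_congr rfl fun k hk => hh'e k hk x]
      exact congrArg _ (mul_rpow_sub_one_of_nonneg (hH0 x) (div_pos hq0 hs'))
    have hdn : lpN (fun x => ∑ k ∈ K, d k x) s' = ofReal (Hn ^ (1 / s')) := by
      simp only [hdH]
      exact lpN_ofReal_rpow hH0 hs' (hHint q hq0)
    have hgM' : ∀ x, ‖g' () x‖ ≤ M ^ (p / s) := fun x => (hga () x).trans
      (Real.rpow_le_rpow (norm_nonneg _) (hgM x) (div_pos hp0 hs).le)
    have h1 := HH (g' ()) d (hg' ()) ((hgint _ (div_pos hp0 hs)).mono'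
      (hg' ()).aestronglyMeasurable (ae_of_all _ (hga ()))) ⟨_, hgM'⟩ hdm
      (by rw [hdn]; exact ofReal_ne_top)
    have h2 : lpN (fun x => ‖g' () x‖ₑ) s ≤ ofReal (Gn ^ (1 / s)) := by
      rw [hGn, ← lpN_ofReal_rpow (fun x => norm_nonneg (g x)) hs (hgint p hp0)]
      refine lpN_mono hs fun x => ?_
      rw [← ofReal_norm]
      exact ofReal_le_ofReal (hga () x)
    have h3 : ofReal ‖∑ k ∈ K, ∫ x, k' k x * kop μ (m k) (Y k) (g' ()) x‖
        ≤ ∑ k ∈ K, ∫⁻ x, (ofReal (v k ^ (p / s)) * d k x) *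
          ‖kop μ (m k) (Y k) (g' ()) x‖ₑ := by
      rw [ofReal_norm]
      refine (enorm_sum_le _ _).trans (sum_le_sum fun k _ => ?_)
      refine (enorm_integral_le_lintegral_enorm _).trans (lintegral_mono fun x => ?_)
      rw [enorm_mul]
      refine mul_le_mul' ?_ le_rfl
      rw [hd, ← ofReal_mul (rpow_nonneg (hv k) _), ← ofReal_norm]
      exact ofReal_le_ofReal (hkc k x)
    have h4 := h3.trans h1
    rw [hdn] at h4
    have h5 := h4.trans (mul_le_mul' (mul_le_mul' le_rfl h2) le_rfl)
    rw [← ofReal_mul hN, ← ofReal_mul (by positivity)] at h5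
    exact (ofReal_le_ofReal_iff (by positivity)).1 h5
  have hkm : ∀ k, Measurable (kop μ (m k) (Y k) g) := fun k => measurable_kop (hm k) (hY k) hg
  set u : κ → ℝ² → ℂ := fun k x => ((v k * h' k x : ℝ) : ℂ) *
    ((starRingEnd ℂ) (kop μ (m k) (Y k) g x) / (‖kop μ (m k) (Y k) g x‖ : ℂ)) with hu
  have hum : ∀ k, Measurable (u k) := fun k => by
    have h1 := hkm k
    have h2 := hh'm k
    have h3 : Measurable fun x => (starRingEnd ℂ) (kop μ (m k) (Y k) g x) :=
      (continuous_conj.measurable).comp h1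
    simp only [hu]
    fun_prop
  have hexp : 1 - (1 - θ) = θ := by ring
  have hconj : 1 / q = (1 - θ) / q₀ + θ / q₁ := by
    have e := hpq.inv_add_inv_eq_one
    have e0 := hpq₀.inv_add_inv_eq_one
    have e1 := hpq₁.inv_add_inv_eq_one
    rw [one_div, div_eq_mul_inv, div_eq_mul_inv] at hθ ⊢
    linear_combination e - (1 - θ) * e0 - θ * e1 - hθ
  have hp₀ := hpq₀.pos
  have hp₁ := hpq₁.pos
  have hq₀ := hpq₀.symm.pos
  have hq₁ := hpq₁.symm.pos
  have hθ' : 0 ≤ 1 - θ := by linarith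
  have hcomb : ∀ {x a b r : ℝ}, 0 ≤ x → r ≠ 0 → a * (1 - θ) + b * θ = r →
      (x ^ a) ^ (1 - θ) * (x ^ b) ^ θ = x ^ r := by
    intro x a b r hx hr he
    rw [← rpow_mul hx, ← rpow_mul hx, ← he, rpow_add' hx (by rwa [he])]
  have hpe : p / p₀ * (1 - θ) + p / p₁ * θ = 1 := by
    have : p * (1 / p) = 1 := by field_simp
    rw [hθ] at this; linear_combination this
  have hqe : q / q₀ * (1 - θ) + q / q₁ * θ = 1 := by
    have : q * (1 / q) = 1 := by field_simp
    rw [hconj] at this; linear_combination this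
  have main := norm_sum_integral_kop_le μ K (fun _ => ()) hm hmi hY
    (a₀ := fun _ x => ‖g x‖ ^ (p / p₀)) (a₁ := fun _ x => ‖g x‖ ^ (p / p₁))
    (c₀ := c p₀ q₀) (c₁ := c p₁ q₁) (fun _ => by fun_prop) (fun _ => by fun_prop)
    (hcm _ _) (hcm _ _) (fun _ x => rpow_nonneg (norm_nonneg _) _)
    (fun _ x => rpow_nonneg (norm_nonneg _) _) (hc0 _ _) (hc0 _ _)
    (M := max (M ^ (p / p₀)) (M ^ (p / p₁)))
    (fun _ x => (Real.rpow_le_rpow (norm_nonneg _) (hgM x) (div_pos hp0 hp₀).le).trans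
      (le_max_left _ _))
    (fun _ x => (Real.rpow_le_rpow (norm_nonneg _) (hgM x) (div_pos hp0 hp₁).le).trans
      (le_max_right _ _))
    (hci _ _ hq₀) (hci _ _ hq₁) hθ0 hθ1 (key p₀ q₀ N₀ hpq₀ hN₀ H₀) (key p₁ q₁ N₁ hpq₁ hN₁ H₁)
    (g := fun _ => g) (h := u) (fun _ => hg) hum
    (fun _ x => by
      rw [hcomb (norm_nonneg _) one_ne_zero hpe, rpow_one])
    (fun k x => by
      have e1 : ‖u k x‖ ≤ v k * h' k x := by
        have h0 := mul_nonneg (hv k) (hh'0 k x)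
        simp only [hu]
        rw [norm_mul, norm_real, norm_of_nonneg h0, norm_div, RCLike.norm_conj,
          norm_real, norm_norm]
        exact mul_le_of_le_one_right h0 (div_self_le_one _)
      refine e1.trans (le_of_eq ?_)
      have r := fun s => rpow_nonneg (hv k) s
      have r' := fun s => rpow_nonneg (hH0 x) s
      simp only [hc]
      rw [mul_rpow (r _) (mul_nonneg (hh'0 k x) (r' _)), mul_rpow (hh'0 k x) (r' _),
        mul_rpow (r _) (mul_nonneg (hh'0 k x) (r' _)), mul_rpow (hh'0 k x) (r' _)]
      have e2 := hcomb (hv k) one_ne_zero hpe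
      rw [rpow_one] at e2
      have e3 : h' k x ^ (1 - θ) * h' k x ^ θ = h' k x := by
        rw [← rpow_add' (hh'0 k x) (by norm_num)]; norm_num
      rcases (hh'0 k x).eq_or_lt with h0 | h0
      · rw [← h0, zero_rpow hθ0.ne']
        ring
      · have hHx : 0 < H x := h0.trans_le (hh'H k x)
        have e4 : (H x ^ (q / q₀ - 1)) ^ (1 - θ) * (H x ^ (q / q₁ - 1)) ^ θ = 1 := by
          rw [← rpow_mul hHx.le, ← rpow_mul hHx.le, ← rpow_add hHx,
            show (q / q₀ - 1) * (1 - θ) + (q / q₁ - 1) * θ = 0 by linarith, rpow_zero]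
        calc v k * h' k x = ((v k ^ (p / p₀)) ^ (1 - θ) * (v k ^ (p / p₁)) ^ θ) *
              (h' k x ^ (1 - θ) * h' k x ^ θ) *
              ((H x ^ (q / q₀ - 1)) ^ (1 - θ) * (H x ^ (q / q₁ - 1)) ^ θ) := by
              rw [e2, e3, e4, mul_one]
          _ = _ := by ring)
  have hkM : ∀ k x, ‖kop μ (m k) (Y k) g x‖ ≤ (∫ ω, ‖m k ω‖ ∂μ) * M := fun k x =>
    norm_kop_le (hmi k) hgM x
  have huk : ∀ k x, u k x * kop μ (m k) (Y k) g x
      = ((v k * h' k x * ‖kop μ (m k) (Y k) g x‖ : ℝ) : ℂ) := fun k x => by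
    simp only [hu]
    rcases eq_or_ne (kop μ (m k) (Y k) g x) 0 with h0 | h0
    · rw [h0]; simp
    · have : (‖kop μ (m k) (Y k) g x‖ : ℂ) ≠ 0 := by
        exact_mod_cast norm_ne_zero_iff.2 h0
      rw [mul_assoc, div_mul_eq_mul_div, mul_comm ((starRingEnd ℂ) _), Complex.mul_conj']
      push_cast
      field_simp
  have hint : ∀ k, Integrable fun x => v k * h' k x * ‖kop μ (m k) (Y k) g x‖ := fun k => by
    have h1 := hkm k
    have h2 := hh'm k
    have h3 := hHint 1 one_pos
    simp only [rpow_one] at h3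
    refine (h3.const_mul (v k * ((∫ ω, ‖m k ω‖ ∂μ) * M))).mono' (by fun_prop)
      (ae_of_all _ fun x => ?_)
    have h0 := mul_nonneg (hv k) (hh'0 k x)
    rw [norm_of_nonneg (mul_nonneg h0 (norm_nonneg _))]
    calc v k * h' k x * ‖kop μ (m k) (Y k) g x‖
        ≤ v k * H x * ((∫ ω, ‖m k ω‖ ∂μ) * M) :=
          mul_le_mul (mul_le_mul_of_nonneg_left (hh'H k x) (hv k)) (hkM k x) (norm_nonneg _)
            (mul_nonneg (hv k) (hH0 x))
      _ = _ := by ring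
  have hL : ∑ k ∈ K, ∫⁻ x, ofReal (v k * h k x) * ‖kop μ (m k) (Y k) g x‖ₑ
      = ofReal ‖∑ k ∈ K, ∫ x, u k x * kop μ (m k) (Y k) g x‖ := by
    simp only [huk]
    have hnn : ∀ k x, 0 ≤ v k * h' k x * ‖kop μ (m k) (Y k) g x‖ := fun k x =>
      mul_nonneg (mul_nonneg (hv k) (hh'0 k x)) (norm_nonneg _)
    have e : ∑ k ∈ K, ∫ x, ((v k * h' k x * ‖kop μ (m k) (Y k) g x‖ : ℝ) : ℂ)
        = ((∑ k ∈ K, ∫ x, v k * h' k x * ‖kop μ (m k) (Y k) g x‖ : ℝ) : ℂ) := by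
      rw [ofReal_sum]
      exact sum_congr rfl fun k _ => integral_ofReal
    rw [e, norm_real, norm_of_nonneg
      (sum_nonneg fun k _ => integral_nonneg (hnn k)),
      ofReal_sum_of_nonneg fun k _ => integral_nonneg (hnn k)]
    refine sum_congr rfl fun k hk => ?_
    rw [ofReal_integral_eq_lintegral_ofReal (hint k) (ae_of_all _ (hnn k))]
    refine lintegral_congr fun x => ?_
    rw [ofReal_mul (mul_nonneg (hv k) (hh'0 k x)), hh'e k hk x, ofReal_norm]
  rw [hL]
  refine (ofReal_le_ofReal main).trans (le_of_eq ?_)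
  have e1 : lpN (fun x => ‖g x‖ₑ) p = ofReal (Gn ^ (1 / p)) := by
    rw [hGn, ← lpN_ofReal_rpow (fun x => norm_nonneg (g x)) hp0 (hgint p hp0)]
    simp only [div_self hp0.ne', rpow_one, ofReal_norm]
  have e2 : lpN (fun x => ∑ k ∈ K, ofReal (h k x)) q = ofReal (Hn ^ (1 / q)) := by
    rw [hHn, ← lpN_ofReal_rpow hH0 hq0 (hHint q hq0)]
    simp only [div_self hq0.ne', rpow_one]
    congr 1
    ext x
    rw [← ofReal_sum_of_nonneg fun k _ => hh0 k x]
  rw [e1, e2, ← ofReal_mul (by positivity), ← ofReal_mul (by positivity)]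
  congr 1
  have f1 := hcomb hGn0 (one_div_ne_zero hp0.ne')
    (show 1 / p₀ * (1 - θ) + 1 / p₁ * θ = 1 / p by rw [hθ]; ring)
  have f2 := hcomb hHn0 (one_div_ne_zero hq0.ne')
    (show 1 / q₀ * (1 - θ) + 1 / q₁ * θ = 1 / q by rw [hconj]; ring)
  rw [mul_rpow (by positivity) (by positivity), mul_rpow hN₀ (by positivity),
    mul_rpow (by positivity) (by positivity), mul_rpow hN₁ (by positivity), ← f1, ← f2]
  ring

lemma subAvg_lapAlong_le_mul {e : ℝ²} {s a a' S : ℝ} (ha : 0 < a) (haa' : a ≤ a')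
    (hs : |s| ≤ S * a) {f : ℝ² → ℝ≥0∞} (hf : Measurable f) (x : ℝ²) :
    subAvg (lapAlong e s a) f x ≤
      ofReal (exp S * (a' / a)) * subAvg (lapAlong e 0 a') f x := by
  rw [subAvg_lapAlong _ _ _ hf, subAvg_lapAlong _ _ _ hf,
    ofReal_mul (exp_pos _).le, mul_assoc]
  simp only [zero_add]
  refine (lintegral_lap_comp_add_le ha (f := fun y => f (x - y • e)) (by fun_prop) s).trans
    (mul_le_mul' (ofReal_le_ofReal (exp_le_exp.2 ?_))
      (lintegral_lap_le_mul ha haa' (by fun_prop)))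
  rw [one_div, inv_mul_le_iff₀ ha]
  linarith

lemma subAvg_mono {μ : Measure (ℝ²)} {f g : ℝ² → ℝ≥0∞} (h : ∀ x, f x ≤ g x) (x : ℝ²) :
    subAvg μ f x ≤ subAvg μ g x := lintegral_mono fun _ => h _

lemma subAvg_const_mul {μ : Measure (ℝ²)} {f : ℝ² → ℝ≥0∞} (hf : Measurable f) (c : ℝ≥0∞)
    (x : ℝ²) : subAvg μ (fun y => c * f y) x = c * subAvg μ f x := by
  simp only [subAvg]
  exact lintegral_const_mul _ (by fun_prop)

lemma lintegral_Icc_le_lap {g : ℝ → ℝ≥0∞} (hg : Measurable g) :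
    ∫⁻ t in Icc (1 / 2 : ℝ) 2, g ((1:ℝ) * t ^ (1:ℝ)) ≤
      ofReal (2 * exp 2) * ∫⁻ s, g s ∂lap 1 := by
  rw [lintegral_lap 1 hg, ← lintegral_const_mul _ (by
    have := measurable_lapDensity 1
    fun_prop), ← lintegral_indicator measurableSet_Icc]
  refine lintegral_mono fun t => ?_
  by_cases ht : t ∈ Icc (1 / 2 : ℝ) 2
  · rw [indicator_of_mem ht, ← mul_assoc, ← ofReal_mul (by positivity), one_mul,
      rpow_one]
    refine le_mul_of_one_le_left' (ENNReal.one_le_ofReal.2 ?_)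
    rw [abs_of_nonneg (by linarith [ht.1]), show 2 * exp 2 * (exp (-t / 1) / (2 * 1))
      = exp 2 * exp (-t / 1) by ring, ← exp_add]
    exact Real.one_le_exp (by linarith [ht.2])
  · rw [indicator_of_notMem ht]
    exact bot_le

/-- If one of the relative widths is at least one, then averages along the smoothed curve are
dominated by product averages. -/
lemma exists_subAvg_curveLap_le {b c ϑ : ℝ} (hb : 1 < b) (hc : c ≠ 0) (hϑ : 1 ≤ ϑ) :
    ∃ C : ℝ, 0 < C ∧ ∀ α β η₁ η₂ B₁ B₂ : ℝ, 0 < α → 0 < β → 0 < η₁ → 0 < η₂ →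
      (1 ≤ η₁ ∨ 1 ≤ η₂) → B₁ = 2 * α * max η₁ 1 → 2 * β * max η₂ 1 ≤ B₂ →
      B₂ ≤ 2 * ϑ * β * max η₂ 1 → ∀ f : ℝ² → ℝ≥0∞, Measurable f → ∀ x,
      subAvg (curveLap b c α β η₁ η₂) f x ≤ ofReal C *
        subAvg (lapAlong (0, 1) 0 B₂) (subAvg (lapAlong (1, 0) 0 B₁) f) x := by
  obtain ⟨C, hC0, hC⟩ := exists_lintegral_monomial_le hb hc
  set S : ℝ := |c| * 2 ^ b with hS
  have hS0 : 0 ≤ S := by positivity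
  set P : ℝ := exp 2 * 2 with hP
  set Q : ℝ := exp S * (2 * ϑ) with hQ
  have hP0 : 0 < P := by positivity
  have hQ0 : 0 < Q := by positivity
  refine ⟨C * (4 * ϑ) * P + Q * (2 * exp 2 * (4 * 1)) + 3 / 2 * (P * Q), by positivity, ?_⟩
  intro α β η₁ η₂ B₁ B₂ hα hβ hη₁ hη₂ hor hB₁ hB₂ hB₂' f hf x
  rw [subAvg_curveLap _ _ _ _ _ _ hf]
  set f₁ := subAvg (lapAlong (1, 0) 0 B₁) f with hf₁
  have hf₁m : Measurable f₁ := measurable_subAvg _ hf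
  have hmax : 0 < max η₂ 1 := by positivity
  have hone : 1 ≤ η₁ → ∀ t ∈ Icc (1 / 2 : ℝ) 2, ∀ y,
      subAvg (lapAlong (1, 0) (α * t) (α * η₁)) f y ≤ ofReal P * f₁ y := by
    intro h t ht y
    have hB : B₁ = 2 * (α * η₁) := by rw [hB₁, max_eq_left h]; ring
    have hαη : 0 < α * η₁ := mul_pos hα hη₁
    refine (subAvg_lapAlong_le_mul (S := 2) hαη (a' := B₁) (by rw [hB]; linarith) ?_ hf y).trans
      (le_of_eq ?_)
    · rw [abs_of_nonneg (mul_nonneg hα.le (by linarith [ht.1]))]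
      nlinarith [mul_le_mul_of_nonneg_left ht.2 hα.le, mul_le_mul_of_nonneg_left h hα.le]
    · rw [hB, mul_div_assoc, div_self hαη.ne', mul_one, hf₁, hB]
  have htwo : 1 ≤ η₂ → ∀ t ∈ Icc (1 / 2 : ℝ) 2, ∀ F : ℝ² → ℝ≥0∞, Measurable F → ∀ y,
      subAvg (lapAlong (0, 1) (β * (c * t ^ b)) (β * η₂)) F y ≤
        ofReal Q * subAvg (lapAlong (0, 1) 0 B₂) F y := by
    intro h t ht F hF y
    rw [max_eq_left h] at hB₂ hB₂'
    have hβη : 0 < β * η₂ := mul_pos hβ hη₂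
    refine (subAvg_lapAlong_le_mul (S := S) hβη (a' := B₂) (by nlinarith) ?_ hF y).trans
      (mul_le_mul' (ofReal_le_ofReal ?_) le_rfl)
    · have ht0 : 0 ≤ t := by linarith [ht.1]
      rw [abs_mul, abs_of_pos hβ, abs_mul, abs_of_nonneg (rpow_nonneg ht0 _)]
      have h1 : |c| * t ^ b ≤ S :=
        mul_le_mul_of_nonneg_left (Real.rpow_le_rpow ht0 ht.2 (by linarith)) (abs_nonneg _)
      calc β * (|c| * t ^ b) ≤ β * S := mul_le_mul_of_nonneg_left h1 hβ.le
        _ ≤ S * (β * η₂) := by nlinarith [mul_nonneg hβ.le hS0]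
    · refine mul_le_mul_of_nonneg_left ?_ (exp_pos _).le
      rw [div_le_iff₀ hβη]
      linarith
  have hle : ∀ {u w : ℝ}, 0 ≤ w → u ≤ C * (4 * ϑ) * P + Q * (2 * exp 2 * (4 * 1)) +
      3 / 2 * (P * Q) → ∀ Z : ℝ≥0∞, ofReal u * Z ≤ ofReal
        (C * (4 * ϑ) * P + Q * (2 * exp 2 * (4 * 1)) + 3 / 2 * (P * Q)) * Z :=
    fun _ hu Z => mul_le_mul' (ofReal_le_ofReal hu) le_rfl
  have hT1 : 0 ≤ C * (4 * ϑ) * P := by positivity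
  have hT2 : 0 ≤ Q * (2 * exp 2 * (4 * 1)) := by positivity
  have hT3 : 0 ≤ 3 / 2 * (P * Q) := by positivity
  rcases le_or_gt 1 η₁ with h1 | h1
  · rcases le_or_gt 1 η₂ with h2 | h2
    · refine le_trans ?_ (hle (u := 3 / 2 * (P * Q)) le_rfl (by linarith) _)
      calc _ ≤ ∫⁻ t in Icc (1 / 2 : ℝ) 2, ofReal (P * Q) *
            subAvg (lapAlong (0, 1) 0 B₂) f₁ x := by
            refine setLIntegral_mono' measurableSet_Icc fun t ht => ?_
            refine (htwo h2 t ht _ (measurable_subAvg _ hf) x).trans ?_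
            rw [mul_comm P, ofReal_mul hQ0.le, mul_assoc, ← subAvg_const_mul hf₁m]
            exact mul_le_mul' le_rfl (subAvg_mono (hone h1 t ht) x)
        _ = _ := by
            rw [setLIntegral_const, volume_Icc, mul_comm, ← mul_assoc,
              ← ofReal_mul (by norm_num)]
            norm_num
    · refine le_trans ?_ (hle (u := C * (4 * ϑ) * P) le_rfl (by linarith) _)
      rw [max_eq_right h2.le, mul_one] at hB₂ hB₂'
      calc _ ≤ ∫⁻ t in Icc (1 / 2 : ℝ) 2, subAvg (lapAlong (0, 1) (β * (c * t ^ b)) (β * η₂))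
              (fun y => ofReal P * f₁ y) x :=
            setLIntegral_mono' measurableSet_Icc fun t ht => subAvg_mono (hone h1 t ht) x
        _ ≤ ofReal C * (4 * ofReal (B₂ / (2 * β))) *
              subAvg (lapAlong (0, 1) 0 B₂) (fun y => ofReal P * f₁ y) x :=
            lintegral_subAvg_curve_le hC hβ hη₂ h2.le hB₂ _ (hf₁m.const_mul _) x
        _ = ofReal (C * (4 * (B₂ / (2 * β))) * P) * subAvg (lapAlong (0, 1) 0 B₂) f₁ x := by
            have : 0 ≤ B₂ / (2 * β) := div_nonneg (by linarith) (by linarith)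
            rw [subAvg_const_mul hf₁m, ofReal_mul (q := P) (by positivity),
              ofReal_mul hC0.le, ofReal_mul (by norm_num : (0:ℝ) ≤ 4)]
            simp only [ofReal_ofNat, mul_assoc]
        _ ≤ _ := by
            refine mul_le_mul' (ofReal_le_ofReal ?_) le_rfl
            have : B₂ / (2 * β) ≤ ϑ := by rw [div_le_iff₀ (by linarith)]; linarith
            gcongr
  · have h2 : 1 ≤ η₂ := hor.resolve_left (not_le.2 h1)
    refine le_trans ?_ (hle (u := Q * (2 * exp 2 * (4 * 1))) le_rfl (by linarith) _)
    rw [max_eq_right h1.le, mul_one] at hB₁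
    calc _ ≤ ∫⁻ t in Icc (1 / 2 : ℝ) 2, ofReal Q * subAvg (lapAlong (0, 1) 0 B₂)
            (subAvg (lapAlong (1, 0) (α * t) (α * η₁)) f) x :=
          setLIntegral_mono' measurableSet_Icc fun t ht =>
            htwo h2 t ht _ (measurable_subAvg _ hf) x
      _ = ofReal Q * ∫⁻ t in Icc (1 / 2 : ℝ) 2, subAvg (lapAlong (0, 1) 0 B₂)
            (subAvg (lapAlong (1, 0) (α * t) (α * η₁)) f) x :=
          lintegral_const_mul' _ _ ofReal_ne_top
      _ = ofReal Q * subAvg (lapAlong (0, 1) 0 B₂) (fun y =>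
            ∫⁻ t in Icc (1 / 2 : ℝ) 2, subAvg (lapAlong (1, 0) (α * t) (α * η₁)) f y) x := by
          congr 1
          have e : ∀ t, subAvg (lapAlong (1, 0) (α * t) (α * η₁)) f = fun y =>
              ∫⁻ z, f (y - (α * t + z) • ((1, 0) : ℝ²)) ∂lap (α * η₁) := fun t =>
            funext fun y => subAvg_lapAlong _ _ _ hf y
          simp only [e]
          simp only [subAvg]
          rw [lintegral_lintegral_swap]
          fun_prop
      _ ≤ ofReal Q * subAvg (lapAlong (0, 1) 0 B₂) (fun y =>
            ofReal (2 * exp 2) * (4 * ofReal (B₁ / (2 * α))) * f₁ y) x := by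
          refine mul_le_mul' le_rfl (subAvg_mono (fun y => ?_) x)
          have := lintegral_subAvg_curve_le (b := 1) (c := 1) (fun g hg => lintegral_Icc_le_lap hg)
            hα hη₁ h1.le hB₁.ge (1, 0) hf y
          simpa only [one_mul, rpow_one] using this
      _ = _ := by
          rw [subAvg_const_mul hf₁m, hB₁, div_self (by positivity),
            ofReal_mul (p := Q) hQ0.le,
            ofReal_mul (p := 2 * exp 2) (by positivity), ofReal_mul (by norm_num : (0:ℝ) ≤ 4)]
          simp only [ofReal_ofNat, mul_assoc]

/-- Scales `β` comparable to a geometric sequence, together with weights `v` bounded in `ℓ^p`. -/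
structure WeightedScales (ϑ p A W : ℝ) (I : Finset ℕ) (β v : ℕ × ℕ × ℕ → ℝ) : Prop where
  le_scale : ∀ j m, ∀ i ∈ I, A / ϑ ^ m ≤ β (j, m, i)
  scale_le : ∀ j m, ∀ i ∈ I, β (j, m, i) ≤ ϑ * (A / ϑ ^ m)
  nonneg : ∀ k, 0 ≤ v k
  sum_le : ∀ j m, ∑ i ∈ I, v (j, m, i) ^ p ≤ W ^ p

/-- The index set of a finite family of curves. -/
def scaleBox (N₁ N₂ : ℕ) (I : Finset ℕ) : Finset (ℕ × ℕ × ℕ) :=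
  Finset.range N₁ ×ˢ Finset.range N₂ ×ˢ I

lemma sum_scaleBox {M : Type*} [AddCommMonoid M] (N₁ N₂ : ℕ) (I : Finset ℕ)
    (f : ℕ × ℕ × ℕ → M) : ∑ k ∈ scaleBox N₁ N₂ I, f k =
      ∑ j ∈ Finset.range N₁, ∑ m ∈ Finset.range N₂, ∑ i ∈ I, f (j, m, i) := by
  rw [scaleBox, sum_product]
  exact sum_congr rfl fun j _ => sum_product _ _ _

lemma mem_scaleBox {N₁ N₂ : ℕ} {I : Finset ℕ} {k : ℕ × ℕ × ℕ} (hk : k ∈ scaleBox N₁ N₂ I) :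
    k.2.2 ∈ I := by
  simp only [scaleBox, mem_product] at hk
  exact hk.2.2

namespace WeightedScales

variable {ϑ p A W : ℝ} {I : Finset ℕ} {β v : ℕ × ℕ × ℕ → ℝ}

lemma scale_pos (H : WeightedScales ϑ p A W I β v) (hϑ : 0 < ϑ) (hA : 0 < A) {k : ℕ × ℕ × ℕ}
    (hk : k.2.2 ∈ I) : 0 < β k :=
  lt_of_lt_of_le (by positivity) (H.le_scale k.1 k.2.1 k.2.2 hk)

lemma weight_le (H : WeightedScales ϑ p A W I β v) (hp : 0 < p) (hW : 0 ≤ W) {k : ℕ × ℕ × ℕ}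
    (hk : k.2.2 ∈ I) : v k ≤ W :=
  (Real.rpow_le_rpow_iff (H.nonneg k) hW hp).1 <|
    (single_le_sum (f := fun i => v (k.1, k.2.1, i) ^ p)
      (fun i _ => rpow_nonneg (H.nonneg _) _) hk).trans (H.sum_le k.1 k.2.1)

lemma rpow (H : WeightedScales ϑ p A W I β v) (hW : 0 ≤ W) {r : ℝ} (hr : 0 < r) :
    WeightedScales ϑ r A (W ^ (p / r)) I β (fun k => v k ^ (p / r)) where
  le_scale := H.le_scale
  scale_le := H.scale_le
  nonneg k := rpow_nonneg (H.nonneg k) _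
  sum_le j m := by
    rw [← rpow_mul hW, div_mul_cancel₀ _ hr.ne']
    simp only [← rpow_mul (H.nonneg _), div_mul_cancel₀ _ hr.ne']
    exact H.sum_le j m

end WeightedScales

lemma exists_sum_subAvg_curveLap_le_of_one_le {b c ϑ : ℝ} (hb : 1 < b) (hc : c ≠ 0)
    (hϑ : 2 ≤ ϑ) : ∃ C : ℝ, 0 < C ∧ ∀ (p q A₁ A₂ W η₁ η₂ : ℝ) (N₁ N₂ : ℕ) (I : Finset ℕ)
      (β v : ℕ × ℕ × ℕ → ℝ), 2 ≤ q → p.HolderConjugate q → 0 < A₁ → 0 < A₂ → 0 ≤ W →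
      WeightedScales ϑ p A₂ W I β v → 0 < η₁ → 0 < η₂ → (1 ≤ η₁ ∨ 1 ≤ η₂) →
      ∀ (G : ℝ² → ℝ≥0∞) (h : ℕ × ℕ × ℕ → ℝ² → ℝ≥0∞), Measurable G →
      (∀ k, Measurable (h k)) →
      ∑ k ∈ scaleBox N₁ N₂ I, ∫⁻ x, (ofReal (v k) * h k x) *
          subAvg (curveLap b c (A₁ / 2 ^ k.1) (β k) η₁ η₂) G x ≤
        ofReal (C * q ^ 4 * W) * lpN G p *
          lpN (fun x => ∑ k ∈ scaleBox N₁ N₂ I, h k x) q := by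
  obtain ⟨C, hC0, hC⟩ := exists_subAvg_curveLap_le hb hc (by linarith : 1 ≤ ϑ)
  refine ⟨C * 2500, by positivity, ?_⟩
  intro p q A₁ A₂ W η₁ η₂ N₁ N₂ I β v hq hpq hA₁ hA₂ hW H hη₁ hη₂ hor G h hG hh
  have hϑ0 : 0 < ϑ := by linarith
  set B₁ : ℝ := 2 * A₁ * max η₁ 1 with hB₁
  set B₂ : ℝ := 2 * ϑ * A₂ * max η₂ 1 with hB₂
  have hm1 : 0 < max η₁ 1 := by positivity
  have hm2 : 0 < max η₂ 1 := by positivity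
  have hB₁0 : 0 < B₁ := by positivity
  have hB₂0 : 0 < B₂ := by positivity
  set T : ℕ → ℕ → (ℝ² → ℝ≥0∞) → ℝ² → ℝ≥0∞ := fun j m f =>
    addAvg (lapAlong (1, 0) 0 (B₁ / 2 ^ j)) (addAvg (lapAlong (0, 1) 0 (B₂ / ϑ ^ m)) f) with hT
  have hTm : ∀ j m f, Measurable f → Measurable (T j m f) := fun j m f hf =>
    measurable_addAvg _ (measurable_addAvg _ hf)
  have h1 : ∀ k ∈ scaleBox N₁ N₂ I, ∫⁻ x, (ofReal (v k) * h k x) *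
      subAvg (curveLap b c (A₁ / 2 ^ k.1) (β k) η₁ η₂) G x ≤
      ofReal (W * C) * ∫⁻ x, T k.1 k.2.1 (h k) x * G x := by
    intro k hk
    have hkI := mem_scaleBox hk
    have hβ := H.scale_pos hϑ0 hA₂ hkI
    have hle := H.le_scale k.1 k.2.1 k.2.2 hkI
    have hge := H.scale_le k.1 k.2.1 k.2.2 hkI
    have hv := H.weight_le hpq.pos hW hkI
    rw [hT, ← lintegral_mul_subAvg _ hG (measurable_addAvg _ (hh k)),
      ← lintegral_mul_subAvg _ (measurable_subAvg _ hG) (hh k),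
      ← lintegral_const_mul' _ _ ofReal_ne_top]
    refine lintegral_mono fun x => ?_
    have h3 := hC (A₁ / 2 ^ k.1) (β k) η₁ η₂ (B₁ / 2 ^ k.1) (B₂ / ϑ ^ k.2.1) (by positivity) hβ
      hη₁ hη₂ hor (by rw [hB₁]; ring)
      (by
        calc 2 * β k * max η₂ 1 ≤ 2 * (ϑ * (A₂ / ϑ ^ k.2.1)) * max η₂ 1 := by gcongr
          _ = _ := by rw [hB₂]; ring)
      (by
        calc B₂ / ϑ ^ k.2.1 = 2 * ϑ * (A₂ / ϑ ^ k.2.1) * max η₂ 1 := by rw [hB₂]; ring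
          _ ≤ _ := by gcongr) G hG x
    calc _ ≤ (ofReal W * h k x) * _ :=
          mul_le_mul' (mul_le_mul' (ofReal_le_ofReal hv) le_rfl) h3
      _ = _ := by rw [ofReal_mul hW]; ring
  have h2 := lpN_sum_lapAlong_lapAlong_le hq hpq.symm (le_refl 2) hϑ hB₁0 hB₂0 N₁ N₂
    (h := fun j m x => ∑ i ∈ I, h (j, m, i) x)
    (fun j m => Finset.measurable_fun_sum _ fun i _ => hh _)
  have e1 : ∀ x, ∑ k ∈ scaleBox N₁ N₂ I, T k.1 k.2.1 (h k) x = ∑ j ∈ Finset.range N₁,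
      ∑ m ∈ Finset.range N₂, T j m (fun x => ∑ i ∈ I, h (j, m, i) x) x := by
    intro x
    rw [sum_scaleBox]
    refine sum_congr rfl fun j _ => sum_congr rfl fun m _ => ?_
    simp only [hT]
    rw [funext fun y => addAvg_finsetSum (lapAlong (0, 1) 0 (B₂ / ϑ ^ m)) I
      (f := fun i => h (j, m, i)) (fun i _ => hh _) y,
      addAvg_finsetSum _ I (fun i _ => measurable_addAvg _ (hh _)) x]
  have hmm : ∀ k, Measurable fun x => T k.1 k.2.1 (h k) x * G x := fun k =>
    (hTm _ _ _ (hh k)).mul hG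
  calc _ ≤ ∑ k ∈ scaleBox N₁ N₂ I, ofReal (W * C) * ∫⁻ x, T k.1 k.2.1 (h k) x * G x :=
        sum_le_sum h1
    _ = ofReal (W * C) * ∫⁻ x, (∑ k ∈ scaleBox N₁ N₂ I, T k.1 k.2.1 (h k) x) * G x := by
        rw [← mul_sum, ← lintegral_finsetSum _ fun k _ => hmm k]
        simp only [sum_mul]
    _ ≤ ofReal (W * C) * ((ofReal (2500 * q ^ 4) *
          lpN (fun x => ∑ k ∈ scaleBox N₁ N₂ I, h k x) q) * lpN G p) := by
        refine mul_le_mul' le_rfl ((lintegral_mul_le_lpN hpq.symm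
          (Finset.measurable_fun_sum _ fun k _ => hTm _ _ _ (hh k)) hG).trans
          (mul_le_mul' ?_ le_rfl))
        simp only [e1, sum_scaleBox]
        exact h2
    _ = _ := by
        rw [show C * 2500 * q ^ 4 * W = W * C * (2500 * q ^ 4) by ring,
          ofReal_mul (p := W * C) (by positivity)]
        ring

lemma exists_sum_subAvg_curveLap_le {b c ϑ : ℝ} (hb : 1 < b) (hc : c ≠ 0)
    (hϑ : 2 ≤ ϑ) : ∃ C : ℝ, 0 < C ∧ ∀ (p q A₁ A₂ W η₁ η₂ : ℝ) (N₁ N₂ M : ℕ) (I : Finset ℕ)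
      (β v : ℕ × ℕ × ℕ → ℝ), 2 ≤ q → p.HolderConjugate q → 0 < A₁ → 0 < A₂ → 0 ≤ W →
      WeightedScales ϑ p A₂ W I β v → (1 / 2) ^ M ≤ η₁ → η₁ ≤ 1 → (1 / 2) ^ M ≤ η₂ → η₂ ≤ 1 →
      ∀ (G : ℝ² → ℝ≥0∞) (h : ℕ × ℕ × ℕ → ℝ² → ℝ≥0∞), Measurable G →
      (∀ k, Measurable (h k)) → lpN (fun x => ∑ k ∈ scaleBox N₁ N₂ I, h k x) q ≠ ⊤ →
      ∑ k ∈ scaleBox N₁ N₂ I, ∫⁻ x, (ofReal (v k) * h k x) *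
          subAvg (curveLap b c (A₁ / 2 ^ k.1) (β k) η₁ η₂) G x ≤
        ofReal (C * (M + q) ^ 2 * q ^ 2 * W) * lpN G p *
          lpN (fun x => ∑ k ∈ scaleBox N₁ N₂ I, h k x) q := by
  obtain ⟨C, hC0, hC⟩ := exists_lintegral_monomial_le hb hc
  obtain ⟨c₀, hc₀⟩ := pow_unbounded_of_one_lt (max 12 (4 * (|c| * 2 ^ b + 1)))
    (by norm_num : (1:ℝ) < 2)
  refine ⟨(5000 * C * ϑ + 200) * (c₀ + 2) ^ 2, by positivity, ?_⟩
  intro p q A₁ A₂ W η₁ η₂ N₁ N₂ M I β v hq hpq hA₁ hA₂ hW H hη₁ hη₁1 hη₂ hη₂1 G h hG hh hfin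
  have hϑ0 : 0 < ϑ := by linarith
  have hM : (0:ℝ) < (1 / 2) ^ M := by positivity
  set n := ⌈q⌉₊ with hn
  have hqn : q ≤ n := le_ceil q
  have hnq : (n:ℝ) ≤ q + 1 := (Nat.ceil_lt_add_one (by linarith)).le
  have hq2 : q ≤ 2 ^ n := hqn.trans (by exact_mod_cast (Nat.lt_two_pow_self).le)
  have hD : ∀ η a : ℝ, (1 / 2) ^ M ≤ η → 0 ≤ a → a ≤ 2 ^ c₀ → a * q ≤ η * 2 ^ (M + n + c₀) := by
    intro η a hη ha ha'
    calc a * q ≤ 2 ^ c₀ * 2 ^ n := by gcongr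
      _ = (1 / 2) ^ M * 2 ^ (M + n + c₀) := by
          rw [pow_add, pow_add, one_div, inv_pow]; field_simp
      _ ≤ _ := by gcongr
  have h2 := lpN_sum_curveLap_le hb hC0 hC hq hpq.symm hϑ hA₁ hA₂ (hM.trans_le hη₁) hη₁1
    (hM.trans_le hη₂) hη₂1 I N₁ N₂ (M + n + c₀)
    (by push_cast; linarith [(cast_nonneg M : (0:ℝ) ≤ M), (cast_nonneg c₀ : (0:ℝ) ≤ c₀)])
    (hD η₁ 12 hη₁ (by norm_num) ((le_max_left _ _).trans hc₀.le))
    (by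
      have := hD η₂ (4 * (|c| * 2 ^ b + 1)) hη₂ (by positivity) ((le_max_right _ _).trans hc₀.le)
      linarith)
    (β := fun j m i => β (j, m, i)) (fun j m i hi => ⟨H.le_scale j m i hi, H.scale_le j m i hi⟩)
    (v := fun j m i => ofReal (v (j, m, i))) (W := ofReal W) ofReal_ne_top
    (fun j m => by
      simp only [ofReal_rpow_of_nonneg (H.nonneg _) hpq.pos.le]
      rw [ofReal_rpow_of_nonneg hW hpq.pos.le, ← ofReal_sum_of_nonneg
        fun i _ => rpow_nonneg (H.nonneg _) _]
      exact ofReal_le_ofReal (H.sum_le j m))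
    (h := fun j m i => h (j, m, i)) (fun j m i => hh _) (by simpa only [sum_scaleBox] using hfin)
  have e1 : ∀ k, ∫⁻ x, (ofReal (v k) * h k x) *
      subAvg (curveLap b c (A₁ / 2 ^ k.1) (β k) η₁ η₂) G x = ∫⁻ x, (ofReal (v k) *
        addAvg (curveLap b c (A₁ / 2 ^ k.1) (β k) η₁ η₂) (h k) x) * G x := by
    intro k
    simp only [mul_assoc]
    rw [lintegral_const_mul' _ _ ofReal_ne_top,
      lintegral_const_mul' _ _ ofReal_ne_top, lintegral_mul_subAvg _ hG (hh k)]
  have hm : ∀ k, Measurable fun x => ofReal (v k) *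
      addAvg (curveLap b c (A₁ / 2 ^ k.1) (β k) η₁ η₂) (h k) x := fun k =>
    (measurable_addAvg _ (hh k)).const_mul _
  have hmm : ∀ k, Measurable fun x => (ofReal (v k) *
      addAvg (curveLap b c (A₁ / 2 ^ k.1) (β k) η₁ η₂) (h k) x) * G x := fun k => (hm k).mul hG
  calc _ = ∫⁻ x, (∑ k ∈ scaleBox N₁ N₂ I, ofReal (v k) *
        addAvg (curveLap b c (A₁ / 2 ^ k.1) (β k) η₁ η₂) (h k) x) * G x := by
        simp only [e1]
        rw [← lintegral_finsetSum _ fun k _ => hmm k]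
        simp only [sum_mul]
    _ ≤ (ofReal ((5000 * C * ϑ + 200) * ((M + n + c₀ : ℕ) : ℝ) ^ 2 * q ^ 2) *
          ofReal W * lpN (fun x => ∑ k ∈ scaleBox N₁ N₂ I, h k x) q) * lpN G p := by
        refine (lintegral_mul_le_lpN hpq.symm
          (Finset.measurable_fun_sum _ fun k _ => hm k) hG).trans (mul_le_mul' ?_ le_rfl)
        simp only [sum_scaleBox]
        exact h2
    _ = ofReal ((5000 * C * ϑ + 200) * ((M + n + c₀ : ℕ) : ℝ) ^ 2 * q ^ 2 * W) *
          lpN G p * lpN (fun x => ∑ k ∈ scaleBox N₁ N₂ I, h k x) q := by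
        rw [← ofReal_mul (by positivity)]
        ring
    _ ≤ _ := by
        refine mul_le_mul' (mul_le_mul' (ofReal_le_ofReal ?_) le_rfl) le_rfl
        have h3 : ((M + n + c₀ : ℕ) : ℝ) ≤ (c₀ + 2) * (M + q) := by
          push_cast
          have : (0:ℝ) ≤ M := cast_nonneg M
          have : (0:ℝ) ≤ c₀ := cast_nonneg c₀
          nlinarith
        calc _ ≤ (5000 * C * ϑ + 200) * ((c₀ + 2) * (M + q)) ^ 2 * q ^ 2 * W := by gcongr
          _ = _ := by ring

/-- The density of the two-sided exponential distribution at scale `a`. -/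
def lapPdf (a y : ℝ) : ℝ := exp (-|y| / a) / (2 * a)

lemma lapPdf_nonneg {a : ℝ} (ha : 0 < a) (y : ℝ) : 0 ≤ lapPdf a y := by
  unfold lapPdf; positivity

lemma measurable_lapPdf (a : ℝ) : Measurable (lapPdf a) := by
  unfold lapPdf; fun_prop

lemma lintegral_lap_eq (a : ℝ) {f : ℝ → ℝ≥0∞} (hf : Measurable f) :
    ∫⁻ y, f y ∂lap a = ∫⁻ y, ofReal (lapPdf a y) * f y :=
  lintegral_lap a hf

lemma integral_exp_mul_lapPdf {a : ℝ} (ha : 0 < a) (s : ℝ) :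
    Integrable (fun y : ℝ => Complex.exp (((s * y : ℝ) : ℂ) * Complex.I) * (lapPdf a y : ℂ)) ∧
    ∫ y : ℝ, Complex.exp (((s * y : ℝ) : ℂ) * Complex.I) * (lapPdf a y : ℂ) =
      ((1 / (1 + (a * s) ^ 2) : ℝ) : ℂ) := by
  have h := integrable_integral_exp_abs ha s
  simp only [mul_comm ((_ : ℝ) : ℂ) (Complex.exp _)] at h
  exact h

lemma integrable_lapPdf {a : ℝ} (ha : 0 < a) : Integrable (lapPdf a) := by
  have h := (integral_exp_mul_lapPdf ha 0).1
  simp only [zero_mul, ofReal_zero, exp_zero, one_mul] at h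
  exact h.re

lemma lintegral_lap_mul {α a : ℝ} (hα : 0 < α) (ha : 0 < a) {f : ℝ → ℝ≥0∞} (hf : Measurable f) :
    ∫⁻ y, f (α * y) ∂lap a = ∫⁻ y, f y ∂lap (α * a) := by
  rw [← lintegral_lap_scale ha (f := fun y => f (α * y)) (by fun_prop),
    ← lintegral_lap_scale (mul_pos hα ha) hf]
  simp only [mul_assoc]

/-- The parameter measure for the regularised curves. -/
def curveBase : Measure (ℝ × ℝ × ℝ) :=
  (volume.restrict (Icc (1 / 2 : ℝ) 2)).prod (volume.prod volume)

instance : SFinite curveBase := by unfold curveBase; infer_instance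

/-- The regularised curve with parameters `α`, `β`. -/
def curveShift (b c α β : ℝ) (ω : ℝ × ℝ × ℝ) : ℝ² :=
  (α * (ω.1 + ω.2.1), β * (c * ω.1 ^ b + ω.2.2))

lemma measurable_curveShift (b c α β : ℝ) : Measurable (curveShift b c α β) := by
  unfold curveShift; fun_prop

lemma kop_add {Ω : Type*} [MeasurableSpace Ω] {μ : Measure Ω} {m m' : Ω → ℂ} {Y : Ω → ℝ²}
    (hY : Measurable Y) {g : ℝ² → ℂ} (hg : Measurable g) {M : ℝ} (hM : ∀ x, ‖g x‖ ≤ M)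
    (hmi : Integrable m μ) (hmi' : Integrable m' μ) (x : ℝ²) :
    kop μ (fun ω => m ω + m' ω) Y g x = kop μ m Y g x + kop μ m' Y g x := by
  have hgm : AEStronglyMeasurable (fun ω => g (x - Y ω)) μ :=
    Measurable.aestronglyMeasurable (by fun_prop)
  have h1 := hmi.mul_bdd (c := M) hgm (ae_of_all _ fun ω => hM _)
  have h2 := hmi'.mul_bdd (c := M) hgm (ae_of_all _ fun ω => hM _)
  simp only [kop, add_mul]
  exact integral_add h1 h2

/-- The product weight of two exponential densities. -/
def lapPair (a c : ℝ) (ω : ℝ × ℝ × ℝ) : ℂ := ((lapPdf a ω.2.1 * lapPdf c ω.2.2 : ℝ) : ℂ)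

lemma measurable_lapPair (a c : ℝ) : Measurable (lapPair a c) := by
  have := measurable_lapPdf a
  have := measurable_lapPdf c
  unfold lapPair
  fun_prop

lemma integrable_lapPair {a c : ℝ} (ha : 0 < a) (hc : 0 < c) :
    Integrable (lapPair a c) curveBase := by
  have h := (integrable_const (μ := volume.restrict (Icc (1 / 2 : ℝ) 2)) (1:ℝ)).mul_prod
    ((integrable_lapPdf ha).mul_prod (integrable_lapPdf hc))
  simp only [one_mul] at h
  exact h.ofReal

lemma lintegral_lapPair {b c α β a a' : ℝ} (hα : 0 < α) (hβ : 0 < β) (ha : 0 < a) (ha' : 0 < a')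
    {f : ℝ² → ℝ≥0∞} (hf : Measurable f) (x : ℝ²) :
    ∫⁻ ω, ‖lapPair a a' ω‖ₑ * f (x - curveShift b c α β ω) ∂curveBase =
      subAvg (curveLap b c α β a a') f x := by
  have hm := measurable_lapPair a a'
  have hY := measurable_curveShift b c α β
  have h1 := measurable_lapPdf a
  have h2 := measurable_lapPdf a'
  have he : ∀ ω, ‖lapPair a a' ω‖ₑ =
      ofReal (lapPdf a ω.2.1) * ofReal (lapPdf a' ω.2.2) := fun ω => by
    rw [← ofReal_mul (lapPdf_nonneg ha _), ← ofReal_norm, lapPair,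
      norm_real, norm_of_nonneg (mul_nonneg (lapPdf_nonneg ha _) (lapPdf_nonneg ha' _))]
  rw [subAvg, lintegral_curveLap _ _ _ _ _ _ (by fun_prop), curveBase,
    lintegral_prod _ (by fun_prop)]
  refine lintegral_congr fun t => ?_
  rw [lintegral_prod _ (by fun_prop), ← lintegral_lap_mul hα ha
    (f := fun y₁ => ∫⁻ y₂, f (x - (α * t + y₁, β * (c * t ^ b) + y₂)) ∂lap (β * a'))
    (by have := sFinite_lap (β * a'); fun_prop),
    lintegral_lap_eq a (by have := sFinite_lap (β * a'); fun_prop)]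
  refine lintegral_congr fun y₁ => ?_
  rw [← lintegral_lap_mul hβ ha'
    (f := fun y₂ => f (x - (α * t + α * y₁, β * (c * t ^ b) + y₂))) (by fun_prop),
    lintegral_lap_eq a' (by fun_prop), ← lintegral_const_mul _ (by fun_prop)]
  refine lintegral_congr fun y₂ => ?_
  simp only [he, curveShift, mul_add, mul_assoc]

lemma subAvg_curveLap_eq_enorm_kop {b c α β a a' : ℝ} (hα : 0 < α) (hβ : 0 < β) (ha : 0 < a)
    (ha' : 0 < a') {g : ℝ² → ℝ} (hg : Measurable g) (hg0 : ∀ x, 0 ≤ g x) {M : ℝ}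
    (hM : ∀ x, g x ≤ M) (x : ℝ²) :
    subAvg (curveLap b c α β a a') (fun y => ofReal (g y)) x =
      ‖kop curveBase (lapPair a a') (curveShift b c α β) (fun y => (g y : ℂ)) x‖ₑ := by
  have hY := measurable_curveShift b c α β
  have h0 : ∀ ω : ℝ × ℝ × ℝ, 0 ≤ lapPdf a ω.2.1 * lapPdf a' ω.2.2 := fun ω =>
    mul_nonneg (lapPdf_nonneg ha _) (lapPdf_nonneg ha' _)
  have hi : Integrable (fun ω : ℝ × ℝ × ℝ => lapPdf a ω.2.1 * lapPdf a' ω.2.2) curveBase := by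
    exact (integrable_lapPair ha ha').re
  have hi2 := hi.mul_bdd (c := M) (g := fun ω => g (x - curveShift b c α β ω))
    (Measurable.aestronglyMeasurable (by fun_prop))
    (ae_of_all _ fun ω => by rw [norm_of_nonneg (hg0 _)]; exact hM _)
  rw [← lintegral_lapPair hα hβ ha ha' (f := fun y => ofReal (g y)) (by fun_prop) x]
  have hk : ∀ ω, ‖lapPair a a' ω‖ₑ = ofReal (lapPdf a ω.2.1 * lapPdf a' ω.2.2) := fun ω => by
    rw [lapPair, ← ofReal_norm, norm_real, norm_of_nonneg (h0 ω)]
  simp only [kop, hk]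
  simp only [lapPair, ← Complex.ofReal_mul]
  rw [integral_complex_ofReal, ← ofReal_norm, norm_real, norm_of_nonneg
    (integral_nonneg fun ω => mul_nonneg (h0 ω) (hg0 _)),
    ofReal_integral_eq_lintegral_ofReal hi2 (ae_of_all _ fun ω => mul_nonneg (h0 ω) (hg0 _))]
  refine lintegral_congr fun ω => ?_
  rw [ofReal_mul (h0 ω)]

/-- The product weight of two differences of exponential densities. -/
def lapDiff (a' a c' c : ℝ) (ω : ℝ × ℝ × ℝ) : ℂ :=
  (((lapPdf a' ω.2.1 - lapPdf a ω.2.1) * (lapPdf c' ω.2.2 - lapPdf c ω.2.2) : ℝ) : ℂ)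

lemma lapDiff_eq (a' a c' c : ℝ) : lapDiff a' a c' c = fun ω =>
    lapPair a' c' ω - lapPair a' c ω - lapPair a c' ω + lapPair a c ω := by
  ext ω
  simp only [lapDiff, lapPair]
  push_cast
  ring

lemma measurable_lapDiff (a' a c' c : ℝ) : Measurable (lapDiff a' a c' c) := by
  rw [lapDiff_eq]
  exact (((measurable_lapPair _ _).sub (measurable_lapPair _ _)).sub (measurable_lapPair _ _)).add
    (measurable_lapPair _ _)

lemma integrable_lapDiff {a' a c' c : ℝ} (ha' : 0 < a') (ha : 0 < a) (hc' : 0 < c') (hc : 0 < c) :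
    Integrable (lapDiff a' a c' c) curveBase := by
  rw [lapDiff_eq]
  exact (((integrable_lapPair ha' hc').sub (integrable_lapPair ha' hc)).sub
    (integrable_lapPair ha hc')).add (integrable_lapPair ha hc)

lemma enorm_kop_lapDiff_le {b κ α β a' a c' c : ℝ} (hα : 0 < α) (hβ : 0 < β) (ha' : 0 < a')
    (ha : 0 < a) (hc' : 0 < c') (hc : 0 < c) {g : ℝ² → ℂ} (hg : Measurable g) (x : ℝ²) :
    ‖kop curveBase (lapDiff a' a c' c) (curveShift b κ α β) g x‖ₑ ≤
      subAvg (curveLap b κ α β a' c') (fun y => ‖g y‖ₑ) x +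
      subAvg (curveLap b κ α β a' c) (fun y => ‖g y‖ₑ) x +
      subAvg (curveLap b κ α β a c') (fun y => ‖g y‖ₑ) x +
      subAvg (curveLap b κ α β a c) (fun y => ‖g y‖ₑ) x := by
  have hY := measurable_curveShift b κ α β
  have hm := measurable_lapPair
  refine (enorm_kop_le x).trans ?_
  rw [← lintegral_lapPair hα hβ ha' hc' hg.enorm, ← lintegral_lapPair hα hβ ha' hc hg.enorm,
    ← lintegral_lapPair hα hβ ha hc' hg.enorm, ← lintegral_lapPair hα hβ ha hc hg.enorm,
    ← lintegral_add_left (by have := hm a' c'; fun_prop),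
    ← lintegral_add_left (by have := hm a' c'; have := hm a' c; fun_prop),
    ← lintegral_add_left (by have := hm a' c'; have := hm a' c; have := hm a c'; fun_prop)]
  refine lintegral_mono fun ω => ?_
  simp only [← add_mul]
  refine mul_le_mul' ?_ le_rfl
  rw [lapDiff_eq]
  exact (enorm_add_le _ _).trans (add_le_add ((enorm_sub_le).trans
    (add_le_add enorm_sub_le le_rfl)) le_rfl)

lemma kopSymbol_lapDiff {b κ α β a' a c' c : ℝ} (ha' : 0 < a')
    (ha : 0 < a) (hc' : 0 < c') (hc : 0 < c) (ξ : ℝ²) :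
    kopSymbol curveBase (lapDiff a' a c' c) (curveShift b κ α β) ξ =
      (∫ t in (1 / 2 : ℝ)..2, Complex.exp (((-(2 * Real.pi * α * ξ.1) * t +
        -(κ * (2 * Real.pi * β * ξ.2)) * t ^ b : ℝ) : ℂ) * Complex.I) * ((1 : ℝ) : ℂ)) *
      (((1 / (1 + (a' * (2 * Real.pi * α * ξ.1)) ^ 2) - 1 / (1 + (a * (2 * Real.pi * α * ξ.1)) ^ 2)) *
       (1 / (1 + (c' * (2 * Real.pi * β * ξ.2)) ^ 2) - 1 / (1 + (c * (2 * Real.pi * β * ξ.2)) ^ 2)) : ℝ) : ℂ) := by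
  have hd : ∀ (a' a s : ℝ), 0 < a' → 0 < a →
      ∫ y : ℝ, Complex.exp (((-s * y : ℝ) : ℂ) * Complex.I) * ((lapPdf a' y - lapPdf a y : ℝ) : ℂ)
        = ((1 / (1 + (a' * s) ^ 2) - 1 / (1 + (a * s) ^ 2) : ℝ) : ℂ) := by
    intro a' a s ha' ha
    have h1 := integral_exp_mul_lapPdf ha' (-s)
    have h2 := integral_exp_mul_lapPdf ha (-s)
    rw [show (a' * s) ^ 2 = (a' * -s) ^ 2 by ring, show (a * s) ^ 2 = (a * -s) ^ 2 by ring,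
      ofReal_sub, ← h1.2, ← h2.2, ← integral_sub h1.1 h2.1]
    simp only [ofReal_sub, mul_sub]
  rw [intervalIntegral.integral_of_le (by norm_num), ← integral_Icc_eq_integral_Ioc,
    Complex.ofReal_mul, ← hd a' a _ ha' ha, ← hd c' c _ hc' hc, ← integral_prod_mul,
    ← integral_prod_mul, kopSymbol, curveBase]
  refine integral_congr_ae (ae_of_all _ fun ω => ?_)
  simp only [lapDiff, curveShift]
  rw [Complex.ofReal_mul, Complex.ofReal_one, mul_one,
    mul_mul_mul_comm (Complex.exp (((-(2 * Real.pi * α * ξ.1) * ω.2.1 : ℝ) : ℂ) * Complex.I)),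
    ← Complex.exp_add, ← mul_assoc (Complex.exp _) (Complex.exp _), ← Complex.exp_add]
  congr 2
  push_cast
  ring

/-- A bump in logarithmic scale. -/
def logBump (u : ℝ) : ℝ := min (√u) (1 / √u)

lemma logBump_nonneg (u : ℝ) : 0 ≤ logBump u := le_min (by positivity) (by positivity)

lemma sum_sqrt_div_pow_le {ϑ : ℝ} (hϑ : 2 ≤ ϑ) (N : ℕ) :
    ∀ u : ℝ, 0 ≤ u → ∑ j ∈ Finset.range N, √(u / ϑ ^ j) ≤ 4 * √u := by
  induction N with
  | zero => intro u _; simp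
  | succ N ih =>
    intro u hu
    rw [Finset.sum_range_succ']
    have h1 := ih (u / ϑ) (by positivity)
    have h2 : √(u / ϑ) ≤ 3 / 4 * √u := by
      rw [show (3 / 4 : ℝ) * √u = √((3 / 4) ^ 2 * u) by
        rw [sqrt_mul (by norm_num), Real.sqrt_sq (by norm_num)]]
      refine Real.sqrt_le_sqrt ?_
      rw [div_le_iff₀ (by linarith)]
      nlinarith
    simp only [pow_succ', ← div_div, pow_zero, div_one] at h1 ⊢
    linarith

lemma sum_logBump_le {ϑ : ℝ} (hϑ : 2 ≤ ϑ) (N : ℕ) {u : ℝ} (hu : 0 ≤ u) :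
    ∑ j ∈ Finset.range N, logBump (u / ϑ ^ j) ≤ 10 := by
  have small : ∀ N : ℕ, ∀ u : ℝ, 0 ≤ u → ∑ j ∈ Finset.range N, logBump (u / ϑ ^ j) ≤ 4 * √u :=
    fun N u hu => (sum_le_sum fun j _ => min_le_left _ _).trans (sum_sqrt_div_pow_le hϑ N u hu)
  have large : ∀ N : ℕ, ∀ u : ℝ, 1 ≤ u →
      ∑ j ∈ Finset.range N, logBump (u / ϑ ^ j) ≤ 10 - 4 * (1 / √u) := by
    intro N
    induction N with
    | zero =>
      intro u hu
      have : 1 / √u ≤ 1 := by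
        rw [div_le_one (by positivity)]; exact one_le_sqrt.2 hu
      simp only [Finset.range_zero, Finset.sum_empty]
      linarith
    | succ N ih =>
      intro u hu
      have h1u : 1 / √u ≤ 1 := by
        rw [div_le_one (by positivity)]; exact one_le_sqrt.2 hu
      have h0u : 0 < 1 / √u := by positivity
      have h2 : logBump u ≤ 1 / √u := min_le_right _ _
      have h3 : ∑ j ∈ Finset.range N, logBump (u / ϑ / ϑ ^ j) ≤ 10 - 5 * (1 / √u) := by
        rcases le_total 1 (u / ϑ) with h | h
        · refine (ih (u / ϑ) h).trans ?_
          have h5 : 5 / 4 * (1 / √u) ≤ 1 / √(u / ϑ) := by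
            rw [Real.sqrt_div (by linarith), one_div_div, ← mul_div_assoc, mul_one]
            refine div_le_div_of_nonneg_right ?_ (by positivity)
            exact Real.le_sqrt_of_sq_le (by linarith)
          linarith
        · refine (small N (u / ϑ) (by positivity)).trans ?_
          have : √(u / ϑ) ≤ 1 := Real.sqrt_le_one.2 h
          linarith
      rw [Finset.sum_range_succ']
      simp only [pow_succ', ← div_div, pow_zero, div_one]
      linarith
  rcases le_total u 1 with h | h
  · have : √u ≤ 1 := Real.sqrt_le_one.2 h
    linarith [small N u hu]
  · have : 0 < 1 / √u := by positivity
    linarith [large N u h]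

lemma logBump_mul_le {s u : ℝ} (hs : 1 ≤ s) (hu : 0 ≤ u) : logBump (s * u) ≤ √s * logBump u := by
  have h1 : 1 ≤ √s := one_le_sqrt.2 hs
  rw [logBump, logBump, mul_min_of_nonneg _ _ (by positivity), sqrt_mul (by linarith)]
  refine min_le_min le_rfl ?_
  rcases hu.eq_or_lt with rfl | hu
  · simp
  · calc 1 / (√s * √u) ≤ 1 / √u := by
          refine one_div_le_one_div_of_le (by positivity) ?_
          exact le_mul_of_one_le_left (by positivity) h1
      _ ≤ _ := le_mul_of_one_le_left (by positivity) h1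

lemma resolvent_diff_sq_le {a' a x : ℝ} (ha' : 0 ≤ a') (haa : a' ≤ a) (ha : 0 < a) :
    (1 / (1 + (a' * x) ^ 2) - 1 / (1 + (a * x) ^ 2)) ^ 2 / √|x| ≤ √a * logBump (a * |x|) := by
  rcases eq_or_ne x 0 with rfl | hx
  · simp [logBump]
  have hx0 : 0 < |x| := abs_pos.2 hx
  set u := a * |x| with hu
  have hu0 : 0 < u := by positivity
  set d := 1 / (1 + (a' * x) ^ 2) - 1 / (1 + (a * x) ^ 2) with hd
  have hsq : (a' * x) ^ 2 ≤ (a * x) ^ 2 := by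
    rw [mul_pow, mul_pow]; gcongr
  have hau : (a * x) ^ 2 = u ^ 2 := by rw [hu, mul_pow, mul_pow, sq_abs]
  have hd0 : 0 ≤ d := sub_nonneg.2 (one_div_le_one_div_of_le (by positivity) (by linarith))
  have h1 : 1 / (1 + (a' * x) ^ 2) ≤ 1 := by
    rw [div_le_one (by positivity)]; linarith [sq_nonneg (a' * x)]
  have hd1 : d ≤ 1 := by
    have : 0 ≤ 1 / (1 + (a * x) ^ 2) := by positivity
    linarith
  have hd2 : d ≤ u ^ 2 := by
    have : 1 - u ^ 2 ≤ 1 / (1 + (a * x) ^ 2) := by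
      rw [hau, le_div_iff₀ (by positivity)]; nlinarith [sq_nonneg (u ^ 2)]
    linarith
  have hs : √|x| = √u / √a := by
    rw [hu, sqrt_mul ha.le]; field_simp
  have hsu : 0 < √u := Real.sqrt_pos.2 hu0
  rw [hs, div_div_eq_mul_div, mul_comm, mul_div_assoc]
  refine mul_le_mul_of_nonneg_left (le_min ?_ ?_) (by positivity)
  · rw [div_le_iff₀ hsu, Real.mul_self_sqrt hu0.le]
    rcases le_total u 1 with h | h
    · calc d ^ 2 ≤ d := by nlinarith
        _ ≤ u ^ 2 := hd2
        _ ≤ u := by nlinarith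
    · calc d ^ 2 ≤ 1 := by nlinarith
        _ ≤ u := h
  · exact div_le_div_of_nonneg_right (by nlinarith) hsu.le

lemma exists_norm_kopSymbol_lapDiff_sq_le {b κ : ℝ} (hb : 1 < b) (hκ : κ ≠ 0) :
    ∃ C : ℝ, 0 < C ∧ ∀ α β a' a c' c : ℝ, 0 < α → 0 < β → 0 < a' → a' ≤ a → 0 < c' → c' ≤ c →
      ∀ ξ : ℝ², ‖kopSymbol curveBase (lapDiff a' a c' c) (curveShift b κ α β) ξ‖ ^ 2 ≤
        C * √(a * c) * (logBump (a * (2 * Real.pi * α * |ξ.1|)) *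
          logBump (c * (2 * Real.pi * β * |ξ.2|))) := by
  obtain ⟨C, hC0, hC⟩ := exists_norm_curve_oscillatory_le hb
  have hκ0 : 0 < |κ| := abs_pos.2 hκ
  refine ⟨C ^ 2 / √|κ|, by positivity, ?_⟩
  intro α β a' a c' c hα hβ ha' haa hc' hcc ξ
  have ha := ha'.trans_le haa
  have hc := hc'.trans_le hcc
  rw [kopSymbol_lapDiff ha' ha hc' hc]
  set x₁ := 2 * Real.pi * α * ξ.1 with hx₁
  set x₂ := 2 * Real.pi * β * ξ.2 with hx₂
  have e1 : 2 * Real.pi * α * |ξ.1| = |x₁| := by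
    rw [hx₁, abs_mul, abs_of_pos (show 0 < 2 * Real.pi * α by positivity)]
  have e2 : 2 * Real.pi * β * |ξ.2| = |x₂| := by
    rw [hx₂, abs_mul, abs_of_pos (show 0 < 2 * Real.pi * β by positivity)]
  rw [e1, e2]
  have hd1 := resolvent_diff_sq_le (x := x₁) ha'.le haa ha
  have hd2 := resolvent_diff_sq_le (x := x₂) hc'.le hcc hc
  set d₁ := 1 / (1 + (a' * x₁) ^ 2) - 1 / (1 + (a * x₁) ^ 2) with hd₁
  set d₂ := 1 / (1 + (c' * x₂) ^ 2) - 1 / (1 + (c * x₂) ^ 2) with hd₂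
  have hrhs : 0 ≤ C ^ 2 / √|κ| * √(a * c) * (logBump (a * |x₁|) * logBump (c * |x₂|)) :=
    mul_nonneg (by positivity) (mul_nonneg (logBump_nonneg _) (logBump_nonneg _))
  rcases eq_or_ne x₁ 0 with h0 | h0
  · rw [show d₁ = 0 by rw [hd₁, h0]; simp]; simpa using hrhs
  rcases eq_or_ne x₂ 0 with h0' | h0'
  · rw [show d₂ = 0 by rw [hd₂, h0']; simp]; simpa using hrhs
  have h1 : 0 < |x₁| := abs_pos.2 h0
  have h2 : 0 < |x₂| := abs_pos.2 h0'
  have hP := hC (fun _ => 1) (fun _ => 0) 1 0 (fun t _ => hasDerivAt_const _ _) continuousOn_const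
    (fun t _ => by simp) (fun t _ => by simp) (-x₁) (-(κ * x₂))
    (by rw [abs_neg]; positivity)
  rw [add_zero, mul_one] at hP
  set P := ∫ t in (1 / 2 : ℝ)..2, Complex.exp (((-x₁ * t + -(κ * x₂) * t ^ b : ℝ) : ℂ) * Complex.I)
    * ((1 : ℝ) : ℂ) with hPdef
  have hP2 : ‖P‖ ^ 2 ≤ C ^ 2 / √|κ| / (√|x₁| * √|x₂|) := by
    have h3 : (|-x₁| + |-(κ * x₂)|) ^ (-(1 / 2) : ℝ) = 1 / √(|x₁| + |κ| * |x₂|) := by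
      rw [abs_neg, abs_neg, abs_mul κ x₂, rpow_neg (by positivity), ← sqrt_eq_rpow, one_div]
    rw [h3] at hP
    calc ‖P‖ ^ 2 ≤ (C * (1 / √(|x₁| + |κ| * |x₂|))) ^ 2 := by gcongr
      _ = C ^ 2 * (1 / (|x₁| + |κ| * |x₂|)) := by
          rw [mul_pow, div_pow, one_pow, sq_sqrt (by positivity)]
      _ ≤ C ^ 2 * (1 / (√|κ| * (√|x₁| * √|x₂|))) := by
          gcongr
          have i1 := sq_sqrt h1.le
          have i2 := sq_sqrt (show 0 ≤ |κ| * |x₂| by positivity)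
          rw [sqrt_mul hκ0.le] at i2
          nlinarith [sq_nonneg (√|x₁| - √|κ| * √|x₂|), sqrt_nonneg |x₁|, sqrt_nonneg |x₂|,
            sqrt_nonneg |κ|, mul_nonneg (sqrt_nonneg |κ|) (mul_nonneg (sqrt_nonneg |x₁|) (sqrt_nonneg |x₂|))]
      _ = _ := by field_simp
  rw [norm_mul, mul_pow, norm_real, norm_eq_abs, sq_abs, mul_pow]
  calc ‖P‖ ^ 2 * (d₁ ^ 2 * d₂ ^ 2) ≤ C ^ 2 / √|κ| / (√|x₁| * √|x₂|) * (d₁ ^ 2 * d₂ ^ 2) := by gcongr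
    _ = C ^ 2 / √|κ| * ((d₁ ^ 2 / √|x₁|) * (d₂ ^ 2 / √|x₂|)) := by field_simp
    _ ≤ C ^ 2 / √|κ| * ((√a * logBump (a * |x₁|)) * (√c * logBump (c * |x₂|))) := by
        refine mul_le_mul_of_nonneg_left (mul_le_mul hd1 hd2 (by positivity)
          (mul_nonneg (by positivity) (logBump_nonneg _))) (by positivity)
    _ = _ := by rw [sqrt_mul ha.le]; ring

lemma exists_sum_weight_kopSymbol_le {b κ ϑ : ℝ} (hb : 1 < b) (hκ : κ ≠ 0) (hϑ : 2 ≤ ϑ) :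
    ∃ C : ℝ, 0 < C ∧ ∀ (p A₁ A₂ W a' a c' c : ℝ) (N₁ N₂ : ℕ) (I : Finset ℕ)
      (β v : ℕ × ℕ × ℕ → ℝ), 0 ≤ W → 0 < A₁ → 0 < A₂ → WeightedScales ϑ p A₂ W I β v →
      0 < a' → a' ≤ a → 0 < c' → c' ≤ c → ∀ ξ : ℝ²,
      ∑ k ∈ scaleBox N₁ N₂ I, v k ^ p * ‖kopSymbol curveBase (lapDiff a' a c' c)
        (curveShift b κ (A₁ / 2 ^ k.1) (β k)) ξ‖ ^ 2 ≤ C * √(a * c) * W ^ p := by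
  obtain ⟨C, hC0, hC⟩ := exists_norm_kopSymbol_lapDiff_sq_le hb hκ
  have hϑ0 : 0 < ϑ := by linarith
  refine ⟨C * √ϑ * √ϑ * 100, by positivity, ?_⟩
  intro p A₁ A₂ W a' a c' c N₁ N₂ I β v hW hA₁ hA₂ H ha' haa hc' hcc ξ
  have ha := ha'.trans_le haa
  have hc := hc'.trans_le hcc
  set u₁ := a * (2 * Real.pi * A₁ * |ξ.1|) with hu₁
  set u₂ := c * (2 * Real.pi * A₂ * |ξ.2|) with hu₂
  have hu₁0 : 0 ≤ u₁ := by positivity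
  have hu₂0 : 0 ≤ u₂ := by positivity
  have hWp : 0 ≤ W ^ p := rpow_nonneg hW _
  have h1 : ∀ j m, ∀ i ∈ I, v (j, m, i) ^ p * ‖kopSymbol curveBase (lapDiff a' a c' c)
      (curveShift b κ (A₁ / 2 ^ j) (β (j, m, i))) ξ‖ ^ 2 ≤
      v (j, m, i) ^ p * (C * √(a * c) * √ϑ * (logBump (u₁ / 2 ^ j) * logBump (u₂ / ϑ ^ m))) := by
    intro j m i hi
    have hβ := H.scale_pos hϑ0 hA₂ (k := (j, m, i)) hi
    refine mul_le_mul_of_nonneg_left ((hC _ _ a' a c' c (by positivity) hβ ha' haa hc' hcc ξ).trans ?_)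
      (rpow_nonneg (H.nonneg _) _)
    have hs : 1 ≤ β (j, m, i) / (A₂ / ϑ ^ m) := by
      rw [one_le_div (by positivity)]; exact H.le_scale j m i hi
    have hs2 : β (j, m, i) / (A₂ / ϑ ^ m) ≤ ϑ := by
      rw [div_le_iff₀ (by positivity)]; exact H.scale_le j m i hi
    have h2 : logBump (c * (2 * Real.pi * β (j, m, i) * |ξ.2|)) ≤ √ϑ * logBump (u₂ / ϑ ^ m) := by
      have := logBump_mul_le (s := β (j, m, i) / (A₂ / ϑ ^ m)) (u := u₂ / ϑ ^ m) hs (by positivity)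
      rw [show β (j, m, i) / (A₂ / ϑ ^ m) * (u₂ / ϑ ^ m) = c * (2 * Real.pi * β (j, m, i) * |ξ.2|) by
        rw [hu₂]; field_simp] at this
      exact this.trans (mul_le_mul_of_nonneg_right (Real.sqrt_le_sqrt hs2) (logBump_nonneg _))
    rw [show a * (2 * Real.pi * (A₁ / 2 ^ j) * |ξ.1|) = u₁ / 2 ^ j by rw [hu₁]; ring]
    calc _ ≤ C * √(a * c) * (logBump (u₁ / 2 ^ j) * (√ϑ * logBump (u₂ / ϑ ^ m))) := by
          have := logBump_nonneg (u₁ / 2 ^ j)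
          gcongr
      _ = _ := by ring
  rw [sum_scaleBox]
  calc _ ≤ ∑ j ∈ Finset.range N₁, ∑ m ∈ Finset.range N₂, W ^ p *
        (C * √(a * c) * √ϑ * (logBump (u₁ / 2 ^ j) * logBump (u₂ / ϑ ^ m))) := by
        refine sum_le_sum fun j _ => sum_le_sum fun m _ => ?_
        refine (sum_le_sum (h1 j m)).trans ?_
        rw [← sum_mul]
        have := mul_nonneg (logBump_nonneg (u₁ / 2 ^ j)) (logBump_nonneg (u₂ / ϑ ^ m))
        exact mul_le_mul_of_nonneg_right (H.sum_le j m) (by positivity)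
    _ = W ^ p * (C * √(a * c) * √ϑ) * ((∑ j ∈ Finset.range N₁, logBump (u₁ / 2 ^ j)) *
        ∑ m ∈ Finset.range N₂, logBump (u₂ / ϑ ^ m)) := by
        rw [Finset.sum_mul_sum, mul_sum]
        refine sum_congr rfl fun j _ => ?_
        rw [mul_sum]
        refine sum_congr rfl fun m _ => ?_
        ring
    _ ≤ W ^ p * (C * √(a * c) * √ϑ) * (10 * 10) := by
        refine mul_le_mul_of_nonneg_left (mul_le_mul (sum_logBump_le le_rfl _ hu₁0)
          (sum_logBump_le hϑ _ hu₂0) (sum_nonneg fun _ _ => logBump_nonneg _)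
          (by norm_num)) (by positivity)
    _ ≤ _ := by
        have : 1 ≤ √ϑ := one_le_sqrt.2 (by linarith)
        have h3 : 0 ≤ W ^ p * (C * √(a * c) * √ϑ) * 100 := by positivity
        nlinarith

lemma lintegral_add_four {f₁ f₂ f₃ f₄ : ℝ² → ℝ≥0∞} (h₁ : Measurable f₁) (h₂ : Measurable f₂)
    (h₃ : Measurable f₃) : ∫⁻ x, (f₁ x + f₂ x + f₃ x + f₄ x) =
      (∫⁻ x, f₁ x) + (∫⁻ x, f₂ x) + (∫⁻ x, f₃ x) + ∫⁻ x, f₄ x := by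
  rw [lintegral_add_left (by fun_prop), lintegral_add_left (by fun_prop), lintegral_add_left h₁]

lemma interpolation_constant_le {C₀ C₁ M p q r r' θ W ac : ℝ} (hC₀ : 0 ≤ C₀) (hC₁0 : 0 ≤ C₁)
    (hM0 : 0 ≤ M) (hq0 : 0 < q) (hq1 : 1 ≤ q) (hr'0 : 0 ≤ r') (hr'q : r' ≤ 3 * q) (hac0 : 0 < ac)
    (hac1 : ac ≤ 1) (hp0 : 0 < p) (hr0 : 0 < r) (hθ0 : 0 < θ) (hθ1 : θ ≤ 1) (hθq : 1 / q ≤ θ)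
    (hθe : 1 / p = (1 - θ) / r + θ / 2) (hW : 0 ≤ W) :
    (4 * (C₀ * (M + r') ^ 2 * r' ^ 2 * W ^ (p / r))) ^ (1 - θ) * √(C₁ * √ac * W ^ p) ^ θ ≤
      (324 * C₀ + 1) * (C₁ + 1) * ((M + q) ^ 2 * q ^ 2 * ac ^ (1 / (4 * q))) * W := by
  have hWr : 0 ≤ W ^ (p / r) := rpow_nonneg hW _
  set N₀ := 4 * (C₀ * (M + r') ^ 2 * r' ^ 2 * W ^ (p / r)) with hN₀
  set N₁' := √(C₁ * √ac * W ^ p) with hN₁'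
  have hN₀0 : 0 ≤ N₀ := by positivity
  set X := (M + q) ^ 2 * q ^ 2 with hX
  have hX1 : 1 ≤ X := by
    have : 1 ≤ (M + q) ^ 2 := one_le_pow₀ (by linarith)
    have : 1 ≤ q ^ 2 := one_le_pow₀ (by linarith)
    nlinarith
  have e0 : N₀ ^ (1 - θ) ≤ ((324 * C₀ + 1) * X) * W ^ (p / r * (1 - θ)) := by
    have hle : N₀ ≤ ((324 * C₀ + 1) * X) * W ^ (p / r) := by
      rw [hN₀]
      calc _ = 4 * C₀ * ((M + r') ^ 2 * r' ^ 2) * W ^ (p / r) := by ring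
        _ ≤ 4 * C₀ * ((3 * (M + q)) ^ 2 * (3 * q) ^ 2) * W ^ (p / r) := by
            gcongr
            linarith
        _ = 324 * C₀ * X * W ^ (p / r) := by rw [hX]; ring
        _ ≤ _ := by gcongr; linarith
    calc N₀ ^ (1 - θ) ≤ (((324 * C₀ + 1) * X) * W ^ (p / r)) ^ (1 - θ) :=
          Real.rpow_le_rpow hN₀0 hle (by linarith)
      _ = ((324 * C₀ + 1) * X) ^ (1 - θ) * W ^ (p / r * (1 - θ)) := by
          rw [mul_rpow (by positivity) hWr, ← rpow_mul hW]
      _ ≤ _ := by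
          refine mul_le_mul_of_nonneg_right ?_ (rpow_nonneg hW _)
          refine (rpow_le_rpow_of_exponent_le ?_ (show 1 - θ ≤ 1 by linarith)).trans_eq
            (rpow_one _)
          nlinarith
  have e1 : N₁' ^ θ ≤ ((C₁ + 1) * ac ^ (1 / (4 * q))) * W ^ (p * (θ / 2)) := by
    rw [hN₁', sqrt_eq_rpow, sqrt_eq_rpow, ← rpow_mul
      (mul_nonneg (by positivity) (rpow_nonneg hW _)),
      mul_rpow (by positivity) (rpow_nonneg hW _), ← rpow_mul hW,
      mul_rpow hC₁0 (by positivity), ← rpow_mul hac0.le,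
      show p * (1 / 2 * θ) = p * (θ / 2) by ring]
    refine mul_le_mul_of_nonneg_right (mul_le_mul ?_ ?_ (by positivity) (by positivity))
      (rpow_nonneg hW _)
    · calc C₁ ^ (1 / 2 * θ) ≤ (C₁ + 1) ^ (1 / 2 * θ) :=
            Real.rpow_le_rpow hC₁0 (by linarith) (by positivity)
        _ ≤ (C₁ + 1) ^ (1:ℝ) :=
            rpow_le_rpow_of_exponent_le (by linarith) (by linarith)
        _ = _ := rpow_one _
    · refine Real.rpow_le_rpow_of_exponent_ge hac0 hac1 ?_
      rw [show 1 / (4 * q) = 1 / q / 4 by field_simp]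
      linarith
  calc N₀ ^ (1 - θ) * N₁' ^ θ ≤ (((324 * C₀ + 1) * X) * W ^ (p / r * (1 - θ))) *
        (((C₁ + 1) * ac ^ (1 / (4 * q))) * W ^ (p * (θ / 2))) :=
        mul_le_mul e0 e1 (rpow_nonneg (sqrt_nonneg _) _)
          (mul_nonneg (by positivity) (rpow_nonneg hW _))
    _ = ((324 * C₀ + 1) * (C₁ + 1) * (X * ac ^ (1 / (4 * q)))) *
        (W ^ (p / r * (1 - θ)) * W ^ (p * (θ / 2))) := by ring
    _ = _ := by
        rw [← Real.rpow_add_of_nonneg hW (mul_nonneg (by positivity) (by linarith)) (by positivity),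
          show p / r * (1 - θ) + p * (θ / 2) = p * ((1 - θ) / r + θ / 2) by ring, ← hθe,
          mul_one_div_cancel hp0.ne', rpow_one]

/-- Interpolation between a bound near `L^1` and an `L^2` bound with decay. -/
lemma exists_sum_kop_lapDiff_le {b κ ϑ : ℝ} (hb : 1 < b) (hκ : κ ≠ 0) (hϑ : 2 ≤ ϑ) :
    ∃ C : ℝ, 0 < C ∧ ∀ (p q A₁ A₂ W a' a c' c : ℝ) (N₁ N₂ M : ℕ) (I : Finset ℕ)
      (β v : ℕ × ℕ × ℕ → ℝ), 2 ≤ q → p.HolderConjugate q → 0 < A₁ → 0 < A₂ → 0 ≤ W →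
      WeightedScales ϑ p A₂ W I β v → (1 / 2) ^ M ≤ a' → a' ≤ a → a ≤ 1 →
      (1 / 2) ^ M ≤ c' → c' ≤ c → c ≤ 1 →
      ∀ (g : ℝ² → ℂ) (h : ℕ × ℕ × ℕ → ℝ² → ℝ) (B : Set (ℝ²)) (D : ℝ), Measurable g →
      (∀ k, Measurable (h k)) → MeasurableSet B → volume B ≠ ⊤ → (∀ x, ‖g x‖ ≤ D) →
      (∀ k x, 0 ≤ h k x) → (∀ k x, h k x ≤ D) → (∀ x, x ∉ B → g x = 0) →
      (∀ k x, x ∉ B → h k x = 0) →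
      ∑ k ∈ scaleBox N₁ N₂ I, ∫⁻ x, ofReal (v k * h k x) *
          ‖kop curveBase (lapDiff a' a c' c) (curveShift b κ (A₁ / 2 ^ k.1) (β k)) g x‖ₑ ≤
        ofReal (C * ((M + q) ^ 2 * q ^ 2 * (a * c) ^ (1 / (4 * q))) * W) *
          lpN (fun x => ‖g x‖ₑ) p *
          lpN (fun x => ∑ k ∈ scaleBox N₁ N₂ I, ofReal (h k x)) q := by
  obtain ⟨C₀, hC₀0, hC₀⟩ := exists_sum_subAvg_curveLap_le hb hκ hϑ
  obtain ⟨C₁, hC₁0, hC₁⟩ := exists_sum_weight_kopSymbol_le hb hκ hϑ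
  have hϑ0 : 0 < ϑ := by linarith
  refine ⟨(324 * C₀ + 1) * (C₁ + 1), by positivity, ?_⟩
  intro p q A₁ A₂ W a' a c' c N₁ N₂ M I β v hq hpq hA₁ hA₂ hW H hMa' haa ha1 hMc' hcc hc1
    g h B D hg hh hB hBf hgD hh0 hhD hgB hhB
  have hM : (0:ℝ) < (1 / 2) ^ M := by positivity
  have ha' := hM.trans_le hMa'
  have hc' := hM.trans_le hMc'
  have ha := ha'.trans_le haa
  have hc := hc'.trans_le hcc
  have hq0 : 0 < q := by linarith
  have hp1 : 1 < p := hpq.lt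
  have hpe : p = q / (q - 1) := hpq.symm.conjugate_eq
  have hp2 : p ≤ 2 := by rw [hpe, div_le_iff₀ (by linarith)]; linarith
  have hqe : q = p / (p - 1) := hpq.conjugate_eq
  set r := (1 + p) / 2 with hr
  set r' := (1 + p) / (p - 1) with hr'
  set θ := 2 * (p - 1) / (p * (3 - p)) with hθ
  have hp10 : 0 < p - 1 := by linarith
  have hr0 : 0 < r := by linarith
  have hrr' : r.HolderConjugate r' := by
    rw [Real.holderConjugate_iff]
    refine ⟨by linarith, ?_⟩
    rw [hr, hr']
    field_simp
    ring
  have h3p : 0 < 3 - p := by linarith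
  have hp0 : 0 < p := by linarith
  have hθ0 : 0 < θ := by positivity
  have hθ1 : θ ≤ 1 := by
    rw [hθ, div_le_one (by positivity)]; nlinarith
  have hθq : 1 / q ≤ θ := by
    rw [hqe, hθ, one_div_div, div_le_div_iff₀ (by positivity) (by positivity)]
    nlinarith [mul_pos hp10 hp0]
  have hθe : 1 / p = (1 - θ) / r + θ / 2 := by
    rw [hr, hθ]; field_simp; ring
  have hr'2 : 2 ≤ r' := by rw [hr', le_div_iff₀ hp10]; linarith
  have hr'q : r' ≤ 3 * q := by
    rw [hr', hqe, ← mul_div_assoc]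
    exact div_le_div_of_nonneg_right (by linarith) hp10.le
  set K := scaleBox N₁ N₂ I with hK
  have hβ : ∀ k ∈ K, 0 < β k := fun k hk => H.scale_pos hϑ0 hA₂ (mem_scaleBox hk)
  set N₀ := 4 * (C₀ * (M + r') ^ 2 * r' ^ 2 * W ^ (p / r)) with hN₀
  set N₁' := √(C₁ * √(a * c) * W ^ p) with hN₁'
  have hWr : 0 ≤ W ^ (p / r) := rpow_nonneg hW _
  have hN₀0 : 0 ≤ N₀ := by positivity
  have hmain := sum_lintegral_mul_kop_interp_le curveBase K
    (m := fun _ => lapDiff a' a c' c) (Y := fun k => curveShift b κ (A₁ / 2 ^ k.1) (β k))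
    (fun _ => measurable_lapDiff _ _ _ _) (fun _ => integrable_lapDiff ha' ha hc' hc)
    (fun _ => measurable_curveShift _ _ _ _) hpq hrr' Real.HolderConjugate.two_two hθ0 hθ1 hθe
    (v := v) H.nonneg (N₀ := N₀) (N₁ := N₁') hN₀0 (sqrt_nonneg _)
    (by
      intro g d hg hgi _ hd hfin
      have hH := H.rpow hW hr0
      set T : ℝ → ℝ → ℝ≥0∞ := fun a c => ∑ k ∈ K, ∫⁻ x, (ofReal (v k ^ (p / r)) * d k x) *
        subAvg (curveLap b κ (A₁ / 2 ^ k.1) (β k) a c) (fun y => ‖g y‖ₑ) x with hT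
      have hTle : ∀ a c : ℝ, (1 / 2) ^ M ≤ a → a ≤ 1 → (1 / 2) ^ M ≤ c → c ≤ 1 → T a c ≤
          ofReal (C₀ * (M + r') ^ 2 * r' ^ 2 * W ^ (p / r)) * lpN (fun x => ‖g x‖ₑ) r *
            lpN (fun x => ∑ k ∈ K, d k x) r' := fun a c h1 h2 h3 h4 =>
        hC₀ r r' A₁ A₂ (W ^ (p / r)) a c N₁ N₂ M I β _ hr'2 hrr' hA₁ hA₂ hWr hH h1 h2 h3 h4
          (fun x => ‖g x‖ₑ) d hg.enorm hd hfin
      have hmm : ∀ (k : ℕ × ℕ × ℕ) (a c : ℝ), Measurable fun x =>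
          (ofReal (v k ^ (p / r)) * d k x) *
            subAvg (curveLap b κ (A₁ / 2 ^ k.1) (β k) a c) (fun y => ‖g y‖ₑ) x := fun k a c =>
        ((hd k).const_mul _).mul (measurable_subAvg _ hg.enorm)
      calc _ ≤ T a' c' + T a' c + T a c' + T a c := by
            simp only [hT, ← sum_add_distrib]
            refine sum_le_sum fun k hk => ?_
            rw [← lintegral_add_four (hmm _ _ _) (hmm _ _ _) (hmm _ _ _)]
            refine lintegral_mono fun x => ?_
            simp only [← mul_add]
            exact mul_le_mul' le_rfl
              (enorm_kop_lapDiff_le (by positivity) (hβ k hk) ha' ha hc' hc hg x)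
        _ ≤ _ := by
            have t1 := hTle a' c' hMa' (haa.trans ha1) hMc' (hcc.trans hc1)
            have t2 := hTle a' c hMa' (haa.trans ha1) (hMc'.trans hcc) hc1
            have t3 := hTle a c' (hMa'.trans haa) ha1 hMc' (hcc.trans hc1)
            have t4 := hTle a c (hMa'.trans haa) ha1 (hMc'.trans hcc) hc1
            refine (add_le_add (add_le_add (add_le_add t1 t2) t3) t4).trans_eq ?_
            rw [hN₀, ofReal_mul (p := 4) (by norm_num), show ofReal 4 = 4 by norm_num]
            ring)
    (by
      intro g d hg hgi ⟨D, hD⟩ hd _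
      have hNe : ofReal N₁' ^ (2:ℝ) = ofReal (C₁ * √(a * c) * W ^ p) := by
        have : 0 ≤ C₁ * √(a * c) * W ^ p := mul_nonneg (by positivity) (rpow_nonneg hW _)
        rw [ofReal_rpow_of_nonneg (sqrt_nonneg _) (by norm_num), rpow_two,
          sq_sqrt this]
      have := sum_lintegral_mul_kop_le K (μ := curveBase)
        (m := fun _ => lapDiff a' a c' c) (Y := fun k => curveShift b κ (A₁ / 2 ^ k.1) (β k))
        (fun _ => measurable_lapDiff _ _ _ _) (fun _ => integrable_lapDiff ha' ha hc' hc)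
        (fun _ => measurable_curveShift _ _ _ _) hg hgi hD (N := ofReal N₁')
        (fun k => ofReal (v k ^ (p / 2)))
        (by
          intro ξ
          rw [hNe]
          refine le_trans (le_of_eq ?_) (ofReal_le_ofReal
            (hC₁ p A₁ A₂ W a' a c' c N₁ N₂ I β v hW hA₁ hA₂ H ha' haa hc' hcc ξ))
          rw [ofReal_sum_of_nonneg fun k _ =>
            mul_nonneg (rpow_nonneg (H.nonneg k) _) (by positivity)]
          refine sum_congr rfl fun k _ => ?_
          rw [ofReal_rpow_of_nonneg (rpow_nonneg (H.nonneg k) _) (by norm_num),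
            ← rpow_mul (H.nonneg k), div_mul_cancel₀ _ (by norm_num), ← ofReal_norm,
            ofReal_rpow_of_nonneg (norm_nonneg _) (by norm_num), rpow_two,
            ← ofReal_mul (rpow_nonneg (H.nonneg k) _)]) hd
      refine this.trans_eq ?_
      ring)
    hg hh hB hBf hgD hh0 hhD hgB hhB
  refine hmain.trans (mul_le_mul' (mul_le_mul' (ofReal_le_ofReal ?_) le_rfl) le_rfl)
  exact interpolation_constant_le hC₀0.le hC₁0.le (cast_nonneg M) hq0 (by linarith) (by linarith) hr'q
    (by positivity) (by nlinarith) hp0 hr0 hθ0 hθ1 hθq hθe hW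

lemma enorm_kop_lapDiff_telescope_le {b κ α β : ℝ} {ε : ℕ → ℝ} (hε : ∀ s, 0 < ε s) (h0 : ε 0 = 1)
    {g : ℝ² → ℂ} (hg : Measurable g) {D : ℝ} (hD : ∀ x, ‖g x‖ ≤ D) (S : ℕ) (x : ℝ²) :
    ‖kop curveBase (lapDiff (ε S) 1 (ε S) 1) (curveShift b κ α β) g x‖ₑ ≤
      ∑ s ∈ Finset.range S,
        (‖kop curveBase (lapDiff (ε (s + 1)) (ε s) (ε (s + 1)) 1) (curveShift b κ α β) g x‖ₑ +
        ‖kop curveBase (lapDiff (ε s) 1 (ε (s + 1)) (ε s)) (curveShift b κ α β) g x‖ₑ) := by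
  have hY := measurable_curveShift b κ α β
  induction S with
  | zero =>
    have : lapDiff (ε 0) 1 (ε 0) 1 = fun _ => 0 := by
      ext ω; simp [lapDiff, h0]
    simp [this, kop]
  | succ S ih =>
    have e : lapDiff (ε (S + 1)) 1 (ε (S + 1)) 1 = fun ω =>
        lapDiff (ε S) 1 (ε S) 1 ω + (lapDiff (ε (S + 1)) (ε S) (ε (S + 1)) 1 ω +
          lapDiff (ε S) 1 (ε (S + 1)) (ε S) ω) := by
      ext ω
      simp only [lapDiff]
      push_cast
      ring
    have i1 := integrable_lapDiff (hε S) one_pos (hε S) one_pos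
    have i2 := integrable_lapDiff (hε (S + 1)) (hε S) (hε (S + 1)) one_pos
    have i3 := integrable_lapDiff (hε S) one_pos (hε (S + 1)) (hε S)
    have i23 : Integrable (fun ω => lapDiff (ε (S + 1)) (ε S) (ε (S + 1)) 1 ω +
        lapDiff (ε S) 1 (ε (S + 1)) (ε S) ω) curveBase := i2.add i3
    rw [e, kop_add hY hg hD i1 i23, kop_add hY hg hD i2 i3, sum_range_succ]
    exact (enorm_add_le _ _).trans (add_le_add ih (enorm_add_le _ _))

lemma subAvg_curveLap_le_enorm_kop_lapDiff_add {b κ α β ε : ℝ} (hα : 0 < α) (hβ : 0 < β)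
    (hε : 0 < ε) {g : ℝ² → ℝ} (hg : Measurable g) (hg0 : ∀ x, 0 ≤ g x) {D : ℝ}
    (hD : ∀ x, g x ≤ D) (x : ℝ²) :
    subAvg (curveLap b κ α β ε ε) (fun y => ofReal (g y)) x ≤
      ‖kop curveBase (lapDiff ε 1 ε 1) (curveShift b κ α β) (fun y => (g y : ℂ)) x‖ₑ +
      subAvg (curveLap b κ α β ε 1) (fun y => ofReal (g y)) x +
      subAvg (curveLap b κ α β 1 ε) (fun y => ofReal (g y)) x +
      subAvg (curveLap b κ α β 1 1) (fun y => ofReal (g y)) x := by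
  have hY := measurable_curveShift b κ α β
  have hgc : Measurable fun y => (g y : ℂ) := by fun_prop
  have hgD : ∀ y, ‖(g y : ℂ)‖ ≤ D := fun y => by
    rw [norm_real, norm_of_nonneg (hg0 y)]; exact hD y
  have e : lapPair ε ε = fun ω => lapDiff ε 1 ε 1 ω + (lapPair ε 1 ω +
      (lapPair 1 ε ω + (-1) * lapPair 1 1 ω)) := by
    ext ω
    simp only [lapDiff, lapPair]
    push_cast
    ring
  have hneg : kop curveBase (fun ω => (-1) * lapPair 1 1 ω) (curveShift b κ α β)
      (fun y => (g y : ℂ)) x = - kop curveBase (lapPair 1 1) (curveShift b κ α β)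
      (fun y => (g y : ℂ)) x := by
    simp only [kop, neg_mul, one_mul, integral_neg]
  have i1 := integrable_lapDiff hε one_pos hε one_pos
  have i2 := integrable_lapPair hε one_pos
  have i3 := integrable_lapPair one_pos hε
  have i4 := (integrable_lapPair one_pos one_pos).const_mul (-1)
  have i34 : Integrable (fun ω => lapPair 1 ε ω + (-1) * lapPair 1 1 ω) curveBase := i3.add i4
  have i234 : Integrable (fun ω => lapPair ε 1 ω + (lapPair 1 ε ω + (-1) * lapPair 1 1 ω))
      curveBase := i2.add i34
  rw [subAvg_curveLap_eq_enorm_kop hα hβ hε hε hg hg0 hD,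
    subAvg_curveLap_eq_enorm_kop hα hβ hε one_pos hg hg0 hD,
    subAvg_curveLap_eq_enorm_kop hα hβ one_pos hε hg hg0 hD,
    subAvg_curveLap_eq_enorm_kop hα hβ one_pos one_pos hg hg0 hD, e,
    kop_add hY hgc hgD i1 i234, kop_add hY hgc hgD i2 i34,
    kop_add hY hgc hgD i3 i4, hneg, add_assoc, add_assoc]
  refine (enorm_add_le _ _).trans (add_le_add le_rfl ?_)
  refine (enorm_add_le _ _).trans (add_le_add le_rfl ?_)
  refine (enorm_add_le _ _).trans (add_le_add le_rfl ?_)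
  rw [enorm_neg]

lemma exists_sum_range_sq_mul_geometric_le :
    ∃ K : ℝ, 0 < K ∧ ∀ S : ℕ, ∑ s ∈ Finset.range S,
      (2 * (s:ℝ) + 3) ^ 2 * (((1:ℝ) / 2) ^ (1 / 4 : ℝ)) ^ s ≤ K := by
  set r : ℝ := ((1:ℝ) / 2) ^ (1 / 4 : ℝ) with hr
  have hr0 : 0 ≤ r := by positivity
  have hr1 : ‖r‖ < 1 := by
    rw [norm_of_nonneg hr0]
    exact Real.rpow_lt_one (by norm_num) (by norm_num) (by norm_num)
  have h : Summable fun s : ℕ => (2 * (s:ℝ) + 3) ^ 2 * r ^ s := by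
    have h2 := summable_pow_mul_geometric_of_norm_lt_one 2 hr1
    have h1 := summable_pow_mul_geometric_of_norm_lt_one 1 hr1
    have h0 := summable_geometric_of_norm_lt_one hr1
    refine (((h2.mul_left 4).add (h1.mul_left 12)).add (h0.mul_left 9)).congr fun s => ?_
    ring
  refine ⟨∑' s : ℕ, (2 * (s:ℝ) + 3) ^ 2 * r ^ s + 1, ?_, fun S => ?_⟩
  · have : 0 ≤ ∑' s : ℕ, (2 * (s:ℝ) + 3) ^ 2 * r ^ s := tsum_nonneg fun s => by positivity
    linarith
  · have := h.sum_le_tsum (Finset.range S) fun s _ => by positivity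
    linarith

lemma lapDiff_constant_le {q C W : ℝ} (hq : 2 ≤ q) (hC : 0 ≤ C) (hW : 0 ≤ W) (s : ℕ) :
    C * ((((s + 1) * ⌈q⌉₊ : ℕ) + q) ^ 2 * q ^ 2 * ((1 / 2) ^ (s * ⌈q⌉₊) : ℝ) ^ (1 / (4 * q))) * W ≤
      C * (q ^ 4 * ((2 * (s:ℝ) + 3) ^ 2 * (((1:ℝ) / 2) ^ (1 / 4 : ℝ)) ^ s)) * W := by
  have hqn : q ≤ ⌈q⌉₊ := le_ceil q
  have hnq : (⌈q⌉₊:ℝ) ≤ q + 1 := (Nat.ceil_lt_add_one (by linarith)).le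
  have hs : (0:ℝ) ≤ s := cast_nonneg s
  have h1 : (((s + 1) * ⌈q⌉₊ : ℕ) + q : ℝ) ≤ q * (2 * s + 3) := by
    push_cast; nlinarith
  have h2 : ((1 / 2) ^ (s * ⌈q⌉₊) : ℝ) ^ (1 / (4 * q)) ≤ (((1:ℝ) / 2) ^ (1 / 4 : ℝ)) ^ s := by
    rw [← rpow_natCast, ← rpow_natCast, ← rpow_mul (by norm_num),
      ← rpow_mul (by norm_num)]
    refine Real.rpow_le_rpow_of_exponent_ge (by norm_num) (by norm_num) ?_
    push_cast
    rw [mul_one_div, le_div_iff₀ (by positivity)]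
    nlinarith
  calc _ ≤ C * ((q * (2 * s + 3)) ^ 2 * q ^ 2 * (((1:ℝ) / 2) ^ (1 / 4 : ℝ)) ^ s) * W := by
        gcongr
    _ = _ := by ring

/-- Boundedness of the regularised maximal averages, uniformly in the regularisation, for bounded
functions with bounded support. -/
lemma exists_sum_subAvg_curveLap_le_of_bounded {b κ ϑ : ℝ} (hb : 1 < b) (hκ : κ ≠ 0) (hϑ : 2 ≤ ϑ) :
    ∃ C : ℝ, 0 < C ∧ ∀ (p q A₁ A₂ W ε : ℝ) (N₁ N₂ : ℕ) (I : Finset ℕ)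
      (β v : ℕ × ℕ × ℕ → ℝ), 2 ≤ q → p.HolderConjugate q → 0 < A₁ → 0 < A₂ → 0 ≤ W →
      WeightedScales ϑ p A₂ W I β v → 0 < ε →
      ∀ (g : ℝ² → ℝ) (h : ℕ × ℕ × ℕ → ℝ² → ℝ) (B : Set (ℝ²)) (D : ℝ), Measurable g →
      (∀ k, Measurable (h k)) → MeasurableSet B → volume B ≠ ⊤ → (∀ x, 0 ≤ g x) → (∀ x, g x ≤ D) →
      (∀ k x, 0 ≤ h k x) → (∀ k x, h k x ≤ D) → (∀ x, x ∉ B → g x = 0) →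
      (∀ k x, x ∉ B → h k x = 0) →
      ∑ k ∈ scaleBox N₁ N₂ I, ∫⁻ x, ofReal (v k * h k x) *
          subAvg (curveLap b κ (A₁ / 2 ^ k.1) (β k) ε ε) (fun y => ofReal (g y)) x ≤
        ofReal (C * q ^ 4 * W) * (lpN (fun x => ofReal (g x)) p *
          lpN (fun x => ∑ k ∈ scaleBox N₁ N₂ I, ofReal (h k x)) q) := by
  obtain ⟨C₀, hC₀0, hC₀⟩ := exists_sum_subAvg_curveLap_le_of_one_le hb hκ hϑ
  obtain ⟨C₁, hC₁0, hC₁⟩ := exists_sum_kop_lapDiff_le hb hκ hϑ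
  obtain ⟨K₀, hK₀0, hK₀⟩ := exists_sum_range_sq_mul_geometric_le
  have hϑ0 : 0 < ϑ := by linarith
  refine ⟨2 * C₁ * K₀ + 3 * C₀, by positivity, ?_⟩
  intro p q A₁ A₂ W ε N₁ N₂ I β v hq hpq hA₁ hA₂ hW H hε g h B D hg hh hB hBf hg0 hgD hh0 hhD hgB hhB
  have hq0 : 0 < q := by linarith
  set K := scaleBox N₁ N₂ I with hK
  set X := lpN (fun x => ofReal (g x)) p *
    lpN (fun x => ∑ k ∈ K, ofReal (h k x)) q with hX
  set T : ℝ → ℝ → ℕ × ℕ × ℕ → ℝ² → ℝ≥0∞ := fun a c k x =>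
    subAvg (curveLap b κ (A₁ / 2 ^ k.1) (β k) a c) (fun y => ofReal (g y)) x with hT
  have hTm : ∀ a c k, Measurable (T a c k) := fun a c k => measurable_subAvg _ (by fun_prop)
  have hTle : ∀ a c : ℝ, 0 < a → 0 < c → (1 ≤ a ∨ 1 ≤ c) →
      ∑ k ∈ K, ∫⁻ x, ofReal (v k * h k x) * T a c k x ≤ ofReal (C₀ * q ^ 4 * W) * X := by
    intro a c ha hc hac
    have := hC₀ p q A₁ A₂ W a c N₁ N₂ I β v hq hpq hA₁ hA₂ hW H ha hc hac
      (fun x => ofReal (g x)) (fun k x => ofReal (h k x)) (by fun_prop)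
      (fun k => (hh k).ennreal_ofReal)
    simp only [ofReal_mul (H.nonneg _), hX, ← mul_assoc] at this ⊢
    exact this
  have hconst : ofReal (C₀ * q ^ 4 * W) ≤
      ofReal ((2 * C₁ * K₀ + 3 * C₀) * q ^ 4 * W) := by
    refine ofReal_le_ofReal ?_
    gcongr
    nlinarith [mul_pos hC₁0 hK₀0]
  rcases le_or_gt 1 ε with h1ε | hε1
  · exact (hTle ε ε hε hε (Or.inl h1ε)).trans (mul_le_mul' hconst le_rfl)
  set L := ⌈q⌉₊ with hL
  have hL0 : L ≠ 0 := (Nat.ceil_pos.2 hq0).ne'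
  have hex : ∃ S : ℕ, ((1:ℝ) / 2) ^ (S * L) ≤ ε := by
    obtain ⟨n, hn⟩ := exists_pow_lt_of_lt_one hε (by norm_num : (1:ℝ) / 2 < 1)
    exact ⟨n, (pow_le_pow_of_le_one (by norm_num) (by norm_num)
      (Nat.le_mul_of_pos_right n (Nat.pos_of_ne_zero hL0))).trans hn.le⟩
  set S := Nat.find hex with hS
  have hSspec : ((1:ℝ) / 2) ^ (S * L) ≤ ε := Nat.find_spec hex
  have hSmin : ∀ s < S, ε < ((1:ℝ) / 2) ^ (s * L) := fun s hs => not_le.1 (Nat.find_min hex hs)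
  set e : ℕ → ℝ := fun s => max (((1:ℝ) / 2) ^ (s * L)) ε with he
  have he0 : ∀ s, 0 < e s := fun s => lt_of_lt_of_le hε (le_max_right _ _)
  have he00 : e 0 = 1 := by simp [he, hε1.le]
  have heS : e S = ε := max_eq_right hSspec
  have hes : ∀ s < S, e s = ((1:ℝ) / 2) ^ (s * L) := fun s hs => max_eq_left (hSmin s hs).le
  have hemono : ∀ s, e (s + 1) ≤ e s := fun s =>
    max_le_max (pow_le_pow_of_le_one (by norm_num) (by norm_num) (by gcongr; omega)) le_rfl
  have he1 : ∀ s, e s ≤ 1 := fun s => max_le (pow_le_one₀ (by norm_num) (by norm_num)) hε1.le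
  have hlow : ∀ s, ((1:ℝ) / 2) ^ (s * L) ≤ e s := fun s => le_max_left _ _
  set g' : ℝ² → ℂ := fun y => (g y : ℂ) with hg'
  have hg'm : Measurable g' := by simp only [hg']; fun_prop
  have hg'D : ∀ y, ‖g' y‖ ≤ D := fun y => by
    rw [hg', norm_real, norm_of_nonneg (hg0 y)]; exact hgD y
  have hg'e : ∀ y, ‖g' y‖ₑ = ofReal (g y) := fun y => by
    rw [← ofReal_norm, hg', norm_real, norm_of_nonneg (hg0 y)]
  set E : ℝ → ℝ → ℝ → ℝ → ℕ × ℕ × ℕ → ℝ² → ℝ≥0∞ := fun a' a c' c k x =>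
    ‖kop curveBase (lapDiff a' a c' c) (curveShift b κ (A₁ / 2 ^ k.1) (β k)) g' x‖ₑ with hE
  have hEm : ∀ a' a c' c k, Measurable (E a' a c' c k) := fun a' a c' c k =>
    (measurable_kop (measurable_lapDiff _ _ _ _) (measurable_curveShift _ _ _ _) hg'm).enorm
  set r : ℝ := ((1:ℝ) / 2) ^ (1 / 4 : ℝ) with hr
  set cst : ℕ → ℝ := fun s => C₁ * (q ^ 4 * ((2 * (s:ℝ) + 3) ^ 2 * r ^ s)) * W with hcst
  have hcst0 : ∀ s, 0 ≤ cst s := fun s => by simp only [hcst]; positivity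
  have hEle : ∀ (s : ℕ) (a' a c' c : ℝ), ((1:ℝ) / 2) ^ ((s + 1) * L) ≤ a' → a' ≤ a → a ≤ 1 →
      ((1:ℝ) / 2) ^ ((s + 1) * L) ≤ c' → c' ≤ c → c ≤ 1 → a * c = (1 / 2) ^ (s * L) →
      ∑ k ∈ K, ∫⁻ x, ofReal (v k * h k x) * E a' a c' c k x ≤ ofReal (cst s) * X := by
    intro s a' a c' c h1 h2 h3 h4 h5 h6 hac
    have := hC₁ p q A₁ A₂ W a' a c' c N₁ N₂ ((s + 1) * L) I β v hq hpq hA₁ hA₂ hW H h1 h2 h3 h4 h5 h6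
      g' h B D hg'm hh hB hBf hg'D hh0 hhD (fun x hx => by simp [hg', hgB x hx]) hhB
    simp only [hg'e, hac] at this
    rw [mul_assoc] at this
    exact this.trans (mul_le_mul' (ofReal_le_ofReal (lapDiff_constant_le hq hC₁0.le hW s))
      le_rfl)
  have hβ : ∀ k ∈ K, 0 < β k := fun k hk => H.scale_pos hϑ0 hA₂ (mem_scaleBox hk)
  have hcm : ∀ k, Measurable fun x => ofReal (v k * h k x) := fun k => by
    have := hh k; fun_prop
  have hcT : ∀ k a c, Measurable fun x => ofReal (v k * h k x) * T a c k x := fun k a c =>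
    (hcm k).mul (hTm a c k)
  have hcE : ∀ k a' a c' c, Measurable fun x => ofReal (v k * h k x) * E a' a c' c k x :=
    fun k a' a c' c => (hcm k).mul (hEm a' a c' c k)
  have hpt : ∀ k ∈ K, ∀ x, ofReal (v k * h k x) * T ε ε k x ≤
      (∑ s ∈ Finset.range S, (ofReal (v k * h k x) * E (e (s + 1)) (e s) (e (s + 1)) 1 k x +
        ofReal (v k * h k x) * E (e s) 1 (e (s + 1)) (e s) k x)) +
      ofReal (v k * h k x) * T ε 1 k x + ofReal (v k * h k x) * T 1 ε k x +
      ofReal (v k * h k x) * T 1 1 k x := by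
    intro k hk x
    simp only [← mul_add, ← mul_sum]
    refine mul_le_mul' le_rfl ?_
    refine (subAvg_curveLap_le_enorm_kop_lapDiff_add (by positivity) (hβ k hk) hε hg hg0 hgD x).trans
      (add_le_add (add_le_add (add_le_add ?_ le_rfl) le_rfl) le_rfl)
    have := enorm_kop_lapDiff_telescope_le (b := b) (κ := κ) (α := A₁ / 2 ^ k.1) (β := β k) he0 he00
      hg'm hg'D S x
    rw [heS] at this
    exact this
  have hsum : ∀ k ∈ K, ∫⁻ x, ofReal (v k * h k x) * T ε ε k x ≤
      (∑ s ∈ Finset.range S, ((∫⁻ x, ofReal (v k * h k x) *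
          E (e (s + 1)) (e s) (e (s + 1)) 1 k x) +
        ∫⁻ x, ofReal (v k * h k x) * E (e s) 1 (e (s + 1)) (e s) k x)) +
      (∫⁻ x, ofReal (v k * h k x) * T ε 1 k x) +
      (∫⁻ x, ofReal (v k * h k x) * T 1 ε k x) +
      ∫⁻ x, ofReal (v k * h k x) * T 1 1 k x := by
    intro k hk
    refine (lintegral_mono (hpt k hk)).trans_eq ?_
    have hms : ∀ s, Measurable fun x =>
        ofReal (v k * h k x) * E (e (s + 1)) (e s) (e (s + 1)) 1 k x +
        ofReal (v k * h k x) * E (e s) 1 (e (s + 1)) (e s) k x := fun s =>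
      (hcE k _ _ _ _).add (hcE k _ _ _ _)
    rw [lintegral_add_four (Finset.measurable_fun_sum _ fun s _ => hms s) (hcT k _ _) (hcT k _ _),
      lintegral_finsetSum _ fun s _ => hms s]
    simp only [lintegral_add_left (hcE k _ _ _ _)]
  calc ∑ k ∈ K, ∫⁻ x, ofReal (v k * h k x) * T ε ε k x
      ≤ (∑ s ∈ Finset.range S, ((∑ k ∈ K, ∫⁻ x, ofReal (v k * h k x) *
          E (e (s + 1)) (e s) (e (s + 1)) 1 k x) +
        ∑ k ∈ K, ∫⁻ x, ofReal (v k * h k x) * E (e s) 1 (e (s + 1)) (e s) k x)) +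
      (∑ k ∈ K, ∫⁻ x, ofReal (v k * h k x) * T ε 1 k x) +
      (∑ k ∈ K, ∫⁻ x, ofReal (v k * h k x) * T 1 ε k x) +
      ∑ k ∈ K, ∫⁻ x, ofReal (v k * h k x) * T 1 1 k x := by
        refine (sum_le_sum hsum).trans_eq ?_
        rw [sum_add_distrib, sum_add_distrib, sum_add_distrib,
          sum_comm]
        simp only [sum_add_distrib]
    _ ≤ (∑ s ∈ Finset.range S, (ofReal (cst s) * X + ofReal (cst s) * X)) +
        ofReal (C₀ * q ^ 4 * W) * X + ofReal (C₀ * q ^ 4 * W) * X +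
        ofReal (C₀ * q ^ 4 * W) * X := by
        refine add_le_add (add_le_add (add_le_add (sum_le_sum fun s hs => ?_)
          (hTle _ _ hε one_pos (Or.inr le_rfl))) (hTle _ _ one_pos hε (Or.inl le_rfl)))
          (hTle _ _ one_pos one_pos (Or.inl le_rfl))
        have hs := Finset.mem_range.1 hs
        exact add_le_add
          (hEle s _ _ _ _ (hlow _) (hemono s) (he1 s) (hlow _) (he1 _) le_rfl
            (by rw [mul_one, hes s hs]))
          (hEle s _ _ _ _ ((pow_le_pow_of_le_one (by norm_num) (by norm_num)
            (by gcongr; omega)).trans (hlow s)) (he1 s) le_rfl (hlow _) (hemono s) (he1 s)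
            (by rw [one_mul, hes s hs]))
    _ = ofReal (∑ s ∈ Finset.range S, (cst s + cst s) + C₀ * q ^ 4 * W + C₀ * q ^ 4 * W +
          C₀ * q ^ 4 * W) * X := by
        have hz : 0 ≤ C₀ * q ^ 4 * W := by positivity
        have hs0 : 0 ≤ ∑ s ∈ Finset.range S, (cst s + cst s) :=
          sum_nonneg fun s _ => add_nonneg (hcst0 s) (hcst0 s)
        rw [ofReal_add (by positivity) hz, ofReal_add (by positivity) hz,
          ofReal_add hs0 hz, ofReal_sum_of_nonneg fun s _ =>
          add_nonneg (hcst0 s) (hcst0 s)]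
        simp only [ofReal_add (hcst0 _) (hcst0 _), add_mul, sum_mul]
    _ ≤ _ := by
        refine mul_le_mul' (ofReal_le_ofReal ?_) le_rfl
        have : ∑ s ∈ Finset.range S, (cst s + cst s) = 2 * C₁ * q ^ 4 * W *
            ∑ s ∈ Finset.range S, (2 * (s:ℝ) + 3) ^ 2 * r ^ s := by
          rw [mul_sum]
          refine sum_congr rfl fun s _ => ?_
          simp only [hcst]
          ring
        rw [this]
        have := mul_le_mul_of_nonneg_left (hK₀ S) (show 0 ≤ 2 * C₁ * q ^ 4 * W by positivity)
        linarith

/-- The truncation of a nonnegative function in height and in space. -/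
def heightTrunc (N : ℕ) (f : ℝ² → ℝ≥0∞) (x : ℝ²) : ℝ≥0∞ :=
  (closedBall 0 (N:ℝ)).indicator (fun x => min (f x) N) x

lemma measurable_heightTrunc (N : ℕ) {f : ℝ² → ℝ≥0∞} (hf : Measurable f) :
    Measurable (heightTrunc N f) :=
  (hf.min measurable_const).indicator isClosed_closedBall.measurableSet

lemma heightTrunc_le (N : ℕ) (f : ℝ² → ℝ≥0∞) (x : ℝ²) : heightTrunc N f x ≤ f x :=
  (indicator_le_self _ _ x).trans (min_le_left _ _)

lemma heightTrunc_le_natCast (N : ℕ) (f : ℝ² → ℝ≥0∞) (x : ℝ²) : heightTrunc N f x ≤ N :=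
  (indicator_le_self _ _ x).trans (min_le_right _ _)

lemma heightTrunc_eq_zero (N : ℕ) (f : ℝ² → ℝ≥0∞) {x : ℝ²}
    (hx : x ∉ closedBall (0 : ℝ²) (N:ℝ)) : heightTrunc N f x = 0 :=
  indicator_of_notMem hx _

lemma monotone_heightTrunc (f : ℝ² → ℝ≥0∞) (x : ℝ²) :
    Monotone fun N => heightTrunc N f x := by
  intro N M hNM
  have h : (N:ℝ≥0∞) ≤ M := by exact_mod_cast hNM
  exact (indicator_le_indicator (f := fun x => min (f x) N) (g := fun x => min (f x) M)
    (min_le_min le_rfl h)).trans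
    (indicator_le_indicator_of_subset (Metric.closedBall_subset_closedBall
      (by exact_mod_cast hNM)) (fun _ => zero_le) x)

lemma iSup_heightTrunc (f : ℝ² → ℝ≥0∞) (x : ℝ²) : ⨆ N, heightTrunc N f x = f x := by
  refine le_antisymm (iSup_le fun N => heightTrunc_le N f x) ?_
  have : f x = ⨆ N : ℕ, min (f x) N := by
    rw [← inf_iSup_eq, ENNReal.iSup_natCast, inf_top_eq]
  rw [this]
  obtain ⟨M, hM⟩ := exists_nat_ge (dist x 0)
  refine iSup_le fun N => le_iSup_of_le (max N M) ?_
  have hx : x ∈ closedBall (0 : ℝ²) ((max N M : ℕ):ℝ) :=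
    Metric.mem_closedBall.2 (hM.trans (by exact_mod_cast le_max_right _ _))
  rw [heightTrunc, indicator_of_mem hx]
  exact min_le_min le_rfl (by exact_mod_cast le_max_left _ _)

lemma subAvg_eq_iSup_heightTrunc (μ : Measure (ℝ²)) {f : ℝ² → ℝ≥0∞} (hf : Measurable f)
    (x : ℝ²) : subAvg μ f x = ⨆ N, subAvg μ (heightTrunc N f) x := by
  simp only [subAvg]
  have hm : ∀ N, Measurable fun y => heightTrunc N f (x - y) := fun N =>
    (measurable_heightTrunc N hf).comp (by fun_prop)
  rw [← lintegral_iSup hm fun N M h y => monotone_heightTrunc f (x - y) h]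
  simp only [iSup_heightTrunc]

lemma ENNReal.iSup_mul_iSup_of_monotone {f g : ℕ → ℝ≥0∞} (hf : Monotone f) (hg : Monotone g) :
    (⨆ n, f n) * ⨆ n, g n = ⨆ n, f n * g n := by
  refine le_antisymm ?_ (iSup_le fun n => mul_le_mul' (le_iSup f n) (le_iSup g n))
  rw [ENNReal.iSup_mul]
  refine iSup_le fun n => ?_
  rw [mul_iSup]
  exact iSup_le fun m => le_iSup_of_le (max n m)
    (mul_le_mul' (hf (le_max_left _ _)) (hg (le_max_right _ _)))

lemma lintegral_mul_subAvg_eq_iSup (μ : Measure (ℝ²)) [SFinite μ] (c : ℝ≥0∞)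
    {f h : ℝ² → ℝ≥0∞} (hf : Measurable f) (hh : Measurable h) :
    ∫⁻ x, c * h x * subAvg μ f x =
      ⨆ N, ∫⁻ x, c * heightTrunc N h x * subAvg μ (heightTrunc N f) x := by
  have m1 : ∀ x, Monotone fun N => c * heightTrunc N h x := fun x N M hNM =>
    mul_le_mul' le_rfl (monotone_heightTrunc h x hNM)
  have m2 : ∀ x, Monotone fun N => subAvg μ (heightTrunc N f) x := fun x N M hNM =>
    lintegral_mono fun y => monotone_heightTrunc f _ hNM
  have hm : ∀ N, Measurable fun x => c * heightTrunc N h x * subAvg μ (heightTrunc N f) x :=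
    fun N => ((measurable_heightTrunc N hh).const_mul c).mul
      (measurable_subAvg μ (measurable_heightTrunc N hf))
  rw [← lintegral_iSup hm fun N M hNM x => mul_le_mul' (m1 x hNM) (m2 x hNM)]
  refine lintegral_congr fun x => ?_
  rw [← ENNReal.iSup_mul_iSup_of_monotone (m1 x) (m2 x), ← subAvg_eq_iSup_heightTrunc μ hf,
    ← mul_iSup, iSup_heightTrunc]

/-- The dual form of the maximal estimate for the averages over regularised curves, with a constant
of order `q ^ 4` which does not depend on the regularisation. -/
lemma exists_sum_subAvg_curveLap_le_uniform {b κ ϑ : ℝ} (hb : 1 < b) (hκ : κ ≠ 0) (hϑ : 2 ≤ ϑ) :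
    ∃ C : ℝ, 0 < C ∧ ∀ (p q A₁ A₂ W ε : ℝ) (N₁ N₂ : ℕ) (I : Finset ℕ)
      (β v : ℕ × ℕ × ℕ → ℝ), 2 ≤ q → p.HolderConjugate q → 0 < A₁ → 0 < A₂ → 0 ≤ W →
      WeightedScales ϑ p A₂ W I β v → 0 < ε →
      ∀ (g : ℝ² → ℝ≥0∞) (h : ℕ × ℕ × ℕ → ℝ² → ℝ≥0∞), Measurable g →
      (∀ k, Measurable (h k)) →
      ∑ k ∈ scaleBox N₁ N₂ I, ∫⁻ x, ofReal (v k) * h k x *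
          subAvg (curveLap b κ (A₁ / 2 ^ k.1) (β k) ε ε) g x ≤
        ofReal (C * q ^ 4 * W) * (lpN g p *
          lpN (fun x => ∑ k ∈ scaleBox N₁ N₂ I, h k x) q) := by
  obtain ⟨C, hC0, hC⟩ := exists_sum_subAvg_curveLap_le_of_bounded hb hκ hϑ
  refine ⟨C, hC0, ?_⟩
  intro p q A₁ A₂ W ε N₁ N₂ I β v hq hpq hA₁ hA₂ hW H hε g h hg hh
  have hS : ∀ k : ℕ × ℕ × ℕ, SFinite (curveLap b κ (A₁ / 2 ^ k.1) (β k) ε ε) := fun k => by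
    unfold curveLap
    have := sFinite_lap
    infer_instance
  simp only [lintegral_mul_subAvg_eq_iSup _ _ hg (hh _)]
  rw [ENNReal.finsetSum_iSup_of_monotone]
  swap
  · intro k N M hNM
    exact lintegral_mono fun x => mul_le_mul' (mul_le_mul' le_rfl (monotone_heightTrunc _ x hNM))
      (lintegral_mono fun y => monotone_heightTrunc _ _ hNM)
  refine iSup_le fun N => ?_
  have hfin : ∀ (f : ℝ² → ℝ≥0∞) x, heightTrunc N f x ≠ ⊤ := fun f x =>
    ne_top_of_le_ne_top (natCast_ne_top N) (heightTrunc_le_natCast N f x)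
  have hle : ∀ (f : ℝ² → ℝ≥0∞) x, (heightTrunc N f x).toReal ≤ N := fun f x => by
    have := ENNReal.toReal_mono (natCast_ne_top N) (heightTrunc_le_natCast N f x)
    simpa using this
  have := hC p q A₁ A₂ W ε N₁ N₂ I β v hq hpq hA₁ hA₂ hW H hε (fun x => (heightTrunc N g x).toReal)
    (fun k x => (heightTrunc N (h k) x).toReal) (closedBall 0 (N:ℝ)) N
    (measurable_heightTrunc N hg).ennreal_toReal
    (fun k => (measurable_heightTrunc N (hh k)).ennreal_toReal)
    isClosed_closedBall.measurableSet measure_closedBall_lt_top.ne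
    (fun x => toReal_nonneg) (hle g) (fun k x => toReal_nonneg)
    (fun k => hle (h k)) (fun x hx => by simp [heightTrunc_eq_zero N g hx])
    (fun k x hx => by simp [heightTrunc_eq_zero N (h k) hx])
  simp only [ofReal_mul (H.nonneg _), ofReal_toReal (hfin _ _)] at this
  refine this.trans (mul_le_mul' le_rfl (mul_le_mul' (lpN_mono hpq.pos fun x =>
    heightTrunc_le N g x) (lpN_mono hpq.symm.pos fun x => sum_le_sum fun k _ =>
    heightTrunc_le N (h k) x)))

/-- The frequency cutoff of the `l`-th piece, normalised to the unit annulus. -/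
def annularSymbol (cp : ℝ) (η : ℝ² → ℝ) (ςm : ℝ → ℝ) (ζ : ℝ² → ℝ) (l : ℕ)
    (ξ : ℝ²) : ℝ :=
  (ζ ξ - ζ ((2:ℝ) • ξ)) * ((1 - η ((2:ℝ) ^ l • ξ)) * ςm (ξ.1 / (cp * ξ.2)))

section annular

variable {b cp : ℝ} {η ζ : ℝ² → ℝ} {ςm : ℝ → ℝ}

lemma annularSymbol_eq_zero_of_le
    (hζone : ∀ ξ : ℝ², ξ.1^2 + ξ.2^2 ≤ ((5:ℝ)/4)^2 → ζ ξ = 1) (l : ℕ) {ξ : ℝ²}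
    (h : ξ.1^2 + ξ.2^2 ≤ ((5:ℝ)/8)^2) : annularSymbol cp η ςm ζ l ξ = 0 := by
  rw [annularSymbol, hζone ξ (by linarith), hζone _ (by simp; linarith), sub_self, zero_mul]

lemma annularSymbol_eq_zero_of_ge
    (hζsupp : ∀ ξ : ℝ², (4:ℝ) ≤ ξ.1^2 + ξ.2^2 → ζ ξ = 0) (l : ℕ) {ξ : ℝ²}
    (h : 4 ≤ ξ.1^2 + ξ.2^2) : annularSymbol cp η ςm ζ l ξ = 0 := by
  rw [annularSymbol, hζsupp ξ h, hζsupp _ (by simp; linarith), sub_self, zero_mul]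

lemma annularSymbol_eq_of_le (hηsupp : ∀ ξ : ℝ², (100:ℝ)^2 < ξ.1^2 + ξ.2^2 → η ξ = 0)
    (hζone : ∀ ξ : ℝ², ξ.1^2 + ξ.2^2 ≤ ((5:ℝ)/4)^2 → ζ ξ = 1) {l : ℕ} (hl : 8 ≤ l) :
    annularSymbol cp η ςm ζ l = annularSymbol cp η ςm ζ 8 := by
  ext ξ
  rcases le_or_gt (ξ.1^2 + ξ.2^2) (((5:ℝ)/8)^2) with h | h
  · rw [annularSymbol_eq_zero_of_le hζone l h, annularSymbol_eq_zero_of_le hζone 8 h]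
  · have key : ∀ k : ℕ, 8 ≤ k → η ((2:ℝ) ^ k • ξ) = 0 := fun k hk => by
      refine hηsupp _ ?_
      have h2 : (2:ℝ) ^ 8 ≤ 2 ^ k := pow_le_pow_right₀ (by norm_num) hk
      simp only [smul_fst, smul_snd, smul_eq_mul, mul_pow, ← mul_add]
      have h3 : ((2:ℝ) ^ 8) ^ 2 ≤ (2 ^ k) ^ 2 := by gcongr
      nlinarith
    rw [annularSymbol, annularSymbol, key l hl, key 8 le_rfl]

lemma contDiff_annularSymbol (hb : 1 < b) (hcp : cp ≠ 0)
    (hηsm : ContDiff ℝ (⊤ : ℕ∞) η) (hςmsm : ContDiff ℝ (⊤ : ℕ∞) ςm)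
    (hςmsupp : ∀ v : ℝ, v ∉ Ioo (-(b * (4:ℝ) ^ (b-1))) (-(b * (4:ℝ)⁻¹ ^ (b-1))) → ςm v = 0)
    (hζsm : ContDiff ℝ (⊤ : ℕ∞) ζ)
    (hζone : ∀ ξ : ℝ², ξ.1^2 + ξ.2^2 ≤ ((5:ℝ)/4)^2 → ζ ξ = 1) (l : ℕ) :
    ContDiff ℝ (⊤ : ℕ∞) (annularSymbol cp η ςm ζ l) := by
  refine contDiff_iff_contDiffAt.2 fun ξ => ?_
  set M : ℝ := b * (4:ℝ) ^ (b-1) with hM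
  by_cases h2 : ξ.2 = 0
  · by_cases h1 : ξ.1 = 0
    · refine (contDiffAt_const (c := (0:ℝ))).congr_of_eventuallyEq ?_
      have : ∀ᶠ z : ℝ² in 𝓝 ξ, z.1^2 + z.2^2 < ((5:ℝ)/8)^2 :=
        (by fun_prop : Continuous fun z : ℝ² => z.1^2 + z.2^2).tendsto ξ |>.eventually_lt_const
          (by simp [h1, h2])
      filter_upwards [this] with z hz using annularSymbol_eq_zero_of_le hζone l hz.le
    · refine (contDiffAt_const (c := (0:ℝ))).congr_of_eventuallyEq ?_
      have : ∀ᶠ z : ℝ² in 𝓝 ξ, 0 < |z.1| - M * |cp * z.2| :=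
        (by fun_prop : Continuous fun z : ℝ² => |z.1| - M * |cp * z.2|).tendsto ξ
          |>.eventually_const_lt (by simp [h1, h2])
      filter_upwards [this] with z hz
      have hς : ςm (z.1 / (cp * z.2)) = 0 := by
        refine hςmsupp _ fun hv => ?_
        have hneg : z.1 / (cp * z.2) < 0 := hv.2.trans (by
          have : 0 < b * (4:ℝ)⁻¹ ^ (b-1) := by positivity
          linarith)
        have hlt : |z.1 / (cp * z.2)| < M := by
          rw [abs_of_neg hneg]; linarith [hv.1]
        have hne : cp * z.2 ≠ 0 := fun h => by simp [h] at hneg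
        rw [abs_div, div_lt_iff₀ (abs_pos.2 hne)] at hlt
        linarith
      rw [annularSymbol, hς, mul_zero, mul_zero]
  · have hne : cp * ξ.2 ≠ 0 := mul_ne_zero hcp h2
    have hd : ContDiffAt ℝ (⊤ : ℕ∞) (fun z : ℝ² => z.1 / (cp * z.2)) ξ :=
      contDiffAt_fst.div (contDiffAt_const.mul contDiffAt_snd) hne
    have hς : ContDiffAt ℝ (⊤ : ℕ∞) (fun z : ℝ² => ςm (z.1 / (cp * z.2))) ξ :=
      hςmsm.contDiffAt.comp ξ hd
    have hη' : ContDiff ℝ (⊤ : ℕ∞) fun z : ℝ² => η ((2:ℝ) ^ l • z) :=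
      hηsm.comp (contDiff_const_smul _)
    have hζ' : ContDiff ℝ (⊤ : ℕ∞) fun z : ℝ² => ζ ((2:ℝ) • z) :=
      hζsm.comp (contDiff_const_smul _)
    exact (hζsm.contDiffAt.sub hζ'.contDiffAt).mul
      ((contDiffAt_const.sub hη'.contDiffAt).mul hς)

lemma hasCompactSupport_annularSymbol
    (hζsupp : ∀ ξ : ℝ², (4:ℝ) ≤ ξ.1^2 + ξ.2^2 → ζ ξ = 0) (l : ℕ) :
    HasCompactSupport (annularSymbol cp η ςm ζ l) := by
  refine HasCompactSupport.intro (isCompact_closedBall (0 : ℝ²) 2) fun ξ hξ =>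
    annularSymbol_eq_zero_of_ge hζsupp l ?_
  rw [Metric.mem_closedBall, dist_zero_right, Prod.norm_def, not_le, lt_max_iff,
    norm_eq_abs, norm_eq_abs] at hξ
  rcases hξ with h | h
  · nlinarith [sq_abs ξ.1, sq_nonneg ξ.2]
  · nlinarith [sq_abs ξ.2, sq_nonneg ξ.1]

/-- The inverse Fourier transforms of smooth compactly supported functions decay rapidly. -/
lemma exists_FT_eq_of_contDiff {Ψ : ℝ² → ℝ} (hΨ : ContDiff ℝ (⊤ : ℕ∞) Ψ)
    (hc : HasCompactSupport Ψ) : ∃ C : ℝ, 0 < C ∧ (∀ ξ, |Ψ ξ| ≤ C) ∧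
      ∃ K : ℝ² → ℂ, Continuous K ∧ (∀ x, ‖K x‖ * (1 + ‖x‖) ^ 3 ≤ C) ∧
        ∀ ξ, FT K ξ = (Ψ ξ : ℂ) := by
  have hΨc : ContDiff ℝ (⊤ : ℕ∞) fun ξ => (Ψ ξ : ℂ) := ofRealCLM.contDiff.comp hΨ
  have hcc : HasCompactSupport fun ξ => (Ψ ξ : ℂ) := hc.comp_left (g := Complex.ofReal) rfl
  set S : SchwartzMap (ℝ²) ℂ := hcc.toSchwartzMap hΨc with hS
  have hSe : ∀ ξ, S ξ = (Ψ ξ : ℂ) := fun ξ => rfl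
  obtain ⟨h, hh⟩ := exists_schwartz_FT S
  obtain ⟨M, hM⟩ := hΨ.continuous.bounded_above_of_compact_support hc
  have hdec := h.one_add_le_sup_seminorm_apply (𝕜 := ℝ) (m := (3, 0)) (k := 3) (n := 0) le_rfl le_rfl
  set D := 2 ^ (3, 0).1 * ((Finset.Iic (3, 0)).sup fun m => SchwartzMap.seminorm ℝ m.1 m.2) h with hD
  refine ⟨|M| + |D| + 1, by positivity, fun ξ => (hM ξ).trans ?_, fun x => h (-x),
    h.continuous.comp continuous_neg, fun x => ?_, fun ξ => ?_⟩
  · linarith [le_abs_self M, abs_nonneg D]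
  · have := hdec (-x)
    rw [norm_neg, norm_iteratedFDeriv_zero] at this
    rw [mul_comm]
    linarith [abs_nonneg M, le_abs_self D]
  · have e : (fun x => h (-x)) = FTinv fun ξ => S ξ := by
      ext x
      rw [FTinv_eq_FT_neg, hh]
    have e2 : FT (fun ξ => S ξ) = fun ξ => h ξ := funext hh
    rw [e, FT_FTinv S.continuous S.integrable (by rw [e2]; exact h.integrable), hSe]

lemma exists_annularSymbol_kernel (hb : 1 < b) (hcp : cp ≠ 0)
    (hηsm : ContDiff ℝ (⊤ : ℕ∞) η)
    (hηsupp : ∀ ξ : ℝ², (100:ℝ)^2 < ξ.1^2 + ξ.2^2 → η ξ = 0)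
    (hςmsm : ContDiff ℝ (⊤ : ℕ∞) ςm)
    (hςmsupp : ∀ v : ℝ, v ∉ Ioo (-(b * (4:ℝ) ^ (b-1))) (-(b * (4:ℝ)⁻¹ ^ (b-1))) → ςm v = 0)
    (hζsm : ContDiff ℝ (⊤ : ℕ∞) ζ)
    (hζsupp : ∀ ξ : ℝ², (4:ℝ) ≤ ξ.1^2 + ξ.2^2 → ζ ξ = 0)
    (hζone : ∀ ξ : ℝ², ξ.1^2 + ξ.2^2 ≤ ((5:ℝ)/4)^2 → ζ ξ = 1) :
    ∃ C : ℝ, 0 < C ∧ ∀ l : ℕ, (∀ ξ, |annularSymbol cp η ςm ζ l ξ| ≤ C) ∧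
      ∃ K : ℝ² → ℂ, Continuous K ∧ (∀ x, ‖K x‖ * (1 + ‖x‖) ^ 3 ≤ C) ∧
        ∀ ξ, FT K ξ = (annularSymbol cp η ςm ζ l ξ : ℂ) := by
  choose C hC0 hCle K hKc hKle hK using fun l => exists_FT_eq_of_contDiff
    (contDiff_annularSymbol hb hcp hηsm hςmsm hςmsupp hζsm hζone l)
    (hasCompactSupport_annularSymbol (cp := cp) (η := η) (ςm := ςm) hζsupp l)
  have hle : ∀ k < 9, C k ≤ ∑ i ∈ Finset.range 9, C i := fun k hk =>
    single_le_sum (fun i _ => (hC0 i).le) (Finset.mem_range.2 hk)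
  refine ⟨∑ i ∈ Finset.range 9, C i, Finset.sum_pos (fun i _ => hC0 i) (by simp), fun l => ?_⟩
  have hl : annularSymbol cp η ςm ζ l = annularSymbol cp η ςm ζ (min l 8) := by
    rcases le_total l 8 with h | h
    · rw [min_eq_left h]
    · rw [min_eq_right h, annularSymbol_eq_of_le hηsupp hζone h]
  have hlt : min l 8 < 9 := by omega
  simp only [hl]
  exact ⟨fun ξ => (hCle _ ξ).trans (hle _ hlt), K (min l 8), hKc _,
    fun x => (hKle _ x).trans (hle _ hlt), hK _⟩

end annular

lemma lapPdf_scale {a r : ℝ} (hr : 0 < r) (y : ℝ) : r * lapPdf a (r * y) = lapPdf (a / r) y := by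
  unfold lapPdf
  rw [abs_mul, abs_of_pos hr]
  have e : -|y| / (a / r) = -(r * |y|) / a := by
    rw [div_div_eq_mul_div]; ring_nf
  rw [e]
  rcases eq_or_ne a 0 with h | h
  · simp [h]
  · field_simp

/-- Polynomially decaying functions are superpositions of exponentially decaying ones. -/
lemma ofReal_inv_one_add_norm_cube_le (X : ℝ²) :
    ofReal ((1 + ‖X‖) ^ 3)⁻¹ ≤ ofReal (32 * exp 2) *
      ∑' a : ℕ, ofReal ((1 / 2) ^ a) *
        ofReal (lapPdf (2 ^ a) X.1 * lapPdf (2 ^ a) X.2) := by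
  obtain ⟨n, hn1, hn2⟩ := exists_nat_pow_near (show 1 ≤ 1 + ‖X‖ by linarith [norm_nonneg X])
    (one_lt_two (α := ℝ))
  refine le_trans ?_ (mul_le_mul' le_rfl (le_tsum (n + 1)))
  rw [← ofReal_mul (by positivity), ← ofReal_mul (by positivity)]
  refine ofReal_le_ofReal ?_
  set A : ℝ := 2 ^ (n + 1) with hA
  have hA0 : 0 < A := by positivity
  have h1 : A ≤ 2 * (1 + ‖X‖) := by rw [hA, pow_succ]; linarith
  have hX1 : |X.1| ≤ A := by
    have := norm_fst_le X
    rw [norm_eq_abs] at this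
    linarith
  have hX2 : |X.2| ≤ A := by
    have := norm_snd_le X
    rw [norm_eq_abs] at this
    linarith
  have he : ∀ y : ℝ, |y| ≤ A → exp (-1) / (2 * A) ≤ lapPdf A y := fun y hy => by
    unfold lapPdf
    gcongr
    rw [le_div_iff₀ hA0]; linarith
  have hp : (1 / 2 : ℝ) ^ (n + 1) = A⁻¹ := by rw [one_div, inv_pow]
  have hn : 0 < 1 + ‖X‖ := by positivity
  have e2 : exp 2 * (exp (-1) * exp (-1)) = 1 := by
    rw [← exp_add, ← exp_add]; norm_num
  calc ((1 + ‖X‖) ^ 3)⁻¹ ≤ ((A / 2) ^ 3)⁻¹ := by gcongr; linarith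
    _ = 32 * exp 2 * (A⁻¹ * (exp (-1) / (2 * A) * (exp (-1) / (2 * A)))) := by
      have : 32 * exp 2 * (A⁻¹ * (exp (-1) / (2 * A) * (exp (-1) / (2 * A)))) =
        8 * (exp 2 * (exp (-1) * exp (-1))) / A ^ 3 := by field_simp; ring
      rw [this, e2]; field_simp; norm_num
    _ ≤ _ := by
      rw [hp]
      have := mul_le_mul (he _ hX1) (he _ hX2) (by positivity) (lapPdf_nonneg hA0 _)
      gcongr

/-- Decay of the Fourier transform of the measure on the curve. -/
lemma exists_norm_tauHat_le {b cp : ℝ} (cm : ℝ) (hb : 1 < b) (hcp : cp ≠ 0) {χp : ℝ → ℝ}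
    (hχsm : ContDiff ℝ (⊤ : ℕ∞) χp)
    (hχsupp : ∀ t : ℝ, t ∉ Ioo (1/2 : ℝ) 2 → χp t = 0) :
    (∀ ξ : ℝ², tauHat b cp cm χp ξ = ∫ t in (1 / 2 : ℝ)..2,
      Complex.exp (((-(2 * Real.pi * ξ.1) * t + -(2 * Real.pi * (cp * ξ.2)) * t ^ b : ℝ) : ℂ) *
        Complex.I) * (χp t : ℂ)) ∧
    ∃ C : ℝ, 0 < C ∧ ∀ ξ : ℝ², 0 < |ξ.1| + |ξ.2| →
      ‖tauHat b cp cm χp ξ‖ ≤ C * (|ξ.1| + |ξ.2|) ^ (-(1 / 2) : ℝ) := by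
  have heq : ∀ ξ : ℝ², tauHat b cp cm χp ξ = ∫ t in (1 / 2 : ℝ)..2,
      Complex.exp (((-(2 * Real.pi * ξ.1) * t + -(2 * Real.pi * (cp * ξ.2)) * t ^ b : ℝ) : ℂ) *
        Complex.I) * (χp t : ℂ) := by
    intro ξ
    rw [intervalIntegral.integral_of_le (by norm_num), tauHat,
      ← setIntegral_eq_integral_of_forall_compl_eq_zero (s := Ioc (1 / 2 : ℝ) 2) fun t ht => ?_]
    · refine setIntegral_congr_fun measurableSet_Ioc fun t ht => ?_
      have : 0 < t := lt_trans (by norm_num) ht.1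
      simp only [curve, if_pos this]
      congr 4
      ring
    · rw [hχsupp t fun h => ht (Ioo_subset_Ioc_self h)]
      simp
  refine ⟨heq, ?_⟩
  obtain ⟨C, hC0, hC⟩ := exists_norm_curve_oscillatory_le hb
  have hd : Continuous (deriv χp) := hχsm.continuous_deriv (by simp)
  obtain ⟨A, hA⟩ := (isCompact_Icc (a := (1/2:ℝ)) (b := 2)).exists_bound_of_continuousOn
    hχsm.continuous.continuousOn
  obtain ⟨A', hA'⟩ := (isCompact_Icc (a := (1/2:ℝ)) (b := 2)).exists_bound_of_continuousOn
    hd.continuousOn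
  set c : ℝ := min 1 |cp| with hc
  have hc0 : 0 < c := lt_min one_pos (abs_pos.2 hcp)
  have hA0 : 0 ≤ A := (norm_nonneg _).trans (hA 1 (by norm_num))
  have hA'0 : 0 ≤ A' := (norm_nonneg _).trans (hA' 1 (by norm_num))
  refine ⟨C * (A + A' + 1) * c ^ (-(1 / 2) : ℝ), by positivity, fun ξ hξ => ?_⟩
  have hpi : 1 ≤ 2 * Real.pi := by linarith [Real.pi_gt_three]
  have hlow : c * (|ξ.1| + |ξ.2|) ≤ |-(2 * Real.pi * ξ.1)| + |-(2 * Real.pi * (cp * ξ.2))| := by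
    rw [abs_neg, abs_neg, abs_mul (2 * Real.pi) ξ.1, abs_mul (2 * Real.pi) (cp * ξ.2),
      abs_of_pos (by positivity : 0 < 2 * Real.pi), abs_mul cp, mul_add]
    have h1 : c * |ξ.1| ≤ 1 * |ξ.1| := by gcongr; exact min_le_left _ _
    have h2 : c * |ξ.2| ≤ |cp| * |ξ.2| := by gcongr; exact min_le_right _ _
    have h3 : 0 ≤ |cp| * |ξ.2| := by positivity
    nlinarith [abs_nonneg ξ.1]
  rw [heq]
  refine (hC χp (deriv χp) A A' (fun t _ => (hχsm.differentiable (by simp) t).hasDerivAt)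
    hd.continuousOn hA hA' _ _ (lt_of_lt_of_le (by positivity) hlow)).trans ?_
  calc C * (A + A') * _ ≤ C * (A + A' + 1) * (c * (|ξ.1| + |ξ.2|)) ^ (-(1 / 2) : ℝ) := by
        exact mul_le_mul (mul_le_mul_of_nonneg_left (by linarith) hC0.le)
          (Real.rpow_le_rpow_of_nonpos (by positivity) hlow (by norm_num)) (by positivity)
          (by positivity)
    _ = _ := by rw [mul_rpow hc0.le (by positivity)]; ring

/-- The kernel, in the variables of `curveBase`, of the `l`-th piece. -/
def pieceKernel (χp : ℝ → ℝ) (K : ℝ² → ℂ) (l : ℕ) (ω : ℝ × ℝ × ℝ) : ℂ :=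
  (χp ω.1 : ℂ) * (((4:ℝ) ^ l : ℝ) * K ((2:ℝ) ^ l • ω.2))

lemma measurable_pieceKernel {χp : ℝ → ℝ} (hχ : Continuous χp) {K : ℝ² → ℂ} (hK : Continuous K)
    (l : ℕ) : Measurable (pieceKernel χp K l) := by
  unfold pieceKernel
  have h1 := hχ.measurable
  have h2 : Measurable fun ω : ℝ × ℝ × ℝ => K ((2:ℝ) ^ l • ω.2) :=
    (hK.comp (by fun_prop : Continuous fun ω : ℝ × ℝ × ℝ => (2:ℝ) ^ l • ω.2)).measurable
  fun_prop

lemma enorm_pieceKernel_le {χp : ℝ → ℝ} {K : ℝ² → ℂ} {A C : ℝ} (hA : 0 ≤ A) (hC : 0 ≤ C)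
    (hχ : ∀ t, |χp t| ≤ A) (hK : ∀ x, ‖K x‖ * (1 + ‖x‖) ^ 3 ≤ C) (l : ℕ) (ω : ℝ × ℝ × ℝ) :
    ‖pieceKernel χp K l ω‖ₑ ≤ ofReal (A * C * (32 * exp 2)) *
      ∑' a : ℕ, ofReal ((1 / 2) ^ a) *
        ‖lapPair (2 ^ a / 2 ^ l) (2 ^ a / 2 ^ l) ω‖ₑ := by
  have h4 : (4:ℝ) ^ l = 2 ^ l * 2 ^ l := by rw [← mul_pow]; norm_num
  have hl : ∀ a : ℕ, ‖lapPair (2 ^ a / 2 ^ l) (2 ^ a / 2 ^ l) ω‖ₑ = ofReal ((4:ℝ) ^ l) *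
      ofReal (lapPdf (2 ^ a) ((2:ℝ) ^ l • ω.2).1 * lapPdf (2 ^ a) ((2:ℝ) ^ l • ω.2).2) := by
    intro a
    have h0 : 0 < (2:ℝ) ^ a / 2 ^ l := by positivity
    rw [← ofReal_norm, lapPair, norm_real, norm_of_nonneg
      (mul_nonneg (lapPdf_nonneg h0 _) (lapPdf_nonneg h0 _)), ← ofReal_mul (by positivity),
      ← lapPdf_scale (by positivity), ← lapPdf_scale (by positivity), h4]
    congr 1
    simp only [smul_fst, smul_snd, smul_eq_mul]
    ring
  simp only [hl]
  have hKx : ‖K ((2:ℝ) ^ l • ω.2)‖ ≤ C * ((1 + ‖(2:ℝ) ^ l • ω.2‖) ^ 3)⁻¹ := by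
    rw [← div_eq_mul_inv, le_div_iff₀ (by positivity)]; exact hK _
  calc ‖pieceKernel χp K l ω‖ₑ ≤ ofReal (A * (4 ^ l * (C * ((1 + ‖(2:ℝ) ^ l • ω.2‖) ^ 3)⁻¹))) := by
        rw [← ofReal_norm, pieceKernel, norm_mul, norm_mul, norm_real,
          norm_real, norm_of_nonneg (by positivity : (0:ℝ) ≤ 4 ^ l)]
        refine ofReal_le_ofReal ?_
        have := hχ ω.1
        rw [norm_eq_abs]
        gcongr
    _ = ofReal (A * C) * ofReal (4 ^ l) *
          ofReal ((1 + ‖(2:ℝ) ^ l • ω.2‖) ^ 3)⁻¹ := by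
        rw [← ofReal_mul (by positivity), ← ofReal_mul (by positivity)]
        congr 1; ring
    _ ≤ ofReal (A * C) * ofReal (4 ^ l) * (ofReal (32 * exp 2) *
        ∑' a : ℕ, ofReal ((1 / 2) ^ a) * ofReal
          (lapPdf (2 ^ a) ((2:ℝ) ^ l • ω.2).1 * lapPdf (2 ^ a) ((2:ℝ) ^ l • ω.2).2)) :=
        mul_le_mul' le_rfl (ofReal_inv_one_add_norm_cube_le _)
    _ = _ := by
        rw [ofReal_mul (p := A * C) (by positivity)]
        simp only [mul_left_comm _ (ofReal ((4:ℝ) ^ l)), ENNReal.tsum_mul_left]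
        ring

lemma curveLap_univ (b c α β : ℝ) {a a' : ℝ} (ha : 0 < a) (ha' : 0 < a') (hα : 0 < α) (hβ : 0 < β) :
    curveLap b c α β a a' univ ≤ 2 := by
  rw [← lintegral_one, lintegral_curveLap _ _ _ _ _ _ (f := fun _ => 1) measurable_const]
  have := isProbabilityMeasure_lap (mul_pos hα ha)
  have := isProbabilityMeasure_lap (mul_pos hβ ha')
  simp only [lintegral_one, measure_univ, Measure.restrict_apply_univ, volume_Icc]
  rw [show (2:ℝ≥0∞) = ofReal 2 by simp]
  exact ofReal_le_ofReal (by norm_num)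

lemma lintegral_pieceKernel_le {b c α β A C : ℝ} {χp : ℝ → ℝ} {K : ℝ² → ℂ} (hα : 0 < α)
    (hβ : 0 < β) (hA : 0 ≤ A) (hC : 0 ≤ C)
    (hχ : ∀ t, |χp t| ≤ A) (hK : ∀ x, ‖K x‖ * (1 + ‖x‖) ^ 3 ≤ C) (l : ℕ)
    {G : ℝ² → ℝ≥0∞} (hG : Measurable G) (x : ℝ²) :
    ∫⁻ ω, ‖pieceKernel χp K l ω‖ₑ * G (x - curveShift b c α β ω) ∂curveBase ≤
      ofReal (A * C * (32 * exp 2)) * ∑' a : ℕ, ofReal ((1 / 2) ^ a) *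
        subAvg (curveLap b c α β (2 ^ a / 2 ^ l) (2 ^ a / 2 ^ l)) G x := by
  have hY := measurable_curveShift b c α β
  have hm : ∀ a : ℕ, Measurable fun ω => ‖lapPair (2 ^ a / 2 ^ l) (2 ^ a / 2 ^ l) ω‖ₑ *
      G (x - curveShift b c α β ω) := fun a => by
    have := (measurable_lapPair (2 ^ a / 2 ^ l) (2 ^ a / 2 ^ l)).enorm
    fun_prop
  calc _ ≤ ∫⁻ ω, ofReal (A * C * (32 * exp 2)) * ∑' a : ℕ,
        ofReal ((1 / 2) ^ a) * (‖lapPair (2 ^ a / 2 ^ l) (2 ^ a / 2 ^ l) ω‖ₑ *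
          G (x - curveShift b c α β ω)) ∂curveBase := by
        refine lintegral_mono fun ω => ?_
        refine (mul_le_mul' (enorm_pieceKernel_le hA hC hχ hK l ω) le_rfl).trans_eq ?_
        rw [mul_assoc, ← ENNReal.tsum_mul_right]
        simp only [mul_assoc]
    _ = _ := by
        rw [lintegral_const_mul _ (Measurable.ennreal_tsum fun a => (hm a).const_mul _),
          lintegral_tsum fun a => ((hm a).const_mul _).aemeasurable]
        congr 2
        ext a
        rw [lintegral_const_mul _ (hm a), lintegral_lapPair hα hβ (by positivity) (by positivity) hG]

lemma lintegral_enorm_pieceKernel_le {A C : ℝ} {χp : ℝ → ℝ} {K : ℝ² → ℂ} (hA : 0 ≤ A)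
    (hC : 0 ≤ C) (hχ : ∀ t, |χp t| ≤ A) (hK : ∀ x, ‖K x‖ * (1 + ‖x‖) ^ 3 ≤ C) (l : ℕ) :
    ∫⁻ ω, ‖pieceKernel χp K l ω‖ₑ ∂curveBase ≤ ofReal (4 * (A * C * (32 * exp 2))) := by
  have h := lintegral_pieceKernel_le (b := 1) (c := 1) one_pos one_pos hA hC hχ hK l
    (G := fun _ => 1) measurable_const 0
  simp only [mul_one, subAvg, lintegral_one] at h
  refine h.trans ?_
  calc _ ≤ ofReal (A * C * (32 * exp 2)) * ∑' a : ℕ, ofReal ((1 / 2) ^ a) * 2 := by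
        gcongr with a
        exact curveLap_univ _ _ _ _ (by positivity) (by positivity) one_pos one_pos
    _ = _ := by
        rw [ENNReal.tsum_mul_right, ← ENNReal.ofReal_tsum_of_nonneg (fun a => by positivity)
          summable_geometric_two, tsum_geometric_two, mul_comm 4,
          ofReal_mul (q := 4) (mul_nonneg (mul_nonneg hA hC) (by positivity)),
          show (2:ℝ≥0∞) = ofReal 2 by simp, ← ofReal_mul (by norm_num)]
        norm_num

lemma kopSymbol_pieceKernel {b cp : ℝ} (cm : ℝ) (hb : 1 < b) (hcp : cp ≠ 0) {χp : ℝ → ℝ}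
    (hχsm : ContDiff ℝ (⊤ : ℕ∞) χp)
    (hχsupp : ∀ t : ℝ, t ∉ Ioo (1/2 : ℝ) 2 → χp t = 0) (K : ℝ² → ℂ) (l : ℕ) (α β : ℝ)
    (ξ : ℝ²) :
    kopSymbol curveBase (pieceKernel χp K l) (curveShift b cp α β) ξ =
      tauHat b cp cm χp (α * ξ.1, β * ξ.2) * FT K (((2:ℝ) ^ l)⁻¹ • (α * ξ.1, β * ξ.2)) := by
  rw [(exists_norm_tauHat_le cm hb hcp hχsm hχsupp).1,
    intervalIntegral.integral_of_le (by norm_num), ← integral_Icc_eq_integral_Ioc]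
  have hFT : FT K (((2:ℝ) ^ l)⁻¹ • (α * ξ.1, β * ξ.2)) = ∫ X : ℝ²,
      Complex.exp ((((-(2 * Real.pi * (X.1 * (α * ξ.1) + X.2 * (β * ξ.2)))) : ℝ) : ℂ) * Complex.I) *
        (((4:ℝ) ^ l : ℝ) * K ((2:ℝ) ^ l • X)) := by
    have h2 : (2:ℝ) ^ l ≠ 0 := by positivity
    have := Measure.integral_comp_smul (volume : Measure (ℝ²)) (fun x : ℝ² =>
      Complex.exp ((((-(2 * Real.pi * (x.1 * (((2:ℝ) ^ l)⁻¹ * (α * ξ.1)) +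
        x.2 * (((2:ℝ) ^ l)⁻¹ * (β * ξ.2))))) : ℝ) : ℂ) * Complex.I) * K x) ((2:ℝ) ^ l)
    have hfr : Module.finrank ℝ (ℝ²) = 2 := by simp
    rw [hfr, abs_of_pos (by positivity)] at this
    simp only [FT, smul_fst, smul_snd, smul_eq_mul] at this ⊢
    have h4 : ((4:ℝ) ^ l) = (2 ^ l) ^ 2 := by rw [← pow_mul, mul_comm, pow_mul]; norm_num
    have e : ∀ X : ℝ², Complex.exp ((((-(2 * Real.pi * (X.1 * (α * ξ.1) + X.2 * (β * ξ.2)))) : ℝ) : ℂ)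
        * Complex.I) * (((4:ℝ) ^ l : ℝ) * K ((2:ℝ) ^ l • X)) = (((4:ℝ) ^ l : ℝ) : ℂ) *
        (Complex.exp ((((-(2 * Real.pi * (2 ^ l * X.1 * (((2:ℝ) ^ l)⁻¹ * (α * ξ.1)) +
        2 ^ l * X.2 * (((2:ℝ) ^ l)⁻¹ * (β * ξ.2))))) : ℝ) : ℂ) * Complex.I) * K ((2:ℝ) ^ l • X)) := by
      intro X
      have : (2:ℝ) ^ l * X.1 * (((2:ℝ) ^ l)⁻¹ * (α * ξ.1)) + 2 ^ l * X.2 * (((2:ℝ) ^ l)⁻¹ * (β * ξ.2)) =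
        X.1 * (α * ξ.1) + X.2 * (β * ξ.2) := by field_simp
      rw [this]; ring
    simp only [e]
    rw [integral_const_mul, this, h4, real_smul, ← mul_assoc ((((2:ℝ) ^ l) ^ 2 : ℝ) : ℂ), ← Complex.ofReal_mul,
      mul_inv_cancel₀ (by positivity), Complex.ofReal_one, one_mul]
  rw [hFT, ← integral_prod_mul, kopSymbol, curveBase]
  refine integral_congr_ae (ae_of_all _ fun ω => ?_)
  simp only [pieceKernel, curveShift]
  rw [show ∀ A B D E : ℂ, A * B * (D * E) = (A * D) * (B * E) by intros; ring, ← Complex.exp_add,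
    ← add_mul, ← Complex.ofReal_add]
  congr 4
  ring

/-- The operators `A_{j,ℓ}^u` in physical space: a kernel with exponentially localized majorants
whose symbols decay in `ℓ`. -/
lemma exists_Ajl_kernel {b cp : ℝ} (cm : ℝ) (hb : 1 < b) (hcp : cp ≠ 0) {χp : ℝ → ℝ}
    (hχsm : ContDiff ℝ (⊤ : ℕ∞) χp)
    (hχsupp : ∀ t : ℝ, t ∉ Ioo (1/2 : ℝ) 2 → χp t = 0)
    {η : ℝ² → ℝ} (hηsm : ContDiff ℝ (⊤ : ℕ∞) η)
    (hηsupp : ∀ ξ : ℝ², (100:ℝ)^2 < ξ.1^2 + ξ.2^2 → η ξ = 0)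
    {ςm : ℝ → ℝ} (hςmsm : ContDiff ℝ (⊤ : ℕ∞) ςm)
    (hςmsupp : ∀ v : ℝ, v ∉ Ioo (-(b * (4:ℝ) ^ (b-1))) (-(b * (4:ℝ)⁻¹ ^ (b-1))) → ςm v = 0)
    {ζ : ℝ² → ℝ} (hζsm : ContDiff ℝ (⊤ : ℕ∞) ζ)
    (hζsupp : ∀ ξ : ℝ², (4:ℝ) ≤ ξ.1^2 + ξ.2^2 → ζ ξ = 0)
    (hζone : ∀ ξ : ℝ², ξ.1^2 + ξ.2^2 ≤ ((5:ℝ)/4)^2 → ζ ξ = 1) :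
    ∃ C : ℝ, 0 < C ∧ ∀ l : ℕ, ∃ m : ℝ × ℝ × ℝ → ℂ, Measurable m ∧
      ∫⁻ ω, ‖m ω‖ₑ ∂curveBase ≤ ofReal C ∧
      (∀ α β : ℝ, 0 < α → 0 < β → ∀ G : ℝ² → ℝ≥0∞, Measurable G → ∀ x,
        ∫⁻ ω, ‖m ω‖ₑ * G (x - curveShift b cp α β ω) ∂curveBase ≤
          ofReal C * ∑' a : ℕ, ofReal ((1 / 2) ^ a) *
            subAvg (curveLap b cp α β (2 ^ a / 2 ^ l) (2 ^ a / 2 ^ l)) G x) ∧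
      (∀ (α β : ℝ) (ξ : ℝ²), ‖kopSymbol curveBase m (curveShift b cp α β) ξ‖ ≤
        C * (2:ℝ) ^ (-(l / 2) : ℝ)) ∧
      ∀ (j : ℤ) (u : ℝ) (g : SchwartzMap (ℝ²) ℝ) (x : ℝ²),
        Ajl b cp cm χp η ςm ζ j l u g x =
          kop curveBase m (curveShift b cp ((2:ℝ) ^ (-(j:ℝ))) ((2:ℝ) ^ (-((j:ℝ) * b)) * u))
            (fun y => (g y : ℂ)) x := by
  obtain ⟨C₁, hC₁, hK⟩ := exists_annularSymbol_kernel hb hcp hηsm hηsupp hςmsm hςmsupp hζsm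
    hζsupp hζone
  obtain ⟨C₂, hC₂, hτ⟩ := (exists_norm_tauHat_le cm hb hcp hχsm hχsupp).2
  have hχc : Continuous χp := hχsm.continuous
  obtain ⟨A, hA'⟩ := (isCompact_Icc (a := (1/2:ℝ)) (b := 2)).exists_bound_of_continuousOn
    hχc.continuousOn
  have hA0 : 0 ≤ A := (norm_nonneg _).trans (hA' 1 (by norm_num))
  have hA : ∀ t, |χp t| ≤ A := fun t => by
    by_cases ht : t ∈ Ioo (1/2:ℝ) 2
    · exact hA' t (Ioo_subset_Icc_self ht)
    · rw [hχsupp t ht]; simpa using hA0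
  set D : ℝ := A * C₁ * (32 * exp 2) with hD
  have hD0 : 0 ≤ D := by positivity
  refine ⟨4 * D + C₂ * (5 / 8) ^ (-(1 / 2) : ℝ) * C₁, by positivity, fun l => ?_⟩
  obtain ⟨hbd, K, hKc, hKd, hKFT⟩ := hK l
  have hE : 0 ≤ C₂ * (5 / 8 : ℝ) ^ (-(1 / 2) : ℝ) * C₁ := by positivity
  have hm := measurable_pieceKernel (χp := χp) hχc hKc l
  have hfin := lintegral_enorm_pieceKernel_le hA0 hC₁.le hA hKd l
  have hmi : Integrable (pieceKernel χp K l) curveBase :=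
    ⟨hm.aestronglyMeasurable, lt_of_le_of_lt hfin ofReal_lt_top⟩
  refine ⟨pieceKernel χp K l, hm, hfin.trans (ofReal_le_ofReal (by linarith)), ?_, ?_, ?_⟩
  · intro α β hα hβ G hG x
    refine (lintegral_pieceKernel_le hα hβ hA0 hC₁.le hA hKd l hG x).trans
      (mul_le_mul' (ofReal_le_ofReal ?_) le_rfl)
    linarith
  · intro α β ξ
    rw [kopSymbol_pieceKernel cm hb hcp hχsm hχsupp, hKFT, norm_mul, norm_real]
    set X : ℝ² := (α * ξ.1, β * ξ.2)
    have h2 : (0:ℝ) < 2 ^ l := by positivity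
    by_cases h : (((2:ℝ) ^ l)⁻¹ • X).1 ^ 2 + (((2:ℝ) ^ l)⁻¹ • X).2 ^ 2 ≤ (5 / 8) ^ 2
    · rw [annularSymbol_eq_zero_of_le hζone l h]
      simp only [norm_zero, mul_zero]
      positivity
    · have hX : 5 / 8 * 2 ^ l ≤ |X.1| + |X.2| := by
        push Not at h
        simp only [smul_fst, smul_snd, smul_eq_mul] at h
        have e : (((2:ℝ) ^ l)⁻¹ * X.1) ^ 2 + (((2:ℝ) ^ l)⁻¹ * X.2) ^ 2 =
          (X.1 ^ 2 + X.2 ^ 2) / (2 ^ l) ^ 2 := by field_simp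
        rw [e, lt_div_iff₀ (by positivity), ← mul_pow] at h
        refine le_of_lt (lt_of_pow_lt_pow_left₀ 2 (by positivity) (h.trans_le ?_))
        nlinarith [sq_abs X.1, sq_abs X.2, mul_nonneg (abs_nonneg X.1) (abs_nonneg X.2)]
      have h1 : (5 / 8 * (2:ℝ) ^ l) ^ (-(1 / 2) : ℝ) =
          (5 / 8) ^ (-(1 / 2) : ℝ) * 2 ^ (-(l / 2) : ℝ) := by
        rw [mul_rpow (by norm_num) h2.le, ← rpow_natCast, ← rpow_mul (by norm_num)]
        ring_nf
      calc ‖tauHat b cp cm χp X‖ * ‖annularSymbol cp η ςm ζ l (((2:ℝ) ^ l)⁻¹ • X)‖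
          ≤ (C₂ * (5 / 8 * 2 ^ l) ^ (-(1 / 2) : ℝ)) * C₁ := by
            refine mul_le_mul ((hτ X (lt_of_lt_of_le (by positivity) hX)).trans ?_) (hbd _)
              (norm_nonneg _) (by positivity)
            exact mul_le_mul_of_nonneg_left
              (Real.rpow_le_rpow_of_nonpos (by positivity) hX (by norm_num)) hC₂.le
        _ = C₂ * (5 / 8) ^ (-(1 / 2) : ℝ) * C₁ * 2 ^ (-(l / 2) : ℝ) := by rw [h1]; ring
        _ ≤ _ := mul_le_mul_of_nonneg_right (by linarith) (by positivity)
  · intro j u g x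
    set gc : SchwartzMap (ℝ²) ℂ := SchwartzMap.postcompCLM (𝕜 := ℝ) ofRealCLM g with hgc
    have hgc' : ⇑gc = fun y => (g y : ℂ) := by
      ext y
      simp [hgc, SchwartzMap.postcompCLM_apply]
    rw [← hgc', ← FTinv_kopSymbol_mul_FT hm hmi (measurable_curveShift _ _ _ _) gc x, hgc', Ajl]
    congr 1
    ext ξ
    congr 1
    rw [kopSymbol_pieceKernel cm hb hcp hχsm hχsupp, hKFT, dil, ← mul_assoc _ u]
    set X : ℝ² := (2 ^ (-(j:ℝ)) * ξ.1, 2 ^ (-((j:ℝ) * b)) * u * ξ.2)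
    have h2 : (2:ℝ) ^ l ≠ 0 := by positivity
    have e1 : (2:ℝ) ^ (-(l:ℝ)) = ((2:ℝ) ^ l)⁻¹ := by
      rw [rpow_neg (by norm_num), rpow_natCast]
    have e2 : (2:ℝ) ^ (1 - (l:ℝ)) = 2 * ((2:ℝ) ^ l)⁻¹ := by
      rw [sub_eq_add_neg, rpow_add (by norm_num), e1, rpow_one]
    have e3 : (((2:ℝ) ^ l)⁻¹ • X).1 / (cp * (((2:ℝ) ^ l)⁻¹ • X).2) = X.1 / (cp * X.2) := by
      simp only [smul_fst, smul_snd, smul_eq_mul]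
      rw [mul_left_comm cp, mul_div_mul_left _ _ (inv_ne_zero h2)]
    rw [annularSymbol, smul_smul, smul_smul, mul_inv_cancel₀ h2, one_smul, e3, zl, e1, e2, rhoHat]
    push_cast
    ring

lemma rpow_mul_rpow_sub_le {s S a : ℝ} (r : ℝ) (hs : 0 ≤ s) (hsS : s ≤ S) (ha : 0 < a) :
    s ^ a * S ^ (r - a) ≤ S ^ r := by
  rcases (hs.trans hsS).eq_or_lt with h | h
  · have : s = 0 := le_antisymm (by rwa [← h] at hsS) hs
    rw [this, zero_rpow ha.ne', zero_mul]
    exact rpow_nonneg h.le _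
  · calc s ^ a * S ^ (r - a) ≤ S ^ a * S ^ (r - a) := by gcongr
      _ = S ^ r := by rw [← rpow_add h]; ring_nf

lemma sum_rpow_mul_rpow_sub {κ : Type*} (K : Finset κ) {s : κ → ℝ} {S q r : ℝ} (hr : r ≠ 0)
    (hS : 0 ≤ S) (h : ∑ k ∈ K, s k ^ q = S ^ q) :
    ∑ k ∈ K, s k ^ q * S ^ (r - q) = S ^ r := by
  rw [← sum_mul, h]
  rcases hS.eq_or_lt with h0 | h0
  · rw [← h0, zero_rpow hr]
    rcases eq_or_ne q 0 with hq | hq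
    · rw [hq, sub_zero, zero_rpow hr, mul_zero]
    · rw [zero_rpow hq, zero_mul]
  · rw [← rpow_add h0]; ring_nf

lemma rpow_interp_left {s S p q : ℝ} (hs : 0 ≤ s) (hsS : s ≤ S) (hp : 0 < p) (hq : 0 < q) :
    S ^ (1 - p / q) * (s ^ (q / p) * S ^ (1 - q / p)) ^ (p / q) = s := by
  rcases hs.eq_or_lt with h | h
  · rw [← h, zero_rpow (by positivity), zero_mul, zero_rpow (by positivity), mul_zero]
  · have hS : 0 < S := h.trans_le hsS
    rw [mul_rpow (by positivity) (by positivity), ← rpow_mul hs, ← rpow_mul hS.le,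
      mul_left_comm, ← rpow_add hS, show q / p * (p / q) = 1 by field_simp,
      show 1 - p / q + (1 - q / p) * (p / q) = 0 by field_simp; ring]
    simp

lemma rpow_interp_right {s S p p' q : ℝ} (hs : 0 ≤ s) (hsS : s ≤ S) (hpp : p.HolderConjugate p')
    (hpq : p ≤ q) :
    (s ^ q * S ^ (p - 1 - q)) ^ (1 - p / q) * (s ^ (q / p') * S ^ (p - 1 - q / p')) ^ (p / q) =
      s ^ (q - 1) * S ^ (p - q) := by
  have hp := hpp.pos
  have hp' := hpp.symm.pos
  have hp1 := hpp.lt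
  have hq : 0 < q := hp.trans_le hpq
  have e : p / p' = p - 1 := by
    rw [div_eq_mul_inv, ← hpp.one_sub_inv]; field_simp
  rcases hs.eq_or_lt with h | h
  · rw [← h, zero_rpow (x := q / p') (by positivity), zero_mul,
      zero_rpow (x := p / q) (by positivity), mul_zero,
      zero_rpow (x := q - 1) (by linarith), zero_mul]
  · have hS : 0 < S := h.trans_le hsS
    have e1 : q / p' * (p / q) = p - 1 := by rw [← e]; field_simp
    rw [mul_rpow (by positivity) (by positivity), mul_rpow (by positivity) (by positivity),
      ← rpow_mul hs, ← rpow_mul hS.le, ← rpow_mul hs, ← rpow_mul hS.le,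
      mul_mul_mul_comm, ← rpow_add hS, ← rpow_add h, e1]
    congr 2
    · field_simp; ring
    · rw [sub_mul (p - 1) (q / p'), e1]
      field_simp; ring

lemma sum_rpow_inv_rpow {κ : Type*} (K : Finset κ) {s : κ → ℝ} (hs : ∀ k, 0 ≤ s k) {q : ℝ}
    (hq : 0 < q) : ((∑ k ∈ K, s k ^ q) ^ (1 / q)) ^ q = ∑ k ∈ K, s k ^ q := by
  rw [← rpow_mul (sum_nonneg fun k _ => rpow_nonneg (hs k) _), one_div,
    inv_mul_cancel₀ hq.ne', rpow_one]

lemma le_sum_rpow_inv {κ : Type*} (K : Finset κ) {s : κ → ℝ} (hs : ∀ k, 0 ≤ s k) {q : ℝ}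
    (hq : 0 < q) {k : κ} (hk : k ∈ K) : s k ≤ (∑ k ∈ K, s k ^ q) ^ (1 / q) := by
  have h0 : 0 ≤ (∑ k ∈ K, s k ^ q) ^ (1 / q) :=
    rpow_nonneg (sum_nonneg fun k _ => rpow_nonneg (hs k) _) _
  rw [← Real.rpow_le_rpow_iff (hs k) h0 hq, sum_rpow_inv_rpow K hs hq]
  exact single_le_sum (f := fun k => s k ^ q) (fun k _ => rpow_nonneg (hs k) _) hk

lemma sum_rpow_inv_le_sum {κ : Type*} (K : Finset κ) {s : κ → ℝ} (hs : ∀ k, 0 ≤ s k) {q : ℝ}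
    (hq : 1 ≤ q) : (∑ k ∈ K, s k ^ q) ^ (1 / q) ≤ ∑ k ∈ K, s k := by
  have h0 : 0 ≤ ∑ k ∈ K, s k := sum_nonneg fun k _ => hs k
  have hq0 : 0 < q := by linarith
  rw [← Real.rpow_le_rpow_iff (rpow_nonneg
    (sum_nonneg fun k _ => rpow_nonneg (hs k) _) _) h0 hq0, sum_rpow_inv_rpow K hs hq0]
  have h1 : ∀ k ∈ K, s k ^ q ≤ s k * (∑ k ∈ K, s k) ^ (q - 1) := fun k hk => by
    rcases (hs k).eq_or_lt with h | h
    · rw [← h, zero_rpow hq0.ne', zero_mul]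
    · rw [show s k ^ q = s k * s k ^ (q - 1) by
        rw [← rpow_one_add' h.le (by linarith)]; ring_nf]
      have : s k ≤ ∑ k ∈ K, s k := single_le_sum (f := s) (fun k _ => hs k) hk
      gcongr
  refine (sum_le_sum h1).trans_eq ?_
  rw [← sum_mul]
  rw [← rpow_one_add' h0 (by linarith)]; ring_nf

lemma ofReal_sum_rpow_inv {κ : Type*} (K : Finset κ) {f : κ → ℂ} {q : ℝ} (hq : 0 < q) :
    ofReal ((∑ k ∈ K, ‖f k‖ ^ q) ^ (1 / q)) = (∑ k ∈ K, ‖f k‖ₑ ^ q) ^ (1 / q) := by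
  rw [← ofReal_rpow_of_nonneg (sum_nonneg fun k _ => by positivity) (by positivity),
    ofReal_sum_of_nonneg fun k _ => by positivity]
  simp only [← ofReal_rpow_of_nonneg (norm_nonneg _) hq.le, ofReal_norm]

lemma enorm_le_ofReal {E : Type*} [SeminormedAddGroup E] {z : E} {a : ℝ} (h : ‖z‖ ≤ a) :
    ‖z‖ₑ ≤ ofReal a := by
  rw [← ofReal_norm]; exact ofReal_le_ofReal h

lemma norm_sum_integral_mul_le {κ : Type*} (K : Finset κ) {h f : κ → ℝ² → ℂ} {R : ℝ}
    (hR : 0 ≤ R) (H : ∑ k ∈ K, ∫⁻ x, ‖h k x‖ₑ * ‖f k x‖ₑ ≤ ofReal R) :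
    ‖∑ k ∈ K, ∫ x, h k x * f k x‖ ≤ R := by
  rw [← ofReal_le_ofReal_iff hR, ofReal_norm]
  refine ((enorm_sum_le _ _).trans (sum_le_sum fun k _ => ?_)).trans H
  refine (enorm_integral_le_lintegral_enorm _).trans_eq ?_
  simp only [enorm_mul]

lemma rpow_mul_rpow_rpow {s S a c r : ℝ} (hs : 0 ≤ s) (hS : 0 ≤ S) :
    (s ^ a * S ^ c) ^ r = s ^ (a * r) * S ^ (c * r) := by
  rw [mul_rpow (by positivity) (by positivity), ← rpow_mul hs, ← rpow_mul hS]

/-- Interpolation between an `ℓ^p`-valued estimate for oscillatory operators and an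
`ℓ^∞`-valued estimate for their positive majorants, on the ball `B`. -/
lemma setLIntegral_lq_kop_le {κ ι Ω : Type*} [MeasurableSpace Ω] (μ : Measure Ω) [SFinite μ]
    (K : Finset κ) (J : Finset ι) (π : κ → ι) 
    {m : κ → Ω → ℂ} {Y : κ → Ω → ℝ²}
    (hm : ∀ k, Measurable (m k)) (hmi : ∀ k, Integrable (m k) μ) (hY : ∀ k, Measurable (Y k))
    {p p' q : ℝ} (hpp : p.HolderConjugate p') (hpq : p ≤ q) {N₀ N₁ : ℝ} (hN₀ : 0 ≤ N₀)
    (hN₁ : 0 ≤ N₁)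
    (H₀ : ∀ (G : ℝ² → ℝ≥0∞) (d : κ → ℝ² → ℝ≥0∞), Measurable G → (∀ k, Measurable (d k)) →
      ∑ k ∈ K, ∫⁻ x, d k x * ∫⁻ ω, ‖m k ω‖ₑ * G (x - Y k ω) ∂μ ≤
        ofReal N₀ * (lpN G p * lpN (fun x => ∑ k ∈ K, d k x) p'))
    (H₁ : ∀ (g : ι → ℝ² → ℂ) (d : κ → ℝ² → ℝ≥0∞), (∀ i, Measurable (g i)) →
      (∀ i, Integrable (g i)) → (∃ M, ∀ i x, ‖g i x‖ ≤ M) → (∀ k, Measurable (d k)) →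
      (∀ k ∈ K, lpN (d k) p' ≠ ∞) →
      ∑ k ∈ K, ∫⁻ x, d k x * ‖kop μ (m k) (Y k) (g (π k)) x‖ₑ ≤ ofReal N₁ *
        ((∑ i ∈ J, ∫⁻ x, ‖g i x‖ₑ ^ p) ^ (1 / p) * (∑ k ∈ K, ∫⁻ x, d k x ^ p') ^ (1 / p')))
    {g : ι → ℝ² → ℂ} (hg : ∀ i, Measurable (g i)) (hgi : ∀ i, Integrable (g i))
    {M : ℝ} (hgM : ∀ i x, ‖g i x‖ ≤ M) (hgJ : ∀ i ∉ J, ∀ x, g i x = 0)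
    {B : Set (ℝ²)} (hB : MeasurableSet B) (hBf : volume B ≠ ∞) :
    (∫⁻ x in B, ofReal ((∑ k ∈ K, ‖kop μ (m k) (Y k) (g (π k)) x‖ ^ q) ^ (1 / q)) ^ p) ^
        (1 / p) ≤
      ofReal (N₀ ^ (1 - p / q) * N₁ ^ (p / q)) *
        lpN (fun x => ofReal ((∑ i ∈ J, ‖g i x‖ ^ q) ^ (1 / q))) p := by
  have hp := hpp.pos
  have hp1 := hpp.lt
  have hp' := hpp.symm.pos
  have hq : 0 < q := hp.trans_le hpq
  have hpp1 : (p - 1) * p' = p := hpp.sub_one_mul_conj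
  obtain ⟨A, hA, hA'⟩ : ∃ A : κ → ℝ² → ℂ, (∀ k ∈ K, A k = kop μ (m k) (Y k) (g (π k))) ∧
      ∀ k ∉ K, A k = 0 :=
    ⟨fun k => if k ∈ K then kop μ (m k) (Y k) (g (π k)) else 0, fun k hk => if_pos hk,
      fun k hk => if_neg hk⟩
  set S : ℝ² → ℝ := fun x => (∑ k ∈ K, ‖A k x‖ ^ q) ^ (1 / q) with hS
  set G : ℝ² → ℝ := fun x => (∑ i ∈ J, ‖g i x‖ ^ q) ^ (1 / q) with hG
  have hSS : ∀ x, (∑ k ∈ K, ‖kop μ (m k) (Y k) (g (π k)) x‖ ^ q) ^ (1 / q) = S x := fun x => by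
    simp only [hS]
    congr 1
    exact sum_congr rfl fun k hk => by rw [hA k hk]
  simp only [hSS]
  have hAm : ∀ k, Measurable (A k) := fun k => by
    by_cases hk : k ∈ K
    · rw [hA k hk]; exact measurable_kop (hm k) (hY k) (hg _)
    · rw [hA' k hk]; exact measurable_const
  have hSm : Measurable S := by
    have := fun k => (hAm k).norm
    fun_prop
  have hGm : Measurable G := by
    have := fun i => (hg i).norm
    fun_prop
  have hS0 : ∀ x, 0 ≤ S x := fun x =>
    rpow_nonneg (sum_nonneg fun k _ => by positivity) _
  have hG0 : ∀ x, 0 ≤ G x := fun x =>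
    rpow_nonneg (sum_nonneg fun k _ => by positivity) _
  have hSq : ∀ x, ∑ k ∈ K, ‖A k x‖ ^ q = S x ^ q := fun x =>
    (sum_rpow_inv_rpow K (fun k => norm_nonneg _) hq).symm
  have hGq : ∀ x, ∑ i ∈ J, ‖g i x‖ ^ q = G x ^ q := fun x =>
    (sum_rpow_inv_rpow J (fun k => norm_nonneg _) hq).symm
  have hAS : ∀ k x, ‖A k x‖ ≤ S x := fun k x => by
    by_cases hk : k ∈ K
    · exact le_sum_rpow_inv K (fun k => norm_nonneg (A k x)) hq hk
    · rw [hA' k hk, Pi.zero_apply, norm_zero]; exact hS0 x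
  have hgG : ∀ i x, ‖g i x‖ ≤ G x := fun i x => by
    by_cases hi : i ∈ J
    · exact le_sum_rpow_inv J (fun k => norm_nonneg (g k x)) hq hi
    · rw [hgJ i hi x, norm_zero]; exact hG0 x
  have hSM : ∃ D, 0 ≤ D ∧ ∀ x, S x ≤ D := by
    have hb : ∀ k ∈ K, ∀ x, ‖A k x‖ ≤ |(∫ ω, ‖m k ω‖ ∂μ) * M| := fun k hk x => by
      rw [hA k hk]; exact (norm_kop_le (hmi k) (hgM _) x).trans (le_abs_self _)
    refine ⟨∑ k ∈ K, |(∫ ω, ‖m k ω‖ ∂μ) * M|, sum_nonneg fun k _ => abs_nonneg _,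
      fun x => ?_⟩
    exact (sum_rpow_inv_le_sum K (fun k => norm_nonneg (A k x)) (hp1.le.trans hpq)).trans
      (sum_le_sum fun k hk => hb k hk x)
  obtain ⟨D, hD0, hD⟩ := hSM
  have hGs : ∀ x, G x ≤ ∑ i ∈ J, ‖g i x‖ := fun x =>
    sum_rpow_inv_le_sum J (fun k => norm_nonneg (g k x)) (hp1.le.trans hpq)
  obtain ⟨D', hD'0, hD'⟩ : ∃ D', 0 ≤ D' ∧ ∀ x, G x ≤ D' :=
    ⟨∑ i ∈ J, |M|, sum_nonneg fun k _ => abs_nonneg _, fun x => (hGs x).trans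
      (sum_le_sum fun k _ => (hgM k x).trans (le_abs_self M))⟩
  have hGi : Integrable G := by
    refine (integrable_finsetSum J fun i _ => (hgi i).norm).mono' hGm.aestronglyMeasurable
      (ae_of_all _ fun x => ?_)
    rw [norm_of_nonneg (hG0 x)]
    exact hGs x
  have hGpi : Integrable fun x => G x ^ p := by
    refine (hGi.mul_const (D' ^ (p - 1))).mono' (hGm.pow_const p).aestronglyMeasurable
      (ae_of_all _ fun x => ?_)
    rw [norm_of_nonneg (rpow_nonneg (hG0 x) _)]
    have : G x ^ p = G x * G x ^ (p - 1) := by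
      rw [← rpow_one_add' (hG0 x) (by linarith)]; ring_nf
    rw [this]
    exact mul_le_mul_of_nonneg_left (Real.rpow_le_rpow (hG0 x) (hD' x) (by linarith)) (hG0 x)
  have hΓ : lpN (fun x => ofReal (G x)) p = ofReal ((∫ x, G x ^ p) ^ (1 / p)) := by
    have := lpN_ofReal_rpow hG0 hp hGpi
    simpa only [div_self hp.ne', rpow_one] using this
  set F : ℝ² → ℝ := B.indicator S with hF
  have hFm : Measurable F := hSm.indicator hB
  have hF0 : ∀ x, 0 ≤ F x := fun x => indicator_nonneg (fun x _ => hS0 x) x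
  have hFB : ∀ x, x ∉ B → F x = 0 := fun x hx => indicator_of_notMem hx _
  have hFD : ∀ x, F x ≤ D := fun x => by
    by_cases hx : x ∈ B
    · rw [hF, indicator_of_mem hx]; exact hD x
    · rw [hFB x hx]; exact hD0
  have hFi : ∀ r : ℝ, 0 < r → Integrable fun x => F x ^ r := fun r hr =>
    integrable_rpow_of_bounded (s := r) hFm hF0 hFD hB hBf hFB hr
  obtain ⟨s, hs⟩ : ∃ s : κ → ℝ² → ℝ, ∀ k, s k = B.indicator fun x => ‖A k x‖ := ⟨_, fun _ => rfl⟩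
  have hsm : ∀ k, Measurable (s k) := fun k => by
    rw [hs]; exact (hAm k).norm.indicator hB
  have hs0 : ∀ k x, 0 ≤ s k x := fun k x => by
    rw [hs]; exact indicator_nonneg (fun x _ => norm_nonneg _) x
  have hsF : ∀ k x, s k x ≤ F x := fun k x => by
    rw [hs, hF]; exact indicator_le_indicator (hAS k x)
  have hsq : ∀ x, ∑ k ∈ K, s k x ^ q = F x ^ q := fun x => by
    by_cases hx : x ∈ B
    · simp only [hs, hF, indicator_of_mem hx]; exact hSq x
    · simp only [hs, hF, indicator_of_notMem hx, zero_rpow hq.ne', Finset.sum_const_zero]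
  set T : ℝ := ∫ x, F x ^ p with hT
  have hT0 : 0 ≤ T := integral_nonneg fun x => rpow_nonneg (hF0 x) _
  have hTF : ∫⁻ x, ofReal (F x ^ p) = ofReal T :=
    (ofReal_integral_eq_lintegral_ofReal (hFi p hp)
      (ae_of_all _ fun x => rpow_nonneg (hF0 x) _)).symm
  have hTS : ∫⁻ x in B, ofReal (S x) ^ p = ofReal T := by
    rw [← hTF, ← lintegral_indicator hB]
    refine lintegral_congr fun x => ?_
    by_cases hx : x ∈ B
    · rw [indicator_of_mem hx, hF, indicator_of_mem hx, ofReal_rpow_of_nonneg (hS0 x) hp.le]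
    · rw [indicator_of_notMem hx, hFB x hx, zero_rpow hp.ne', ENNReal.ofReal_zero]
  set Γ : ℝ := (∫ x, G x ^ p) ^ (1 / p) with hΓ'
  have hΓ0 : 0 ≤ Γ := rpow_nonneg (integral_nonneg fun x => rpow_nonneg (hG0 x) _) _
  have hGT : ∫⁻ x, ofReal (G x ^ p) = ofReal (∫ x, G x ^ p) :=
    (ofReal_integral_eq_lintegral_ofReal hGpi
      (ae_of_all _ fun x => rpow_nonneg (hG0 x) _)).symm
  rw [hTS, hΓ, ofReal_rpow_of_nonneg hT0 (by positivity), ← ofReal_mul (by positivity)]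
  refine ofReal_le_ofReal ?_
  have hX0 : 0 ≤ T ^ (1 / p') := by positivity
  have key : T ≤ (N₀ * (Γ * T ^ (1 / p'))) ^ (1 - p / q) * (N₁ * (Γ * T ^ (1 / p'))) ^ (p / q) := by
    have hpi' : p / p' = p - 1 := by rw [div_eq_iff hp'.ne', hpp1]
    have hFX : lpN (fun x => ofReal (F x ^ (p - 1))) p' = ofReal (T ^ (1 / p')) := by
      rw [← hpi']; exact lpN_ofReal_rpow hF0 hp' (hFi p hp)
    have hsin : ∀ k x (a : ℝ), 0 < a → s k x ^ a * F x ^ (p - 1 - a) ≤ F x ^ (p - 1) :=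
      fun k x a ha => rpow_mul_rpow_sub_le _ (hs0 k x) (hsF k x) ha
    have hci : ∀ k (a : ℝ), 0 < a → Integrable fun x => s k x ^ a * F x ^ (p - 1 - a) :=
      fun k a ha => (hFi (p - 1) (by linarith)).mono'
        (((hsm k).pow_const _).mul (hFm.pow_const _)).aestronglyMeasurable
        (ae_of_all _ fun x => by
          rw [norm_of_nonneg (mul_nonneg (rpow_nonneg (hs0 k x) _)
            (rpow_nonneg (hF0 x) _))]
          exact hsin k x a ha)
    have hc0 : ∀ k x (a c : ℝ), 0 ≤ s k x ^ a * F x ^ c := fun k x a c =>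
      mul_nonneg (rpow_nonneg (hs0 k x) _) (rpow_nonneg (hF0 x) _)
    have ha0 : ∀ i x (a c : ℝ), 0 ≤ ‖g i x‖ ^ a * G x ^ c := fun k x a c =>
      mul_nonneg (rpow_nonneg (norm_nonneg _) _) (rpow_nonneg (hG0 x) _)
    have haG : ∀ i x, ‖g i x‖ ^ (q / p) * G x ^ (1 - q / p) ≤ G x := fun i x => by
      have := rpow_mul_rpow_sub_le 1 (norm_nonneg _) (hgG i x) (by positivity : 0 < q / p)
      rwa [rpow_one] at this
    have hfin := norm_sum_integral_kop_le μ K π hm hmi hY (a₀ := fun _ => G)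
      (a₁ := fun i x => ‖g i x‖ ^ (q / p) * G x ^ (1 - q / p))
      (c₀ := fun k x => s k x ^ q * F x ^ (p - 1 - q))
      (c₁ := fun k x => s k x ^ (q / p') * F x ^ (p - 1 - q / p'))
      (fun _ => hGm) (fun i => ((hg i).norm.pow_const _).mul (hGm.pow_const _))
      (fun k => ((hsm k).pow_const _).mul (hFm.pow_const _))
      (fun k => ((hsm k).pow_const _).mul (hFm.pow_const _))
      (fun _ x => hG0 x) (fun i x => ha0 i x _ _) (fun k x => hc0 k x _ _) (fun k x => hc0 k x _ _)
      (M := D') (fun _ x => hD' x) (fun i x => (haG i x).trans (hD' x))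
      (fun k => hci k q hq) (fun k => hci k (q / p') (by positivity))
      (N₀ := N₀ * (Γ * T ^ (1 / p'))) (N₁ := N₁ * (Γ * T ^ (1 / p'))) (t := p / q)
      (by positivity) ((div_le_one hq).2 hpq) ?_ ?_ (g := g)
      (h := fun k x => (starRingEnd ℂ) (B.indicator (A k) x) * ((s k x ^ (q - 2) * F x ^ (p - q) : ℝ) : ℂ))
      hg ?_ ?_ ?_
    · refine hfin.trans' ?_
      have hint : ∀ k ∈ K, Integrable fun x => s k x ^ q * F x ^ (p - q) := fun k _ =>
        (hFi p hp).mono' (((hsm k).pow_const _).mul (hFm.pow_const _)).aestronglyMeasurable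
          (ae_of_all _ fun x => by
            rw [norm_of_nonneg (hc0 k x _ _)]
            exact rpow_mul_rpow_sub_le _ (hs0 k x) (hsF k x) hq)
      have hI : ∑ k ∈ K, ∫ x, (starRingEnd ℂ) (B.indicator (A k) x) *
          ((s k x ^ (q - 2) * F x ^ (p - q) : ℝ) : ℂ) * kop μ (m k) (Y k) (g (π k)) x = (T : ℂ) := by
        have h1 : ∀ k ∈ K, ∫ x, (starRingEnd ℂ) (B.indicator (A k) x) *
            ((s k x ^ (q - 2) * F x ^ (p - q) : ℝ) : ℂ) * kop μ (m k) (Y k) (g (π k)) x =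
            ((∫ x, s k x ^ q * F x ^ (p - q) : ℝ) : ℂ) := fun k hk => by
          rw [← integral_complex_ofReal, ← hA k hk]
          refine integral_congr_ae (ae_of_all _ fun x => ?_)
          by_cases hx : x ∈ B
          · have e1 : s k x = ‖A k x‖ := by rw [hs, indicator_of_mem hx]
            simp only [indicator_of_mem hx]
            rw [mul_right_comm, conj_mul', ← Complex.ofReal_pow, ← Complex.ofReal_mul, e1,
              ← mul_assoc, ← rpow_natCast, ← rpow_add' (norm_nonneg _) (by norm_num; exact hq.ne')]
            norm_num
          · have e1 : s k x = 0 := by rw [hs, indicator_of_notMem hx]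
            simp only [indicator_of_notMem hx, e1, zero_rpow hq.ne']
            simp
        rw [sum_congr rfl h1, ← ofReal_sum, ← integral_finsetSum K hint]
        congr 2
        ext x
        exact sum_rpow_mul_rpow_sub K hp.ne' (hF0 x) (hsq x)
      rw [hI, norm_real]
      exact le_abs_self T
    · intro g' h' hg' hh' hg'G hh'c
      refine norm_sum_integral_mul_le K (by positivity) ?_
      have h1 := H₀ (fun x => ofReal (G x))
        (fun k x => ofReal (s k x ^ q * F x ^ (p - 1 - q))) hGm.ennreal_ofReal
        fun k => (((hsm k).pow_const _).mul (hFm.pow_const _)).ennreal_ofReal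
      have e1 : ∀ x, ∑ k ∈ K, ofReal (s k x ^ q * F x ^ (p - 1 - q)) =
          ofReal (F x ^ (p - 1)) := fun x => by
        rw [← ofReal_sum_of_nonneg fun k _ => hc0 k x _ _,
          sum_rpow_mul_rpow_sub K (by linarith) (hF0 x) (hsq x)]
      simp only [e1] at h1
      rw [hFX, hΓ, ← ofReal_mul hΓ0, ← ofReal_mul hN₀] at h1
      refine (sum_le_sum fun k _ => lintegral_mono fun x => ?_).trans h1
      refine mul_le_mul' (enorm_le_ofReal (hh'c k x)) ((enorm_kop_le x).trans ?_)
      exact lintegral_mono fun ω => mul_le_mul' le_rfl (enorm_le_ofReal (hg'G _ _))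
    · intro g' h' hg' hh' hg'G hh'c
      refine norm_sum_integral_mul_le K (by positivity) ?_
      have e1 : ∀ k x, ofReal (s k x ^ (q / p') * F x ^ (p - 1 - q / p')) ^ p' =
          ofReal (s k x ^ q * F x ^ (p - q)) := fun k x => by
        rw [ofReal_rpow_of_nonneg (hc0 k x _ _) hp'.le,
          rpow_mul_rpow_rpow (hs0 k x) (hF0 x), sub_mul, hpp1, div_mul_cancel₀ _ hp'.ne']
      have e2 : ∑ k ∈ K, ∫⁻ x, ofReal (s k x ^ (q / p') * F x ^ (p - 1 - q / p')) ^ p' =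
          ofReal T := by
        simp only [e1]
        have hmeas : ∀ k ∈ K, Measurable fun x => ofReal (s k x ^ q * F x ^ (p - q)) :=
          fun k _ => (((hsm k).pow_const _).mul (hFm.pow_const _)).ennreal_ofReal
        rw [← lintegral_finsetSum _ hmeas, ← hTF]
        refine lintegral_congr fun x => ?_
        rw [← ofReal_sum_of_nonneg fun k _ => hc0 k x _ _,
          sum_rpow_mul_rpow_sub K hp.ne' (hF0 x) (hsq x)]
      have e3 : ∑ i ∈ J, ∫⁻ x, ‖g' i x‖ₑ ^ p ≤ ofReal (∫ x, G x ^ p) := by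
        rw [← hGT, ← lintegral_finsetSum _ fun i _ => (hg' i).enorm.pow_const _]
        refine lintegral_mono fun x => ?_
        rw [← sum_rpow_mul_rpow_sub J hp.ne' (hG0 x) (hGq x),
          ofReal_sum_of_nonneg fun k _ => ha0 k x _ _]
        refine sum_le_sum fun i _ => ?_
        refine (rpow_le_rpow (enorm_le_ofReal (hg'G i x)) hp.le).trans_eq ?_
        rw [ofReal_rpow_of_nonneg (ha0 i x _ _) hp.le,
          rpow_mul_rpow_rpow (norm_nonneg _) (hG0 x), sub_mul, div_mul_cancel₀ _ hp.ne', one_mul]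
      have h1 := H₁ g' (fun k x => ofReal (s k x ^ (q / p') * F x ^ (p - 1 - q / p'))) hg'
        (fun i => hGi.mono' (hg' i).aestronglyMeasurable
          (ae_of_all _ fun x => (hg'G i x).trans (haG i x)))
        ⟨D', fun i x => ((hg'G i x).trans (haG i x)).trans (hD' x)⟩
        (fun k => (((hsm k).pow_const _).mul (hFm.pow_const _)).ennreal_ofReal)
        fun k hk => by
          refine (ENNReal.rpow_lt_top_of_nonneg (by positivity) ?_).ne
          refine (lt_of_le_of_lt ?_ (ofReal_lt_top (r := T))).ne
          rw [← e2]
          exact single_le_sum (f := fun k => ∫⁻ x, ofReal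
            (s k x ^ (q / p') * F x ^ (p - 1 - q / p')) ^ p') (fun _ _ => zero_le) hk
      refine ((sum_le_sum fun k _ => lintegral_mono fun x =>
        mul_le_mul' (enorm_le_ofReal (hh'c k x)) le_rfl).trans h1).trans ?_
      rw [e2, ofReal_rpow_of_nonneg hT0 (by positivity), ofReal_mul hN₁,
        ofReal_mul hΓ0, hΓ', ← ofReal_rpow_of_nonneg
          (integral_nonneg fun x => rpow_nonneg (hG0 x) _) (by positivity)]
      exact mul_le_mul' le_rfl (mul_le_mul' (rpow_le_rpow e3 (by positivity)) le_rfl)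
    · intro k
      have h1 : Measurable (B.indicator (A k)) := (hAm k).indicator hB
      have h2 := hsm k
      exact (continuous_conj.measurable.comp h1).mul (measurable_ofReal.comp
        ((h2.pow_const _).mul (hFm.pow_const _)))
    · intro i x
      exact (rpow_interp_left (norm_nonneg _) (hgG i x) hp hq).ge
    · intro k x
      have e1 : ‖B.indicator (A k) x‖ = s k x := by rw [hs, norm_indicator_eq_indicator_norm]
      rw [rpow_interp_right (hs0 k x) (hsF k x) hpp hpq, norm_mul, RCLike.norm_conj, e1,
        norm_real, norm_of_nonneg (hc0 k x _ _), ← mul_assoc,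
        ← rpow_one_add' (hs0 k x) (by linarith)]
      ring_nf
      exact le_rfl
  rcases hT0.eq_or_lt with h | h
  · rw [← h, zero_rpow (by positivity)]; positivity
  have hX : 0 < T ^ (1 / p') := by positivity
  have e : T = T ^ (1 / p) * T ^ (1 / p') := by
    rw [← rpow_add h, one_div, one_div, hpp.inv_add_inv_eq_one, rpow_one]
  have hΓX : 0 ≤ Γ * T ^ (1 / p') := by positivity
  have e2 : (N₀ * (Γ * T ^ (1 / p'))) ^ (1 - p / q) * (N₁ * (Γ * T ^ (1 / p'))) ^ (p / q) =
      N₀ ^ (1 - p / q) * N₁ ^ (p / q) * Γ * T ^ (1 / p') := by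
    rw [mul_rpow hN₀ hΓX, mul_rpow hN₁ hΓX, mul_mul_mul_comm,
      ← rpow_add' hΓX (by norm_num)]
    norm_num
    ring
  rw [e2] at key
  refine le_of_mul_le_mul_right ?_ hX
  rwa [← e]

lemma lpN_le_of_setLIntegral_le {F : ℝ² → ℝ≥0∞} {p : ℝ} (hp : 0 < p) {X : ℝ≥0∞}
    (h : ∀ N : ℕ, (∫⁻ x in closedBall (0 : ℝ²) N, F x ^ p) ^ (1 / p) ≤ X) :
    lpN F p ≤ X := by
  have h1 : ∫⁻ x, F x ^ p = ⨆ N : ℕ, ∫⁻ x in closedBall (0 : ℝ²) N, F x ^ p := by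
    rw [← setLIntegral_iUnion_of_directed _ (Monotone.directed_le fun m n hmn =>
      Metric.closedBall_subset_closedBall (cast_le.2 hmn)), Metric.iUnion_closedBall_nat,
      setLIntegral_univ]
  rw [lpN, one_div, rpow_inv_le_iff hp, h1]
  exact iSup_le fun N => (rpow_inv_le_iff hp).1 (one_div p ▸ h N)

section lqkop

variable {κ ι Ω : Type*} [MeasurableSpace Ω] (μ : Measure Ω) [SFinite μ]
  (K : Finset κ) (J : Finset ι) (π : κ → ι) {m : κ → Ω → ℂ} {Y : κ → Ω → ℝ²} {p p' : ℝ}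

/-- `ℓ^∞` bound with constant `N₀` for the positive majorants of the operators `kop μ (m k) (Y k)`,
in dual form. -/
def KopSupBound (m : κ → Ω → ℂ) (Y : κ → Ω → ℝ²) (p p' N₀ : ℝ) : Prop :=
  ∀ (G : ℝ² → ℝ≥0∞) (d : κ → ℝ² → ℝ≥0∞), Measurable G → (∀ k, Measurable (d k)) →
    ∑ k ∈ K, ∫⁻ x, d k x * ∫⁻ ω, ‖m k ω‖ₑ * G (x - Y k ω) ∂μ ≤
      ofReal N₀ * (lpN G p * lpN (fun x => ∑ k ∈ K, d k x) p')

/-- `ℓ^p` bound with constant `N₁` for the operators `kop μ (m k) (Y k)`, in dual form. -/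
def KopDiagBound (m : κ → Ω → ℂ) (Y : κ → Ω → ℝ²) (p p' N₁ : ℝ) : Prop :=
  ∀ (g : ι → ℝ² → ℂ) (d : κ → ℝ² → ℝ≥0∞), (∀ i, Measurable (g i)) →
    (∀ i, Integrable (g i)) → (∃ M, ∀ i x, ‖g i x‖ ≤ M) → (∀ k, Measurable (d k)) →
    (∀ k ∈ K, lpN (d k) p' ≠ ∞) →
    ∑ k ∈ K, ∫⁻ x, d k x * ‖kop μ (m k) (Y k) (g (π k)) x‖ₑ ≤ ofReal N₁ *
      ((∑ i ∈ J, ∫⁻ x, ‖g i x‖ₑ ^ p) ^ (1 / p) * (∑ k ∈ K, ∫⁻ x, d k x ^ p') ^ (1 / p'))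

lemma lpN_lq_kop_le (hm : ∀ k, Measurable (m k)) (hmi : ∀ k, Integrable (m k) μ)
    (hY : ∀ k, Measurable (Y k)) {q : ℝ} (hpp : p.HolderConjugate p') (hpq : p ≤ q) {N₀ N₁ : ℝ}
    (hN₀ : 0 ≤ N₀) (hN₁ : 0 ≤ N₁) (H₀ : KopSupBound μ K m Y p p' N₀)
    (H₁ : KopDiagBound μ K J π m Y p p' N₁)
    {g : ι → ℝ² → ℂ} (hg : ∀ i, Measurable (g i)) (hgi : ∀ i, Integrable (g i))
    {M : ℝ} (hgM : ∀ i x, ‖g i x‖ ≤ M) (hgJ : ∀ i ∉ J, ∀ x, g i x = 0) :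
    lpN (fun x => (∑ k ∈ K, ‖kop μ (m k) (Y k) (g (π k)) x‖ₑ ^ q) ^ (1 / q)) p ≤
      ofReal (N₀ ^ (1 - p / q) * N₁ ^ (p / q)) *
        lpN (fun x => (∑ i ∈ J, ‖g i x‖ₑ ^ q) ^ (1 / q)) p := by
  have hq : 0 < q := hpp.pos.trans_le hpq
  refine lpN_le_of_setLIntegral_le hpp.pos fun N => ?_
  have := setLIntegral_lq_kop_le μ K J π hm hmi hY hpp hpq hN₀ hN₁ H₀ H₁ hg hgi hgM hgJ
    (B := closedBall 0 N) isClosed_closedBall.measurableSet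
    measure_closedBall_lt_top.ne
  simpa only [ofReal_sum_rpow_inv _ hq] using this

lemma lpN_iSup_kop_le (hm : ∀ k, Measurable (m k)) (hmi : ∀ k, Integrable (m k) μ)
    (hY : ∀ k, Measurable (Y k)) (hpp : p.HolderConjugate p') {N₀ N₁ : ℝ}
    (hN₀ : 0 < N₀) (hN₁ : 0 < N₁) (H₀ : KopSupBound μ K m Y p p' N₀)
    (H₁ : KopDiagBound μ K J π m Y p p' N₁)
    {g : ι → ℝ² → ℂ} (hg : ∀ i, Measurable (g i)) (hgi : ∀ i, Integrable (g i))
    {M : ℝ} (hgM : ∀ i x, ‖g i x‖ ≤ M) (hgJ : ∀ i ∉ J, ∀ x, g i x = 0) :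
    lpN (fun x => ⨆ k ∈ K, ‖kop μ (m k) (Y k) (g (π k)) x‖ₑ) p ≤
      ofReal N₀ * lpN (fun x => ⨆ i ∈ J, ‖g i x‖ₑ) p := by
  have hp := hpp.pos
  set X := lpN (fun x => ⨆ i ∈ J, ‖g i x‖ₑ) p with hX
  set c : ℝ := J.card + 1
  have hc : 0 < c := by positivity
  have hGm : Measurable fun x => ⨆ i ∈ J, ‖g i x‖ₑ :=
    Measurable.biSup _ J.countable_toSet fun i _ => (hg i).enorm
  have key : ∀ q : ℝ, p ≤ q → lpN (fun x => ⨆ k ∈ K, ‖kop μ (m k) (Y k) (g (π k)) x‖ₑ) p ≤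
      ofReal (N₀ ^ (1 - p / q) * N₁ ^ (p / q) * c ^ (1 / q)) * X := fun q hpq => by
    have hq : 0 < q := hp.trans_le hpq
    have h1 := lpN_lq_kop_le μ K J π hm hmi hY hpp hpq hN₀.le hN₁.le H₀ H₁ hg hgi hgM hgJ
    refine ((lpN_mono hp fun x => ?_).trans h1).trans ?_
    · refine iSup₂_le fun k hk => ?_
      rw [one_div, ENNReal.le_rpow_inv_iff hq]
      exact single_le_sum (f := fun k => ‖kop μ (m k) (Y k) (g (π k)) x‖ₑ ^ q)
        (fun _ _ => zero_le) hk
    · rw [ofReal_mul (p := N₀ ^ (1 - p / q) * N₁ ^ (p / q)) (by positivity), mul_assoc]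
      refine mul_le_mul' le_rfl ?_
      rw [hX, ← lpN_const_mul _ hp hGm]
      refine lpN_mono hp fun x => ?_
      rw [one_div, rpow_inv_le_iff hq, mul_rpow_of_nonneg _ _ hq.le,
        ← ofReal_rpow_of_nonneg hc.le (by positivity), ← ENNReal.rpow_mul,
        inv_mul_cancel₀ hq.ne', ENNReal.rpow_one]
      refine (Finset.sum_le_card_nsmul J _ ((⨆ i ∈ J, ‖g i x‖ₑ) ^ q) fun i hi => ?_).trans ?_
      · exact rpow_le_rpow (le_iSup₂ (f := fun i (_ : i ∈ J) => ‖g i x‖ₑ) i hi) hq.le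
      · rw [nsmul_eq_mul]
        refine mul_le_mul' ?_ le_rfl
        rw [← ofReal_natCast]
        exact ofReal_le_ofReal (by simp [c])
  rcases eq_or_ne X ∞ with hX' | hX'
  · rw [hX', mul_top (by simpa using hN₀)]; exact le_top
  refine ge_of_tendsto (f := fun q : ℝ => ofReal (N₀ ^ (1 - p / q) * N₁ ^ (p / q) *
    c ^ (1 / q)) * X) (x := atTop) ?_ (eventually_ge_atTop p |>.mono key)
  refine ENNReal.Tendsto.mul_const ?_ (Or.inr hX')
  refine ENNReal.tendsto_ofReal ?_
  have h0 : ∀ a : ℝ, Tendsto (fun q : ℝ => a / q) atTop (𝓝 0) := fun a =>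
    tendsto_const_nhds.div_atTop tendsto_id
  have h1 : ∀ x : ℝ, 0 < x → ∀ {f : ℝ → ℝ} {l : ℝ}, Tendsto f atTop (𝓝 l) →
      Tendsto (fun q => x ^ f q) atTop (𝓝 (x ^ l)) := fun x hx f l hf =>
    tendsto_const_nhds.rpow hf (Or.inl hx.ne')
  have := ((h1 N₀ hN₀ ((h0 p).const_sub 1)).mul (h1 N₁ hN₁ (h0 p))).mul (h1 c hc (h0 1))
  simpa using this

end lqkop

section diag

variable {Ω : Type*} [MeasurableSpace Ω] {μ : Measure Ω} [SFinite μ] {m : Ω → ℂ} {Y : Ω → ℝ²}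
  {p p' N₀ N₁ : ℝ} {g : ℝ² → ℂ}

lemma lintegral_majorant_eq (hm : Measurable m) (hY : Measurable Y) {G : ℝ² → ℝ≥0∞}
    (hG : Measurable G) :
    ∫⁻ x, ∫⁻ ω, ‖m ω‖ₑ * G (x - Y ω) ∂μ = (∫⁻ ω, ‖m ω‖ₑ ∂μ) * ∫⁻ x, G x := by
  rw [lintegral_lintegral_swap (by fun_prop), ← lintegral_mul_const _ hm.enorm]
  refine lintegral_congr fun ω => ?_
  rw [lintegral_const_mul _ (by fun_prop), lintegral_sub_right_eq_self G]

lemma lintegral_mul_kop_le_of_support (hm : Measurable m) (hmi : Integrable m μ) (hY : Measurable Y)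
    (hpp : p.HolderConjugate p') (hp2 : 2 ≤ p') (hN₀ : 0 ≤ N₀) (hN₁ : 0 ≤ N₁)
    (H₀ : ∫⁻ ω, ‖m ω‖ₑ ∂μ ≤ ofReal N₀) (H₁ : ∀ ξ, ‖kopSymbol μ m Y ξ‖ ≤ N₁)
    {h : ℝ² → ℝ} (hg : Measurable g) (hh : Measurable h)
    {B : Set (ℝ²)} (hB : MeasurableSet B) (hBf : volume B ≠ ∞) {M : ℝ} (hgM : ∀ x, ‖g x‖ ≤ M)
    (hh0 : ∀ x, 0 ≤ h x) (hhM : ∀ x, h x ≤ M) (hgB : ∀ x ∉ B, g x = 0) (hhB : ∀ x ∉ B, h x = 0) :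
    ∫⁻ x, ofReal (h x) * ‖kop μ m Y g x‖ₑ ≤ ofReal (N₀ ^ (1 - 2 / p') * N₁ ^ (2 / p')) *
      (lpN (fun x => ‖g x‖ₑ) p * lpN (fun x => ofReal (h x)) p') := by
  have hp := hpp.pos
  have hp' := hpp.symm.pos
  have hinv : 1 / p = 1 - 1 / p' := by
    have := hpp.inv_add_inv_eq_one
    rw [one_div, one_div]; linarith
  set A := kop μ m Y g with hA
  have hAm : Measurable A := measurable_kop hm hY hg
  have hgi : ∀ r : ℝ, 0 < r → Integrable fun x => ‖g x‖ ^ r := fun r hr =>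
    integrable_rpow_of_bounded hg.norm (fun x => norm_nonneg _) hgM hB hBf
      (fun x hx => by rw [hgB x hx, norm_zero]) hr
  have hhi : ∀ r : ℝ, 0 < r → Integrable fun x => h x ^ r := fun r hr =>
    integrable_rpow_of_bounded hh hh0 hhM hB hBf hhB hr
  have hM0 : 0 ≤ M := (norm_nonneg _).trans (hgM 0)
  set P := ∫ x, ‖g x‖ ^ p with hP
  set Q := ∫ x, h x ^ p' with hQ
  have hP0 : 0 ≤ P := integral_nonneg fun x => rpow_nonneg (norm_nonneg _) _
  have hQ0 : 0 ≤ Q := integral_nonneg fun x => rpow_nonneg (hh0 x) _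
  have e1 : lpN (fun x => ‖g x‖ₑ) p = ofReal (P ^ (1 / p)) := by
    have := lpN_ofReal_rpow (fun x => norm_nonneg (g x)) hp (hgi p hp)
    simpa only [div_self hp.ne', rpow_one, ofReal_norm] using this
  have e2 : lpN (fun x => ofReal (h x)) p' = ofReal (Q ^ (1 / p')) := by
    have := lpN_ofReal_rpow hh0 hp' (hhi p' hp')
    simpa only [div_self hp'.ne', rpow_one] using this
  have e3 : lpN (fun x => ofReal (‖g x‖ ^ (p / 2))) 2 = ofReal (P ^ (1 / 2 : ℝ)) :=
    lpN_ofReal_rpow (fun x => norm_nonneg (g x)) two_pos (hgi p hp)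
  have e4 : lpN (fun x => ofReal (h x ^ (p' / 2))) 2 = ofReal (Q ^ (1 / 2 : ℝ)) :=
    lpN_ofReal_rpow hh0 two_pos (hhi p' hp')
  have e5 : ∫⁻ x, ofReal (‖g x‖ ^ p) = ofReal P :=
    (ofReal_integral_eq_lintegral_ofReal (hgi p hp)
      (ae_of_all _ fun x => rpow_nonneg (norm_nonneg _) _)).symm
  have hAi : Integrable fun x => h x * ‖A x‖ := by
    refine ((hhi 1 one_pos).mul_const ((∫ ω, ‖m ω‖ ∂μ) * M)).mono'
      (hh.mul hAm.norm).aestronglyMeasurable (ae_of_all _ fun x => ?_)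
    rw [norm_of_nonneg (mul_nonneg (hh0 x) (norm_nonneg _)), rpow_one]
    exact mul_le_mul_of_nonneg_left (norm_kop_le hmi hgM x) (hh0 x)
  have e6 : ∫⁻ x, ofReal (h x) * ‖A x‖ₑ = ofReal (∫ x, h x * ‖A x‖) := by
    rw [ofReal_integral_eq_lintegral_ofReal hAi
      (ae_of_all _ fun x => mul_nonneg (hh0 x) (norm_nonneg _))]
    exact lintegral_congr fun x => by rw [ofReal_mul (hh0 x), ofReal_norm]
  rw [e6, e1, e2, ← ofReal_mul (by positivity), ← ofReal_mul (by positivity)]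
  refine ofReal_le_ofReal ?_
  set H : ℝ² → ℂ := fun x => (h x : ℂ) * ((starRingEnd ℂ) (A x) / (‖A x‖ : ℂ)) with hH
  have hHm : Measurable H := (measurable_ofReal.comp hh).mul
    ((continuous_conj.measurable.comp hAm).div (measurable_ofReal.comp hAm.norm))
  have hHh : ∀ x, ‖H x‖ ≤ h x := fun x => by
    rw [hH, norm_mul, norm_div, RCLike.norm_conj, norm_real, norm_real, norm_norm,
      norm_of_nonneg (hh0 x)]
    exact mul_le_of_le_one_right (hh0 x) (div_self_le_one _)
  have hHA : ∀ x, H x * A x = ((h x * ‖A x‖ : ℝ) : ℂ) := fun x => by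
    rcases eq_or_ne (A x) 0 with h0 | h0
    · simp [h0]
    · have : (‖A x‖ : ℂ) ≠ 0 := by simpa using h0
      simp only [hH]
      rw [mul_assoc, div_mul_eq_mul_div, conj_mul', Complex.ofReal_mul]
      field_simp
  have hfin := norm_sum_integral_kop_le μ {()} (fun _ : Unit => ()) (m := fun _ => m)
    (Y := fun _ => Y) (fun _ => hm) (fun _ => hmi) (fun _ => hY)
    (a₀ := fun _ x => ‖g x‖ ^ p) (a₁ := fun _ x => ‖g x‖ ^ (p / 2))
    (c₀ := fun _ => B.indicator fun _ => (1 : ℝ)) (c₁ := fun _ x => h x ^ (p' / 2))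
    (fun _ => hg.norm.pow_const _) (fun _ => hg.norm.pow_const _)
    (fun _ => measurable_const.indicator hB) (fun _ => hh.pow_const _)
    (fun _ x => rpow_nonneg (norm_nonneg _) _) (fun _ x => rpow_nonneg (norm_nonneg _) _)
    (fun _ => indicator_nonneg fun _ _ => zero_le_one) (fun _ x => rpow_nonneg (hh0 x) _)
    (M := max (M ^ p) (M ^ (p / 2)))
    (fun _ x => (Real.rpow_le_rpow (norm_nonneg _) (hgM x) hp.le).trans (le_max_left _ _))
    (fun _ x => (Real.rpow_le_rpow (norm_nonneg _) (hgM x) (by positivity)).trans (le_max_right _ _))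
    (fun _ => (integrable_indicator_iff hB).2 (integrableOn_const hBf))
    (fun _ => hhi _ (by positivity)) (N₀ := N₀ * P)
    (N₁ := N₁ * (P ^ (1 / 2 : ℝ) * Q ^ (1 / 2 : ℝ))) (t := 2 / p') (by positivity)
    ((div_le_one hp').2 hp2) ?_ ?_ (g := fun _ => g) (h := fun _ => H) (fun _ => hg) (fun _ => hHm)
    ?_ ?_
  · rw [sum_singleton, integral_congr_ae (ae_of_all _ hHA), integral_complex_ofReal,
      norm_real] at hfin
    refine (le_abs_self _).trans (hfin.trans_eq ?_)
    rw [mul_rpow hN₀ hP0, mul_rpow hN₁ (by positivity), mul_rpow (by positivity)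
      (by positivity), ← rpow_mul hP0, ← rpow_mul hQ0, hinv]
    rw [show (1 / 2 : ℝ) * (2 / p') = 1 / p' by ring,
      show P ^ (1 - 1 / p') = P ^ (1 - 2 / p') * P ^ (1 / p') by
        rw [← rpow_add' hP0 (by rw [show 1 - 2 / p' + 1 / p' = 1 / p by rw [hinv]; ring]; positivity)]
        congr 1; ring]
    ring
  · intro g' h' hg' hh' hga hhc
    refine norm_sum_integral_mul_le _ (by positivity) ?_
    rw [sum_singleton, ofReal_mul hN₀, ← e5]
    refine le_trans ?_ (mul_le_mul' H₀ le_rfl)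
    rw [← lintegral_majorant_eq hm hY (hg.norm.pow_const _).ennreal_ofReal]
    refine lintegral_mono fun x => (mul_le_of_le_one_left' ?_).trans ((enorm_kop_le x).trans ?_)
    · refine (enorm_le_ofReal (hhc () x)).trans ?_
      rw [← ofReal_one]
      exact ofReal_le_ofReal (indicator_le_self' (fun _ _ => zero_le_one) x)
    · exact lintegral_mono fun ω => mul_le_mul' le_rfl (enorm_le_ofReal (hga () _))
  · intro g' h' hg' hh' hga hhc
    refine norm_sum_integral_mul_le _ (by positivity) ?_
    have h1 := sum_lintegral_mul_kop_le (μ := μ) {()} (m := fun _ => m) (Y := fun _ => Y)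
      (fun _ => hm) (fun _ => hmi) (fun _ => hY) (hg' ())
      ((hgi (p / 2) (by positivity)).mono' (hg' ()).aestronglyMeasurable (ae_of_all _ (hga ())))
      (M := M ^ (p / 2))
      (fun x => (hga () x).trans (Real.rpow_le_rpow (norm_nonneg _) (hgM x) (by positivity)))
      (N := ofReal N₁) (fun _ => 1) (fun ξ => by
        rw [sum_singleton, one_rpow, one_mul]
        exact rpow_le_rpow (enorm_le_ofReal (H₁ ξ)) (by norm_num))
      (d := fun _ x => ‖h' () x‖ₑ) fun _ => (hh' ()).enorm
    simp only [sum_singleton, one_mul] at h1 ⊢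
    refine h1.trans ?_
    rw [ofReal_mul hN₁, ofReal_mul (by positivity), ← e3, ← e4, mul_left_comm,
      mul_comm (lpN (fun x => ofReal (‖g x‖ ^ (p / 2))) 2)]
    exact mul_le_mul' le_rfl (mul_le_mul' (lpN_mono two_pos fun x => enorm_le_ofReal (hhc () x))
      (lpN_mono two_pos fun x => enorm_le_ofReal (hga () x)))
  · intro _ x
    rw [← rpow_mul (norm_nonneg _), ← rpow_mul (norm_nonneg _),
      ← rpow_add' (norm_nonneg _)]
    · rw [show p * (1 - 2 / p') + p / 2 * (2 / p') = p * (1 / p) by rw [hinv]; ring,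
        mul_one_div_cancel hp.ne', rpow_one]
    · rw [show p * (1 - 2 / p') + p / 2 * (2 / p') = p * (1 / p) by rw [hinv]; ring,
        mul_one_div_cancel hp.ne']
      exact one_ne_zero
  · intro _ x
    refine (hHh x).trans ?_
    by_cases hx : x ∈ B
    · rw [indicator_of_mem hx, Real.one_rpow, one_mul, ← rpow_mul (hh0 x),
        show p' / 2 * (2 / p') = 1 by field_simp, rpow_one]
    · rw [hhB x hx]
      exact mul_nonneg (rpow_nonneg (indicator_nonneg (fun _ _ => zero_le_one) _) _)
        (rpow_nonneg (rpow_nonneg le_rfl _) _)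

lemma lintegral_mul_kop_le (hm : Measurable m) (hmi : Integrable m μ) (hY : Measurable Y)
    (hpp : p.HolderConjugate p') (hp2 : 2 ≤ p') (hN₀ : 0 ≤ N₀) (hN₁ : 0 ≤ N₁)
    (H₀ : ∫⁻ ω, ‖m ω‖ₑ ∂μ ≤ ofReal N₀) (H₁ : ∀ ξ, ‖kopSymbol μ m Y ξ‖ ≤ N₁)
    {d : ℝ² → ℝ≥0∞} (hg : Measurable g) (hd : Measurable d) {M : ℝ} (hgM : ∀ x, ‖g x‖ ≤ M)
    (hdf : lpN d p' ≠ ∞) :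
    ∫⁻ x, d x * ‖kop μ m Y g x‖ₑ ≤ ofReal (N₀ ^ (1 - 2 / p') * N₁ ^ (2 / p')) *
      (lpN (fun x => ‖g x‖ₑ) p * lpN d p') := by
  have hp' := hpp.symm.pos
  have hdt : ∀ᵐ x, d x < ∞ := by
    have : ∫⁻ x, d x ^ p' ≠ ∞ := by
      rw [← lpN_rpow _ hp']; exact rpow_ne_top_of_nonneg hp'.le hdf
    filter_upwards [ae_lt_top (hd.pow_const p') this] with x hx
    exact (ENNReal.rpow_lt_top_iff_of_pos hp').1 hx
  set B : ℕ → Set (ℝ²) := fun N => closedBall 0 N with hBdef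
  have hB : ∀ N, MeasurableSet (B N) := fun N => isClosed_closedBall.measurableSet
  have hBx : ∀ x, ∀ᶠ N in atTop, x ∈ B N := fun x => by
    filter_upwards [eventually_ge_atTop ⌈‖x‖⌉₊] with N hN
    exact mem_closedBall_zero_iff.2 (Nat.ceil_le.1 hN)
  set h : ℕ → ℝ² → ℝ := fun N => (B N).indicator fun x => min (d x).toReal N with hh
  set G : ℕ → ℝ² → ℂ := fun N => (B N).indicator g with hG
  have hhm : ∀ N, Measurable (h N) := fun N => (hd.ennreal_toReal.min measurable_const).indicator (hB N)
  have hGm : ∀ N, Measurable (G N) := fun N => hg.indicator (hB N)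
  have hGg : ∀ N x, ‖G N x‖ ≤ ‖g x‖ := fun N x => norm_indicator_le_norm_self _ _
  have hhd : ∀ N x, ofReal (h N x) ≤ d x := fun N x => by
    by_cases hx : x ∈ B N
    · simp only [hh, indicator_of_mem hx]
      exact (ofReal_le_ofReal (min_le_left _ _)).trans ENNReal.ofReal_toReal_le
    · simp only [hh, indicator_of_notMem hx, ENNReal.ofReal_zero, zero_le]
  have hlim : ∀ᵐ x, Tendsto (fun N => ofReal (h N x) * ‖kop μ m Y (G N) x‖ₑ) atTop
      (𝓝 (d x * ‖kop μ m Y g x‖ₑ)) := by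
    filter_upwards [hdt] with x hx
    have h1 : Tendsto (fun N => kop μ m Y (G N) x) atTop (𝓝 (kop μ m Y g x)) := by
      refine tendsto_integral_of_dominated_convergence (fun ω => ‖m ω‖ * M)
        (fun N => (hm.mul ((hGm N).comp (measurable_const.sub hY))).aestronglyMeasurable)
        (hmi.norm.mul_const M) (fun N => ae_of_all _ fun ω => ?_) (ae_of_all _ fun ω => ?_)
      · rw [norm_mul]
        exact mul_le_mul_of_nonneg_left ((hGg N _).trans (hgM _)) (norm_nonneg _)
      · refine tendsto_const_nhds.congr' ?_
        filter_upwards [hBx (x - Y ω)] with N hN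
        simp only [hG, indicator_of_mem hN]
    have h2 : ∀ᶠ N in atTop, d x = ofReal (h N x) := by
      filter_upwards [hBx x, eventually_ge_atTop ⌈(d x).toReal⌉₊] with N h3 h4
      simp only [hh, indicator_of_mem h3]
      rw [min_eq_left (Nat.ceil_le.1 h4), ofReal_toReal hx.ne]
    have h3 := ENNReal.Tendsto.const_mul (a := d x) h1.enorm (Or.inr hx.ne)
    exact h3.congr' (h2.mono fun N hN => by rw [hN])
  have hkm : ∀ N, Measurable (kop μ m Y (G N)) := fun N => measurable_kop hm hY (hGm N)
  calc ∫⁻ x, d x * ‖kop μ m Y g x‖ₑ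
      = ∫⁻ x, liminf (fun N => ofReal (h N x) * ‖kop μ m Y (G N) x‖ₑ) atTop :=
        lintegral_congr_ae (hlim.mono fun x hx => hx.liminf_eq.symm)
    _ ≤ liminf (fun N => ∫⁻ x, ofReal (h N x) * ‖kop μ m Y (G N) x‖ₑ) atTop :=
        lintegral_liminf_le fun N => (hhm N).ennreal_ofReal.mul (hkm N).enorm
    _ ≤ _ := by
        refine liminf_le_of_le (by isBoundedDefault) fun b hb => ?_
        obtain ⟨N, hN⟩ := hb.exists
        refine hN.trans ((lintegral_mul_kop_le_of_support hm hmi hY hpp hp2 hN₀ hN₁ H₀ H₁ (hGm N)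
          (hhm N) (hB N) measure_closedBall_lt_top.ne (M := max M N)
          (fun x => ((hGg N x).trans (hgM x)).trans (le_max_left _ _)) (fun x => ?_) (fun x => ?_)
          (fun x hx => indicator_of_notMem hx _) fun x hx => indicator_of_notMem hx _).trans ?_)
        · exact indicator_nonneg (fun x _ => le_min toReal_nonneg N.cast_nonneg) x
        · refine (indicator_le_self' (fun _ _ => ?_) x).trans ((min_le_right _ _).trans (le_max_right _ _))
          exact le_min toReal_nonneg N.cast_nonneg
        · exact mul_le_mul' le_rfl (mul_le_mul' (lpN_mono hpp.pos fun x =>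
            enorm_le_iff_norm_le.2 (hGg N x)) (lpN_mono hp' (hhd N)))

end diag

lemma lpN_majorant_le {Ω : Type*} [MeasurableSpace Ω] {μ : Measure Ω} {m : Ω → ℂ}
    (hm : Measurable m) {Y : Ω → ℝ²} (hY : Measurable Y) {N₀ : ℝ}
    (H₀ : ∫⁻ ω, ‖m ω‖ₑ ∂μ ≤ ofReal N₀) {G : ℝ² → ℝ≥0∞} (hG : Measurable G)
    {p : ℝ} (hp : 1 ≤ p) :
    lpN (fun x => ∫⁻ ω, ‖m ω‖ₑ * G (x - Y ω) ∂μ) p ≤ ofReal N₀ * lpN G p := by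
  set ν := μ.withDensity fun ω => ‖m ω‖ₑ
  have hν : ν univ = ∫⁻ ω, ‖m ω‖ₑ ∂μ := by rw [withDensity_apply _ .univ, setLIntegral_univ]
  have : IsFiniteMeasure ν := ⟨by rw [hν]; exact H₀.trans_lt ofReal_lt_top⟩
  have hYm : Measurable fun ω => -Y ω := hY.neg
  have e : ∀ x, ∫⁻ ω, ‖m ω‖ₑ * G (x - Y ω) ∂μ = addAvg (ν.map fun ω => -Y ω) G x := fun x => by
    rw [addAvg, lintegral_map (by fun_prop) hYm,
      lintegral_withDensity_eq_lintegral_mul _ hm.enorm (by fun_prop)]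
    simp only [Pi.mul_apply, sub_eq_add_neg]
  simp only [e]
  refine (lpN_addAvg_le _ hG hp).trans (mul_le_mul' ?_ le_rfl)
  rw [Measure.map_apply hYm .univ, preimage_univ, hν]
  exact H₀

section diagBound

variable {κ ι Ω : Type*} [MeasurableSpace Ω] {μ : Measure Ω} [SFinite μ] {K : Finset κ}
  {J : Finset ι} {π : κ → ι} {m : Ω → ℂ} {Y : κ → Ω → ℝ²} {v : κ → ℝ} {p p' : ℝ}

lemma kop_const_mul (c : ℂ) (Y : Ω → ℝ²) (g : ℝ² → ℂ) (x : ℝ²) :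
    kop μ (fun ω => c * m ω) Y g x = c * kop μ m Y g x := by
  simp only [kop, mul_assoc, integral_const_mul]

lemma kopDiagBound_of_symbol (hm : Measurable m) (hY : ∀ k, Measurable (Y k))
    (hpp : p.HolderConjugate p') (hp2 : 2 ≤ p') {N₀ N₁ W : ℝ} (hN₀ : 0 ≤ N₀) (hN₁ : 0 ≤ N₁)
    (hW : 0 ≤ W) (H₀ : ∫⁻ ω, ‖m ω‖ₑ ∂μ ≤ ofReal N₀)
    (H₁ : ∀ k ξ, ‖kopSymbol μ m (Y k) ξ‖ ≤ N₁) (hv : ∀ k, 0 ≤ v k) (hπ : ∀ k ∈ K, π k ∈ J)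
    (hvW : ∀ i ∈ J, ∑ k ∈ K with π k = i, v k ^ p ≤ W ^ p) :
    KopDiagBound μ K J π (fun k ω => (v k : ℂ) * m ω) Y p p'
      (N₀ ^ (1 - 2 / p') * N₁ ^ (2 / p') * W) := by
  intro g d hg _ hM hd hdf
  obtain ⟨M, hM⟩ := hM
  have hp := hpp.pos
  have hp' := hpp.symm.pos
  have hmi : Integrable m μ :=
    ⟨hm.aestronglyMeasurable, hasFiniteIntegral_iff_enorm.2 (H₀.trans_lt ofReal_lt_top)⟩
  set c := N₀ ^ (1 - 2 / p') * N₁ ^ (2 / p') with hc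
  have hc0 : 0 ≤ c := by positivity
  set a : ι → ℝ≥0∞ := fun i => lpN (fun x => ‖g i x‖ₑ) p with ha
  have h1 : ∀ k ∈ K, ∫⁻ x, d k x * ‖kop μ (fun ω => (v k : ℂ) * m ω) (Y k) (g (π k)) x‖ₑ ≤
      ofReal c * ((ofReal (v k) * a (π k)) * lpN (d k) p') := fun k hk => by
    have hkm : Measurable (kop μ m (Y k) (g (π k))) := measurable_kop hm (hY k) (hg _)
    have e : ∀ x, d k x * ‖kop μ (fun ω => (v k : ℂ) * m ω) (Y k) (g (π k)) x‖ₑ =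
        ofReal (v k) * (d k x * ‖kop μ m (Y k) (g (π k)) x‖ₑ) := fun x => by
      rw [kop_const_mul, enorm_mul, ← ofReal_norm (v k : ℂ), norm_real,
        norm_of_nonneg (hv k), mul_left_comm]
    simp only [e]
    have hdk := hd k
    rw [lintegral_const_mul _ (by fun_prop)]
    refine (mul_le_mul' le_rfl (lintegral_mul_kop_le hm hmi (hY k) hpp hp2 hN₀ hN₁ H₀ (H₁ k)
      (hg (π k)) (hd k) (hM _) (hdf k hk))).trans_eq ?_
    ring
  refine (sum_le_sum h1).trans ?_
  rw [← mul_sum, ofReal_mul hc0, mul_assoc]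
  refine mul_le_mul' le_rfl ?_
  refine (ENNReal.inner_le_Lp_mul_Lq K _ _ hpp).trans ?_
  rw [← mul_assoc]
  refine mul_le_mul' ?_ (by simp only [lpN_rpow _ hp', le_rfl])
  rw [one_div, rpow_inv_le_iff hp, mul_rpow_of_nonneg _ _ hp.le,
    ← ENNReal.rpow_mul, inv_mul_cancel₀ hp.ne', ENNReal.rpow_one,
    ← Finset.sum_fiberwise_of_maps_to hπ, mul_sum]
  refine sum_le_sum fun i hi => ?_
  have h2 : ∀ k ∈ K.filter (fun k => π k = i), (ofReal (v k) * a (π k)) ^ p =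
      ofReal (v k ^ p) * ∫⁻ x, ‖g i x‖ₑ ^ p := fun k hk => by
    rw [(mem_filter.1 hk).2, mul_rpow_of_nonneg _ _ hp.le, ha, lpN_rpow _ hp,
      ofReal_rpow_of_nonneg (hv k) hp.le]
  rw [sum_congr rfl h2, ← sum_mul, ← ofReal_sum_of_nonneg fun k _ =>
    rpow_nonneg (hv k) _, ofReal_rpow_of_nonneg hW hp.le]
  exact mul_le_mul' (ofReal_le_ofReal (hvW i hi)) le_rfl

lemma kopSupBound_of_integrable (hm : Measurable m) (hY : ∀ k, Measurable (Y k))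
    (hpp : p.HolderConjugate p') {N₀ W : ℝ} (hN₀ : 0 ≤ N₀)
    (hW : 0 ≤ W) (H₀ : ∫⁻ ω, ‖m ω‖ₑ ∂μ ≤ ofReal N₀) (hv : ∀ k, 0 ≤ v k)
    (hvW : ∑ k ∈ K, v k ^ p ≤ W ^ p) :
    KopSupBound μ K (fun k ω => (v k : ℂ) * m ω) Y p p' (N₀ * W) := by
  intro G d hG hd
  have hp := hpp.pos
  set F : κ → ℝ² → ℝ≥0∞ := fun k x => ∫⁻ ω, ‖(v k : ℂ) * m ω‖ₑ * G (x - Y k ω) ∂μ with hF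
  have e : ∀ k x, F k x = ofReal (v k) * ∫⁻ ω, ‖m ω‖ₑ * G (x - Y k ω) ∂μ := fun k x => by
    have := hY k
    rw [← lintegral_const_mul _ (by fun_prop)]
    refine lintegral_congr fun ω => ?_
    rw [enorm_mul, ← ofReal_norm (v k : ℂ), norm_real,
        norm_of_nonneg (hv k), mul_assoc]
  have hBm : ∀ k, Measurable fun x => ∫⁻ ω, ‖m ω‖ₑ * G (x - Y k ω) ∂μ := fun k => by
    have := hY k
    fun_prop
  have hFm : ∀ k, Measurable (F k) := fun k => by
    rw [show F k = _ from funext (e k)]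
    exact (hBm k).const_mul _
  set S : ℝ² → ℝ≥0∞ := fun x => (∑ k ∈ K, F k x ^ p) ^ (1 / p) with hS
  have hSm : Measurable S := by fun_prop
  calc ∑ k ∈ K, ∫⁻ x, d k x * F k x = ∫⁻ x, ∑ k ∈ K, d k x * F k x :=
        (lintegral_finsetSum _ fun k _ => (hd k).mul (hFm k)).symm
    _ ≤ ∫⁻ x, S x * ∑ k ∈ K, d k x := by
        refine lintegral_mono fun x => ?_
        rw [mul_sum]
        refine sum_le_sum fun k hk => ?_
        rw [mul_comm]
        refine mul_le_mul' ?_ le_rfl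
        rw [hS, one_div, ENNReal.le_rpow_inv_iff hp]
        exact single_le_sum (f := fun k => F k x ^ p) (fun _ _ => zero_le) hk
    _ ≤ lpN S p * lpN (fun x => ∑ k ∈ K, d k x) p' :=
        lintegral_mul_le_lpN hpp hSm (Finset.measurable_fun_sum _ fun k _ => hd k)
    _ ≤ _ := by
        rw [← mul_assoc]
        refine mul_le_mul' ?_ le_rfl
        rw [← rpow_le_rpow_iff hp, lpN_rpow _ hp]
        have e1 : ∀ x, S x ^ p = ∑ k ∈ K, F k x ^ p := fun x => by
          rw [hS, ← ENNReal.rpow_mul, one_div_mul_cancel hp.ne', ENNReal.rpow_one]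
        simp only [e1]
        rw [lintegral_finsetSum _ fun k _ => (hFm k).pow_const _]
        have e2 : ∀ k ∈ K, ∫⁻ x, F k x ^ p ≤
            ofReal (v k ^ p) * (ofReal N₀ * lpN G p) ^ p := fun k _ => by
          rw [← lpN_rpow _ hp, show F k = _ from funext (e k), lpN_const_mul _ hp (hBm k),
            mul_rpow_of_nonneg _ _ hp.le, ofReal_rpow_of_nonneg (hv k) hp.le]
          exact mul_le_mul' le_rfl (rpow_le_rpow
            (lpN_majorant_le hm (hY k) H₀ hG hpp.lt.le) hp.le)
        refine (sum_le_sum e2).trans ?_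
        rw [← sum_mul, ← ofReal_sum_of_nonneg fun k _ => rpow_nonneg (hv k) _,
          mul_comm N₀, ofReal_mul hW, mul_assoc (ofReal W),
          mul_rpow_of_nonneg (ofReal W) _ hp.le, ofReal_rpow_of_nonneg hW hp.le]
        exact mul_le_mul' (ofReal_le_ofReal hvW) le_rfl

end diagBound

/-- The index set `{(j, n, i) : |j|, |n| ≤ R, i < N}`. -/
def intBox (R N : ℕ) : Finset (ℤ × ℤ × ℕ) :=
  Finset.Icc (-(R:ℤ)) R ×ˢ Finset.Icc (-(R:ℤ)) R ×ˢ Finset.range N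

/-- The shift belonging to the index `(j, n, i)`. -/
def boxShift (b κ : ℝ) (s : ℤ → ℕ → ℝ) (k : ℤ × ℤ × ℕ) : ℝ × ℝ × ℝ → ℝ² :=
  curveShift b κ ((2:ℝ) ^ (-(k.1:ℝ)))
    ((2:ℝ) ^ (-((k.1:ℝ) * b)) * ((2:ℝ) ^ (b * (k.2.1:ℝ)) * s k.2.1 k.2.2))

lemma sum_intBox_le_sum_scaleBox {F : ℕ × ℕ × ℕ → ℝ≥0∞} {f : ℤ × ℤ × ℕ → ℝ≥0∞} {R N : ℕ}
    (hF : ∀ k ∈ intBox R N, f k ≤ F ((k.1 + R).toNat, (k.1 - k.2.1 + 2 * R).toNat, k.2.2)) :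
    ∑ k ∈ intBox R N, f k ≤ ∑ k ∈ scaleBox (2 * R + 1) (4 * R + 1) (Finset.range N), F k := by
  have hinj : Set.InjOn (fun k : ℤ × ℤ × ℕ => ((k.1 + R).toNat, (k.1 - k.2.1 + 2 * R).toNat, k.2.2))
      (intBox R N) := by
    rintro ⟨j, n, i⟩ h ⟨j', n', i'⟩ h' hh
    simp only [intBox, Finset.coe_product, mem_prod, Finset.coe_Icc, mem_Icc, Prod.mk.injEq] at *
    omega
  refine (sum_le_sum hF).trans ?_
  rw [← sum_image (f := F) (s := intBox R N) hinj]
  refine sum_le_sum_of_subset fun k hk => ?_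
  obtain ⟨⟨j, n, i⟩, h, rfl⟩ := Finset.mem_image.1 hk
  simp only [intBox, scaleBox, mem_product, Finset.mem_Icc, Finset.mem_range] at *
  omega

lemma exists_kopSupBound {b κ : ℝ} (hb : 1 < b) (hκ : κ ≠ 0) :
    ∃ C : ℝ, 0 < C ∧ ∀ (C₁ : ℝ) (l : ℕ) (m : ℝ × ℝ × ℝ → ℂ), 0 ≤ C₁ →
      (∀ α β : ℝ, 0 < α → 0 < β → ∀ G : ℝ² → ℝ≥0∞, Measurable G → ∀ x,
        ∫⁻ ω, ‖m ω‖ₑ * G (x - curveShift b κ α β ω) ∂curveBase ≤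
          ofReal C₁ * ∑' a : ℕ, ofReal ((1 / 2) ^ a) *
            subAvg (curveLap b κ α β (2 ^ a / 2 ^ l) (2 ^ a / 2 ^ l)) G x) →
      ∀ (s w : ℤ → ℕ → ℝ) (p p' W : ℝ) (R N : ℕ), (∀ n i, s n i ∈ Icc (1:ℝ) ((2:ℝ) ^ b)) →
        p.HolderConjugate p' → 2 ≤ p' → 0 ≤ W → (∀ n i, 0 ≤ w n i) →
        (∀ n, ∑ i ∈ Finset.range N, w n i ^ p ≤ W ^ p) →
        KopSupBound curveBase (intBox R N) (fun k ω => (w k.2.1 k.2.2 : ℂ) * m ω)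
          (boxShift b κ s) p p' (C * C₁ * p' ^ 4 * W) := by
  have hϑ : (2:ℝ) ≤ 2 ^ b := by
    simpa using rpow_le_rpow_of_exponent_le one_le_two hb.le
  obtain ⟨C, hC0, hC⟩ := exists_sum_subAvg_curveLap_le_uniform hb hκ hϑ
  refine ⟨2 * C, by positivity, ?_⟩
  intro C₁ l m hC₁ hm s w p p' W R N hs hpp hp2 hW hw hwW G d hG hd
  have hp := hpp.pos
  have hϑm : ∀ m : ℕ, ((2:ℝ) ^ b) ^ m = 2 ^ (b * m) := fun m => by
    rw [rpow_mul two_pos.le, rpow_natCast]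
  set A₁ : ℝ := 2 ^ R with hA₁
  set A₂ : ℝ := 2 ^ (b * (2 * R)) with hA₂
  set nn : ℕ × ℕ × ℕ → ℤ := fun k => k.1 - k.2.1 + R with hnn
  set β : ℕ × ℕ × ℕ → ℝ := fun k => A₂ / (2 ^ b) ^ k.2.1 * s (nn k) k.2.2 with hβ
  set v : ℕ × ℕ × ℕ → ℝ := fun k => w (nn k) k.2.2 with hv
  have hA₂0 : 0 < A₂ := by positivity
  have hsc : WeightedScales (2 ^ b) p A₂ W (Finset.range N) β v :=
    { le_scale := fun j m i _ => le_mul_of_one_le_right (by positivity) (hs _ _).1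
      scale_le := fun j m i _ => by
        rw [mul_comm ((2:ℝ) ^ b)]
        exact mul_le_mul_of_nonneg_left (hs (nn (j, m, i)) i).2 (by positivity)
      nonneg := fun k => hw _ _
      sum_le := fun j m => hwW (nn (j, m, 0)) }
  set back : ℕ × ℕ × ℕ → ℤ × ℤ × ℕ := fun k => ((k.1 : ℤ) - R, nn k, k.2.2) with hback
  set h : ℕ × ℕ × ℕ → ℝ² → ℝ≥0∞ := fun k => if back k ∈ intBox R N then d (back k) else 0 with hh
  have hhm : ∀ k, Measurable (h k) := fun k => by
    simp only [hh]; split_ifs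
    exacts [hd _, measurable_const]
  have hbk : ∀ k ∈ intBox R N,
      back ((k.1 + R).toNat, (k.1 - k.2.1 + 2 * R).toNat, k.2.2) = k := by
    rintro ⟨j, n, i⟩ hk
    simp only [intBox, mem_product, Finset.mem_Icc] at hk
    simp only [hback, hnn, Prod.mk.injEq, and_true]
    omega
  set B := scaleBox (2 * R + 1) (4 * R + 1) (Finset.range N) with hB
  have hHd : ∀ x, ∑ k ∈ B, h k x ≤ ∑ k ∈ intBox R N, d k x := fun x => by
    have hinj : Set.InjOn back (B.filter fun k => back k ∈ intBox R N) := by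
      rintro ⟨j, n, i⟩ _ ⟨j', n', i'⟩ _ hh
      simp only [hback, hnn, Prod.mk.injEq] at *
      omega
    have e : ∀ k, h k x = if back k ∈ intBox R N then d (back k) x else 0 := fun k => by
      simp only [hh]; split_ifs <;> rfl
    simp only [e]
    rw [← sum_filter, ← sum_image (f := fun k => d k x) hinj]
    refine sum_le_sum_of_subset fun k hk => ?_
    obtain ⟨k', hk', rfl⟩ := Finset.mem_image.1 hk
    exact (mem_filter.1 hk').2
  have hSF : ∀ (k : ℕ × ℕ × ℕ) (ε : ℝ), SFinite (curveLap b κ (A₁ / 2 ^ k.1) (β k) ε ε) :=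
    fun k ε => by
      unfold curveLap
      have := sFinite_lap
      infer_instance
  have hsm : ∀ (k : ℕ × ℕ × ℕ) (ε : ℝ), Measurable (subAvg (curveLap b κ (A₁ / 2 ^ k.1) (β k) ε ε) G) :=
    fun k ε => measurable_subAvg _ hG
  set ε : ℕ → ℝ := fun a => 2 ^ a / 2 ^ l with hε
  set F : ℕ × ℕ × ℕ → ℝ≥0∞ := fun k => ofReal C₁ * ∑' a, ofReal ((1 / 2) ^ a) *
    ∫⁻ x, ofReal (v k) * h k x *
      subAvg (curveLap b κ (A₁ / 2 ^ k.1) (β k) (ε a) (ε a)) G x with hF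
  have key : ∀ k ∈ intBox R N, ∫⁻ x, d k x * ∫⁻ ω, ‖(w k.2.1 k.2.2 : ℂ) * m ω‖ₑ *
      G (x - boxShift b κ s k ω) ∂curveBase ≤
      F ((k.1 + R).toNat, (k.1 - k.2.1 + 2 * R).toNat, k.2.2) := by
    intro k hk
    have hb1 := hbk k hk
    set k' : ℕ × ℕ × ℕ := ((k.1 + R).toNat, (k.1 - k.2.1 + 2 * R).toNat, k.2.2) with hk'
    have h1 : ((k'.1 : ℤ) : ℝ) = k.1 + R := by
      have : (k'.1 : ℤ) = k.1 + R := by have := congrArg fst hb1; simp only [hback] at this; omega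
      rw [this]; push_cast; rfl
    have h2 : nn k' = k.2.1 := by have := congrArg (fun z => z.2.1) hb1; simpa only [hback] using this
    have h3 : ((k'.2.1 : ℤ) : ℝ) = k.1 - k.2.1 + 2 * R := by
      have : (k'.2.1 : ℤ) = k.1 - k.2.1 + 2 * R := by
        have h4 := congrArg fst hb1; simp only [hback, hnn] at h4 h2; omega
      rw [this]; push_cast; rfl
    have e1 : (2:ℝ) ^ (-(k.1:ℝ)) = A₁ / 2 ^ k'.1 := by
      rw [hA₁, ← rpow_natCast, ← rpow_natCast, ← rpow_sub two_pos, ← Int.cast_natCast k'.1,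
        h1]
      congr 1; ring
    have e2 : (2:ℝ) ^ (-((k.1:ℝ) * b)) * ((2:ℝ) ^ (b * (k.2.1:ℝ)) * s k.2.1 k.2.2) = β k' := by
      change _ = A₂ / (2 ^ b) ^ k'.2.1 * s (nn k') k.2.2
      rw [hϑm, hA₂, ← rpow_sub two_pos, ← mul_assoc, ← rpow_add two_pos, h2,
        ← Int.cast_natCast k'.2.1, h3]
      congr 2; ring
    have e3 : h k' = d k := by simp only [hh]; rw [hb1, if_pos hk]
    have e4 : v k' = w k.2.1 k.2.2 := by
      change w (nn k') k.2.2 = _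
      rw [h2]
    have hs0 : 0 < s k.2.1 k.2.2 := zero_lt_one.trans_le (hs _ _).1
    have hbd : ∀ x, ∫⁻ ω, ‖(w k.2.1 k.2.2 : ℂ) * m ω‖ₑ * G (x - boxShift b κ s k ω) ∂curveBase ≤
        ofReal (v k') * (ofReal C₁ * ∑' a : ℕ, ofReal ((1 / 2) ^ a) *
            subAvg (curveLap b κ (A₁ / 2 ^ k'.1) (β k') (ε a) (ε a)) G x) := fun x => by
      have h5 := hm _ _ (by positivity : 0 < (2:ℝ) ^ (-(k.1:ℝ)))
        (by positivity : 0 < (2:ℝ) ^ (-((k.1:ℝ) * b)) * ((2:ℝ) ^ (b * (k.2.1:ℝ)) * s k.2.1 k.2.2)) G hG x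
      have e5 : ∀ ω, ‖(w k.2.1 k.2.2 : ℂ) * m ω‖ₑ * G (x - boxShift b κ s k ω) =
          ofReal (v k') * (‖m ω‖ₑ * G (x - boxShift b κ s k ω)) := fun ω => by
        rw [enorm_mul, ← ofReal_norm (w k.2.1 k.2.2 : ℂ), norm_real,
          norm_of_nonneg (hw _ _), mul_assoc, e4]
      simp only [e5]
      rw [lintegral_const_mul' _ _ ofReal_ne_top]
      refine mul_le_mul' le_rfl (h5.trans_eq ?_)
      rw [e1, e2]
    refine (lintegral_mono fun x => mul_le_mul' le_rfl (hbd x)).trans_eq ?_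
    have hdk := hd k
    have hsk := hsm k'
    simp only [hF, e3, ← ENNReal.tsum_mul_left]
    rw [lintegral_tsum fun a => by have := hsk (ε a); fun_prop]
    refine tsum_congr fun a => ?_
    have := hsk (ε a)
    rw [← lintegral_const_mul _ (by fun_prop), ← lintegral_const_mul _ (by fun_prop)]
    exact lintegral_congr fun x => by ring
  refine (sum_intBox_le_sum_scaleBox (F := F) key).trans ?_
  simp only [hF]
  rw [← mul_sum, ← Summable.tsum_finsetSum fun _ _ => ENNReal.summable]
  simp only [← mul_sum]
  have hT : ∀ a, ∑ k ∈ B, ∫⁻ x, ofReal (v k) * h k x *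
      subAvg (curveLap b κ (A₁ / 2 ^ k.1) (β k) (ε a) (ε a)) G x ≤
      ofReal (C * p' ^ 4 * W) * (lpN G p * lpN (fun x => ∑ k ∈ intBox R N, d k x) p') :=
    fun a => (hC p p' A₁ A₂ W (ε a) (2 * R + 1) (4 * R + 1) (Finset.range N) β v hp2 hpp
      (by positivity) hA₂0 hW hsc (by positivity) G h hG hhm).trans
      (mul_le_mul' le_rfl (mul_le_mul' le_rfl (lpN_mono hpp.symm.pos hHd)))
  refine (mul_le_mul' le_rfl (ENNReal.tsum_le_tsum fun a => mul_le_mul' le_rfl (hT a))).trans_eq ?_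
  rw [ENNReal.tsum_mul_right, ← ENNReal.ofReal_tsum_of_nonneg (fun a => by positivity)
    summable_geometric_two, tsum_geometric_two, ← mul_assoc, ← mul_assoc,
    ← ofReal_mul hC₁, ← ofReal_mul (by positivity)]
  congr 2
  ring

lemma exists_sign_interval {χ : ℝ → ℝ} (hχ : Continuous χ)
    (hsum : HasSum (fun j : ℤ => χ ((2:ℝ) ^ j * 1)) 1) :
    ∃ σ t₀ ρ c₀ : ℝ, |σ| = 1 ∧ 0 < ρ ∧ ρ ≤ 1 / 8 ∧ 0 < c₀ ∧ ∀ t, |t - t₀| ≤ 3 * ρ → c₀ ≤ σ * χ t := by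
  obtain ⟨t₀, ht₀⟩ : ∃ t, χ t ≠ 0 := by
    by_contra! h
    simp only [h] at hsum
    exact zero_ne_one (hasSum_zero.unique hsum)
  obtain ⟨d, hd, hd'⟩ := Metric.continuous_iff.1 hχ t₀ (|χ t₀| / 2) (by positivity)
  refine ⟨SignType.sign (χ t₀), t₀, min (1 / 8) (d / 4), |χ t₀| / 2, ?_, by positivity,
    min_le_left _ _, by positivity, fun t ht => ?_⟩
  · rcases lt_or_gt_of_ne ht₀ with h | h <;> simp [sign_neg, sign_pos, h]
  · have h1 := hd' t (by rw [dist_eq]; linarith [min_le_right (1 / 8) (d / 4)])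
    rw [dist_eq, abs_lt] at h1
    rcases lt_or_gt_of_ne ht₀ with h | h
    · simp only [sign_neg h, abs_of_neg h, SignType.coe_neg_one] at h1 ⊢; linarith
    · simp only [sign_pos h, abs_of_pos h, SignType.coe_one] at h1 ⊢; linarith

lemma abs_rpow_sub_rpow_le {b v v' : ℝ} (hb : 1 < b) (hv : v ∈ Icc (0:ℝ) 2) (hv' : v' ∈ Icc (0:ℝ) 2) :
    |v ^ b - v' ^ b| ≤ b * 2 ^ (b - 1) * |v - v'| := by
  refine Convex.norm_image_sub_le_of_norm_deriv_le (f := fun v : ℝ => v ^ b) (s := Icc (0:ℝ) 2)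
    (fun x hx => (hasDerivAt_rpow_const (Or.inr hb.le)).differentiableAt) (fun x hx => ?_)
    (convex_Icc _ _) hv' hv
  rw [(hasDerivAt_rpow_const (Or.inr hb.le)).deriv, norm_of_nonneg (by
    have := hx.1; positivity)]
  exact mul_le_mul_of_nonneg_left (Real.rpow_le_rpow hx.1 hx.2 (by linarith)) (by linarith)

lemma measurable_curve (b cp cm : ℝ) : Measurable (curve b cp cm) :=
  Measurable.ite measurableSet_Ioi (by fun_prop) (Measurable.ite measurableSet_Iio (by fun_prop) (by fun_prop))

lemma le_abs_tauConv {b cp cm σ t₀ ρ c₀ δ r : ℝ} {χ : ℝ → ℝ} (hb : 1 < b) (hχ : Continuous χ)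
    (hsupp : ∀ t : ℝ, t ∉ Ioo (1/2 : ℝ) 2 → χ t = 0) (hσ : |σ| = 1) (hδρ : δ ≤ ρ)
    (hr : 0 < r) (hrδ : r ≤ δ) (hc₀ : 0 < c₀) (hlow : ∀ t, |t - t₀| ≤ 3 * ρ → c₀ ≤ σ * χ t)
    (hrκ : 2 ^ b * |cp| * (b * 2 ^ (b - 1)) * r ≤ δ / 2) {f : ℝ² → ℝ} (hf : Continuous f)
    (hf0 : ∀ x, 0 ≤ f x) (hf1 : ∀ x, f x ≤ 1) (hfone : ∀ x : ℝ², |x.1| ≤ δ → |x.2| ≤ δ → f x = 1)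
    (hfsupp : ∀ x : ℝ², 2 * δ ≤ |x.1| → f x = 0) (m : ℕ) {u : ℝ} (hu : 0 < u)
    (hu' : u * ((2:ℝ) ^ m) ^ (b - 1) ≤ 2 ^ b) {x : ℝ²} (hx1 : |x.1 / 2 ^ m - t₀| ≤ ρ)
    (hx2 : |x.2 - u * (cp * x.1 ^ b)| ≤ δ / 2) :
    2 * r * (c₀ / 2 ^ m) ≤ |tauConv b cp cm χ (-m) u f x| := by
  have hδ : 0 < δ := hr.trans_le hrδ
  set T : ℝ := 2 ^ m with hT
  have hT1 : 1 ≤ T := one_le_pow₀ one_le_two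
  have hT0 : 0 < T := by positivity
  have hIoo : ∀ t, |t - t₀| ≤ 3 * ρ → t ∈ Ioo (1/2 : ℝ) 2 := fun t ht => by
    by_contra h
    have := hlow t ht
    rw [hsupp t h] at this
    linarith
  have hTj : (2:ℝ) ^ (-(m:ℤ)) = T⁻¹ := by rw [zpow_neg, zpow_natCast]
  have hχc : HasCompactSupport χ := HasCompactSupport.intro (isCompact_Icc (a := (1/2:ℝ)) (b := 2))
    fun t ht => hsupp t fun h => ht ⟨h.1.le, h.2.le⟩
  set I : ℝ → ℝ := fun t => f (x - (t, u * curve b cp cm t)) * (T⁻¹ * χ (T⁻¹ * t)) with hI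
  have hint : Integrable I := by
    have h1 : Integrable fun t => χ (T⁻¹ * t) :=
      (hχ.integrable_of_hasCompactSupport hχc).comp_mul_left' (by positivity)
    refine (h1.const_mul _).bdd_mul (c := 1) ?_ (ae_of_all _ fun t => ?_)
    · have := measurable_curve b cp cm
      exact (hf.measurable.comp (by fun_prop)).aestronglyMeasurable
    · rw [norm_of_nonneg (hf0 _)]; exact hf1 _
  have e : |tauConv b cp cm χ (-m) u f x| = |σ * ∫ t, I t| := by
    rw [abs_mul, hσ, one_mul, tauConv, hTj]
  rw [e, ← integral_const_mul]
  refine le_trans ?_ (le_abs_self _)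
  have e2 : 2 * r * (c₀ / T) = ∫ t, (Icc (x.1 - r) (x.1 + r)).indicator (fun _ => c₀ / T) t := by
    rw [integral_indicator measurableSet_Icc, setIntegral_const, Real.volume_real_Icc_of_le (by linarith),
      smul_eq_mul]
    ring
  rw [e2]
  refine integral_mono ((integrable_indicator_iff measurableSet_Icc).2 (by simp)) (hint.const_mul σ)
    fun t => ?_
  have e3 : σ * I t = f (x - (t, u * curve b cp cm t)) * (T⁻¹ * (σ * χ (T⁻¹ * t))) := by
    simp only [hI]; ring
  simp only [e3]
  by_cases ht : |x.1 - t| < 2 * δ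
  · have h1 : |T⁻¹ * t - t₀| ≤ 3 * ρ := by
      have h2 : |T⁻¹ * t - x.1 / T| ≤ 2 * δ := by
        rw [div_eq_inv_mul, ← mul_sub, abs_mul, abs_of_pos (by positivity), abs_sub_comm]
        exact (mul_le_of_le_one_left (abs_nonneg _) (inv_le_one_of_one_le₀ hT1)).trans ht.le
      have := abs_sub_le (T⁻¹ * t) (x.1 / T) t₀
      linarith
    have h3 := hlow _ h1
    by_cases hti : t ∈ Icc (x.1 - r) (x.1 + r)
    · rw [indicator_of_mem hti, hfone, one_mul, div_eq_inv_mul]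
      · exact mul_le_mul_of_nonneg_left h3 (by positivity)
      · change |x.1 - t| ≤ δ
        rw [abs_le]; constructor <;> linarith [hti.1, hti.2]
      · have h4 := hIoo _ h1
        have h5 := hIoo (x.1 / T) (by linarith [(abs_nonneg _).trans hx1])
        have ht0 : 0 < t := by
          have h6 := h4.1
          have : 0 < T⁻¹ * t := by linarith
          exact (pos_iff_pos_of_mul_pos this).1 (by positivity)
        have e4 : T * (T⁻¹ * t) = t := by field_simp
        have e5 : T * (x.1 / T) = x.1 := by field_simp
        have h7 : |t ^ b - x.1 ^ b| ≤ T ^ (b - 1) * (b * 2 ^ (b - 1) * r) := by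
          conv_lhs => rw [← e4, ← e5]
          rw [mul_rpow hT0.le (by linarith [h4.1]), mul_rpow hT0.le (by linarith [h5.1]),
            ← mul_sub, abs_mul, abs_of_pos (by positivity)]
          refine (mul_le_mul_of_nonneg_left (abs_rpow_sub_rpow_le hb ⟨by linarith [h4.1], h4.2.le⟩
            ⟨by linarith [h5.1], h5.2.le⟩) (by positivity)).trans ?_
          have e6 : T ^ b = T ^ (b - 1) * T := by
            rw [← Real.rpow_add_one hT0.ne']; ring_nf
          have h8 : |T⁻¹ * t - x.1 / T| ≤ T⁻¹ * r := by
            rw [div_eq_inv_mul, ← mul_sub, abs_mul, abs_of_pos (by positivity)]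
            refine mul_le_mul_of_nonneg_left ?_ (by positivity)
            rw [abs_le]; constructor <;> linarith [hti.1, hti.2]
          calc T ^ b * (b * 2 ^ (b - 1) * |T⁻¹ * t - x.1 / T|)
              ≤ T ^ b * (b * 2 ^ (b - 1) * (T⁻¹ * r)) := by
                have : 0 ≤ b * 2 ^ (b - 1) := by positivity
                exact mul_le_mul_of_nonneg_left (mul_le_mul_of_nonneg_left h8 this) (by positivity)
            _ = _ := by rw [e6]; field_simp
        have e7 : (x - (t, u * curve b cp cm t)).2 =
            (x.2 - u * (cp * x.1 ^ b)) - u * (cp * (t ^ b - x.1 ^ b)) := by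
          simp only [curve, if_pos ht0, Prod.snd_sub]; ring
        rw [e7]
        refine (abs_sub _ _).trans ?_
        have h9 : |u * (cp * (t ^ b - x.1 ^ b))| ≤ δ / 2 := by
          rw [abs_mul, abs_mul, abs_of_pos hu]
          calc u * (|cp| * |t ^ b - x.1 ^ b|) ≤ u * (|cp| * (T ^ (b - 1) * (b * 2 ^ (b - 1) * r))) := by
                gcongr
            _ = u * T ^ (b - 1) * (|cp| * (b * 2 ^ (b - 1)) * r) := by ring
            _ ≤ 2 ^ b * (|cp| * (b * 2 ^ (b - 1)) * r) := by gcongr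
            _ ≤ δ / 2 := by linarith
        linarith
    · rw [indicator_of_notMem hti]
      have h10 := hf0 (x - (t, u * curve b cp cm t))
      have : 0 ≤ σ * χ (T⁻¹ * t) := hc₀.le.trans h3
      positivity
  · rw [hfsupp _ (not_lt.1 ht), indicator_of_notMem fun hti => ht ?_]
    · simp
    · refine lt_of_le_of_lt (b := r) ?_ (by linarith)
      rw [abs_le]; constructor <;> linarith [hti.1, hti.2]

/-- The neighbourhood of width `δ` of the piece `|x₁/2^m - t₀| ≤ ρ` of the curve `x₂ = v x₁^b`. -/
def curveTube (b t₀ ρ δ v : ℝ) (m : ℕ) : Set (ℝ²) :=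
  {x | |x.1 / 2 ^ m - t₀| ≤ ρ ∧ |x.2 - v * x.1 ^ b| ≤ δ / 2}

lemma measurableSet_curveTube (b t₀ ρ δ v : ℝ) (m : ℕ) : MeasurableSet (curveTube b t₀ ρ δ v m) :=
  MeasurableSet.inter (measurableSet_le (f := fun x : ℝ² => |x.1 / 2 ^ m - t₀|) (by fun_prop)
    measurable_const) (measurableSet_le (f := fun x : ℝ² => |x.2 - v * x.1 ^ b|) (by fun_prop)
    measurable_const)

lemma volume_curveTube {b t₀ ρ δ : ℝ} (v : ℝ) (m : ℕ) (hρ : 0 < ρ) :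
    volume (curveTube b t₀ ρ δ v m) = ofReal (2 * ρ * 2 ^ m * δ) := by
  have hT : (0:ℝ) < 2 ^ m := by positivity
  rw [Measure.volume_eq_prod, Measure.prod_apply (measurableSet_curveTube ..)]
  have e : ∀ x : ℝ, volume (Prod.mk x ⁻¹' curveTube b t₀ ρ δ v m) =
      (Icc (2 ^ m * (t₀ - ρ)) (2 ^ m * (t₀ + ρ))).indicator (fun _ => ofReal δ) x := fun x => by
    have h1 : |x / 2 ^ m - t₀| ≤ ρ ↔ x ∈ Icc (2 ^ m * (t₀ - ρ)) (2 ^ m * (t₀ + ρ)) := by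
      rw [abs_le, mem_Icc, neg_le_sub_iff_le_add, sub_le_iff_le_add, div_le_iff₀ hT, mul_comm _ (t₀ - ρ),
        ← le_div_iff₀ hT]
      constructor <;> rintro ⟨h, h'⟩ <;> constructor <;> linarith
    by_cases hx : |x / 2 ^ m - t₀| ≤ ρ
    · rw [indicator_of_mem (h1.1 hx)]
      have : Prod.mk x ⁻¹' curveTube b t₀ ρ δ v m = Icc (v * x ^ b - δ / 2) (v * x ^ b + δ / 2) := by
        ext y
        rw [mem_preimage, curveTube, mem_setOf_eq, and_iff_right hx, abs_le, mem_Icc]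
        constructor <;> rintro ⟨h, h'⟩ <;> constructor <;> linarith
      rw [this, volume_Icc]; congr 1; ring
    · rw [indicator_of_notMem (fun h => hx (h1.2 h))]
      have : Prod.mk x ⁻¹' curveTube b t₀ ρ δ v m = ∅ := by
        ext y; simp [curveTube, hx]
      rw [this, measure_empty]
  simp only [e]
  rw [lintegral_indicator_const measurableSet_Icc, volume_Icc, mul_comm,
    ← ofReal_mul (by nlinarith)]
  congr 1; ring

lemma eq_of_mem_curveTube {b cp t₀ ρ δ : ℝ} {s : ℤ → ℕ → ℝ} (hb : 1 < b)
    (hs : ∀ n i, s n i ∈ Icc (1:ℝ) ((2:ℝ) ^ b)) (hρ : ρ ≤ 1 / 8) (hδ : δ < |cp|)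
    (ht₀ : ∀ t, |t - t₀| ≤ ρ → 1 / 2 < t) {m a m' a' : ℕ} {x : ℝ²}
    (h : x ∈ curveTube b t₀ ρ δ
      ((2:ℝ) ^ (b * ((-m + 2 * a : ℤ) : ℝ)) * s (-m + 2 * a) 0 * cp) m)
    (h' : x ∈ curveTube b t₀ ρ δ
      ((2:ℝ) ^ (b * ((-m' + 2 * a' : ℤ) : ℝ)) * s (-m' + 2 * a') 0 * cp) m') :
    m = m' ∧ a = a' := by
  have hm : ∀ {m m' : ℕ}, |x.1 / 2 ^ m - t₀| ≤ ρ → |x.1 / 2 ^ m' - t₀| ≤ ρ → ¬ m < m' := by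
    intro m m' h h' hlt
    have h1 := ht₀ _ h
    have h2 := ht₀ _ h'
    have h3 : (2:ℝ) ^ m * 2 ≤ 2 ^ m' := by rw [← pow_succ]; gcongr <;> [norm_num; omega]
    have h4 : x.1 / 2 ^ m' ≤ x.1 / 2 ^ m / 2 := by
      rw [div_div]
      have : 0 < x.1 := by
        have := (lt_div_iff₀ (by positivity)).1 h1
        linarith [show (0:ℝ) < 2 ^ m by positivity]
      gcongr
    rw [abs_le] at h h'
    linarith [ht₀ t₀ (by rw [sub_self, abs_zero]; linarith)]
  obtain rfl : m = m' := by
    have := hm h.1 h'.1; have := hm h'.1 h.1; omega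
  refine ⟨rfl, ?_⟩
  have ha : ∀ {a a' : ℕ}, |x.2 - (2:ℝ) ^ (b * ((-m + 2 * a : ℤ) : ℝ)) * s (-m + 2 * a) 0 * cp * x.1 ^ b| ≤ δ / 2 →
      |x.2 - (2:ℝ) ^ (b * ((-m + 2 * a' : ℤ) : ℝ)) * s (-m + 2 * a') 0 * cp * x.1 ^ b| ≤ δ / 2 → ¬ a < a' := by
    intro a a' h2 h2' hlt
    set u := (2:ℝ) ^ (b * ((-m + 2 * a : ℤ) : ℝ)) * s (-m + 2 * a) 0 with hu
    set u' := (2:ℝ) ^ (b * ((-m + 2 * a' : ℤ) : ℝ)) * s (-m + 2 * a') 0 with hu'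
    have hx : (2:ℝ) ^ (b * (m - 1)) ≤ x.1 ^ b := by
      rw [mul_comm, rpow_mul two_pos.le, rpow_sub two_pos, rpow_natCast, rpow_one]
      refine Real.rpow_le_rpow (by positivity) ?_ (by linarith)
      have := (lt_div_iff₀ (by positivity)).1 (ht₀ _ h.1)
      linarith
    have h3 : u ≤ 2 ^ (b * (-m + 2 * a + 1)) := by
      rw [hu, show b * (-m + 2 * a + 1) = b * ((-m + 2 * a : ℤ) : ℝ) + b by push_cast; ring,
        rpow_add two_pos]
      exact mul_le_mul_of_nonneg_left (hs _ _).2 (by positivity)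
    have h4 : 2 ^ (b * (-m + 2 * a + 1)) * 2 ≤ u' := by
      refine le_trans ?_ (le_mul_of_one_le_right (by positivity) (hs _ _).1)
      rw [← Real.rpow_add_one two_ne_zero]
      refine rpow_le_rpow_of_exponent_le one_le_two ?_
      push_cast
      have : (a:ℝ) + 1 ≤ a' := by exact_mod_cast hlt
      nlinarith
    have h5 : 1 ≤ (u' - u) * x.1 ^ b := by
      calc (1:ℝ) = 2 ^ (b * (-m + 1)) * 2 ^ (b * (m - 1)) := by
            rw [← rpow_add two_pos]; ring_nf; simp
        _ ≤ 2 ^ (b * (-m + 2 * a + 1)) * 2 ^ (b * (m - 1)) := by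
            refine mul_le_mul_of_nonneg_right (rpow_le_rpow_of_exponent_le one_le_two ?_) (by positivity)
            have : (0:ℝ) ≤ a := by positivity
            nlinarith
        _ ≤ (u' - u) * x.1 ^ b := mul_le_mul (by linarith) hx (by positivity) (by
            linarith [show (0:ℝ) < 2 ^ (b * (-m + 2 * a + 1)) by positivity])
    have h6 : |(u' - u) * x.1 ^ b * cp| ≤ δ := by
      have := abs_sub (x.2 - u * cp * x.1 ^ b) (x.2 - u' * cp * x.1 ^ b)
      rw [show (u' - u) * x.1 ^ b * cp = x.2 - u * cp * x.1 ^ b - (x.2 - u' * cp * x.1 ^ b) by ring]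
      linarith
    rw [abs_mul, abs_of_pos (by linarith)] at h6
    nlinarith [abs_nonneg cp]
  have := ha h.2 h'.2; have := ha h'.2 h.2; omega

lemma exists_sum_le_BpR_rpow {b cp : ℝ} (cm : ℝ) (hb : 1 < b) (hcp : cp ≠ 0) {χ : ℝ → ℝ} (hχ : Continuous χ)
    (hsupp : ∀ t : ℝ, t ∉ Ioo (1/2 : ℝ) 2 → χ t = 0)
    (hsum : HasSum (fun j : ℤ => χ ((2:ℝ) ^ j * 1)) 1) :
    ∃ c : ℝ, 0 < c ∧ c ≤ 1 ∧ ∀ s : ℤ → ℕ → ℝ, (∀ n i, s n i ∈ Icc (1:ℝ) ((2:ℝ) ^ b)) → ∀ (p : ℝ) (R : ℕ),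
      0 < p → ∀ P : Finset (ℕ × ℕ), (∀ k ∈ P, k.1 ≤ R ∧ 2 * k.2 * b ≤ k.1) →
      ∑ k ∈ P, ofReal ((c / 2 ^ k.1) ^ p * (c * 2 ^ k.1)) ≤ BpR b cp cm χ s p R ^ p := by
  obtain ⟨σ, t₀, ρ, c₀, hσ, hρ, hρ8, hc₀, hlow⟩ := exists_sign_interval hχ hsum
  have hcp' : 0 < |cp| := abs_pos.2 hcp
  set δ : ℝ := min ρ (|cp| / 2) with hδd
  have hδ : 0 < δ := by positivity
  have hδρ : δ ≤ ρ := min_le_left _ _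
  set D : ℝ := 2 ^ b * |cp| * (b * 2 ^ (b - 1)) with hD
  have hD0 : 0 < D := by positivity
  set r : ℝ := min δ (δ / 2 / D) with hrd
  have hr : 0 < r := by positivity
  set c : ℝ := min 1 (min (2 * r * c₀) (2 * ρ * δ)) with hcd
  have hc : 0 < c := by positivity
  refine ⟨c, hc, min_le_left _ _, fun s hs p R hp P hP => ?_⟩
  let bump : ContDiffBump (0 : ℝ²) := ⟨δ, 2 * δ, hδ, by linarith⟩
  set f : SchwartzMap (ℝ²) ℝ := bump.hasCompactSupport.toSchwartzMap bump.contDiff with hf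
  have hfb : ∀ x, f x = bump x := fun x => rfl
  have hf0 : ∀ x, 0 ≤ f x := fun x => bump.nonneg
  have hf1 : ∀ x, f x ≤ 1 := fun x => bump.le_one
  have hfone : ∀ x : ℝ², |x.1| ≤ δ → |x.2| ≤ δ → f x = 1 := fun x h h' => by
    refine bump.one_of_mem_closedBall ?_
    rw [mem_closedBall_zero_iff]; exact max_le h h'
  have hfsupp' : ∀ x, x ∉ Metric.ball (0 : ℝ²) (2 * δ) → f x = 0 := fun x h => by
    rw [hfb]; exact Function.notMem_support.1 (by rw [bump.support_eq]; exact h)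
  have hfsupp : ∀ x : ℝ², 2 * δ ≤ |x.1| → f x = 0 := fun x h => hfsupp' x fun hx => by
    rw [mem_ball_zero_iff] at hx
    exact absurd (lt_of_le_of_lt (le_max_left _ _ : ‖x.1‖ ≤ ‖x‖) hx) (not_lt.2 h)
  set w : ℤ → ℕ → ℂ := fun _ i => if i = 0 then 1 else 0 with hw
  have hwN : ∀ n, wNorm (w n) p ≤ 1 := fun n => by
    rw [wNorm, tsum_eq_single 0 fun i hi => by simp [hw, hi, hp.ne']]
    simp [hw]
  have hfN : eLpNorm (⇑f) (eN p) volume ≤ 1 := by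
    have h1 : eLpNorm (⇑f) (eN p) (volume.restrict (Metric.ball (0 : ℝ²) (2 * δ))) =
        eLpNorm (⇑f) (eN p) volume := by
      rw [← eLpNorm_indicator_eq_eLpNorm_restrict Metric.isOpen_ball.measurableSet,
        indicator_eq_self.2 fun x hx => by_contra fun h => hx (hfsupp' x h)]
    rw [← h1]
    refine (eLpNorm_le_of_ae_bound (C := 1) (ae_of_all _ fun x => ?_)).trans ?_
    · rw [norm_of_nonneg (hf0 x)]; exact hf1 x
    · rw [ofReal_one, mul_one, Measure.restrict_apply_univ]
      refine ENNReal.rpow_le_one ?_ (by positivity)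
      have h2 : Metric.ball (0 : ℝ²) (2 * δ) = Metric.ball 0 (2 * δ) ×ˢ Metric.ball 0 (2 * δ) :=
        (ball_prod_same ..).symm
      rw [h2, Measure.volume_eq_prod, Measure.prod_prod, Real.volume_ball]
      exact mul_le_one' (ofReal_le_one.2 (by linarith)) (ofReal_le_one.2 (by linarith))
  have hB : lpN (MfrakR b cp cm χ s R ⇑f w) p ≤ BpR b cp cm χ s p R :=
    le_iSup_of_le f (le_iSup_of_le w (le_iSup_of_le hfN (le_iSup_of_le hwN le_rfl)))
  set v : ℕ × ℕ → ℝ := fun k => (2:ℝ) ^ (b * ((-k.1 + 2 * k.2 : ℤ) : ℝ)) * s (-k.1 + 2 * k.2) 0 with hv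
  set S : ℕ × ℕ → Set (ℝ²) := fun k => curveTube b t₀ ρ δ (v k * cp) k.1 with hS
  have hM : ∀ k ∈ P, ∀ x ∈ S k, ofReal (c / 2 ^ k.1) ≤ MfrakR b cp cm χ s R ⇑f w x := by
    rintro ⟨m, a⟩ hk x hx
    obtain ⟨hm, ha⟩ := hP _ hk
    simp only at hm ha
    have hv0 : 0 < v (m, a) := mul_pos (by positivity) (zero_lt_one.trans_le (hs _ _).1)
    have hvu : v (m, a) * ((2:ℝ) ^ m) ^ (b - 1) ≤ 2 ^ b := by
      refine (mul_le_mul_of_nonneg_right (mul_le_mul_of_nonneg_left (hs _ _).2 (by positivity))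
        (by positivity)).trans ?_
      rw [← rpow_natCast, ← rpow_mul two_pos.le, ← rpow_add two_pos, ← rpow_add two_pos]
      refine rpow_le_rpow_of_exponent_le one_le_two ?_
      push_cast
      nlinarith
    have h1 := le_abs_tauConv (cm := cm) hb hχ hsupp hσ hδρ hr (min_le_left _ _) hc₀ hlow (by
      rw [mul_comm, ← le_div_iff₀ hD0]; exact min_le_right _ _) f.continuous hf0 hf1 hfone hfsupp m hv0 hvu
      hx.1 (by rw [← mul_assoc]; exact hx.2)
    have ham : (2 * a : ℤ) ≤ m := by
      have : (2 * a : ℝ) ≤ m := le_trans (le_mul_of_one_le_right (by positivity) hb.le) ha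
      exact_mod_cast this
    refine le_trans (ofReal_le_ofReal ?_)
      (le_iSup_of_le (-(m:ℤ)) (le_iSup_of_le (by omega) (le_iSup_of_le (-m + 2 * a : ℤ)
        (le_iSup_of_le (by omega) (le_iSup_of_le 0 le_rfl)))))
    simp only [hw, if_pos, norm_one, one_mul]
    refine le_trans ?_ h1
    rw [← mul_div_assoc]
    gcongr
    exact (min_le_right _ _).trans (min_le_left _ _)
  calc ∑ k ∈ P, ofReal ((c / 2 ^ k.1) ^ p * (c * 2 ^ k.1))
      ≤ ∑ k ∈ P, ∫⁻ x, (S k).indicator (fun _ => ofReal (c / 2 ^ k.1) ^ p) x := by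
        refine sum_le_sum fun k _ => ?_
        rw [lintegral_indicator_const (measurableSet_curveTube ..), volume_curveTube _ _ hρ,
          ofReal_rpow_of_nonneg (by positivity) hp.le, ← ofReal_mul (by positivity)]
        refine ofReal_le_ofReal (mul_le_mul_of_nonneg_left ?_ (by positivity))
        rw [mul_right_comm]
        gcongr
        exact (min_le_right _ _).trans (min_le_right _ _)
    _ = ∫⁻ x, ∑ k ∈ P, (S k).indicator (fun _ => ofReal (c / 2 ^ k.1) ^ p) x :=
        (lintegral_finsetSum _ fun k _ => measurable_const.indicator (measurableSet_curveTube ..)).symm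
    _ ≤ ∫⁻ x, MfrakR b cp cm χ s R ⇑f w x ^ p := by
        refine lintegral_mono fun x => ?_
        by_cases hx : ∃ k ∈ P, x ∈ S k
        · obtain ⟨k, hk, hxk⟩ := hx
          rw [Finset.sum_eq_single_of_mem k hk fun k' _ hne => indicator_of_notMem (fun hxk' => hne ?_) _,
            indicator_of_mem hxk]
          · exact rpow_le_rpow (hM k hk x hxk) hp.le
          · have := eq_of_mem_curveTube hb hs hρ8 (lt_of_le_of_lt (min_le_right _ _) (half_lt_self hcp'))
              (fun t ht => ?_) hxk' hxk
            · exact Prod.ext this.1 this.2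
            · by_contra h
              have h1 := hlow t (by linarith)
              rw [hsupp t fun h' => h h'.1] at h1
              linarith
        · push Not at hx
          rw [sum_eq_zero fun k hk => indicator_of_notMem (hx k hk) _]
          exact zero_le
    _ = lpN (MfrakR b cp cm χ s R ⇑f w) p ^ p := (lpN_rpow _ hp).symm
    _ ≤ _ := rpow_le_rpow hB hp.le

lemma exists_min_le_BpR {b cp : ℝ} (cm : ℝ) (hb : 1 < b) (hcp : cp ≠ 0) {χ : ℝ → ℝ} (hχ : Continuous χ)
    (hsupp : ∀ t : ℝ, t ∉ Ioo (1/2 : ℝ) 2 → χ t = 0)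
    (hsum : HasSum (fun j : ℤ => χ ((2:ℝ) ^ j * 1)) 1) :
    ∃ c : ℝ, 0 < c ∧ ∀ s : ℤ → ℕ → ℝ, (∀ n i, s n i ∈ Icc (1:ℝ) ((2:ℝ) ^ b)) → ∀ (p : ℝ) (R : ℕ),
      1 < p → p ≤ 2 → ofReal (c * min ((2 * (R:ℝ) + 1) ^ 2) ((p - 1)⁻¹ ^ 4)) ≤
        ofReal ((p - 1)⁻¹ ^ 2) * BpR b cp cm χ s p R := by
  obtain ⟨c, hc, hc1, H⟩ := exists_sum_le_BpR_rpow cm hb hcp hχ hsupp hsum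
  set c₁ : ℝ := c ^ 3 / 2 / (16 * b) with hc₁
  have hc₁0 : 0 < c₁ := by positivity
  refine ⟨c₁ * exp (-4) / 4, by positivity, fun s hs p R hp hp2 => ?_⟩
  set L : ℝ := (p - 1)⁻¹ with hL
  have hL1 : 1 ≤ L := by rw [hL, one_le_inv₀ (by linarith)]; linarith
  have hpL : p - 1 = L⁻¹ := by rw [hL, inv_inv]
  set M : ℕ := min R ⌊L⌋₊ with hM
  have hML : (M:ℝ) ≤ L := (cast_le.2 (min_le_right _ _)).trans (Nat.floor_le (by linarith))
  set P : Finset (ℕ × ℕ) := Finset.Icc (M - M / 2) M ×ˢ Finset.range (⌊(M:ℝ) / (4 * b)⌋₊ + 1) with hP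
  have hPk : ∀ k ∈ P, k.1 ≤ M ∧ 2 * k.2 * b ≤ k.1 := by
    rintro ⟨m, a⟩ hk
    simp only [hP, mem_product, Finset.mem_Icc, Finset.mem_range, Nat.lt_succ_iff] at hk
    refine ⟨hk.1.2, ?_⟩
    have h1 : (a:ℝ) ≤ M / (4 * b) := (cast_le.2 hk.2).trans (Nat.floor_le (by positivity))
    rw [le_div_iff₀ (by positivity)] at h1
    have h2 : (M:ℝ) ≤ 2 * m := by exact_mod_cast (by omega : M ≤ 2 * m)
    simp only
    linarith
  have hcard : ((M:ℝ) + 1) ^ 2 / (16 * b) ≤ P.card := by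
    rw [hP, Finset.card_product, Nat.card_Icc, Finset.card_range, Nat.cast_mul]
    have h1 : ((M:ℝ) + 1) / 2 ≤ ((M + 1 - (M - M / 2) : ℕ) : ℝ) := by
      rw [div_le_iff₀ two_pos]
      exact_mod_cast (by omega : M + 1 ≤ (M + 1 - (M - M / 2)) * 2)
    have h2 : ((M:ℝ) + 1) / (8 * b) ≤ ((⌊(M:ℝ) / (4 * b)⌋₊ + 1 : ℕ) : ℝ) := by
      rcases Nat.eq_zero_or_pos M with h0 | h0
      · rw [h0]; simp only [Nat.cast_zero, zero_add, zero_div, Nat.floor_zero, Nat.cast_one]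
        rw [div_le_one (by positivity)]; linarith
      · push_cast
        refine le_trans ?_ (Nat.lt_floor_add_one _).le
        rw [div_le_div_iff₀ (by positivity) (by positivity)]
        have : (1:ℝ) ≤ M := by exact_mod_cast h0
        nlinarith
    calc ((M:ℝ) + 1) ^ 2 / (16 * b) = ((M:ℝ) + 1) / 2 * (((M:ℝ) + 1) / (8 * b)) := by field_simp; ring
      _ ≤ _ := mul_le_mul h1 h2 (by positivity) (by positivity)
  have hBp : ofReal (c₁ * (M + 1) ^ 2) ≤ BpR b cp cm χ s p R ^ p := by
    refine le_trans ?_ (H s hs p R (by linarith) P fun k hk => ⟨(hPk k hk).1.trans (min_le_left _ _),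
      (hPk k hk).2⟩)
    rw [← ofReal_sum_of_nonneg fun k _ => by positivity]
    refine ofReal_le_ofReal ?_
    calc c₁ * (M + 1) ^ 2 = ((M:ℝ) + 1) ^ 2 / (16 * b) * (c ^ 3 / 2) := by rw [hc₁]; field_simp
      _ ≤ P.card * (c ^ 3 / 2) := mul_le_mul_of_nonneg_right hcard (by positivity)
      _ = ∑ _k ∈ P, c ^ 3 / 2 := by rw [sum_const, nsmul_eq_mul]
      _ ≤ _ := sum_le_sum fun k hk => ?_
    have h1 : (2:ℝ) ^ (k.1 * (p - 1)) ≤ 2 := by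
      refine (rpow_le_rpow_of_exponent_le one_le_two ?_).trans_eq (rpow_one 2)
      rw [hpL, ← div_eq_mul_inv, div_le_one (by linarith)]
      exact (cast_le.2 (hPk k hk).1).trans hML
    have h2 : ((2:ℝ) ^ k.1) ^ p = 2 ^ (k.1 * (p - 1)) * 2 ^ k.1 := by
      rw [← rpow_natCast, ← rpow_mul two_pos.le, ← rpow_add two_pos]; ring_nf
    have h3 : c ^ 2 ≤ c ^ p := by
      rw [← rpow_two]; exact Real.rpow_le_rpow_of_exponent_ge hc hc1 hp2
    have e : (c / 2 ^ k.1) ^ p * (c * 2 ^ k.1) = c ^ p * c / 2 ^ (k.1 * (p - 1)) := by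
      rw [div_rpow hc.le (by positivity), h2]; field_simp
    rw [e]
    calc c ^ 3 / 2 = c ^ 2 * c / 2 := by ring
      _ ≤ _ := by gcongr
  set y : ℝ := c₁ * exp (-4) * (M + 1) ^ 2 with hy
  have hy0 : 0 < y := by positivity
  have hyB : ofReal y ≤ BpR b cp cm χ s p R := by
    rw [← rpow_le_rpow_iff (z := p) (by linarith), ofReal_rpow_of_pos hy0]
    refine (ofReal_le_ofReal ?_).trans hBp
    have h1 : y ≤ (2 * L) ^ 2 := by
      have h2 : c₁ ≤ 1 := by
        rw [hc₁, div_div, div_le_one (by positivity)]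
        have := pow_le_one₀ (n := 3) hc.le hc1
        linarith
      have h3 : exp (-4) ≤ 1 := by rw [Real.exp_le_one_iff]; norm_num
      calc y ≤ 1 * 1 * (M + 1) ^ 2 := by rw [hy]; gcongr
        _ ≤ 1 * 1 * (2 * L) ^ 2 := by gcongr; linarith
        _ = _ := by ring
    have h4 : y ^ (p - 1) ≤ exp 4 := by
      refine (Real.rpow_le_rpow hy0.le h1 (by linarith)).trans ?_
      have hlog : Real.log (2 * L) ≤ 2 * L := (Real.log_le_sub_one_of_pos (by positivity)).trans (by linarith)
      rw [Real.rpow_def_of_pos (by positivity), exp_le_exp, Real.log_pow, hpL, ← div_eq_mul_inv,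
        div_le_iff₀ (by linarith)]
      push_cast; linarith
    have h5 : y ^ p = y * y ^ (p - 1) := by rw [rpow_sub_one hy0.ne']; field_simp
    rw [h5]
    refine (mul_le_mul_of_nonneg_left h4 hy0.le).trans_eq ?_
    rw [hy, mul_right_comm, mul_assoc c₁, ← exp_add]; simp
  refine le_trans ?_ (mul_le_mul' le_rfl hyB)
  rw [← ofReal_mul (by positivity)]
  refine ofReal_le_ofReal ?_
  have h6 : min ((2 * (R:ℝ) + 1) ^ 2) (L ^ 4) ≤ 4 * (L ^ 2 * (M + 1) ^ 2) := by
    rcases min_choice R ⌊L⌋₊ with h | h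
    · rw [hM, h]
      refine (min_le_left _ _).trans ?_
      have : 1 ≤ L ^ 2 := one_le_pow₀ hL1
      nlinarith [mul_le_mul_of_nonneg_right this (sq_nonneg ((R:ℝ) + 1)), (cast_nonneg R : (0:ℝ) ≤ R)]
    · rw [hM, h]
      refine (min_le_right _ _).trans ?_
      have h7 : L ^ 2 ≤ ((⌊L⌋₊:ℝ) + 1) ^ 2 := pow_le_pow_left₀ (by linarith) (Nat.lt_floor_add_one L).le 2
      nlinarith [mul_le_mul_of_nonneg_left h7 (sq_nonneg L), sq_nonneg (L ^ 2)]
  calc c₁ * exp (-4) / 4 * min ((2 * (R:ℝ) + 1) ^ 2) (L ^ 4)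
      ≤ c₁ * exp (-4) / 4 * (4 * (L ^ 2 * (M + 1) ^ 2)) :=
        mul_le_mul_of_nonneg_left h6 (by positivity)
    _ = L ^ 2 * y := by rw [hy]; ring

lemma lqS_comp_le {ι κ : Type*} (q : ℝ≥0∞) (f : κ → ℝ≥0∞) {e : ι → κ} (he : Injective e) :
    lqS q (fun i => f (e i)) ≤ lqS q f := by
  unfold lqS
  split_ifs
  · exact iSup_comp_le f e
  · exact rpow_le_rpow (ENNReal.tsum_comp_le_tsum_of_injective he fun k => f k ^ q.toReal)
      (by positivity)

lemma le_lqS {ι : Type*} {q : ℝ≥0∞} (hq : q ≠ 0) (f : ι → ℝ≥0∞) (i : ι) : f i ≤ lqS q f := by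
  unfold lqS
  split_ifs with h
  · exact le_iSup f i
  · have hq' := toReal_pos hq h
    calc f i = (f i ^ q.toReal) ^ (1 / q.toReal) := by
          rw [← ENNReal.rpow_mul, mul_one_div_cancel hq'.ne', ENNReal.rpow_one]
      _ ≤ _ := rpow_le_rpow (le_tsum i) (by positivity)

lemma lqS_top_finset {κ : Type*} (K : Finset κ) (f : κ → ℝ≥0∞) :
    lqS ⊤ (fun k : K => f k) = ⨆ k ∈ K, f k := by
  rw [lqS, if_pos rfl, iSup_subtype]

lemma lqS_finset {κ : Type*} {q : ℝ≥0∞} (hq : q ≠ ⊤) (K : Finset κ) (f : κ → ℝ≥0∞) :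
    lqS q (fun k : K => f k) = (∑ k ∈ K, f k ^ q.toReal) ^ (1 / q.toReal) := by
  rw [lqS, if_neg hq, tsum_fintype, Finset.sum_coe_sort K fun k => f k ^ q.toReal]

lemma measurable_lqS_finset {κ : Type*} (q : ℝ≥0∞) (K : Finset κ) {f : κ → ℝ² → ℝ≥0∞}
    (hf : ∀ k, Measurable (f k)) : Measurable fun x => lqS q (fun k : K => f k x) := by
  by_cases hq : q = ⊤
  · subst hq
    have e := fun x => lqS_top_finset K fun k => f k x
    simp only [e]
    exact Measurable.biSup _ K.countable_toSet fun k _ => hf k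
  · have e := fun x => lqS_finset hq K fun k => f k x
    simp only [e]
    fun_prop

lemma lqS_le_iSup_finset {ι κ : Type*} {q : ℝ≥0∞} (hq0 : q ≠ 0) (f : κ → ℝ≥0∞) {e : ι → κ}
    (he : Injective e) {K : ℕ → Finset κ} (hK : Monotone K) (heK : ∀ i, ∃ N, e i ∈ K N) :
    lqS q (fun i => f (e i)) ≤ ⨆ N, lqS q (fun k : K N => f k) := by
  by_cases hq : q = ⊤
  · subst hq
    simp only [lqS_top_finset _ f]
    rw [lqS, if_pos rfl]
    refine iSup_le fun i => ?_
    obtain ⟨N, hN⟩ := heK i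
    exact le_iSup_of_le N (le_iSup₂_of_le (e i) hN le_rfl)
  · simp only [lqS_finset hq _ f]
    have hmono : Monotone fun y : ℝ≥0∞ => y ^ (1 / q.toReal) := ENNReal.monotone_rpow_of_nonneg (by positivity)
    rw [lqS, if_neg hq, ENNReal.tsum_eq_iSup_sum,
      hmono.map_iSup_of_continuousAt (ENNReal.continuous_rpow_const).continuousAt (by
        have := toReal_pos hq0 hq
        exact zero_rpow_of_pos (by positivity))]
    refine iSup_le fun t => ?_
    choose N hN using heK
    refine le_iSup_of_le (t.sup N) (hmono ?_)
    rw [← sum_image (f := fun k => f k ^ q.toReal) he.injOn]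
    refine sum_le_sum_of_subset fun k hk => ?_
    obtain ⟨i, hi, rfl⟩ := Finset.mem_image.1 hk
    exact hK (Finset.le_sup hi) (hN i)

lemma lpN_iSup_le {F : ℕ → ℝ² → ℝ≥0∞} (hF : ∀ N, Measurable (F N)) (hmono : Monotone F) {p : ℝ}
    (hp : 0 < p) {A : ℝ≥0∞} (hA : ∀ N, lpN (F N) p ≤ A) : lpN (fun x => ⨆ N, F N x) p ≤ A := by
  rw [← rpow_le_rpow_iff hp, lpN_rpow _ hp]
  have e : ∀ x, (⨆ N, F N x) ^ p = ⨆ N, F N x ^ p := fun x =>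
    (ENNReal.orderIsoRpow p hp).map_iSup fun N => F N x
  simp only [e]
  rw [lintegral_iSup (fun N => (hF N).pow_const p) fun N N' h x => rpow_le_rpow (hmono h x) hp.le]
  refine iSup_le fun N => ?_
  rw [← lpN_rpow _ hp]
  exact rpow_le_rpow (hA N) hp.le

lemma KopSupBound.mono {Ω κ : Type*} [MeasurableSpace Ω] {μ : Measure Ω} {K : Finset κ} {m : κ → Ω → ℂ}
    {Y : κ → Ω → ℝ²} {p p' N₀ N₁ : ℝ} (H : KopSupBound μ K m Y p p' N₀) (h : N₀ ≤ N₁) :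
    KopSupBound μ K m Y p p' N₁ := fun G d hG hd =>
  (H G d hG hd).trans (mul_le_mul' (ofReal_le_ofReal h) le_rfl)

lemma lpN_lqS_kop_le {Ω κ ι : Type*} [MeasurableSpace Ω] (μ : Measure Ω) [SFinite μ] (K : Finset κ)
    (J : Finset ι) (π : κ → ι) {m : κ → Ω → ℂ} {Y : κ → Ω → ℝ²} {p p' : ℝ}
    (hm : ∀ k, Measurable (m k)) (hmi : ∀ k, Integrable (m k) μ)
    (hY : ∀ k, Measurable (Y k)) {q : ℝ≥0∞} (hpp : p.HolderConjugate p') (hpq : eN p ≤ q) {N₀ N₁ : ℝ}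
    (hN₀ : 0 < N₀) (hN₁ : 0 < N₁) (H₀ : KopSupBound μ K m Y p p' N₀)
    (H₁ : KopDiagBound μ K J π m Y p p' N₁)
    {g : ι → ℝ² → ℂ} (hg : ∀ i, Measurable (g i)) (hgi : ∀ i, Integrable (g i))
    {M : ℝ} (hgM : ∀ i x, ‖g i x‖ ≤ M) (hgJ : ∀ i ∉ J, ∀ x, g i x = 0) :
    lpN (fun x => lqS q fun k : K => ‖kop μ (m k) (Y k) (g (π k)) x‖ₑ) p ≤
      ofReal (N₀ ^ (1 - pqr p q) * N₁ ^ pqr p q) *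
        lpN (fun x => lqS q fun i : J => ‖g i x‖ₑ) p := by
  by_cases hq : q = ⊤
  · subst hq
    have e := fun x => lqS_top_finset K fun k => ‖kop μ (m k) (Y k) (g (π k)) x‖ₑ
    have e' := fun x => lqS_top_finset J fun i => ‖g i x‖ₑ
    simp only [e, e', pqr, if_true, sub_zero, rpow_one, rpow_zero, mul_one]
    exact lpN_iSup_kop_le μ K J π hm hmi hY hpp hN₀ hN₁ H₀ H₁ hg hgi hgM hgJ
  · have e := fun x => lqS_finset hq K fun k => ‖kop μ (m k) (Y k) (g (π k)) x‖ₑ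
    have e' := fun x => lqS_finset hq J fun i => ‖g i x‖ₑ
    simp only [e, e', pqr, if_neg hq]
    exact lpN_lq_kop_le μ K J π hm hmi hY hpp ((ENNReal.ofReal_le_iff_le_toReal hq).1 hpq) hN₀.le hN₁.le
      H₀ H₁ hg hgi hgM hgJ

lemma sum_filter_comp_le {κ α : Type*} {S : Finset κ} {P : κ → Prop} {_ : DecidablePred P}
    (e : κ → α) {T : Finset α} {F : κ → ℝ} {f : α → ℝ}
    (hinj : ∀ k ∈ S, P k → ∀ k' ∈ S, P k' → e k = e k' → k = k') (hT : ∀ k ∈ S, P k → e k ∈ T)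
    (hf : ∀ a, 0 ≤ f a) (hF : ∀ k ∈ S, P k → F k = f (e k)) :
    ∑ k ∈ S with P k, F k ≤ ∑ a ∈ T, f a := by
  rw [sum_congr rfl fun k hk => hF k (mem_filter.1 hk).1 (mem_filter.1 hk).2,
    ← sum_image (f := f) (g := e)]
  · refine Finset.sum_le_sum_of_subset_of_nonneg (fun a ha => ?_) fun _ _ _ => hf _
    obtain ⟨k, hk, rfl⟩ := Finset.mem_image.1 ha
    exact hT k (mem_filter.1 hk).1 (mem_filter.1 hk).2
  · intro k hk k' hk' h
    have hk := mem_filter.1 hk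
    have hk' := mem_filter.1 hk'
    exact hinj k hk.1 hk.2 k' hk'.1 hk'.2 h

lemma exists_lpN_lqS_Ajl_le {b cp : ℝ} (cm : ℝ) (hb : 1 < b) (hcp : cp ≠ 0) {χp : ℝ → ℝ}
    (hχsm : ContDiff ℝ (⊤ : ℕ∞) χp)
    (hχsupp : ∀ t : ℝ, t ∉ Ioo (1/2 : ℝ) 2 → χp t = 0)
    {η : ℝ² → ℝ} (hηsm : ContDiff ℝ (⊤ : ℕ∞) η)
    (hηsupp : ∀ ξ : ℝ², (100:ℝ)^2 < ξ.1^2 + ξ.2^2 → η ξ = 0)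
    {ςm : ℝ → ℝ} (hςmsm : ContDiff ℝ (⊤ : ℕ∞) ςm)
    (hςmsupp : ∀ v : ℝ, v ∉ Ioo (-(b * (4:ℝ) ^ (b-1))) (-(b * (4:ℝ)⁻¹ ^ (b-1))) → ςm v = 0)
    {ζ : ℝ² → ℝ} (hζsm : ContDiff ℝ (⊤ : ℕ∞) ζ)
    (hζsupp : ∀ ξ : ℝ², (4:ℝ) ≤ ξ.1^2 + ξ.2^2 → ζ ξ = 0)
    (hζone : ∀ ξ : ℝ², ξ.1^2 + ξ.2^2 ≤ ((5:ℝ)/4)^2 → ζ ξ = 1) :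
    ∃ C : ℝ, 0 < C ∧ ∀ s : ℤ → ℕ → ℝ, (∀ n i, s n i ∈ Icc (1:ℝ) ((2:ℝ) ^ b)) →
      ∀ p : ℝ, 1 < p → p ≤ 2 → ∀ q : ℝ≥0∞, eN p ≤ q → ∀ l R : ℕ,
      ∀ (g : ℤ → ℤ → SchwartzMap (ℝ²) ℝ) (w : ℤ → ℕ → ℂ) (W : ℝ), 0 < W →
        (∀ n N, ∑ i ∈ Finset.range N, ‖w n i‖ ^ p ≤ W ^ p) →
        lpN (fun x => lqS q
            (fun jni : {j : ℤ // -(R:ℤ) ≤ j ∧ j ≤ R} × {n : ℤ // -(R:ℤ) ≤ n ∧ n ≤ R} × ℕ =>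
              ofReal ‖w (jni.2.1 : ℤ) jni.2.2‖ *
                (‖Ajl b cp cm χp η ςm ζ (jni.1 : ℤ) l
                    ((2:ℝ) ^ (b * ((jni.2.1 : ℤ) : ℝ)) * s (jni.2.1 : ℤ) jni.2.2)
                    (⇑(g (jni.1 : ℤ) (jni.2.1 : ℤ))) x‖₊ : ℝ≥0∞))) p
          ≤ ofReal ((C * min ((2 * (R:ℝ) + 1) ^ 2) ((p - 1)⁻¹ ^ 4) * W) ^ (1 - pqr p q) *
              (C * (2:ℝ) ^ (-(l : ℝ) * (1 - 1 / p)) * W) ^ pqr p q)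
              * lpN (fun x => lqS q (fun jn : ℤ × ℤ => (‖(g jn.1 jn.2) x‖₊ : ℝ≥0∞))) p := by
  obtain ⟨C₁, hC₁, hA⟩ := exists_Ajl_kernel cm hb hcp hχsm hχsupp hηsm hηsupp hςmsm hςmsupp hζsm hζsupp hζone
  obtain ⟨C₂, hC₂, hS⟩ := exists_kopSupBound hb hcp
  refine ⟨max C₁ (C₂ * C₁ * 16), by positivity, fun s hs p hp1 hp2 q hpq l R g w W hW hwW => ?_⟩
  set C := max C₁ (C₂ * C₁ * 16) with hC
  obtain ⟨m, hm, hmC, hmaj, hsym, hAjl⟩ := hA l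
  set L : ℝ := (p - 1)⁻¹ with hL
  have hL1 : 1 ≤ L := by rw [hL, one_le_inv₀ (by linarith)]; linarith
  have hpp : p.HolderConjugate (1 + L) := by
    rw [Real.holderConjugate_iff]
    refine ⟨hp1, ?_⟩
    have : p - 1 ≠ 0 := by linarith
    have hp00 : p ≠ 0 := by linarith
    rw [show 1 + L = p / (p - 1) by rw [hL]; field_simp; ring, inv_div]; field_simp; ring
  have hp2' : 2 ≤ 1 + L := by linarith
  have h2p : 2 / (1 + L) = 2 * (1 - 1 / p) := by
    have : (1 + L)⁻¹ = 1 - p⁻¹ := by linarith [hpp.inv_add_inv_eq_one]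
    rw [div_eq_mul_inv, this, one_div]
  have hp0 : 0 < p := hpp.pos
  set J : Finset (ℤ × ℤ) := Finset.Icc (-(R:ℤ)) R ×ˢ Finset.Icc (-(R:ℤ)) R with hJ
  set gg : ℤ × ℤ → ℝ² → ℂ := fun i y => if i ∈ J then (g i.1 i.2 y : ℂ) else 0 with hgg
  have hggJ : ∀ i ∈ J, gg i = fun y => (g i.1 i.2 y : ℂ) := fun i hi => by simp only [hgg, if_pos hi]
  have hggJ' : ∀ i ∉ J, gg i = fun _ => 0 := fun i hi => by simp only [hgg, if_neg hi]
  have hgm : ∀ i, Measurable (gg i) := fun i => by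
    by_cases hi : i ∈ J
    · rw [hggJ i hi]; exact (Complex.continuous_ofReal.comp (g i.1 i.2).continuous).measurable
    · rw [hggJ' i hi]; exact measurable_const
  have hgi : ∀ i, Integrable (gg i) := fun i => by
    by_cases hi : i ∈ J
    · rw [hggJ i hi]; exact (g i.1 i.2).integrable.ofReal
    · rw [hggJ' i hi]; exact integrable_zero _ _ _
  obtain ⟨M, hM⟩ : ∃ M, ∀ i x, ‖gg i x‖ ≤ M := by
    choose M hM using fun i : ℤ × ℤ => (g i.1 i.2).toBoundedContinuousFunction.bddAbove_range_norm_comp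
    refine ⟨∑ i ∈ J, |M i|, fun i x => ?_⟩
    by_cases hi : i ∈ J
    · rw [hggJ i hi]
      refine le_trans ?_ (single_le_sum (f := fun i => |M i|) (fun i _ => abs_nonneg _) hi)
      simp only [norm_real]
      exact (hM i ⟨x, rfl⟩).trans (le_abs_self _)
    · rw [hggJ' i hi, norm_zero]; positivity
  set v : ℤ × ℤ × ℕ → ℝ := fun k => ‖w k.2.1 k.2.2‖ with hv
  set mm : ℤ × ℤ × ℕ → ℝ × ℝ × ℝ → ℂ := fun k ω => (v k : ℂ) * m ω with hmm
  set F : ℤ × ℤ × ℕ → ℝ² → ℝ≥0∞ := fun k x =>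
    ‖kop curveBase (mm k) (boxShift b cp s k) (gg (k.1, k.2.1)) x‖ₑ with hF
  have hmmm : ∀ k, Measurable (mm k) := fun k => hm.const_mul _
  have hmi : Integrable m curveBase :=
    ⟨hm.aestronglyMeasurable, hasFiniteIntegral_iff_enorm.2 (hmC.trans_lt ofReal_lt_top)⟩
  have hY : ∀ k, Measurable (boxShift b cp s k) := fun k => measurable_curveShift ..
  have hFm : ∀ k, Measurable (F k) := fun k => (measurable_kop (hmmm k) (hY k) (hgm _)).enorm
  have hLHS : ∀ (jni : {j : ℤ // -(R:ℤ) ≤ j ∧ j ≤ R} × {n : ℤ // -(R:ℤ) ≤ n ∧ n ≤ R} × ℕ) x,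
      ofReal ‖w (jni.2.1 : ℤ) jni.2.2‖ * (‖Ajl b cp cm χp η ςm ζ (jni.1 : ℤ) l
        ((2:ℝ) ^ (b * ((jni.2.1 : ℤ) : ℝ)) * s (jni.2.1 : ℤ) jni.2.2)
        (⇑(g (jni.1 : ℤ) (jni.2.1 : ℤ))) x‖₊ : ℝ≥0∞) = F (jni.1, jni.2.1, jni.2.2) x := by
    rintro ⟨⟨j, hj⟩, ⟨n, hn⟩, i⟩ x
    simp only [hF, hmm]
    rw [kop_const_mul, enorm_mul, hggJ (j, n) (by simp only [hJ, mem_product, Finset.mem_Icc]; omega),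
      ← ofReal_norm (v _ : ℂ), norm_real, norm_of_nonneg (norm_nonneg _), hAjl]
    rfl
  simp only [hLHS]
  have hq0 : q ≠ 0 := fun h => by
    rw [h, eN, nonpos_iff_eq_zero, ofReal_eq_zero] at hpq; linarith
  have hmono : Monotone fun N => intBox R N := fun N N' h =>
    Finset.product_subset_product_right (Finset.product_subset_product_right (Finset.range_mono h))
  refine (lpN_mono hp0 fun x => lqS_le_iSup_finset hq0 (fun k => F k x)
    (e := fun jni : {j : ℤ // -(R:ℤ) ≤ j ∧ j ≤ R} × {n : ℤ // -(R:ℤ) ≤ n ∧ n ≤ R} × ℕ =>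
      ((jni.1 : ℤ), (jni.2.1 : ℤ), jni.2.2)) ?_ hmono ?_).trans ?_
  · rintro ⟨⟨j, hj⟩, ⟨n, hn⟩, i⟩ ⟨⟨j', hj'⟩, ⟨n', hn'⟩, i'⟩ h
    simpa using h
  · rintro ⟨⟨j, hj⟩, ⟨n, hn⟩, i⟩
    refine ⟨i + 1, ?_⟩
    simp only [intBox, mem_product, Finset.mem_Icc, Finset.mem_range]
    omega
  refine lpN_iSup_le (fun N => measurable_lqS_finset q _ hFm) (fun N N' h x =>
    lqS_comp_le q (fun k : intBox R N' => F k x) (e := fun k : intBox R N => ⟨k, hmono h k.2⟩)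
      fun k k' h => Subtype.ext (by simpa using h)) hp0 fun N => ?_
  have hv0 : ∀ k, 0 ≤ v k := fun k => norm_nonneg _
  have hCC : C₁ ≤ C := le_max_left _ _
  have H₀ : KopSupBound curveBase (intBox R N) mm (boxShift b cp s) p (1 + L)
      (C * min ((2 * (R:ℝ) + 1) ^ 2) (L ^ 4) * W) := by
    rcases min_choice ((2 * (R:ℝ) + 1) ^ 2) (L ^ 4) with h | h
    · rw [h, mul_assoc]
      refine (kopSupBound_of_integrable (W := (2 * (R:ℝ) + 1) ^ 2 * W) hm hY hpp hC₁.le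
        (by positivity) hmC hv0 ?_).mono (mul_le_mul_of_nonneg_right hCC (by positivity))
      have e1 : ((Finset.Icc (-(R:ℤ)) R).card : ℝ) = 2 * R + 1 := by
        rw [Int.card_Icc, show (R + 1 - -(R:ℤ)).toNat = 2 * R + 1 by omega]; push_cast; rfl
      rw [intBox, sum_product]
      simp only [sum_product]
      calc ∑ _j ∈ Finset.Icc (-(R:ℤ)) R, ∑ n ∈ Finset.Icc (-(R:ℤ)) R, ∑ i ∈ Finset.range N, ‖w n i‖ ^ p
          ≤ ∑ _j ∈ Finset.Icc (-(R:ℤ)) R, ∑ _n ∈ Finset.Icc (-(R:ℤ)) R, W ^ p :=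
            sum_le_sum fun j _ => sum_le_sum fun n _ => hwW n N
        _ = (2 * (R:ℝ) + 1) ^ 2 * W ^ p := by
            rw [sum_const, sum_const, nsmul_eq_mul, nsmul_eq_mul, e1]; ring
        _ ≤ ((2 * (R:ℝ) + 1) ^ 2) ^ p * W ^ p := by
            refine mul_le_mul_of_nonneg_right (Real.self_le_rpow_of_one_le ?_ hp1.le) (by positivity)
            exact one_le_pow₀ (by linarith [(cast_nonneg R : (0:ℝ) ≤ R)])
        _ = _ := (mul_rpow (by positivity) hW.le).symm
    · rw [h]
      refine (hS C₁ l m hC₁.le hmaj s (fun n i => ‖w n i‖) p (1 + L) W R N hs hpp hp2' hW.le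
        (fun n i => norm_nonneg _) fun n => hwW n N).mono (mul_le_mul_of_nonneg_right ?_ hW.le)
      calc C₂ * C₁ * (1 + L) ^ 4 ≤ C₂ * C₁ * (2 * L) ^ 4 := by gcongr; linarith
        _ = C₂ * C₁ * 16 * L ^ 4 := by ring
        _ ≤ C * L ^ 4 := mul_le_mul_of_nonneg_right (le_max_right _ _) (by positivity)
  have H₁ : KopDiagBound curveBase (intBox R N) J (fun k => (k.1, k.2.1)) mm (boxShift b cp s) p (1 + L)
      (C * (2:ℝ) ^ (-(l : ℝ) * (1 - 1 / p)) * W) := by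
    have e : C ^ (1 - 2 / (1 + L)) * (C * (2:ℝ) ^ (-(l / 2) : ℝ)) ^ (2 / (1 + L)) =
        C * (2:ℝ) ^ (-(l : ℝ) * (1 - 1 / p)) := by
      rw [mul_rpow (by positivity) (by positivity), ← mul_assoc, ← rpow_add (by positivity),
        sub_add_cancel, rpow_one, ← rpow_mul two_pos.le, h2p]
      ring_nf
    rw [← e]
    refine kopDiagBound_of_symbol hm hY hpp hp2' (by positivity) (by positivity) hW.le
      (hmC.trans (ofReal_le_ofReal hCC)) (fun k ξ => (hsym _ _ ξ).trans
        (mul_le_mul_of_nonneg_right hCC (by positivity))) hv0 (fun k hk => ?_) fun i _ => ?_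
    · simp only [intBox, hJ, mem_product] at hk ⊢
      exact ⟨hk.1, hk.2.1⟩
    · refine (sum_filter_comp_le (fun k : ℤ × ℤ × ℕ => k.2.2) (T := Finset.range N)
        (f := fun a => ‖w i.2 a‖ ^ p) (fun k hk h k' hk' h' e => ?_) (fun k hk _ => ?_)
        (fun a => by positivity) fun k hk h => ?_).trans (hwW i.2 N)
      · have := h.trans h'.symm
        simp only [Prod.mk.injEq] at this
        exact Prod.ext this.1 (Prod.ext this.2 e)
      · simp only [intBox, mem_product] at hk
        exact hk.2.2
      · rw [← h]
  refine (lpN_lqS_kop_le curveBase (intBox R N) J (fun k => (k.1, k.2.1)) hmmm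
    (fun k => hmi.const_mul _) hY hpp hpq (by positivity) (by positivity) H₀ H₁ hgm hgi hM
    fun i hi x => by rw [hggJ' i hi]).trans (mul_le_mul' le_rfl (lpN_mono hp0 fun x => ?_))
  refine le_trans (le_of_eq ?_) (lqS_comp_le q (fun jn : ℤ × ℤ => (‖(g jn.1 jn.2) x‖₊ : ℝ≥0∞))
    (e := fun i : J => (i : ℤ × ℤ)) Subtype.val_injective)
  congr 1
  funext i
  rw [hggJ i i.2, ← ofReal_norm, norm_real, ofReal_norm]
  rfl

lemma ofReal_interp_le {C c m W x A t : ℝ} {B : ℝ≥0∞} (hC : 0 < C) (hc : 0 < c) (hm : 0 < m)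
    (hW : 0 < W) (hx : 0 < x) (hA : 0 < A) (ht0 : 0 ≤ t) (ht1 : t ≤ 1)
    (h : ofReal (c * m) ≤ ofReal A * B) :
    ofReal ((C * m * W) ^ (1 - t) * (C * x * W) ^ t) ≤
      ofReal (max (C / c) C * A ^ (1 - t) * x ^ t) * B ^ (1 - t) * ofReal W := by
  have ht : 0 ≤ 1 - t := by linarith
  have hM : 0 < max (C / c) C := lt_max_of_lt_right hC
  have h1 : (C * m * W) ^ (1 - t) * (C * x * W) ^ t ≤ max (C / c) C * x ^ t * (c * m) ^ (1 - t) * W := by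
    have e1 : C * m * W = C / c * (c * m) * W := by field_simp
    rw [e1, mul_rpow (by positivity) hW.le, mul_rpow (by positivity) (by positivity),
      mul_rpow (by positivity) hW.le, mul_rpow hC.le hx.le]
    have e2 : W ^ (1 - t) * W ^ t = W := by
      rw [← rpow_add hW, sub_add_cancel, rpow_one]
    have e3 : (C / c) ^ (1 - t) * C ^ t ≤ max (C / c) C := by
      calc _ ≤ max (C / c) C ^ (1 - t) * max (C / c) C ^ t :=
            mul_le_mul (Real.rpow_le_rpow (by positivity) (le_max_left _ _) ht)
              (Real.rpow_le_rpow hC.le (le_max_right _ _) ht0) (by positivity) (by positivity)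
        _ = _ := by rw [← rpow_add hM, sub_add_cancel, rpow_one]
    calc _ = (C / c) ^ (1 - t) * C ^ t * (x ^ t * (c * m) ^ (1 - t) * (W ^ (1 - t) * W ^ t)) := by ring
      _ ≤ max (C / c) C * (x ^ t * (c * m) ^ (1 - t) * W) := by
        rw [e2]; exact mul_le_mul_of_nonneg_right e3 (by positivity)
      _ = _ := by ring
  calc _ ≤ ofReal (max (C / c) C * x ^ t) * ofReal (c * m) ^ (1 - t) * ofReal W := by
        rw [ofReal_rpow_of_nonneg (by positivity) ht, ← ofReal_mul (by positivity),
          ← ofReal_mul (by positivity)]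
        exact ofReal_le_ofReal h1
    _ ≤ ofReal (max (C / c) C * x ^ t) * (ofReal A * B) ^ (1 - t) * ofReal W :=
        mul_le_mul' (mul_le_mul' le_rfl (rpow_le_rpow h ht)) le_rfl
    _ = _ := by
        rw [mul_rpow_of_nonneg _ _ ht, ofReal_rpow_of_nonneg hA.le ht, ← mul_assoc,
          ← ofReal_mul (by positivity), mul_right_comm (max (C / c) C)]

lemma sum_rpow_le_of_wNorm_le {w : ℕ → ℂ} {p W : ℝ} (hp : 0 < p) (hW : 0 ≤ W)
    (h : wNorm w p ≤ ofReal W) (N : ℕ) : ∑ i ∈ Finset.range N, ‖w i‖ ^ p ≤ W ^ p := by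
  have h1 := rpow_le_rpow h hp.le
  rw [wNorm, ← ENNReal.rpow_mul, one_div_mul_cancel hp.ne', ENNReal.rpow_one,
    ofReal_rpow_of_nonneg hW hp.le] at h1
  rw [← ofReal_le_ofReal_iff (by positivity), ofReal_sum_of_nonneg fun i _ => by positivity]
  exact (ENNReal.sum_le_tsum _).trans h1

lemma eq_zero_of_wNorm_eq_zero {w : ℕ → ℂ} {p : ℝ} (hp : 0 < p) (h : wNorm w p = 0) (i : ℕ) :
    w i = 0 := by
  rw [wNorm, ENNReal.rpow_eq_zero_iff_of_pos (by positivity), ENNReal.tsum_eq_zero] at h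
  have := h i
  rw [← ofReal_rpow_of_nonneg (norm_nonneg _) hp.le, ENNReal.rpow_eq_zero_iff_of_pos hp,
    ofReal_eq_zero] at this
  exact norm_le_zero_iff.1 this

lemma lqS_zero {ι : Type*} {q : ℝ≥0∞} (hq : q ≠ 0) : lqS q (fun _ : ι => 0) = 0 := by
  unfold lqS
  split_ifs with h
  · simp
  · have := toReal_pos hq h
    simp [zero_rpow_of_pos this, this]

lemma eq_zero_of_lpN_lqS_eq_zero {ι : Type*} {q : ℝ≥0∞} (hq : q ≠ 0) {p : ℝ} (hp : 0 < p)
    {g : ι → ℝ² → ℝ} (hg : ∀ i, Continuous (g i))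
    (h : lpN (fun x => lqS q fun i => (‖g i x‖₊ : ℝ≥0∞)) p = 0) (i : ι) : g i = 0 := by
  have h1 : lpN (fun x => (‖g i x‖₊ : ℝ≥0∞)) p = 0 :=
    le_antisymm ((lpN_mono hp fun x => le_lqS hq (fun i => (‖g i x‖₊ : ℝ≥0∞)) i).trans h.le) (zero_le)
  have h2 := lpN_rpow (fun x => (‖g i x‖₊ : ℝ≥0∞)) hp
  have hm : Measurable fun x => (‖g i x‖₊ : ℝ≥0∞) ^ p := by
    have := (hg i).measurable
    fun_prop
  rw [h1, zero_rpow_of_pos hp, eq_comm, lintegral_eq_zero_iff hm] at h2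
  refine (Continuous.ae_eq_iff_eq volume (hg i) continuous_zero).1 (h2.mono fun x hx => ?_)
  simpa [hp, hp.ne', hp.not_gt] using hx

lemma Ajl_zero (b cp cm : ℝ) (χp : ℝ → ℝ) (η : ℝ² → ℝ) (ςm : ℝ → ℝ) (ζ : ℝ² → ℝ)
    (j : ℤ) (l : ℕ) (u : ℝ) (x : ℝ²) : Ajl b cp cm χp η ςm ζ j l u (0 : ℝ² → ℝ) x = 0 := by
  simp [Ajl, FT, FTinv]

end

theorem statement13 (b cp cm : ℝ) (hb : 1 < b) (hcp : cp ≠ 0) (hcm : cm ≠ 0)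
    (χp : ℝ → ℝ) (hχsm : ContDiff ℝ (⊤ : ℕ∞) χp)
    (hχsupp : ∀ t : ℝ, t ∉ Ioo (1/2 : ℝ) 2 → χp t = 0)
    (hχsum : ∀ t : ℝ, 0 < t → HasSum (fun j : ℤ => χp ((2:ℝ) ^ j * t)) 1)
    (η : ℝ × ℝ → ℝ) (hηsm : ContDiff ℝ (⊤ : ℕ∞) η)
    (hηsupp : ∀ ξ : ℝ × ℝ, (100:ℝ)^2 < ξ.1^2 + ξ.2^2 → η ξ = 0)
    (hηone : ∀ ξ : ℝ × ℝ, ξ.1^2 + ξ.2^2 ≤ (50:ℝ)^2 → η ξ = 1)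
    (ςm : ℝ → ℝ) (hςmsm : ContDiff ℝ (⊤ : ℕ∞) ςm)
    (hςmsupp : ∀ v : ℝ, v ∉ Ioo (-(b * (4:ℝ) ^ (b-1))) (-(b * (4:ℝ)⁻¹ ^ (b-1))) → ςm v = 0)
    (hςmone : ∀ v ∈ Icc (-(b * ((7:ℝ)/2) ^ (b-1))) (-(b * ((2:ℝ)/7) ^ (b-1))), ςm v = 1)
    (ζ : ℝ × ℝ → ℝ) (hζsm : ContDiff ℝ (⊤ : ℕ∞) ζ)
    (hζsupp : ∀ ξ : ℝ × ℝ, (4:ℝ) ≤ ξ.1^2 + ξ.2^2 → ζ ξ = 0)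
    (hζone : ∀ ξ : ℝ × ℝ, ξ.1^2 + ξ.2^2 ≤ ((5:ℝ)/4)^2 → ζ ξ = 1) :
    ∃ C : ℝ, ∀ s : ℤ → ℕ → ℝ, (∀ n i, s n i ∈ Icc (1:ℝ) ((2:ℝ) ^ b)) →
      ∀ p : ℝ, 1 < p → p ≤ 2 → ∀ q : ℝ≥0∞, eN p ≤ q → ∀ l : ℕ, 1 ≤ l → ∀ R : ℕ,
      ∀ (g : ℤ → ℤ → SchwartzMap (ℝ × ℝ) ℝ) (w : ℤ → ℕ → ℂ),
        lpN (fun x => lqS q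
            (fun jni : {j : ℤ // -(R:ℤ) ≤ j ∧ j ≤ R} × {n : ℤ // -(R:ℤ) ≤ n ∧ n ≤ R} × ℕ =>
              ENNReal.ofReal ‖w (jni.2.1 : ℤ) jni.2.2‖ *
                (‖Ajl b cp cm χp η ςm ζ (jni.1 : ℤ) l
                    ((2:ℝ) ^ (b * ((jni.2.1 : ℤ) : ℝ)) * s (jni.2.1 : ℤ) jni.2.2)
                    (⇑(g (jni.1 : ℤ) (jni.2.1 : ℤ))) x‖₊ : ℝ≥0∞))) p
          ≤ ENNReal.ofReal
                (C * (p - 1) ^ (-(2 * (1 - pqr p q)))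
                  * (2:ℝ) ^ (-(l : ℝ) * (1 - 1 / p) * pqr p q))
              * BpR b cp cm χp s p R ^ (1 - pqr p q)
              * (⨆ n : ℤ, wNorm (w n) p)
              * lpN (fun x => lqS q
                  (fun jn : ℤ × ℤ => (‖(g jn.1 jn.2) x‖₊ : ℝ≥0∞))) p := by
  obtain ⟨C, hC, hA⟩ := exists_lpN_lqS_Ajl_le cm hb hcp hχsm hχsupp hηsm hηsupp hςmsm hςmsupp
    hζsm hζsupp hζone
  obtain ⟨c, hc, hB⟩ := exists_min_le_BpR cm hb hcp hχsm.continuous hχsupp (hχsum 1 one_pos)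
  refine ⟨max (C / c) C, fun s hs p hp1 hp2 q hpq l hl R g w => ?_⟩
  have hp0 : 0 < p := by linarith
  have hpL : 0 < p - 1 := by linarith
  have hq : q ≠ 0 := by
    rintro rfl
    simp only [eN, nonpos_iff_eq_zero, ENNReal.ofReal_eq_zero] at hpq
    linarith
  have ht : 0 ≤ pqr p q ∧ pqr p q ≤ 1 := by
    unfold pqr
    split_ifs with h
    · simp
    · have h1 : p ≤ q.toReal := (ENNReal.ofReal_le_iff_le_toReal h).1 hpq
      exact ⟨by positivity, (div_le_one (by linarith)).2 h1⟩
  have hM : 0 < max (C / c) C := lt_max_of_lt_right hC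
  have hm : 0 < min ((2 * (R:ℝ) + 1) ^ 2) ((p - 1)⁻¹ ^ 4) := lt_min (by positivity) (by positivity)
  have hBR := hB s hs p R hp1 hp2
  have hB0 : BpR b cp cm χp s p R ≠ 0 := fun h => by
    rw [h, mul_zero, nonpos_iff_eq_zero, ENNReal.ofReal_eq_zero] at hBR
    exact hBR.not_gt (by positivity)
  have e1 : (p - 1) ^ (-(2 * (1 - pqr p q))) = ((p - 1)⁻¹ ^ 2) ^ (1 - pqr p q) := by
    rw [inv_pow, Real.inv_rpow (by positivity), Real.rpow_neg hpL.le, ← Real.rpow_natCast,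
      ← Real.rpow_mul hpL.le]
    norm_num
  have e2 : (2:ℝ) ^ (-(l : ℝ) * (1 - 1 / p) * pqr p q) =
      ((2:ℝ) ^ (-(l : ℝ) * (1 - 1 / p))) ^ pqr p q := Real.rpow_mul two_pos.le _ _
  rw [e1, e2]
  have hF0 : ENNReal.ofReal (max (C / c) C * ((p - 1)⁻¹ ^ 2) ^ (1 - pqr p q) *
      ((2:ℝ) ^ (-(l : ℝ) * (1 - 1 / p))) ^ pqr p q) ≠ 0 := by
    rw [Ne, ENNReal.ofReal_eq_zero, not_le]
    positivity
  by_cases hG : lpN (fun x => lqS q (fun jn : ℤ × ℤ => (‖(g jn.1 jn.2) x‖₊ : ℝ≥0∞))) p = 0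
  · have h0 := eq_zero_of_lpN_lqS_eq_zero hq hp0 (g := fun jn : ℤ × ℤ => ⇑(g jn.1 jn.2))
      (fun jn => (g jn.1 jn.2).continuous) hG
    have h1 : ∀ j n, ⇑(g j n) = 0 := fun j n => h0 (j, n)
    simp only [h1, Ajl_zero, nnnorm_zero, ENNReal.coe_zero, mul_zero, lqS_zero hq, lpN_zero hp0]
    exact zero_le
  by_cases hW0 : (⨆ n : ℤ, wNorm (w n) p) = 0
  · have h1 : ∀ n i, w n i = 0 := fun n =>
      eq_zero_of_wNorm_eq_zero hp0 (ENNReal.iSup_eq_zero.1 hW0 n)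
    simp only [h1, norm_zero, ENNReal.ofReal_zero, zero_mul, lqS_zero hq, lpN_zero hp0]
    exact zero_le
  by_cases hWt : (⨆ n : ℤ, wNorm (w n) p) = ⊤
  · have h1 : BpR b cp cm χp s p R ^ (1 - pqr p q) ≠ 0 := by
      rw [Ne, ENNReal.rpow_eq_zero_iff]
      rintro (h | h)
      · exact hB0 h.1
      · linarith [h.2]
    rw [hWt, ENNReal.mul_top (mul_ne_zero hF0 h1), ENNReal.top_mul hG]
    exact le_top
  have hW := ENNReal.toReal_pos hW0 hWt
  refine (hA s hs p hp1 hp2 q hpq l R g w _ hW fun n N => sum_rpow_le_of_wNorm_le hp0 hW.le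
    (by rw [ENNReal.ofReal_toReal hWt]; exact le_iSup (fun n => wNorm (w n) p) n) N).trans
    (mul_le_mul' ?_ le_rfl)
  refine (ofReal_interp_le hC hc hm hW (by positivity) (by positivity) ht.1 ht.2 hBR).trans ?_
  rw [ENNReal.ofReal_toReal hWt]

end
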